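/- Let M be a simple Harish-Chandra module over the superconformal current algebra ĝ. Then M is a highest weight module, a lowest weight module, or a simple quotient of a tensor module Γ(λ,V,b) or of its parity change Π(Γ(λ,V,b)) for some finite-dimensional simple ġ-module V and some λ,b ∈ ℂ. -/

import Mathlib

/-!
Representations of the superconformal current algebra
`ĝ = 𝔰 ⋉ (ġ ⊗ A ⊕ ℂC₁)` are encoded by the families of operators giving the
action of the basis elements `L i`, `G i`, `C`, `C₁`, `x ⊗ tⁱ` (operator `E i x`)
and `x ⊗ tⁱξ` (operator `F i x`), subject to the supercommutator relations.
-/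

noncomputable section

open Module

variable (𝕘 : Type) [LieRing 𝕘] [LieAlgebra ℂ 𝕘]

/-- The operators `L, G, C, C₁, E, F` on `M` form a representation of the
superconformal current algebra `ĝ` (with invariant form `Φ` on `ġ`):
all supercommutator relations of `ĝ` hold (commutators for pairs with at least one
even element, anticommutators for pairs of odd elements). -/
structure IsSCCRep {M : Type} [AddCommGroup M] [Module ℂ M]
    (Φ : 𝕘 →ₗ[ℂ] 𝕘 →ₗ[ℂ] ℂ)
    (L G : ℤ → End ℂ M) (C C1 : End ℂ M)
    (E F : ℤ → 𝕘 →ₗ[ℂ] End ℂ M) : Prop where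
  comm_LL : ∀ i j : ℤ, L i * L j - L j * L i
      = ((j : ℂ) - (i : ℂ)) • L (i + j)
        + (if i + j = 0 then ((i : ℂ) ^ 3 - (i : ℂ)) / 12 else 0) • C
  comm_LG : ∀ i j : ℤ, L i * G j - G j * L i = ((j : ℂ) - (i : ℂ) / 2) • G (i + j)
  comm_GG : ∀ i j : ℤ, G i * G j + G j * G i
      = (-2 : ℂ) • L (i + j)
        + (if i + j = 0 then (4 * (i : ℂ) ^ 2 - 1) / 12 else 0) • C
  comm_LE : ∀ (i j : ℤ) (x : 𝕘), L i * E j x - E j x * L i = (j : ℂ) • E (i + j) x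
  comm_LF : ∀ (i j : ℤ) (x : 𝕘),
      L i * F j x - F j x * L i = ((j : ℂ) + (i : ℂ) / 2) • F (i + j) x
  comm_GE : ∀ (i j : ℤ) (x : 𝕘), G i * E j x - E j x * G i = (j : ℂ) • F (i + j) x
  comm_GF : ∀ (i j : ℤ) (x : 𝕘), G i * F j x + F j x * G i = - E (i + j) x
  comm_EE : ∀ (i j : ℤ) (x y : 𝕘), E i x * E j y - E j y * E i x
      = E (i + j) ⁅x, y⁆ + (if i + j = 0 then (i : ℂ) * Φ x y else 0) • C1
  comm_FE : ∀ (i j : ℤ) (x y : 𝕘), F i x * E j y - E j y * F i x = F (i + j) ⁅x, y⁆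
  comm_FF : ∀ (i j : ℤ) (x y : 𝕘), F i x * F j y + F j y * F i x
      = (if i + j = 0 then Φ x y else 0) • C1
  central_C_L : ∀ i, C * L i = L i * C
  central_C_G : ∀ i, C * G i = G i * C
  central_C_E : ∀ (i : ℤ) (x : 𝕘), C * E i x = E i x * C
  central_C_F : ∀ (i : ℤ) (x : 𝕘), C * F i x = F i x * C
  central_C_C1 : C * C1 = C1 * C
  central_C1_L : ∀ i, C1 * L i = L i * C1
  central_C1_G : ∀ i, C1 * G i = G i * C1
  central_C1_E : ∀ (i : ℤ) (x : 𝕘), C1 * E i x = E i x * C1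
  central_C1_F : ∀ (i : ℤ) (x : 𝕘), C1 * F i x = F i x * C1

/-- An endomorphism has parity `p` with respect to a `ℤ/2`-grading. -/
def MapsGr {M : Type} [AddCommGroup M] [Module ℂ M]
    (gr : Fin 2 → Submodule ℂ M) (p : Fin 2) (f : End ℂ M) : Prop :=
  ∀ q, (gr q).map f ≤ gr (q + p)

/-- The grading `gr` makes `M` into a super vector space on which the operator
families act with the correct parities. -/
structure IsSCCSuper {M : Type} [AddCommGroup M] [Module ℂ M]
    (gr : Fin 2 → Submodule ℂ M)
    (L G : ℤ → End ℂ M) (C C1 : End ℂ M)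
    (E F : ℤ → 𝕘 →ₗ[ℂ] End ℂ M) : Prop where
  internal : DirectSum.IsInternal gr
  hL : ∀ i, MapsGr gr 0 (L i)
  hG : ∀ i, MapsGr gr 1 (G i)
  hC : MapsGr gr 0 C
  hC1 : MapsGr gr 0 C1
  hE : ∀ (i : ℤ) (x : 𝕘), MapsGr gr 0 (E i x)
  hF : ∀ (i : ℤ) (x : 𝕘), MapsGr gr 1 (F i x)

/-- `M` is a weight module: `L₀` acts diagonalizably. -/
def IsWeightMod {M : Type} [AddCommGroup M] [Module ℂ M] (L0 : End ℂ M) : Prop :=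
  ⨆ μ : ℂ, L0.eigenspace μ = ⊤

/-- `M` is a Harish-Chandra module: a weight module with finite-dimensional
weight spaces. -/
def IsHarishChandra {M : Type} [AddCommGroup M] [Module ℂ M] (L0 : End ℂ M) : Prop :=
  IsWeightMod L0 ∧ ∀ μ : ℂ, FiniteDimensional ℂ (L0.eigenspace μ)

/-- `M` is cuspidal (uniformly bounded): a weight module whose weight space
dimensions admit a uniform finite bound. -/
def IsCuspidalMod {M : Type} [AddCommGroup M] [Module ℂ M] (L0 : End ℂ M) : Prop :=
  IsWeightMod L0 ∧ ∃ N : ℕ, ∀ μ : ℂ, Module.rank ℂ (L0.eigenspace μ) ≤ N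

/-- The set of all operators in the image of the representation. -/
def sccOps {M : Type} [AddCommGroup M] [Module ℂ M]
    (L G : ℤ → End ℂ M) (C C1 : End ℂ M)
    (E F : ℤ → 𝕘 →ₗ[ℂ] End ℂ M) : Set (End ℂ M) :=
  Set.range L ∪ Set.range G ∪ {C, C1}
    ∪ {f | ∃ (i : ℤ) (x : 𝕘), f = E i x} ∪ {f | ∃ (i : ℤ) (x : 𝕘), f = F i x}

/-- A subspace is invariant under a set of operators. -/
def InvariantUnder {M : Type} [AddCommGroup M] [Module ℂ M]
    (S : Set (End ℂ M)) (N : Submodule ℂ M) : Prop :=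
  ∀ f ∈ S, N.map f ≤ N

/-- A subspace is graded (homogeneous) with respect to the grading `gr`. -/
def GradedSub {M : Type} [AddCommGroup M] [Module ℂ M]
    (gr : Fin 2 → Submodule ℂ M) (N : Submodule ℂ M) : Prop :=
  N ≤ (N ⊓ gr 0) ⊔ (N ⊓ gr 1)

/-- Simplicity: `M ≠ 0` and the only graded subspaces invariant under all the
operators are `0` and `M`. -/
def IsSimpleRep {M : Type} [AddCommGroup M] [Module ℂ M]
    (S : Set (End ℂ M)) (gr : Fin 2 → Submodule ℂ M) : Prop :=
  (∃ v : M, v ≠ 0) ∧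
    ∀ N : Submodule ℂ M, InvariantUnder S N → GradedSub gr N → N = ⊥ ∨ N = ⊤

/-- The root space of `χ : H → ℂ` for a subalgebra `H ≤ ġ`: simultaneous
eigenvectors for the adjoint action of `H`. -/
def rootSp {𝕘 : Type} [LieRing 𝕘] [LieAlgebra ℂ 𝕘]
    (H : LieSubalgebra ℂ 𝕘) (χ : H → ℂ) : Submodule ℂ 𝕘 where
  carrier := {x : 𝕘 | ∀ h : H, ⁅(h : 𝕘), x⁆ = χ h • x}
  add_mem' := by
    intro a b ha hb h
    rw [lie_add, ha h, hb h, smul_add]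
  zero_mem' := by
    intro h
    rw [lie_zero, smul_zero]
  smul_mem' := by
    intro c a ha h
    rw [lie_smul, ha h, smul_comm]

/-- `P` is a system of positive roots for the Cartan subalgebra `H` of `ġ`. -/
def IsPositiveSystem {𝕘 : Type} [LieRing 𝕘] [LieAlgebra ℂ 𝕘]
    (H : LieSubalgebra ℂ 𝕘) (P : Set (H → ℂ)) : Prop :=
  (∀ χ ∈ P, χ ≠ 0 ∧ rootSp H χ ≠ ⊥) ∧
  (∀ χ : H → ℂ, χ ≠ 0 → rootSp H χ ≠ ⊥ → ((χ ∈ P ∨ -χ ∈ P) ∧ ¬(χ ∈ P ∧ -χ ∈ P))) ∧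
  (∀ χ ψ : H → ℂ, χ ∈ P → ψ ∈ P → rootSp H (χ + ψ) ≠ ⊥ → χ + ψ ∈ P)

/-- `M` is a highest weight module over `ĝ`: it is generated by a nonzero vector `v₀`
annihilated by `ĝ₊ ⊕ ġ₊` which is an eigenvector for the Cartan subalgebra
`ĥ = ḣ ⊕ ℂC ⊕ ℂC₁ ⊕ ℂL₀`. -/
def IsHighestWeight (𝕘 : Type) [LieRing 𝕘] [LieAlgebra ℂ 𝕘]
    {M : Type} [AddCommGroup M] [Module ℂ M]
    (L G : ℤ → End ℂ M) (C C1 : End ℂ M)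
    (E F : ℤ → 𝕘 →ₗ[ℂ] End ℂ M) : Prop :=
  ∃ (H : LieSubalgebra ℂ 𝕘), H.IsCartanSubalgebra ∧
    ∃ P : Set (H → ℂ), IsPositiveSystem H P ∧
      ∃ v₀ : M, v₀ ≠ 0 ∧
        (∀ i : ℤ, 0 < i →
          L i v₀ = 0 ∧ G i v₀ = 0 ∧ ∀ x : 𝕘, E i x v₀ = 0 ∧ F i x v₀ = 0) ∧
        (∀ χ ∈ P, ∀ x ∈ rootSp H χ, E 0 x v₀ = 0) ∧
        (∀ h : H, ∃ c : ℂ, E 0 (h : 𝕘) v₀ = c • v₀) ∧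
        (∃ c : ℂ, L 0 v₀ = c • v₀) ∧ (∃ c : ℂ, C v₀ = c • v₀) ∧
        (∃ c : ℂ, C1 v₀ = c • v₀) ∧
        (∀ N : Submodule ℂ M,
          InvariantUnder (sccOps 𝕘 L G C C1 E F) N → v₀ ∈ N → N = ⊤)

/-- `M` is a lowest weight module over `ĝ` (defined dually). -/
def IsLowestWeight (𝕘 : Type) [LieRing 𝕘] [LieAlgebra ℂ 𝕘]
    {M : Type} [AddCommGroup M] [Module ℂ M]
    (L G : ℤ → End ℂ M) (C C1 : End ℂ M)
    (E F : ℤ → 𝕘 →ₗ[ℂ] End ℂ M) : Prop :=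
  ∃ (H : LieSubalgebra ℂ 𝕘), H.IsCartanSubalgebra ∧
    ∃ P : Set (H → ℂ), IsPositiveSystem H P ∧
      ∃ v₀ : M, v₀ ≠ 0 ∧
        (∀ i : ℤ, i < 0 →
          L i v₀ = 0 ∧ G i v₀ = 0 ∧ ∀ x : 𝕘, E i x v₀ = 0 ∧ F i x v₀ = 0) ∧
        (∀ χ ∈ P, ∀ x ∈ rootSp H (-χ), E 0 x v₀ = 0) ∧
        (∀ h : H, ∃ c : ℂ, E 0 (h : 𝕘) v₀ = c • v₀) ∧
        (∃ c : ℂ, L 0 v₀ = c • v₀) ∧ (∃ c : ℂ, C v₀ = c • v₀) ∧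
        (∃ c : ℂ, C1 v₀ = c • v₀) ∧
        (∀ N : Submodule ℂ M,
          InvariantUnder (sccOps 𝕘 L G C C1 E F) N → v₀ ∈ N → N = ⊤)

/-! ### Tensor modules `Γ(λ, V, b)`

The underlying space of `Γ(λ, V, b) = A ⊗ V` is realised as finitely supported
functions on `ℤ × Fin 2`, the pair `(m, r)` corresponding to `tᵐ ξ^r ⊗ v`. -/

/-- Underlying space of `A ⊗ V`. -/
abbrev TMod (V : Type) [AddCommGroup V] [Module ℂ V] : Type := (ℤ × Fin 2) →₀ V

variable {𝕘' : Type} [LieRing 𝕘'] [LieAlgebra ℂ 𝕘']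

/-- Action of `L i` on `Γ(λ, V, b)`:
`L_i ∘ (tᵐξ^r ⊗ v) = (λ + m + i b + (i/2) δ_{r,1}) t^{i+m} ξ^r ⊗ v`. -/
def tmL (V : Type) [AddCommGroup V] [Module ℂ V] (lam b : ℂ) (i : ℤ) :
    End ℂ (TMod V) :=
  Finsupp.lsum ℂ fun p =>
    (lam + (p.1 : ℂ) + (i : ℂ) * b + (if p.2 = 1 then (i : ℂ) / 2 else 0)) •
      Finsupp.lsingle (p.1 + i, p.2)

/-- Action of `G i` on `Γ(λ, V, b)`:
`G_i ∘ (tᵐ ⊗ v) = (λ + m + 2 i b) t^{i+m}ξ ⊗ v`, `G_i ∘ (tᵐξ ⊗ v) = −t^{i+m} ⊗ v`. -/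
def tmG (V : Type) [AddCommGroup V] [Module ℂ V] (lam b : ℂ) (i : ℤ) :
    End ℂ (TMod V) :=
  Finsupp.lsum ℂ fun p =>
    if p.2 = 0 then
      (lam + (p.1 : ℂ) + 2 * (i : ℂ) * b) • Finsupp.lsingle (p.1 + i, (1 : Fin 2))
    else - Finsupp.lsingle (p.1 + i, (0 : Fin 2))

/-- Action of `x ⊗ tⁱ` on `Γ(λ, V, b)`: `(x ⊗ tⁱ) ∘ (f ⊗ v) = tⁱ f ⊗ (x · v)`. -/
def tmE (V : Type) [AddCommGroup V] [Module ℂ V]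
    [LieRingModule 𝕘' V] [LieModule ℂ 𝕘' V] (i : ℤ) (x : 𝕘') :
    End ℂ (TMod V) :=
  Finsupp.lsum ℂ fun p =>
    Finsupp.lsingle (p.1 + i, p.2) ∘ₗ (LieModule.toEnd ℂ 𝕘' V x)

/-- Action of `x ⊗ tⁱξ` on `Γ(λ, V, b)`:
`(x ⊗ tⁱξ) ∘ (f ⊗ v) = tⁱ ξ f ⊗ (x · v)`. -/
def tmF (V : Type) [AddCommGroup V] [Module ℂ V]
    [LieRingModule 𝕘' V] [LieModule ℂ 𝕘' V] (i : ℤ) (x : 𝕘') :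
    End ℂ (TMod V) :=
  Finsupp.lsum ℂ fun p =>
    if p.2 = 0 then Finsupp.lsingle (p.1 + i, (1 : Fin 2)) ∘ₗ (LieModule.toEnd ℂ 𝕘' V x)
    else 0

/-- The super grading on `Γ(λ, V, b)`, with `V` purely even: the parity of
`tᵐξ^r ⊗ v` is `r`. -/
def tmGr (V : Type) [AddCommGroup V] [Module ℂ V] (q : Fin 2) :
    Submodule ℂ (TMod V) :=
  Finsupp.supported V ℂ {p : ℤ × Fin 2 | p.2 = q}

/-- A simple module over the Lie algebra `ġ`. -/
def IsSimpleGMod (𝕘 : Type) [LieRing 𝕘] [LieAlgebra ℂ 𝕘]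
    (V : Type) [AddCommGroup V] [Module ℂ V] [LieRingModule 𝕘 V] : Prop :=
  (∃ v : V, v ≠ 0) ∧
    ∀ N : Submodule ℂ V, (∀ (x : 𝕘), ∀ v ∈ N, ⁅x, v⁆ ∈ N) → N = ⊥ ∨ N = ⊤

/-- Bundled data of a finite-dimensional simple `ġ`-module. -/
structure SimpleFDModuleData (𝕘 : Type) [LieRing 𝕘] [LieAlgebra ℂ 𝕘] where
  V : Type
  [grp : AddCommGroup V]
  [mod : Module ℂ V]
  [lrm : LieRingModule 𝕘 V]
  [lm : LieModule ℂ 𝕘 V]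
  findim : FiniteDimensional ℂ V
  simple : IsSimpleGMod 𝕘 V

attribute [instance] SimpleFDModuleData.grp SimpleFDModuleData.mod
  SimpleFDModuleData.lrm SimpleFDModuleData.lm

open Filter Asymptotics in
/-- `a` and its first `k` differences decay like a symbol of order `r` at `+∞`. -/
def SymK {A : Type*} [NormedRing A] : ℕ → ℤ → (ℤ → A) → Prop
  | 0, r, a => a =O[atTop] (fun n : ℤ => (n : ℝ) ^ r)
  | k + 1, r, a => a =O[atTop] (fun n : ℤ => (n : ℝ) ^ r) ∧ SymK k (r - 1) (fun n => a (n + 1) - a n)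

section SymbolCalculus

open Filter Asymptotics

variable {A : Type*} [NormedRing A]

lemma isBigO_zpow_shift (r j : ℤ) :
    (fun n : ℤ => ((n + j : ℤ) : ℝ) ^ r) =O[atTop] (fun n : ℤ => (n : ℝ) ^ r) := by
  have h1 : Tendsto (fun n : ℤ => (((n + j : ℤ) : ℝ) / (n : ℝ)) ^ r) atTop (nhds ((1 : ℝ) ^ r)) := by
    apply Tendsto.zpow₀ _ _ (Or.inl one_ne_zero)
    have h2 : Tendsto (fun n : ℤ => 1 + (j : ℝ) * ((n : ℝ))⁻¹) atTop (nhds (1 + (j : ℝ) * 0)) :=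
      tendsto_const_nhds.add (tendsto_const_nhds.mul
        (tendsto_inv_atTop_zero.comp tendsto_intCast_atTop_atTop))
    rw [mul_zero, add_zero] at h2
    refine h2.congr' ?_
    filter_upwards [eventually_gt_atTop 0] with n hn
    have : (n : ℝ) ≠ 0 := by exact_mod_cast hn.ne'
    push_cast
    field_simp
  refine isBigO_of_div_tendsto_nhds ?_ _ (h1.congr fun n => div_zpow _ _ _)
  filter_upwards [eventually_gt_atTop 0] with n hn h
  have : (n : ℝ) ≠ 0 := by exact_mod_cast hn.ne'
  exact absurd h (zpow_ne_zero _ this)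

lemma isBigO_zpow_mono {r r' : ℤ} (h : r ≤ r') :
    (fun n : ℤ => (n : ℝ) ^ r) =O[atTop] (fun n : ℤ => (n : ℝ) ^ r') := by
  refine IsBigO.of_bound 1 ?_
  filter_upwards [eventually_ge_atTop 1] with n hn
  have h1 : (1 : ℝ) ≤ n := by exact_mod_cast hn
  rw [one_mul, Real.norm_of_nonneg (by positivity), Real.norm_of_nonneg (by positivity)]
  exact zpow_le_zpow_right₀ h1 h

lemma SymK.isBigO {k : ℕ} {r : ℤ} {a : ℤ → A} (h : SymK k r a) :
    a =O[atTop] (fun n : ℤ => (n : ℝ) ^ r) := by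
  cases k with
  | zero => exact h
  | succ k => exact h.1

lemma SymK.mono {k : ℕ} {r r' : ℤ} {a : ℤ → A} (h : SymK k r a) (hr : r ≤ r') : SymK k r' a := by
  induction k generalizing r r' a with
  | zero => exact IsBigO.trans h (isBigO_zpow_mono hr)
  | succ k ih => exact ⟨h.1.trans (isBigO_zpow_mono hr), ih h.2 (by linarith)⟩

lemma SymK.of_succ {k : ℕ} {r : ℤ} {a : ℤ → A} (h : SymK (k + 1) r a) : SymK k r a := by
  induction k generalizing r a with
  | zero => exact h.1
  | succ k ih => exact ⟨h.1, ih h.2⟩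

lemma SymK.congr {k : ℕ} {r : ℤ} {a b : ℤ → A} (h : SymK k r a) (hab : a =ᶠ[atTop] b) :
    SymK k r b := by
  induction k generalizing r a b with
  | zero => exact IsBigO.congr' h hab EventuallyEq.rfl
  | succ k ih =>
    refine ⟨h.1.congr' hab EventuallyEq.rfl, ih h.2 ?_⟩
    have h2 := (tendsto_atTop_add_const_right atTop (1 : ℤ) tendsto_id).eventually hab
    filter_upwards [hab, h2] with n h3 h4
    simp only [id] at h4
    rw [h3, h4]

lemma SymK.add {k : ℕ} {r : ℤ} {a b : ℤ → A} (ha : SymK k r a) (hb : SymK k r b) :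
    SymK k r (fun n => a n + b n) := by
  induction k generalizing r a b with
  | zero => exact IsBigO.add ha hb
  | succ k ih =>
    refine ⟨ha.1.add hb.1, ?_⟩
    have := ih ha.2 hb.2
    convert this using 2 with n
    beta_reduce
    abel

lemma SymK.neg {k : ℕ} {r : ℤ} {a : ℤ → A} (ha : SymK k r a) :
    SymK k r (fun n => - a n) := by
  induction k generalizing r a with
  | zero => exact IsBigO.neg_left ha
  | succ k ih =>
    refine ⟨ha.1.neg_left, ?_⟩
    have := ih ha.2
    convert this using 2 with n
    beta_reduce
    abel

lemma SymK.sub {k : ℕ} {r : ℤ} {a b : ℤ → A} (ha : SymK k r a) (hb : SymK k r b) :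
    SymK k r (fun n => a n - b n) := by
  simpa only [sub_eq_add_neg] using ha.add hb.neg

lemma SymK.shift {k : ℕ} {r : ℤ} {a : ℤ → A} (ha : SymK k r a) (j : ℤ) :
    SymK k r (fun n => a (n + j)) := by
  have key : ∀ {r : ℤ} {a : ℤ → A}, a =O[atTop] (fun n : ℤ => (n : ℝ) ^ r) →
      (fun n => a (n + j)) =O[atTop] (fun n : ℤ => (n : ℝ) ^ r) := by
    intro r a h
    exact (h.comp_tendsto (tendsto_atTop_add_const_right atTop j tendsto_id)).trans
      (isBigO_zpow_shift r j)
  induction k generalizing r a with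
  | zero => exact key ha
  | succ k ih =>
    refine ⟨key ha.1, ?_⟩
    have := ih ha.2
    convert this using 4
    ring

lemma isBigO_zpow_mul {a b : ℤ → A} {r r' : ℤ} (ha : a =O[atTop] (fun n : ℤ => (n : ℝ) ^ r))
    (hb : b =O[atTop] (fun n : ℤ => (n : ℝ) ^ r')) :
    (fun n => a n * b n) =O[atTop] (fun n : ℤ => (n : ℝ) ^ (r + r')) := by
  refine (ha.mul hb).congr' EventuallyEq.rfl ?_
  filter_upwards [eventually_gt_atTop 0] with n hn
  have : (n : ℝ) ≠ 0 := by exact_mod_cast hn.ne'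
  rw [zpow_add₀ this]

lemma SymK.mul {k : ℕ} {r r' : ℤ} {a b : ℤ → A} (ha : SymK k r a) (hb : SymK k r' b) :
    SymK k (r + r') (fun n => a n * b n) := by
  induction k generalizing r r' a b with
  | zero => exact isBigO_zpow_mul ha hb
  | succ k ih =>
    refine ⟨isBigO_zpow_mul ha.1 hb.1, ?_⟩
    have h1 := ih ha.2 (hb.of_succ.shift 1)
    have h2 := ih ha.of_succ hb.2
    rw [show r - 1 + r' = r + r' - 1 by ring] at h1
    rw [show r + (r' - 1) = r + r' - 1 by ring] at h2
    convert h1.add h2 using 2 with n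
    noncomm_ring

lemma SymK.zero (k : ℕ) (r : ℤ) : SymK k r (fun _ => (0 : A)) := by
  induction k generalizing r with
  | zero => exact isBigO_zero _ _
  | succ k ih => exact ⟨isBigO_zero _ _, by simpa using ih (r - 1)⟩

lemma SymK.const (k : ℕ) (x : A) : SymK k 0 (fun _ => x) := by
  have h : (fun _ : ℤ => x) =O[atTop] (fun n : ℤ => (n : ℝ) ^ (0 : ℤ)) := by
    simpa using isBigO_const_const x (one_ne_zero (α := ℝ)) atTop
  cases k with
  | zero => exact h
  | succ k => exact ⟨h, by simpa using SymK.zero k (0 - 1)⟩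

lemma SymK.natural [NormedAlgebra ℂ A] (k : ℕ) (x : A) : SymK k 1 (fun n : ℤ => (n : ℂ) • x) := by
  have h : (fun n : ℤ => (n : ℂ) • x) =O[atTop] (fun n : ℤ => (n : ℝ) ^ (1 : ℤ)) := by
    refine IsBigO.of_bound ‖x‖ (Eventually.of_forall fun n => ?_)
    rw [norm_smul, mul_comm]
    simp
  cases k with
  | zero => exact h
  | succ k =>
    refine ⟨h, ?_⟩
    have e : (fun n : ℤ => ((n + 1 : ℤ) : ℂ) • x - (n : ℂ) • x) = fun _ => x := by
      funext n
      push_cast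
      rw [add_smul, one_smul]
      abel
    change SymK k (1 - 1) (fun n : ℤ => ((n + 1 : ℤ) : ℂ) • x - (n : ℂ) • x)
    rw [e]
    exact SymK.const k x

lemma SymK.map [NormedAlgebra ℂ A] {B : Type*} [NormedRing B] [NormedAlgebra ℂ B] {k : ℕ} {r : ℤ}
    {a : ℤ → A} (φ : A →L[ℂ] B) (ha : SymK k r a) : SymK k r (fun n => φ (a n)) := by
  induction k generalizing r a with
  | zero => exact (φ.isBigO_comp a atTop).trans ha
  | succ k ih =>
    refine ⟨(φ.isBigO_comp a atTop).trans ha.1, ?_⟩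
    simpa using ih ha.2

lemma SymK.smul_const [NormedAlgebra ℂ A] {k : ℕ} {r : ℤ} {a : ℤ → ℂ} (ha : SymK k r a) (x : A) :
    SymK k r (fun n => a n • x) :=
  ha.map ((ContinuousLinearMap.id ℂ ℂ).smulRight x)

/-- Inverses of symbols that are bounded below are symbols. -/
lemma SymK.inverse {x y : ℤ → A} {r : ℤ} (hx : ∀ k, SymK k r x)
    (hy : y =O[atTop] (fun n : ℤ => (n : ℝ) ^ (-r)))
    (hxy : ∀ᶠ n in atTop, x n * y n = 1) (hyx : ∀ᶠ n in atTop, y n * x n = 1) (k : ℕ) :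
    SymK k (-r) y := by
  induction k with
  | zero => exact hy
  | succ k ih =>
    refine ⟨hy, ?_⟩
    have h1 := ((ih.shift 1).mul (hx (k + 1)).2).mul ih
    rw [show -r + (r - 1) + -r = -r - 1 by ring] at h1
    refine h1.neg.congr ?_
    have h2 := (tendsto_atTop_add_const_right atTop (1 : ℤ) tendsto_id).eventually hyx
    filter_upwards [hxy, h2] with n h3 h4
    simp only [id] at h4
    rw [mul_sub, sub_mul, h4, one_mul, mul_assoc, h3]
    noncomm_ring

/-- A symbol of some order. -/
def Symb (a : ℤ → A) : Prop := ∃ r : ℤ, ∀ k, SymK k r a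

lemma Symb.add {a b : ℤ → A} (ha : Symb a) (hb : Symb b) : Symb (fun n => a n + b n) := by
  obtain ⟨r, hr⟩ := ha
  obtain ⟨s, hs⟩ := hb
  exact ⟨max r s, fun k => ((hr k).mono (le_max_left _ _)).add ((hs k).mono (le_max_right _ _))⟩

lemma Symb.mul {a b : ℤ → A} (ha : Symb a) (hb : Symb b) : Symb (fun n => a n * b n) := by
  obtain ⟨r, hr⟩ := ha
  obtain ⟨s, hs⟩ := hb
  exact ⟨r + s, fun k => (hr k).mul (hs k)⟩

lemma Symb.neg {a : ℤ → A} (ha : Symb a) : Symb (fun n => - a n) := by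
  obtain ⟨r, hr⟩ := ha
  exact ⟨r, fun k => (hr k).neg⟩

lemma Symb.sub {a b : ℤ → A} (ha : Symb a) (hb : Symb b) : Symb (fun n => a n - b n) := by
  simpa only [sub_eq_add_neg] using ha.add hb.neg

lemma Symb.shift {a : ℤ → A} (ha : Symb a) (j : ℤ) : Symb (fun n => a (n + j)) := by
  obtain ⟨r, hr⟩ := ha
  exact ⟨r, fun k => (hr k).shift j⟩

lemma Symb.congr {a b : ℤ → A} (ha : Symb a) (hab : a =ᶠ[atTop] b) : Symb b := by
  obtain ⟨r, hr⟩ := ha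
  exact ⟨r, fun k => (hr k).congr hab⟩

lemma Symb.const (x : A) : Symb (fun _ : ℤ => x) := ⟨0, fun k => SymK.const k x⟩

lemma Symb.natural [NormedAlgebra ℂ A] (x : A) : Symb (fun n : ℤ => (n : ℂ) • x) :=
  ⟨1, fun k => SymK.natural k x⟩

lemma Symb.map [NormedAlgebra ℂ A] {B : Type*} [NormedRing B] [NormedAlgebra ℂ B]
    {a : ℤ → A} (φ : A →L[ℂ] B) (ha : Symb a) : Symb (fun n => φ (a n)) := by
  obtain ⟨r, hr⟩ := ha
  exact ⟨r, fun k => (hr k).map φ⟩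

lemma Symb.smul [NormedAlgebra ℂ A] {a : ℤ → A} (ha : Symb a) (c : ℂ) :
    Symb (fun n => c • a n) :=
  ha.map (c • ContinuousLinearMap.id ℂ A)

lemma Symb.polynomial (P : Polynomial ℂ) : Symb (fun n : ℤ => P.eval (n : ℂ)) := by
  induction P using Polynomial.induction_on' with
  | add p q hp hq => simpa using hp.add hq
  | monomial m c =>
    induction m with
    | zero => simpa using Symb.const c
    | succ m ih =>
      have := ih.mul (Symb.natural (1 : ℂ))
      refine this.congr (Eventually.of_forall fun n => ?_)
      simp [pow_succ, mul_assoc]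

/-- A function which is a symbol and periodic near `+∞` is eventually constant. -/
lemma Symb.eventually_const {a : ℤ → A} [NormedAlgebra ℂ A] (ha : Symb a) {i : ℕ} (hi : i ≠ 0)
    (hper : ∀ᶠ n in atTop, a (n + i) = a n) : ∃ x, ∀ᶠ n in atTop, a n = x := by
  -- a symbol of negative order which is periodic vanishes
  have shiftev : ∀ {p : ℤ → Prop}, (∀ᶠ n in atTop, p n) → ∀ᶠ n in atTop, p (n + 1) :=
    fun h => (tendsto_atTop_add_const_right atTop (1 : ℤ) tendsto_id).eventually h
  have perdiff : ∀ {b : ℤ → A}, (∀ᶠ n in atTop, b (n + i) = b n) →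
      ∀ᶠ n in atTop, b (n + i + 1) - b (n + i) = b (n + 1) - b n := by
    intro b hb
    filter_upwards [hb, shiftev hb] with n h1 h2
    rw [← h1, ← h2]
    congr 2
    ring
  have iter : ∀ {b : ℤ → A} {n₀ : ℤ}, (∀ n ≥ n₀, b (n + i) = b n) → ∀ n ≥ n₀, ∀ j : ℕ,
      b (n + i * j) = b n := by
    intro b n₀ h n hn j
    induction j with
    | zero => simp
    | succ j ih =>
      rw [← ih, ← h (n + i * j) (by nlinarith [mul_nonneg (Int.natCast_nonneg i) (Int.natCast_nonneg j)])]
      push_cast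
      congr 1
      ring
  have neg_order : ∀ (b : ℤ → A), SymK 0 (-1) b → (∀ᶠ n in atTop, b (n + i) = b n) →
      ∀ᶠ n in atTop, b n = 0 := by
    intro b hb hp
    obtain ⟨n₀, h₀⟩ := eventually_atTop.1 hp
    have lim : Tendsto b atTop (nhds 0) := by
      refine hb.trans_tendsto ?_
      simp only [zpow_neg_one]
      exact tendsto_inv_atTop_zero.comp tendsto_intCast_atTop_atTop
    filter_upwards [eventually_ge_atTop n₀] with n hn
    have h1 : Tendsto (fun j : ℕ => b (n + i * j)) atTop (nhds 0) := by
      refine lim.comp ?_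
      refine tendsto_atTop_add_const_left _ _ ?_
      refine Tendsto.const_mul_atTop' (by omega) tendsto_natCast_atTop_atTop
    have h2 : Tendsto (fun j : ℕ => b (n + i * j)) atTop (nhds (b n)) := by
      simp only [iter h₀ n hn]
      exact tendsto_const_nhds
    exact tendsto_nhds_unique h2 h1
  -- descending induction on the order
  have desc : ∀ (k : ℕ) (b : ℤ → A), SymK k ((k : ℤ) - 1) b →
      (∀ᶠ n in atTop, b (n + i) = b n) → ∃ x, ∀ᶠ n in atTop, b n = x := by
    intro k
    induction k with
    | zero =>
      intro b hb hp
      exact ⟨0, neg_order b (by simpa using hb) hp⟩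
    | succ k ih =>
      intro b hb hp
      have h1 := hb.2
      rw [show ((k + 1 : ℕ) : ℤ) - 1 - 1 = (k : ℤ) - 1 by push_cast; ring] at h1
      obtain ⟨x, hx⟩ := ih _ h1 (perdiff hp)
      obtain ⟨n₀, h₀⟩ := eventually_atTop.1 (hx.and hp)
      have lin : ∀ j : ℕ, b (n₀ + j) = b n₀ + j • x := by
        intro j
        induction j with
        | zero => simp
        | succ j ihj =>
          have := (h₀ (n₀ + j) (by omega)).1
          rw [sub_eq_iff_eq_add, ihj] at this
          push_cast
          rw [← add_assoc, this, succ_nsmul]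
          abel
      have hx0 : x = 0 := by
        have h2 := lin i
        rw [(h₀ n₀ le_rfl).2] at h2
        have h3 : (i : ℂ) • x = 0 := by
          rw [Nat.cast_smul_eq_nsmul]
          simpa using h2.symm
        exact (smul_eq_zero.1 h3).resolve_left (by exact_mod_cast hi)
      refine ⟨b n₀, ?_⟩
      filter_upwards [eventually_ge_atTop n₀] with n hn
      obtain ⟨j, rfl⟩ := Int.le.dest hn
      rw [lin j, hx0, smul_zero, add_zero]
  obtain ⟨r, hr⟩ := ha
  refine desc (r.toNat + 1) a ?_ hper
  refine (hr _).mono ?_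
  push_cast
  omega

end SymbolCalculus

section PolynomialDifferences

open Polynomial Filter

lemma exists_antidifference {i : ℂ} (hi : i ≠ 0) (k : ℕ) (P : ℂ[X]) (hP : P.natDegree ≤ k) :
    ∃ Q : ℂ[X], Q.natDegree ≤ k + 1 ∧ ∀ x, Q.eval x - Q.eval (x - i) = P.eval x := by
  induction k generalizing P with
  | zero =>
    obtain ⟨c, rfl⟩ := natDegree_eq_zero.1 (Nat.le_zero.1 hP)
    refine ⟨C (c / i) * X, (natDegree_C_mul_le _ _).trans (by simp), fun x => ?_⟩
    simp only [eval_mul, eval_C, eval_X]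
    field_simp
    ring
  | succ k ih =>
    set a := P.coeff (k + 1) with ha
    set T : ℂ[X] := C (a / (i * (k + 2))) * X ^ (k + 2) with hT
    have hk : ((k : ℂ) + 2) ≠ 0 := by exact_mod_cast (show k + 2 ≠ 0 by omega)
    set R : ℂ[X] := P - (T - T.comp (X - C i)) with hR
    have hTd : T.natDegree ≤ k + 2 := (natDegree_C_mul_le _ _).trans (by simp)
    have hcomp : (T.comp (X - C i)).natDegree ≤ k + 2 := by
      rw [natDegree_comp]
      simpa using hTd
    have hRdeg : R.natDegree ≤ k + 2 :=
      (natDegree_sub_le _ _).trans (max_le (by omega)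
        ((natDegree_sub_le _ _).trans (max_le hTd hcomp)))
    have hX : (X - C i : ℂ[X]) = X + C (-i) := by rw [C_neg, sub_eq_add_neg]
    have hTc : T.comp (X - C i) = C (a / (i * (k + 2))) * (X + C (-i)) ^ (k + 2) := by
      rw [hT, hX]; simp
    have hc2 : R.coeff (k + 2) = 0 := by
      rw [hR, coeff_sub, coeff_sub, hTc, hT, coeff_C_mul, coeff_C_mul, coeff_X_add_C_pow,
        coeff_X_pow, coeff_eq_zero_of_natDegree_lt (by omega)]
      simp
    have hc1 : R.coeff (k + 1) = 0 := by
      rw [hR, coeff_sub, coeff_sub, hTc, hT, coeff_C_mul, coeff_C_mul, coeff_X_add_C_pow,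
        coeff_X_pow, show k + 2 - (k + 1) = 1 by omega, if_neg (by omega), ← ha,
        show (k + 2).choose (k + 1) = k + 2 from Nat.choose_succ_self_right (k + 1)]
      push_cast
      field_simp
      ring
    have hRk : R.natDegree ≤ k := by
      rw [natDegree_le_iff_coeff_eq_zero]
      intro N hN
      rcases Nat.lt_or_ge (k + 2) N with h | h
      · exact coeff_eq_zero_of_natDegree_lt (by omega)
      · rcases (show N = k + 1 ∨ N = k + 2 by omega) with rfl | rfl
        · exact hc1
        · exact hc2
    obtain ⟨Q, hQ, hQe⟩ := ih R hRk
    refine ⟨Q + T, (natDegree_add_le _ _).trans (max_le (by omega) (by omega)), fun x => ?_⟩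
    have h1 := hQe x
    rw [hR] at h1
    simp only [eval_sub, eval_comp, eval_add, eval_X, eval_C] at h1 ⊢
    linear_combination h1

/-- A function on `ℤ` with polynomial difference `F n - F (n - i)`, which is a symbol at `-∞`,
is polynomial. -/
lemma polynomial_of_difference {F : ℤ → ℂ} {i : ℤ} (hi : i ≠ 0) {k : ℕ} {P : ℂ[X]}
    (hP : P.natDegree ≤ k) (hF : ∀ n, F n - F (n - i) = P.eval (n : ℂ))
    (hS : Symb (fun n => F (-n))) :
    ∃ Q : ℂ[X], Q.natDegree ≤ k + 1 ∧ ∀ n : ℤ, F n = Q.eval (n : ℂ) := by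
  have hi' : (i : ℂ) ≠ 0 := by exact_mod_cast hi
  obtain ⟨Q, hQ, hQe⟩ := exists_antidifference hi' k P hP
  set H : ℤ → ℂ := fun n => F n - Q.eval (n : ℂ) with hH
  have hper : ∀ n, H (n - i) = H n := by
    intro n
    have h1 := hF n
    have h2 := hQe n
    simp only [hH]
    push_cast
    linear_combination h2 - h1
  have hper1 : Function.Periodic H i := fun n => by
    rw [← hper (n + i), add_sub_cancel_right]
  have hperiod : ∀ n, H (n + i.natAbs) = H n := by
    intro n
    rcases Int.natAbs_eq i with h | h
    · rw [← h]; exact hper1 n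
    · have := hper1.neg n
      rwa [show -i = (i.natAbs : ℤ) by omega] at this
  have hHS : Symb (fun n => H (-n)) := by
    refine hS.sub ?_
    refine (Symb.polynomial (Q.comp (-X))).congr (Eventually.of_forall fun n => ?_)
    simp
  have hnat : i.natAbs ≠ 0 := Int.natAbs_ne_zero.2 hi
  obtain ⟨x, hx⟩ := hHS.eventually_const hnat (Eventually.of_forall fun n => by
    have := hperiod (-(n + i.natAbs))
    rw [← this]
    congr 1
    ring)
  obtain ⟨n₀, h₀⟩ := eventually_atTop.1 hx
  have hconst : ∀ n, H n = x := by
    intro n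
    have hp : Function.Periodic H i.natAbs := hperiod
    have h1 := hp.sub_zsmul_eq (x := n) ((n.natAbs + n₀.natAbs : ℕ) : ℤ)
    rw [← h1]
    have h2 := h₀ (-(n - ((n.natAbs + n₀.natAbs : ℕ) : ℤ) • (i.natAbs : ℤ))) (by
      have h3 : (1 : ℤ) ≤ i.natAbs := by omega
      have h4 : ((n.natAbs + n₀.natAbs : ℕ) : ℤ) ≤ ((n.natAbs + n₀.natAbs : ℕ) : ℤ) * i.natAbs :=
        le_mul_of_one_le_right (by positivity) h3
      rw [smul_eq_mul]
      push_cast at h4 ⊢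
      cases abs_cases n <;> cases abs_cases n₀ <;> linarith)
    rwa [neg_neg] at h2
  refine ⟨Q + C x, (natDegree_add_le _ _).trans (max_le hQ (by simp)), fun n => ?_⟩
  rw [eval_add, eval_C, ← hconst n]
  simp [hH]

end PolynomialDifferences

section WeightTraces

variable {M : Type*} [AddCommGroup M] [Module ℂ M]

/-- The weight space of weight `lam + n`. -/
def wt (L0 : End ℂ M) (lam : ℂ) (n : ℤ) : Submodule ℂ M := L0.eigenspace (lam + n)

lemma mem_wt {L0 : End ℂ M} {lam : ℂ} {n : ℤ} {x : M} :
    x ∈ wt L0 lam n ↔ L0 x = (lam + n) • x := End.mem_eigenspace_iff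

lemma wt_iSupIndep (L0 : End ℂ M) (lam : ℂ) : iSupIndep (wt L0 lam) :=
  (End.eigenspaces_iSupIndep L0).comp (f := fun n : ℤ => lam + n)
    (fun a b h => by simpa using h)

/-- An operator shifting weights by `k`. -/
def Shifts (L0 : End ℂ M) (lam : ℂ) (k : ℤ) (A : End ℂ M) : Prop :=
  ∀ n, ∀ x ∈ wt L0 lam n, A x ∈ wt L0 lam (n + k)

lemma Shifts.mul {L0 : End ℂ M} {lam : ℂ} {k l : ℤ} {A B : End ℂ M} (hA : Shifts L0 lam k A)
    (hB : Shifts L0 lam l B) : Shifts L0 lam (k + l) (A * B) := fun n x hx => by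
  have := hA _ _ (hB n x hx)
  rwa [show n + l + k = n + (k + l) by ring] at this

lemma Shifts.of_comm {L0 : End ℂ M} {lam : ℂ} {k : ℤ} {A : End ℂ M}
    (h : L0 * A - A * L0 = (k : ℂ) • A) : Shifts L0 lam k A := fun n x hx => by
  rw [mem_wt] at hx ⊢
  have h1 := LinearMap.congr_fun h x
  simp only [LinearMap.sub_apply, Module.End.mul_apply, LinearMap.smul_apply, hx, map_smul] at h1
  rw [sub_eq_iff_eq_add] at h1
  rw [h1, ← add_smul]
  push_cast
  congr 1
  ring

open scoped Classical in
/-- Projection to the weight space of weight `lam + n`. -/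
def wtProj (L0 : End ℂ M) (lam : ℂ) (n : ℤ) : M →ₗ[ℂ] wt L0 lam n :=
  if h : DirectSum.IsInternal (wt L0 lam) then
    DirectSum.component ℂ ℤ (fun n => wt L0 lam n) n ∘ₗ
      (LinearEquiv.ofBijective (DirectSum.coeLinearMap (wt L0 lam)) h).symm.toLinearMap
  else 0

variable {L0 : End ℂ M} {lam : ℂ}

lemma wt_isInternal (h : ⨆ n, wt L0 lam n = ⊤) : DirectSum.IsInternal (wt L0 lam) := by
  classical
  exact DirectSum.isInternal_submodule_of_iSupIndep_of_iSup_eq_top (wt_iSupIndep L0 lam) h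

lemma wtProj_apply (h : ⨆ n, wt L0 lam n = ⊤) {m n : ℤ} {x : M} (hx : x ∈ wt L0 lam m) :
    (wtProj L0 lam n x : M) = if m = n then x else 0 := by
  classical
  have hi := wt_isInternal h
  have e : (LinearEquiv.ofBijective (DirectSum.coeLinearMap (wt L0 lam)) hi).symm x =
      DirectSum.lof ℂ ℤ (fun n => wt L0 lam n) m ⟨x, hx⟩ := by
    rw [LinearEquiv.symm_apply_eq]
    exact (DirectSum.coeLinearMap_lof (wt L0 lam) m ⟨x, hx⟩).symm
  rw [wtProj, dif_pos (by convert hi)]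
  have e2 : DirectSum.component ℂ ℤ (fun n => wt L0 lam n) n
      (DirectSum.lof ℂ ℤ (fun n => wt L0 lam n) m ⟨x, hx⟩) = if h : m = n then h ▸ ⟨x, hx⟩ else 0 := by
    split_ifs with hmn
    · subst hmn
      simp [DirectSum.component.lof_self]
    · rw [DirectSum.component.of]
      simp [hmn]
  have e3 : (wtProj L0 lam n x) = DirectSum.component ℂ ℤ (fun n => wt L0 lam n) n
      ((LinearEquiv.ofBijective (DirectSum.coeLinearMap (wt L0 lam)) hi).symm x) := by
    rw [wtProj, dif_pos (by convert hi)]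
    rfl
  rw [wtProj, dif_pos (by convert hi)] at e3
  rw [e3, e, e2]
  split_ifs with hmn
  · subst hmn; rfl
  · rfl

lemma wtProj_self (h : ⨆ n, wt L0 lam n = ⊤) {n : ℤ} (x : wt L0 lam n) :
    wtProj L0 lam n (x : M) = x := by
  ext
  rw [wtProj_apply h x.2, if_pos rfl]

lemma ext_wt (h : ⨆ n, wt L0 lam n = ⊤) {W : Type*} [AddCommGroup W] [Module ℂ W]
    {f g : M →ₗ[ℂ] W} (hfg : ∀ n, ∀ x ∈ wt L0 lam n, f x = g x) : f = g := by
  have : (⊤ : Submodule ℂ M) ≤ LinearMap.eqLocus f g := by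
    rw [← h, iSup_le_iff]
    exact fun n x hx => hfg n x hx
  ext x
  exact this (Submodule.mem_top (x := x))

/-- The trace of the weight-zero component of `A` on the weight space of weight `lam + n`. -/
def wtTrace (L0 : End ℂ M) (lam : ℂ) (n : ℤ) : End ℂ M →ₗ[ℂ] ℂ where
  toFun A := LinearMap.trace ℂ (wt L0 lam n) (wtProj L0 lam n ∘ₗ A ∘ₗ (wt L0 lam n).subtype)
  map_add' A B := by
    rw [LinearMap.add_comp, LinearMap.comp_add, map_add]
  map_smul' c A := by
    rw [LinearMap.smul_comp, LinearMap.comp_smul, map_smul]; rfl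

lemma wtTrace_apply (n : ℤ) (A : End ℂ M) : wtTrace L0 lam n A =
    LinearMap.trace ℂ (wt L0 lam n) (wtProj L0 lam n ∘ₗ A ∘ₗ (wt L0 lam n).subtype) := rfl

lemma wtTrace_mul_comm (h : ⨆ n, wt L0 lam n = ⊤)
    (hf : ∀ n, FiniteDimensional ℂ (wt L0 lam n)) {k : ℤ} {A : End ℂ M}
    (hA : Shifts L0 lam k A) (B : End ℂ M) (n : ℤ) :
    wtTrace L0 lam n (A * B) = wtTrace L0 lam (n - k) (B * A) := by
  have := hf n
  have := hf (n - k)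
  set P := wtProj L0 lam n ∘ₗ A ∘ₗ (wt L0 lam (n - k)).subtype with hP
  set Q := wtProj L0 lam (n - k) ∘ₗ B ∘ₗ (wt L0 lam n).subtype with hQ
  have h1 : wtProj L0 lam n ∘ₗ (A * B) ∘ₗ (wt L0 lam n).subtype = P ∘ₗ Q := by
    have : wtProj L0 lam n ∘ₗ A = P ∘ₗ wtProj L0 lam (n - k) := by
      refine ext_wt h fun m x hx => ?_
      ext
      simp only [hP, LinearMap.comp_apply, Submodule.subtype_apply]
      rw [wtProj_apply h (hA _ _ hx), wtProj_apply h hx]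
      by_cases hm : m + k = n
      · rw [if_pos hm, if_pos (by omega), wtProj_apply h (hA _ _ hx), if_pos hm]
      · rw [if_neg hm, if_neg (by omega)]
        simp
    rw [show (wtProj L0 lam n ∘ₗ (A * B) ∘ₗ (wt L0 lam n).subtype) =
      (wtProj L0 lam n ∘ₗ A) ∘ₗ (B ∘ₗ (wt L0 lam n).subtype) from rfl, this]
    rfl
  have h2 : wtProj L0 lam (n - k) ∘ₗ (B * A) ∘ₗ (wt L0 lam (n - k)).subtype = Q ∘ₗ P := by
    ext x
    simp only [hP, hQ, LinearMap.comp_apply, Submodule.subtype_apply, Module.End.mul_apply]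
    rw [wtProj_apply h (hA _ _ x.2), if_pos (by ring)]
  rw [wtTrace_apply, wtTrace_apply, h1, h2, LinearMap.trace_comp_comm']

lemma wtTrace_one (h : ⨆ n, wt L0 lam n = ⊤)
    (hf : ∀ n, FiniteDimensional ℂ (wt L0 lam n)) (n : ℤ) :
    wtTrace L0 lam n 1 = finrank ℂ (wt L0 lam n) := by
  have := hf n
  rw [wtTrace_apply, ← LinearMap.trace_one ℂ (wt L0 lam n)]
  congr 1
  ext x
  simp [wtProj_self h]

lemma wtTrace_L0_mul (h : ⨆ n, wt L0 lam n = ⊤) (A : End ℂ M) (n : ℤ) :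
    wtTrace L0 lam n (L0 * A) = (lam + n) * wtTrace L0 lam n A := by
  rw [wtTrace_apply, wtTrace_apply, ← smul_eq_mul (lam + (n : ℂ)), ← map_smul]
  congr 1
  have : wtProj L0 lam n ∘ₗ L0 = (lam + n) • wtProj L0 lam n := by
    refine ext_wt h fun m x hx => ?_
    ext
    rw [LinearMap.comp_apply, mem_wt.1 hx, map_smul, LinearMap.smul_apply, Submodule.coe_smul,
      Submodule.coe_smul, wtProj_apply h hx]
    split_ifs with hm
    · rw [hm]
    · simp
  rw [show (wtProj L0 lam n ∘ₗ (L0 * A) ∘ₗ (wt L0 lam n).subtype) =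
    (wtProj L0 lam n ∘ₗ L0) ∘ₗ (A ∘ₗ (wt L0 lam n).subtype) from rfl, this]
  rfl

lemma wtTrace_of_shifts (h : ⨆ n, wt L0 lam n = ⊤) {k : ℤ} (hk : k ≠ 0) {A : End ℂ M}
    (hA : Shifts L0 lam k A) (n : ℤ) : wtTrace L0 lam n A = 0 := by
  rw [wtTrace_apply]
  convert map_zero (LinearMap.trace ℂ (wt L0 lam n))
  ext x
  simp only [LinearMap.comp_apply, Submodule.subtype_apply]
  rw [wtProj_apply h (hA _ _ x.2), if_neg (by omega)]
  simp

end WeightTraces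

section VirasoroModules

variable {M : Type*} [AddCommGroup M] [Module ℂ M]

/-- Weight modules for the Virasoro algebra with finite-dimensional weight spaces and weights
in `lam + ℤ`, on which the central element acts by `c`. -/
structure VirMod (L : ℤ → End ℂ M) (lam c : ℂ) : Prop where
  comm : ∀ i j : ℤ, L i * L j - L j * L i = ((j : ℂ) - i) • L (i + j) +
    (if i + j = 0 then ((i : ℂ) ^ 3 - i) / 12 * c else 0) • (1 : End ℂ M)
  top : ⨆ n, wt (L 0) lam n = ⊤
  fin : ∀ n, FiniteDimensional ℂ (wt (L 0) lam n)

variable {L : ℤ → End ℂ M} {lam c : ℂ}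

lemma VirMod.shifts (h : VirMod L lam c) (i : ℤ) : Shifts (L 0) lam i (L i) := by
  refine Shifts.of_comm ?_
  have := h.comm 0 i
  simpa using this

lemma wt_neg (L0 : End ℂ M) (lam : ℂ) (n : ℤ) : wt (-L0) (-lam) n = wt L0 lam (-n) := by
  ext x
  rw [mem_wt, mem_wt, LinearMap.neg_apply, neg_eq_iff_eq_neg, ← neg_smul]
  push_cast
  rw [show -(-lam + (n : ℂ)) = lam + -n by ring]

lemma VirMod.flip (h : VirMod L lam c) : VirMod (fun i => - L (-i)) (-lam) (-c) where
  comm i j := by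
    have := h.comm (-i) (-j)
    rw [neg_mul_neg, neg_mul_neg, this, show -i + -j = -(i + j) by ring]
    simp only [neg_eq_zero]
    rw [smul_neg, ← neg_smul]
    congr 1
    · congr 1
      push_cast
      ring
    · congr 1
      split_ifs
      · push_cast
        ring
      · rfl
  top := by
    rw [← h.top]
    change ⨆ n, wt (-L (-0)) (-lam) n = _
    have e : ∀ n, wt (-L (-0)) (-lam) n = wt (L 0) lam (-n) := fun n => by
      rw [neg_zero]; exact wt_neg _ _ n
    simp only [e]
    exact (Equiv.neg ℤ).iSup_comp (g := fun n => wt (L 0) lam n)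
  fin n := by
    change FiniteDimensional ℂ (wt (-L (-0)) (-lam) n)
    rw [neg_zero, wt_neg]
    exact h.fin _

lemma linearIndependent_of_pow_strings {T : End ℂ M} (a : ℕ → ℕ)
    (ha : Function.Injective a) (u : ℕ → M) (h1 : ∀ k, (T ^ a k) (u k) ≠ 0)
    (h2 : ∀ k, (T ^ (a k + 1)) (u k) = 0) : LinearIndependent ℂ u := by
  rw [linearIndependent_iff']
  by_contra! hcon
  obtain ⟨s, g, hs, i, his, hgi⟩ := hcon
  obtain ⟨j, hj, hmax⟩ := Finset.exists_max_image (s.filter fun i => g i ≠ 0) a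
    ⟨i, Finset.mem_filter.2 ⟨his, hgi⟩⟩
  rw [Finset.mem_filter] at hj
  have h3 := congrArg (T ^ a j) hs
  rw [map_sum, map_zero, Finset.sum_eq_single_of_mem j hj.1] at h3
  · rw [map_smul] at h3
    exact h1 j ((smul_eq_zero.1 h3).resolve_left hj.2)
  · intro b hb hbj
    rw [map_smul]
    by_cases hgb : g b = 0
    · rw [hgb, zero_smul]
    · have hlt : a b < a j := lt_of_le_of_ne (hmax b (Finset.mem_filter.2 ⟨hb, hgb⟩))
        (fun e => hbj (ha e))
      obtain ⟨d, hd⟩ := Nat.exists_eq_add_of_le (Nat.succ_le_of_lt hlt)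
      rw [hd, Nat.succ_eq_add_one, add_comm, pow_add, Module.End.mul_apply, h2, map_zero, smul_zero]

/-- The coefficient by which `L k` acts back along the string generated by `L (-k)`. -/
lemma VirMod.lowering_string (h : VirMod L lam c) {k : ℤ} {n : ℤ} {v : M} (hv : v ∈ wt (L 0) lam n)
    (hkv : L k v = 0) (q : ℕ) :
    (L (-k) ^ q) v ∈ wt (L 0) lam (n - k * q) ∧
    L k ((L (-k) ^ (q + 1)) v) = (((q + 1 : ℕ) : ℂ) * (-2 * k * (lam + n) + (k : ℂ) ^ 2 * q +
      ((k : ℂ) ^ 3 - k) / 12 * c)) • (L (-k) ^ q) v := by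
  have hw : ∀ q : ℕ, (L (-k) ^ q) v ∈ wt (L 0) lam (n - k * q) := by
    intro q
    induction q with
    | zero => simpa using hv
    | succ q ih =>
      rw [pow_succ', Module.End.mul_apply]
      have := h.shifts (-k) _ _ ih
      push_cast
      rwa [show n - k * (q + 1) = n - k * q + -k by ring]
  have hc : ∀ x, L k (L (-k) x) = L (-k) (L k x) + ((-2 * k : ℂ) • L 0 x +
      (((k : ℂ) ^ 3 - k) / 12 * c) • x) := by
    intro x
    have := LinearMap.congr_fun (h.comm k (-k)) x
    simp only [LinearMap.sub_apply, Module.End.mul_apply, LinearMap.add_apply, LinearMap.smul_apply,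
      add_neg_cancel, if_true, Module.End.one_apply] at this
    rw [sub_eq_iff_eq_add] at this
    rw [this]
    push_cast
    rw [show (-(k : ℂ) - k) = -2 * k by ring]
    abel
  refine ⟨hw q, ?_⟩
  induction q with
  | zero =>
    rw [pow_one, hc, hkv, map_zero, zero_add, mem_wt.1 hv]
    simp only [pow_zero, Module.End.one_apply]
    rw [smul_smul, ← add_smul]
    push_cast
    congr 1
    ring
  | succ q ih =>
    rw [pow_succ', Module.End.mul_apply, hc, ih, map_smul, ← Module.End.mul_apply, ← pow_succ',
      mem_wt.1 (hw (q + 1)), smul_smul, ← add_smul, ← add_smul]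
    push_cast
    congr 1
    ring

/-- In a weight module with finite-dimensional weight spaces, the weights of vectors
annihilated by `L k` (`k > 0`) are bounded above. -/
lemma VirMod.bounded_of_annihilated (h : VirMod L lam c) {k : ℕ} (hk : 0 < k) :
    ∃ B : ℤ, ∀ n, B ≤ n → ∀ v ∈ wt (L 0) lam n, L k v = 0 → v = 0 := by
  by_contra! hcon
  choose n hn v hv hkv hv0 using hcon
  -- choose a class modulo `k`
  set B₀ : ℤ := ⌈|(-2 * k * lam + ((k : ℂ) ^ 3 - k) / 12 * c).re|⌉ + 1 with hB₀
  obtain ⟨r, hr⟩ := Finite.exists_infinite_fiber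
    (fun j : ℕ => (⟨(n (B₀ + j) % k).toNat, by
      have := Int.emod_lt_of_pos (n (B₀ + j)) (show (0 : ℤ) < k by exact_mod_cast hk)
      omega⟩ : Fin k))
  have hinf := Set.infinite_coe_iff.1 hr
  -- a strictly increasing sequence of weights in this class
  have hex : ∀ m : ℤ, ∃ j : ℕ, m < n (B₀ + j) ∧ n (B₀ + j) % k = r := by
    intro m
    obtain ⟨j, hj, hjm⟩ := hinf.exists_gt m.natAbs
    refine ⟨j, ?_, ?_⟩
    · have := hn (B₀ + j)
      have hB : 0 ≤ B₀ := by positivity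
      omega
    · have h1 : (⟨(n (B₀ + j) % k).toNat, _⟩ : Fin k) = r := hj
      have h2 := congrArg Fin.val h1
      have h3 := Int.emod_nonneg (n (B₀ + j)) (show (k : ℤ) ≠ 0 by omega)
      simp only at h2
      omega
  obtain ⟨j₀, -, hj₀⟩ := hex 0
  set m₀ := n (B₀ + j₀) with hm₀
  have hex2 : ∀ Q : ℕ, ∃ (q : ℕ) (w : M), Q < q ∧ w ≠ 0 ∧ w ∈ wt (L 0) lam (m₀ + k * q) ∧
      L k w = 0 := by
    intro Q
    obtain ⟨j, hj, hjr⟩ := hex (m₀ + k * Q)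
    have hdvd : (k : ℤ) ∣ n (B₀ + j) - m₀ := (Int.emod_emod_of_dvd _ dvd_rfl ▸
      Int.emod_eq_emod_iff_emod_sub_eq_zero.1 (hjr.trans hj₀.symm) |> Int.dvd_of_emod_eq_zero)
    obtain ⟨q, hq⟩ := hdvd
    have hk' : (0 : ℤ) < k := by exact_mod_cast hk
    have hqQ : (Q : ℤ) < q := by
      have : (k : ℤ) * Q < k * q := by linarith
      exact lt_of_mul_lt_mul_left this hk'.le
    lift q to ℕ using by omega
    refine ⟨q, v (B₀ + j), by exact_mod_cast hqQ, hv0 _, ?_, hkv _⟩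
    rw [show m₀ + k * q = n (B₀ + j) by linarith]
    exact hv _
  choose q w hQ hw0 hw hkw using hex2
  let idx : ℕ → ℕ := fun i => Nat.rec (motive := fun _ => ℕ) (q 0) (fun _ p => q p) i
  have hidx : StrictMono idx := strictMono_nat_of_lt_succ fun i => hQ (idx i)
  have hex3 : ∀ i, ∃ w : M, w ≠ 0 ∧ w ∈ wt (L 0) lam (m₀ + k * idx i) ∧ L k w = 0 := by
    intro i
    cases i with
    | zero => exact ⟨w 0, hw0 _, hw _, hkw _⟩
    | succ i => exact ⟨w (idx i), hw0 _, hw _, hkw _⟩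
  choose x hx0 hx hkx using hex3
  have hstr : ∀ i, ∀ p : ℕ, p ≤ idx i → ((L k) ^ p) ((L (-k) ^ p) (x i)) ≠ 0 ∧
      ((L k) ^ (p + 1)) ((L (-k) ^ p) (x i)) = 0 := by
    intro i p hp
    induction p with
    | zero => simpa using ⟨hx0 i, hkx i⟩
    | succ p ih =>
      have ih' := ih (by omega)
      have h1 := (h.lowering_string (hx i) (hkx i) p).2
      rw [pow_succ (L k) p, pow_succ (L k) (p + 1), Module.End.mul_apply, Module.End.mul_apply, h1,
        map_smul, map_smul, ih'.2, smul_zero]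
      refine ⟨smul_ne_zero (mul_ne_zero (by exact_mod_cast Nat.succ_ne_zero p) ?_) ih'.1, rfl⟩
      intro h0
      have h2 := congrArg Complex.re h0
      have h3 : ((-2 * (k : ℂ) * (lam + ((m₀ + k * idx i : ℤ) : ℂ)) + (k : ℂ) ^ 2 * p +
          ((k : ℂ) ^ 3 - k) / 12 * c)) = (-2 * k * lam + ((k : ℂ) ^ 3 - k) / 12 * c) +
          ((-2 * (k : ℝ) * (m₀ + k * idx i) + (k : ℝ) ^ 2 * p : ℝ) : ℂ) := by
        push_cast
        ring
      rw [Int.cast_natCast] at h2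
      rw [h3, Complex.add_re, Complex.ofReal_re, Complex.zero_re] at h2
      have h4 : |(-2 * k * lam + ((k : ℂ) ^ 3 - k) / 12 * c).re| < (B₀ : ℝ) := by
        rw [hB₀, Int.cast_add, Int.cast_one]
        exact (Int.le_ceil _).trans_lt (lt_add_one _)
      have h5 : (B₀ : ℝ) ≤ m₀ := by
        have := hn (B₀ + j₀)
        exact_mod_cast (show B₀ ≤ m₀ by omega)
      have h6 := le_abs_self ((-2 * k * lam + ((k : ℂ) ^ 3 - k) / 12 * c).re)
      have h7 : (p : ℝ) ≤ idx i := by exact_mod_cast (show p ≤ idx i by omega)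
      have h8 : (1 : ℝ) ≤ k := by exact_mod_cast hk
      have h9 : (0 : ℝ) ≤ B₀ := (abs_nonneg _).trans h4.le
      have h10 : (k : ℝ) ^ 2 * p ≤ k ^ 2 * idx i := by gcongr
      have h11 : (m₀ : ℝ) ≤ k * m₀ := le_mul_of_one_le_left (h9.trans h5) h8
      have h12 : (0 : ℝ) ≤ k ^ 2 * idx i := by positivity
      nlinarith
  have hLI : LinearIndependent ℂ (fun i => (L (-k) ^ idx i) (x i)) :=
    linearIndependent_of_pow_strings (T := L k) idx hidx.injective _
      (fun i => (hstr i _ le_rfl).1) (fun i => (hstr i _ le_rfl).2)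
  have hmem : ∀ i, (L (-k) ^ idx i) (x i) ∈ wt (L 0) lam m₀ := by
    intro i
    have := (h.lowering_string (hx i) (hkx i) (idx i)).1
    rwa [add_sub_cancel_right] at this
  have := h.fin m₀
  have hLI2 : LinearIndependent ℂ (fun i => (⟨_, hmem i⟩ : wt (L 0) lam m₀)) :=
    LinearIndependent.of_comp (wt (L 0) lam m₀).subtype hLI
  exact absurd hLI2.finite (by infer_instance : Infinite ℕ).not_finite

end VirasoroModules

section Gronwall

open Filter Asymptotics

/-- A discrete Gronwall estimate. -/
lemma isBigO_of_difference {A : Type*} [NormedRing A] {a : ℤ → A} {R : ℕ} {C D : ℝ}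
    (h : ∀ᶠ n : ℤ in atTop,
      ‖a (n + 1) - a n‖ ≤ C * (n : ℝ) ^ R + D / (n : ℝ) ^ 2 * (‖a (n + 1)‖ + ‖a n‖)) :
    a =O[atTop] (fun n : ℤ => (n : ℝ) ^ ((R : ℤ) + 1)) := by
  set D' := max D 0
  have hD' : 0 ≤ D' := le_max_right _ _
  obtain ⟨n₁, hn₁⟩ := eventually_atTop.1 h
  obtain ⟨n₂, hn₂⟩ := exists_nat_gt (2 * (D' * (1 + 2 ^ (R + 1))) + D' + 1)
  set n₀ := max n₁ n₂
  set B := max (2 * C) (max ‖a n₀‖ 0)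
  have hB : 0 ≤ B := (le_max_right _ _).trans (le_max_right _ _)
  have hB1 : ‖a n₀‖ ≤ B := (le_max_left _ _).trans (le_max_right _ _)
  have hB2 : 2 * C ≤ B := le_max_left _ _
  have hlarge : ∀ n ≥ n₀, 2 * (D' * (1 + 2 ^ (R + 1))) + D' + 1 < (n : ℝ) := fun n hn => by
    have : ((n₂ : ℤ) : ℝ) ≤ n := by exact_mod_cast (le_max_right _ _).trans hn
    rw [Int.cast_natCast] at this
    exact hn₂.trans_le this
  refine IsBigO.of_bound B ?_
  filter_upwards [eventually_ge_atTop n₀] with n hn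
  rw [show ((R : ℤ) + 1) = ((R + 1 : ℕ) : ℤ) by push_cast; ring]
  simp only [zpow_natCast]
  induction n, hn using Int.leInduction with
  | base =>
    have h1 := hlarge n₀ le_rfl
    have h2 : (1 : ℝ) ≤ n₀ := by
      have : 0 ≤ D' * (1 + 2 ^ (R + 1)) := by positivity
      linarith
    rw [Real.norm_of_nonneg (pow_nonneg (by linarith) _)]
    exact hB1.trans (le_mul_of_one_le_right hB (one_le_pow₀ h2))
  | succ n hn ih =>
    have h1 := hlarge n hn
    have hD2 : 0 ≤ D' * (1 + 2 ^ (R + 1)) := by positivity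
    have h2 : (1 : ℝ) ≤ n := by linarith
    have hn0 : (0 : ℝ) ≤ n := by linarith
    have h3 := hn₁ n ((le_max_left _ _).trans hn)
    rw [Real.norm_of_nonneg (pow_nonneg hn0 _)] at ih
    rw [Real.norm_of_nonneg (by push_cast; positivity)]
    have h4 : D / (n : ℝ) ^ 2 * (‖a (n + 1)‖ + ‖a n‖) ≤ D' / (n : ℝ) ^ 2 * (‖a (n + 1)‖ + ‖a n‖) := by
      gcongr
      exact le_max_left _ _
    have h5 : ‖a (n + 1)‖ ≤ ‖a n‖ + ‖a (n + 1) - a n‖ := by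
      simpa using norm_add_le (a n) (a (n + 1) - a n)
    set ε := D' / (n : ℝ) ^ 2 with hε
    have hε0 : 0 ≤ ε := by positivity
    have hε1 : ε < 1 := by
      rw [hε, div_lt_one (by positivity)]
      nlinarith
    have h6 : (n : ℝ) ^ (R + 1) + n ^ R ≤ (n + 1) ^ (R + 1) := by
      have : (n : ℝ) ^ R ≤ (n + 1) ^ R := by gcongr; linarith
      calc (n : ℝ) ^ (R + 1) + n ^ R = n ^ R * (n + 1) := by ring
        _ ≤ (n + 1) ^ R * (n + 1) := by gcongr
        _ = _ := by ring
    have h7 : ((n : ℝ) + 1) ^ (R + 1) ≤ 2 ^ (R + 1) * n ^ (R + 1) := by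
      rw [← mul_pow]; gcongr; linarith
    have h8 : ε * n ^ (R + 1) * (1 + 2 ^ (R + 1)) ≤ n ^ R / 2 := by
      rw [hε]
      have : D' / (n : ℝ) ^ 2 * n ^ (R + 1) * (1 + 2 ^ (R + 1)) =
          (D' * (1 + 2 ^ (R + 1))) / n * n ^ R := by
        field_simp
        ring
      rw [this]
      have h9 : (D' * (1 + 2 ^ (R + 1))) / n ≤ 1 / 2 := by
        rw [div_le_iff₀ (by linarith)]
        linarith
      have : (0 : ℝ) ≤ n ^ R := by positivity
      nlinarith
    have h10 : (0 : ℝ) ≤ n ^ R := by positivity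
    push_cast
    have key : (1 - ε) * ‖a (n + 1)‖ ≤ (1 - ε) * (B * ((n : ℝ) + 1) ^ (R + 1)) := by
      have e1 : (1 - ε) * ‖a (n + 1)‖ ≤ C * n ^ R + (1 + ε) * ‖a n‖ := by nlinarith
      have e2 : (1 + ε) * ‖a n‖ ≤ (1 + ε) * (B * n ^ (R + 1)) := by gcongr
      have e3 : C * n ^ R ≤ B * (n ^ R / 2) := by nlinarith
      have e4 : B * (ε * n ^ (R + 1) * (1 + 2 ^ (R + 1))) ≤ B * (n ^ R / 2) := by gcongr
      have e5 : B * ((n : ℝ) ^ (R + 1) + n ^ R) ≤ B * (n + 1) ^ (R + 1) := by gcongr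
      have e6 : B * ε * ((n : ℝ) + 1) ^ (R + 1) ≤ B * ε * (2 ^ (R + 1) * n ^ (R + 1)) := by gcongr
      nlinarith
    exact le_of_mul_le_mul_left key (by linarith)

/-- A sequence whose differences form a symbol is a symbol. -/
lemma Symb.of_difference {A : Type*} [NormedRing A] {a : ℤ → A}
    (h : Symb (fun n => a (n + 1) - a n)) : Symb a := by
  obtain ⟨r, hr⟩ := h
  have h1 : a =O[atTop] (fun n : ℤ => (n : ℝ) ^ (((r.toNat : ℕ) : ℤ) + 1)) := by
    have h2 := (((hr 0).mono (Int.self_le_toNat r)).isBigO).bound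
    obtain ⟨C, hC⟩ := h2
    refine isBigO_of_difference (C := C) (D := 0) ?_
    filter_upwards [hC, eventually_ge_atTop 0] with n hn hn0
    have : (0 : ℝ) ≤ n := by exact_mod_cast hn0
    rw [zpow_natCast, Real.norm_of_nonneg (by positivity)] at hn
    simpa using hn
  refine ⟨(r.toNat : ℤ) + 1, fun k => ?_⟩
  cases k with
  | zero => exact h1
  | succ k => exact ⟨h1, (hr k).mono (by have := Int.self_le_toNat r; linarith)⟩

end Gronwall

section Frames

variable {M : Type*} [AddCommGroup M] [Module ℂ M]

/-- Bases of the weight spaces near `-∞`, compatible with the action of `L (-1)`. -/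
structure Frame (L : ℤ → End ℂ M) (lam : ℂ) (V : Type*) [AddCommGroup V] [Module ℂ V] where
  start : ℤ
  e : ℤ → V →ₗ[ℂ] M
  p : ℤ → M →ₗ[ℂ] V
  left_inv : ∀ n ≥ start, ∀ v, p n (e n v) = v
  mem : ∀ n ≥ start, ∀ v, e n v ∈ wt (L 0) lam (-n)
  right_inv : ∀ n ≥ start, ∀ x ∈ wt (L 0) lam (-n), e n (p n x) = x
  step : ∀ n ≥ start, ∀ v, e (n + 1) v = L (-1) (e n v)

variable {L : ℤ → End ℂ M} {lam c : ℂ}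

lemma VirMod.exists_injective_lowering (h : VirMod L lam c) :
    ∃ B : ℤ, ∀ n, B ≤ n → ∀ v ∈ wt (L 0) lam (-n), L (-1) v = 0 → v = 0 := by
  obtain ⟨B, hB⟩ := h.flip.bounded_of_annihilated (k := 1) one_pos
  refine ⟨B, fun n hn v hv h1 => hB n hn v ?_ ?_⟩
  · change v ∈ wt (-L (-0)) (-lam) n
    rwa [neg_zero, wt_neg]
  · simpa using h1

lemma VirMod.exists_frame (h : VirMod L lam c) {N : ℕ}
    (hN : ∀ n, finrank ℂ (wt (L 0) lam n) ≤ N) : ∃ d, Nonempty (Frame L lam (Fin d → ℂ)) := by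
  obtain ⟨B, hB⟩ := h.exists_injective_lowering
  have hf := h.fin
  let T : ∀ n : ℤ, wt (L 0) lam (-n) →ₗ[ℂ] wt (L 0) lam (-(n + 1)) := fun n =>
    (L (-1)).restrict (p := wt (L 0) lam (-n)) (q := wt (L 0) lam (-(n + 1))) (fun x hx => by
      have := h.shifts (-1) _ _ hx
      rwa [show -n + -1 = -(n + 1) by ring] at this)
  have hT : ∀ n ≥ B, Function.Injective (T n) := fun n hn => by
    rw [injective_iff_map_eq_zero]
    intro x hx
    ext
    exact hB n hn x x.2 (congrArg Subtype.val hx)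
  -- the dimensions stabilise
  set S : Set ℕ := {k | ∃ n ≥ B, finrank ℂ (wt (L 0) lam (-n)) = k}
  have hSb : BddAbove S := ⟨N, by rintro k ⟨n, -, rfl⟩; exact hN _⟩
  have hSn : S.Nonempty := ⟨_, B, le_rfl, rfl⟩
  obtain ⟨n₀, hn₀, hd⟩ := Nat.sSup_mem hSn hSb
  have hmax : ∀ n ≥ B, finrank ℂ (wt (L 0) lam (-n)) ≤ sSup S := fun n hn =>
    le_csSup hSb ⟨n, hn, rfl⟩
  set d := sSup S
  have hdim : ∀ n ≥ n₀, finrank ℂ (wt (L 0) lam (-n)) = d := fun n hn => by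
    induction n, hn using Int.leInduction with
    | base => exact hd
    | succ n hn ih =>
      refine le_antisymm (hmax _ (by linarith)) ?_
      rw [← ih]
      exact LinearMap.finrank_le_finrank_of_injective (hT n (by linarith))
  let e0 : (Fin d → ℂ) ≃ₗ[ℂ] wt (L 0) lam (-n₀) :=
    LinearEquiv.ofFinrankEq _ _ (by rw [hd, finrank_fin_fun])
  let e : ℤ → (Fin d → ℂ) →ₗ[ℂ] M := fun n =>
    (L (-1) ^ (n - n₀).toNat) ∘ₗ (wt (L 0) lam (-n₀)).subtype ∘ₗ e0.toLinearMap
  have hstep : ∀ n ≥ n₀, ∀ v, e (n + 1) v = L (-1) (e n v) := fun n hn v => by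
    simp only [e, LinearMap.comp_apply]
    rw [show (n + 1 - n₀).toNat = (n - n₀).toNat + 1 by omega, pow_succ', Module.End.mul_apply]
  have hmem : ∀ n ≥ n₀, ∀ v, e n v ∈ wt (L 0) lam (-n) := fun n hn => by
    induction n, hn using Int.leInduction with
    | base => intro v; simp [e]
    | succ n hn ih =>
      intro v
      rw [hstep n hn]
      have := h.shifts (-1) _ _ (ih v)
      rwa [show -n + -1 = -(n + 1) by ring] at this
  have hinj : ∀ n ≥ n₀, Function.Injective (e n) := fun n hn => by
    induction n, hn using Int.leInduction with
    | base => exact fun v w hvw => e0.injective (Subtype.ext (by simpa [e] using hvw))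
    | succ n hn ih =>
      intro v w hvw
      rw [hstep n hn, hstep n hn] at hvw
      refine ih ?_
      have := @hT n (hn₀.trans hn) ⟨e n v, hmem n hn v⟩ ⟨e n w, hmem n hn w⟩ (Subtype.ext hvw)
      exact congrArg Subtype.val this
  have hp : ∀ n, ∃ p : M →ₗ[ℂ] (Fin d → ℂ), n₀ ≤ n → p ∘ₗ e n = LinearMap.id := fun n => by
    by_cases hn : n₀ ≤ n
    · obtain ⟨p, hp⟩ := (e n).exists_leftInverse_of_injective (LinearMap.ker_eq_bot.2 (hinj n hn))
      exact ⟨p, fun _ => hp⟩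
    · exact ⟨0, fun h => absurd h hn⟩
  choose p hp using hp
  have hleft : ∀ n ≥ n₀, ∀ v, p n (e n v) = v := fun n hn v => LinearMap.congr_fun (hp n hn) v
  refine ⟨d, ⟨⟨n₀, e, p, hleft, hmem, fun n hn x hx => ?_, hstep⟩⟩⟩
  let e' : (Fin d → ℂ) →ₗ[ℂ] wt (L 0) lam (-n) := (e n).codRestrict _ (hmem n hn)
  have he' : Function.Injective e' := fun v w hvw => hinj n hn (congrArg Subtype.val hvw)
  have hs := (LinearMap.injective_iff_surjective_of_finrank_eq_finrank
    (by rw [hdim n hn, finrank_fin_fun])).1 he'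
  obtain ⟨v, hv⟩ := hs ⟨x, hx⟩
  have hv' : e n v = x := congrArg Subtype.val hv
  rw [← hv', hleft n hn]

variable {V : Type*} [NormedAddCommGroup V] [NormedSpace ℂ V] [FiniteDimensional ℂ V]
  (Fr : Frame L lam V)

/-- The matrix of an operator of weight `k` in a frame. -/
def Frame.sym (A : End ℂ M) (k n : ℤ) : V →L[ℂ] V :=
  LinearMap.toContinuousLinearMap (Fr.p (n - k) ∘ₗ A ∘ₗ Fr.e n)

lemma Frame.sym_apply (A : End ℂ M) (k n : ℤ) (v : V) :
    Fr.sym A k n v = Fr.p (n - k) (A (Fr.e n v)) := rfl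

lemma Frame.e_sym {A : End ℂ M} {k n : ℤ} (hA : Shifts (L 0) lam k A) (hn : Fr.start ≤ n)
    (hnk : Fr.start ≤ n - k) (v : V) : Fr.e (n - k) (Fr.sym A k n v) = A (Fr.e n v) := by
  rw [Fr.sym_apply, Fr.right_inv _ hnk]
  have := hA _ _ (Fr.mem n hn v)
  rwa [show -n + k = -(n - k) by ring] at this

lemma Frame.sym_mul {A B : End ℂ M} {k l n : ℤ}
    (hB : Shifts (L 0) lam l B) (hn : Fr.start ≤ n) (hnl : Fr.start ≤ n - l) :
    Fr.sym (A * B) (k + l) n = Fr.sym A k (n - l) * Fr.sym B l n := by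
  ext1 v
  rw [mul_apply_eq_comp, Fr.sym_apply A, Fr.e_sym hB hn hnl, Fr.sym_apply,
    show n - (k + l) = n - l - k by ring]
  rfl

lemma Frame.sym_add (A B : End ℂ M) (k n : ℤ) :
    Fr.sym (A + B) k n = Fr.sym A k n + Fr.sym B k n := by
  ext1 v; simp [Fr.sym_apply]

lemma Frame.sym_sub (A B : End ℂ M) (k n : ℤ) :
    Fr.sym (A - B) k n = Fr.sym A k n - Fr.sym B k n := by
  ext1 v; simp [Fr.sym_apply]

lemma Frame.sym_smul (a : ℂ) (A : End ℂ M) (k n : ℤ) :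
    Fr.sym (a • A) k n = a • Fr.sym A k n := by
  ext1 v; simp [Fr.sym_apply]

lemma Frame.sym_one {n : ℤ} (hn : Fr.start ≤ n) : Fr.sym 1 0 n = 1 := by
  ext1 v
  rw [Fr.sym_apply, sub_zero]
  exact Fr.left_inv n hn v

lemma Frame.sym_zero {n : ℤ} (hn : Fr.start ≤ n) : Fr.sym (L 0) 0 n = (lam - n) • 1 := by
  ext1 v
  rw [Fr.sym_apply, sub_zero, mem_wt.1 (Fr.mem n hn v), map_smul, Fr.left_inv n hn]
  simp [sub_eq_add_neg]

lemma Frame.sym_neg_one {n : ℤ} (hn : Fr.start ≤ n) : Fr.sym (L (-1)) (-1) n = 1 := by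
  ext1 v
  rw [Fr.sym_apply, ← Fr.step n hn, sub_neg_eq_add]
  exact Fr.left_inv _ (by linarith) v

lemma Frame.sym_comm (h : VirMod L lam c) {i j k n : ℤ} (hk : i + j = k) (hn : Fr.start ≤ n)
    (hi : Fr.start ≤ n - i) (hj : Fr.start ≤ n - j) :
    Fr.sym (L i) i (n - j) * Fr.sym (L j) j n - Fr.sym (L j) j (n - i) * Fr.sym (L i) i n =
      ((j : ℂ) - i) • Fr.sym (L k) k n +
      (if k = 0 then ((i : ℂ) ^ 3 - i) / 12 * c else 0) • (1 : V →L[ℂ] V) := by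
  rw [← Fr.sym_mul (h.shifts j) hn hj, ← Fr.sym_mul (h.shifts i) hn hi, add_comm j i, hk,
    ← Fr.sym_sub, h.comm, Fr.sym_add, Fr.sym_smul, Fr.sym_smul, hk]
  congr 1
  by_cases h0 : k = 0
  · rw [h0, Fr.sym_one hn]
  · rw [if_neg h0, zero_smul, zero_smul]

lemma Frame.wtTrace_eq (h : VirMod L lam c) (A : End ℂ M) {n : ℤ}
    (hA : Shifts (L 0) lam 0 A) (hn : Fr.start ≤ n) :
    wtTrace (L 0) lam (-n) A = LinearMap.trace ℂ V (Fr.sym A 0 n) := by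
  have := h.fin (-n)
  let e : V ≃ₗ[ℂ] wt (L 0) lam (-n) := LinearEquiv.ofLinearMap
    ((Fr.e n).codRestrict _ (Fr.mem n hn)) (Fr.p n ∘ₗ (wt (L 0) lam (-n)).subtype)
    (by ext x; exact Fr.right_inv n hn x x.2) (LinearMap.ext fun v => Fr.left_inv n hn v)
  rw [wtTrace_apply, ← LinearMap.trace_conj' _ e]
  congr 1
  ext x
  rw [LinearEquiv.conj_apply_apply]
  change (wtProj (L 0) lam (-n) (A x) : M) = Fr.e n (Fr.sym A 0 n (Fr.p n x))
  have h1 := Fr.e_sym hA hn (by simpa using hn) (Fr.p n x)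
  rw [sub_zero] at h1
  rw [h1, Fr.right_inv n hn _ x.2, wtProj_apply h.top (hA _ _ x.2), if_pos (by simp)]

end Frames

section SymbolRelations

open Filter Asymptotics

variable {A : Type*} [NormedRing A] [NormedAlgebra ℂ A]

lemma eventually_add_const {p : ℤ → Prop} (h : ∀ᶠ n in atTop, p n) (j : ℤ) :
    ∀ᶠ n in atTop, p (n + j) :=
  (tendsto_atTop_add_const_right atTop j tendsto_id).eventually h

lemma eventually_const_of_difference {B : Type*} [AddGroup B] {a : ℤ → B}
    (h : ∀ᶠ n in atTop, a (n + 1) = a n) : ∃ x, ∀ᶠ n in atTop, a n = x := by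
  obtain ⟨n₀, hn₀⟩ := eventually_atTop.1 h
  refine ⟨a n₀, eventually_atTop.2 ⟨n₀, fun n hn => ?_⟩⟩
  induction n, hn using Int.leInduction with
  | base => rfl
  | succ n hn ih => rw [hn₀ n hn, ih]

lemma SymK.of_difference {a : ℤ → A} {R : ℕ} (h : SymK 0 R (fun n => a (n + 1) - a n)) :
    SymK 0 ((R : ℤ) + 1) a := by
  obtain ⟨C, hC⟩ := h.isBigO.bound
  refine isBigO_of_difference (C := C) (D := 0) ?_
  filter_upwards [hC, eventually_ge_atTop 0] with n hn hn0
  have : (0 : ℝ) ≤ n := by exact_mod_cast hn0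
  rw [zpow_natCast, Real.norm_of_nonneg (by positivity)] at hn
  simpa using hn

/-- A bounded sequence with constant second-step difference has zero difference. -/
lemma eq_zero_of_bounded_of_difference {a : ℤ → ℂ} {κ : ℂ} (h : SymK 0 0 a)
    (hd : ∀ᶠ n in atTop, a n - a (n - 2) = κ) : κ = 0 := by
  obtain ⟨C, hC⟩ := h.isBigO.bound
  obtain ⟨n₀, hn₀⟩ := eventually_atTop.1 (hC.and hd)
  have h1 : ∀ j : ℕ, a (n₀ + 2 * j) = a n₀ + j * κ := by
    intro j
    induction j with
    | zero => simp
    | succ j ih =>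
      have := (hn₀ (n₀ + 2 * (j + 1 : ℕ)) (by push_cast; linarith)).2
      rw [show n₀ + 2 * ((j + 1 : ℕ) : ℤ) - 2 = n₀ + 2 * j by push_cast; ring, ih] at this
      rw [sub_eq_iff_eq_add.1 this]
      push_cast
      ring
  by_contra hκ
  obtain ⟨j, hj⟩ := exists_nat_gt (2 * C / ‖κ‖)
  have hκ' : 0 < ‖κ‖ := norm_pos_iff.2 hκ
  rw [div_lt_iff₀ hκ'] at hj
  have h2 := (hn₀ n₀ le_rfl).1
  have h3 := (hn₀ (n₀ + 2 * j) (by linarith [Int.natCast_nonneg j])).1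
  have h4 : (j : ℂ) * κ = a (n₀ + 2 * j) - a n₀ := by rw [h1]; ring
  have h5 := norm_sub_le (a (n₀ + 2 * j)) (a n₀)
  rw [← h4, norm_mul, Complex.norm_natCast] at h5
  simp only [zpow_zero, norm_one, mul_one] at h2 h3
  linarith

/-- Symbols of the Virasoro operators. -/
structure SymbolRel (lam c : ℂ) (X : ℤ → ℤ → A) : Prop where
  comm : ∀ i j : ℤ, ∀ᶠ n in atTop, X i (n - j) * X j n - X j (n - i) * X i n =
    ((j : ℂ) - i) • X (i + j) n + (if i + j = 0 then ((i : ℂ) ^ 3 - i) / 12 * c else 0) • (1 : A)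
  zero : ∀ᶠ n in atTop, X 0 n = (lam - n) • 1
  neg_one : ∀ᶠ n in atTop, X (-1) n = 1

variable {lam c : ℂ} {X : ℤ → ℤ → A}

lemma SymbolRel.difference (h : SymbolRel lam c X) (i : ℤ) :
    ∀ᶠ n in atTop, X i (n + 1) - X i n = (-(i + 1 : ℂ)) • X (i - 1) n := by
  filter_upwards [h.comm i (-1), h.neg_one, eventually_add_const h.neg_one (-i)] with n h1 h2 h3
  rw [← sub_eq_add_neg] at h3
  rw [h2, ← sub_eq_add_neg, h3, mul_one, one_mul, sub_neg_eq_add] at h1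
  rw [h1]
  have : (if i - 1 = 0 then ((i : ℂ) ^ 3 - i) / 12 * c else 0) = 0 := by
    split_ifs with hi
    · rw [sub_eq_zero.1 hi]; simp
    · rfl
  rw [this, zero_smul, add_zero]
  push_cast
  congr 1
  ring

/-- The scalar part of the symbol of `L 1`. -/
def oneSymb (lam : ℂ) (n : ℤ) : ℂ := n ^ 2 - n - 2 * lam * n

lemma SymbolRel.one_eq (h : SymbolRel lam c X) :
    ∃ K : A, ∀ᶠ n in atTop, X 1 n = oneSymb lam n • 1 + K := by
  obtain ⟨K, hK⟩ := eventually_const_of_difference (a := fun n => X 1 n - oneSymb lam n • (1 : A)) (by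
    filter_upwards [h.difference 1, h.zero] with n h1 h2
    rw [sub_self, h2] at h1
    rw [sub_eq_iff_eq_add.1 h1]
    simp only [oneSymb]
    push_cast
    module)
  exact ⟨K, hK.mono fun n hn => by rw [← hn]; abel⟩

lemma symK_natural_sub (k : ℕ) (a : ℂ) : SymK k 1 (fun n : ℤ => (n : ℂ) - a) := by
  have h1 := SymK.natural k (1 : ℂ)
  have h2 := (SymK.const k a).mono (show (0 : ℤ) ≤ 1 by norm_num)
  simpa using h1.sub h2

lemma symK_oneSymb (k : ℕ) : SymK k 2 (oneSymb lam) := by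
  have := (symK_natural_sub k 0).mul (symK_natural_sub k (1 + 2 * lam))
  refine this.congr (Eventually.of_forall fun n => ?_)
  simp only [oneSymb]
  ring

lemma oneSymb_lower : ∀ᶠ n : ℤ in atTop, (n : ℝ) ^ 2 / 2 ≤ ‖oneSymb lam n‖ ∧ 1 ≤ n := by
  obtain ⟨B, hB⟩ := exists_nat_gt (2 * ‖1 + 2 * lam‖ + 1)
  filter_upwards [eventually_ge_atTop (B : ℤ)] with n hn
  have h1 : (B : ℝ) ≤ n := by exact_mod_cast hn
  have h0 := norm_nonneg (1 + 2 * lam)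
  have hn1 : (1 : ℝ) ≤ n := by linarith
  refine ⟨?_, by exact_mod_cast hn1⟩
  have h2 : oneSymb lam n = n * (n - (1 + 2 * lam)) := by simp only [oneSymb]; ring
  have h3 : ‖(n : ℂ)‖ = n := by
    rw [Complex.norm_intCast, abs_of_nonneg (by linarith)]
  have h4 := norm_sub_norm_le (n : ℂ) (1 + 2 * lam)
  rw [h2, norm_mul, h3]
  rw [h3] at h4
  nlinarith

lemma oneSymb_ne_zero (lam : ℂ) : ∀ᶠ n in atTop, oneSymb lam n ≠ 0 := by
  filter_upwards [oneSymb_lower (lam := lam)] with n hn h0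
  rw [h0, norm_zero] at hn
  have : (1 : ℝ) ≤ n := by exact_mod_cast hn.2
  nlinarith

lemma symK_oneSymb_inv (k : ℕ) : SymK k (-2) (fun n => (oneSymb lam n)⁻¹) := by
  have h0 := oneSymb_ne_zero lam
  refine SymK.inverse (x := oneSymb lam) symK_oneSymb ?_ (h0.mono fun n hn => mul_inv_cancel₀ hn)
    (h0.mono fun n hn => inv_mul_cancel₀ hn) k
  refine IsBigO.of_bound 2 ?_
  filter_upwards [oneSymb_lower (lam := lam)] with n hn
  have h1 : (1 : ℝ) ≤ n := by exact_mod_cast hn.2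
  rw [norm_inv, Real.norm_of_nonneg (by positivity), zpow_neg, ← div_eq_mul_inv,
    inv_le_comm₀ (by nlinarith) (by positivity), inv_div]
  exact_mod_cast hn.1

/-- The normalised symbol of `L (-2)`. -/
def negTwoSymb (lam : ℂ) (X : ℤ → ℤ → A) (n : ℤ) : A :=
  (oneSymb lam (n + 1) * oneSymb lam (n + 2)) • X (-2) n

lemma eventually_negTwoSymb (lam : ℂ) (X : ℤ → ℤ → A) :
    ∀ᶠ n in atTop, X (-2) n = ((oneSymb lam (n + 1))⁻¹ * (oneSymb lam (n + 2))⁻¹) •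
      negTwoSymb lam X n := by
  have h0 := oneSymb_ne_zero lam
  filter_upwards [eventually_add_const h0 1, eventually_add_const h0 2] with n h1 h2
  rw [negTwoSymb, smul_smul, ← mul_inv, inv_mul_cancel₀ (mul_ne_zero h1 h2), one_smul]

lemma SymbolRel.negTwo_difference (h : SymbolRel lam c X) {K : A}
    (hK : ∀ᶠ n in atTop, X 1 n = oneSymb lam n • 1 + K) :
    ∀ᶠ n in atTop, negTwoSymb lam X (n + 1) - negTwoSymb lam X n =
      (-3 * oneSymb lam (n + 2)) • 1 -
        (oneSymb lam (n + 3))⁻¹ • (K * negTwoSymb lam X (n + 1)) +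
        (oneSymb lam (n + 1))⁻¹ • (negTwoSymb lam X n * K) := by
  have h0 := oneSymb_ne_zero lam
  filter_upwards [eventually_add_const (h.comm 1 (-2)) 1, eventually_add_const hK 3,
    eventually_add_const hK 1, eventually_add_const h.neg_one 1, eventually_add_const h0 1,
    eventually_add_const h0 3] with n h1 h2 h3 h4 h5 h6
  rw [show n + 1 - -2 = n + 3 by ring, h2, h3, show n + 1 - 1 = n by ring,
    show (1 : ℤ) + -2 = -1 by norm_num, h4, if_neg (by norm_num), zero_smul, add_zero] at h1
  simp only [negTwoSymb, show n + 1 + 1 = n + 2 by ring, show n + 1 + 2 = n + 3 by ring]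
  have e1 : (oneSymb lam (n + 3))⁻¹ • (K * ((oneSymb lam (n + 2) * oneSymb lam (n + 3)) •
      X (-2) (n + 1))) = oneSymb lam (n + 2) • (K * X (-2) (n + 1)) := by
    rw [mul_smul_comm, smul_smul]
    congr 1
    field_simp
  have e2 : (oneSymb lam (n + 1))⁻¹ • ((oneSymb lam (n + 1) * oneSymb lam (n + 2)) •
      X (-2) n * K) = oneSymb lam (n + 2) • (X (-2) n * K) := by
    rw [smul_mul_assoc, smul_smul]
    congr 1
    field_simp
  rw [e1, e2]
  have h7 := congrArg (fun z => oneSymb lam (n + 2) • z) h1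
  simp only [add_mul, mul_add, smul_mul_assoc, one_mul, mul_smul_comm, mul_one] at h7
  have h8 : (-3 * oneSymb lam (n + 2)) • (1 : A) =
      oneSymb lam (n + 2) • (((((-2 : ℤ) : ℂ)) - ((1 : ℤ) : ℂ)) • (1 : A)) := by
    push_cast
    module
  rw [h8, ← h7]
  module

lemma SymbolRel.negTwo_symK (h : SymbolRel lam c X) (k : ℕ) : SymK k 3 (negTwoSymb lam X) := by
  obtain ⟨K, hK⟩ := h.one_eq
  have hd := h.negTwo_difference hK
  set W := negTwoSymb lam X
  have h0 : SymK 0 3 W := by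
    obtain ⟨D₁, hD₁⟩ := ((symK_oneSymb_inv (lam := lam) 0).shift 3).isBigO.bound
    obtain ⟨D₂, hD₂⟩ := ((symK_oneSymb_inv (lam := lam) 0).shift 1).isBigO.bound
    obtain ⟨C, hC⟩ := ((symK_oneSymb (lam := lam) 0).shift 2).isBigO.bound
    refine isBigO_of_difference (R := 2) (C := 3 * C * ‖(1 : A)‖)
      (D := (max D₁ D₂) * ‖K‖) ?_
    filter_upwards [hd, hD₁, hD₂, hC, eventually_ge_atTop 1] with n h1 h2 h3 h4 h5
    have hn : (1 : ℝ) ≤ n := by exact_mod_cast h5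
    rw [Real.norm_of_nonneg (by positivity)] at h2 h3 h4
    rw [zpow_neg, ← div_eq_mul_inv] at h2 h3
    norm_cast at h2 h3 h4
    norm_cast
    have hn2 : (0 : ℝ) < (n ^ 2 : ℤ) := by push_cast; positivity
    have i1 : ‖(oneSymb lam (n + 3))⁻¹‖ ≤ max D₁ D₂ / (n ^ 2 : ℤ) :=
      h2.trans (by gcongr; exact le_max_left _ _)
    have i2 : ‖(oneSymb lam (n + 1))⁻¹‖ ≤ max D₁ D₂ / (n ^ 2 : ℤ) :=
      h3.trans (by gcongr; exact le_max_right _ _)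
    rw [h1]
    calc _ ≤ ‖(-3 * oneSymb lam (n + 2)) • (1 : A)‖ + ‖(oneSymb lam (n + 3))⁻¹ • (K * W (n + 1))‖
          + ‖(oneSymb lam (n + 1))⁻¹ • (W n * K)‖ :=
          (norm_add_le _ _).trans (by gcongr; exact norm_sub_le _ _)
      _ ≤ (3 * (C * (n ^ 2 : ℤ))) * ‖(1 : A)‖ + (max D₁ D₂ / (n ^ 2 : ℤ)) * (‖K‖ * ‖W (n + 1)‖) +
          (max D₁ D₂ / (n ^ 2 : ℤ)) * (‖W n‖ * ‖K‖) := by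
        have hm : 0 ≤ max D₁ D₂ / (n ^ 2 : ℤ) := (norm_nonneg _).trans i1
        rw [norm_smul, norm_smul, norm_smul, norm_mul, norm_neg, Complex.norm_ofNat]
        gcongr
        · exact norm_mul_le _ _
        · exact norm_mul_le _ _
      _ = _ := by ring
  induction k with
  | zero => exact h0
  | succ k ih =>
    refine ⟨h0.isBigO, ?_⟩
    have hx := ((((symK_oneSymb (lam := lam) k).shift 2).map
      ((-3 : ℂ) • ContinuousLinearMap.id ℂ ℂ)).smul_const (1 : A))
    have h1 := (((symK_oneSymb_inv (lam := lam) k).shift 3).smul_const (1 : A)).mul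
      ((SymK.const k K).mul (ih.shift 1))
    have h2 := (((symK_oneSymb_inv (lam := lam) k).shift 1).smul_const (1 : A)).mul
      (ih.mul (SymK.const k K))
    refine ((hx.sub (h1.mono (by norm_num))).add (h2.mono (by norm_num))).congr ?_
    filter_upwards [hd] with n hn
    rw [hn]
    simp

/-- All symbols of Virasoro operators are polynomially bounded together with their differences. -/
lemma SymbolRel.symb (h : SymbolRel lam c X) (i : ℤ) : Symb (X i) := by
  have hneg1 : Symb (X (-1)) :=
    (Symb.const (1 : A)).congr (h.neg_one.mono fun n hn => hn.symm)
  have h0 : Symb (X 0) :=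
    ((Symb.const (lam • (1 : A))).sub (Symb.natural (1 : A))).congr
      (h.zero.mono fun n hn => by rw [hn, sub_smul])
  have hneg2 : Symb (X (-2)) := by
    have h1 : Symb (negTwoSymb lam X) := ⟨3, h.negTwo_symK⟩
    have h2 : Symb (fun n => (oneSymb lam n)⁻¹) := ⟨-2, symK_oneSymb_inv⟩
    have h3 := ((h2.shift 1).mul (h2.shift 2)).map ((ContinuousLinearMap.id ℂ ℂ).smulRight (1 : A))
    refine (h3.mul h1).congr ?_
    filter_upwards [eventually_negTwoSymb lam X] with n hn
    rw [hn]
    simp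
  have hpos : ∀ i : ℕ, Symb (X i) := by
    intro i
    induction i with
    | zero => exact h0
    | succ i ih =>
      refine Symb.of_difference ((ih.smul (-((i : ℂ) + 1 + 1))).congr ?_)
      filter_upwards [h.difference (i + 1)] with n hn
      push_cast at hn ⊢
      rw [hn, add_sub_cancel_right]
  have hneg : ∀ i : ℕ, Symb (X (-(i + 2))) := by
    intro i
    induction i with
    | zero => simpa using hneg2
    | succ i ih =>
      refine (((ih.shift 1).sub ih).smul ((i : ℂ) + 1)⁻¹).congr ?_
      filter_upwards [h.difference (-(i + 2))] with n hn
      rw [hn, smul_smul]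
      have hi : (i : ℂ) + 1 ≠ 0 := by exact_mod_cast Nat.succ_ne_zero i
      push_cast
      rw [show ((i : ℂ) + 1)⁻¹ * -(-((i : ℂ) + 2) + 1) = 1 by field_simp; ring, one_smul]
      congr 1
  obtain hi | hi | hi : 0 ≤ i ∨ i = -1 ∨ i ≤ -2 := by omega
  · lift i to ℕ using hi
    exact hpos i
  · exact hi ▸ hneg1
  · obtain ⟨j, rfl⟩ : ∃ j : ℕ, i = -(j + 2) := ⟨(-i - 2).toNat, by omega⟩
    exact hneg j

/-- The centred variable `n - 1/2 - lam`. -/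
def centred (lam : ℂ) (n : ℤ) : ℂ := n - (1 / 2 + lam)

lemma symK_centred (k : ℕ) : SymK k 1 (centred lam) := symK_natural_sub k _

lemma SymK.ofConst {r : ℤ} (hr : 0 ≤ r) (k : ℕ) (x : A) : SymK k r (fun _ => x) :=
  (SymK.const k x).mono hr

lemma SymbolRel.two_asymp (h : SymbolRel lam c X) : SymK 0 1 (fun n =>
    X 2 (n + 2) + (centred lam n ^ 3 + 9 / 2 * centred lam n ^ 2) • (1 : A)) := by
  obtain ⟨K, hK⟩ := h.one_eq
  have h1 : SymK 0 1 (fun n => X 2 n + (centred lam n ^ 3 - 3 / 2 * centred lam n ^ 2) • (1 : A)) := by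
    refine SymK.of_difference (R := 0) ((SymK.const 0 ((3 * (1 / 2 + lam) ^ 2 - 1 / 2 : ℂ) •
      (1 : A) - (3 : ℂ) • K)).congr ?_)
    filter_upwards [h.difference 2, hK] with n h2 h3
    rw [show (2 : ℤ) - 1 = 1 by norm_num, h3] at h2
    rw [sub_eq_iff_eq_add.1 h2]
    simp only [centred, oneSymb]
    push_cast
    module
  have h2 := (h1.shift 2).sub (((symK_centred (lam := lam) 0).smul_const ((6 : ℂ) • (1 : A))).add
    (SymK.ofConst zero_le_one 0 ((2 : ℂ) • (1 : A))))
  refine h2.congr (Eventually.of_forall fun n => ?_)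
  simp only [centred]
  push_cast
  module

lemma SymbolRel.negTwo_asymp (h : SymbolRel lam c X) : SymK 0 1 (fun n =>
    negTwoSymb lam X n + (centred lam n ^ 3 + 9 / 2 * centred lam n ^ 2) • (1 : A)) := by
  obtain ⟨K, hK⟩ := h.one_eq
  have hd := h.negTwo_difference hK
  have hW := h.negTwo_symK
  set W := negTwoSymb lam X
  set w : ℤ → ℂ := fun n => centred lam n ^ 3 + 9 / 2 * centred lam n ^ 2 with hw
  have hwS : ∀ k, SymK k 3 w := fun k => by
    have h1 := symK_centred (lam := lam) k
    refine (((h1.mul h1).mul h1).add (((h1.mul h1).mono (show (1 : ℤ) + 1 ≤ 3 by norm_num)).map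
      ((9 / 2 : ℂ) • ContinuousLinearMap.id ℂ ℂ))).congr (Eventually.of_forall fun n => ?_)
    simp only [hw, smul_apply, ContinuousLinearMap.id_apply, smul_eq_mul]
    ring
  have hy := symK_oneSymb_inv (lam := lam)
  -- the difference equation for the error term
  have hd' : ∀ᶠ n in atTop, (W (n + 1) + w (n + 1) • (1 : A)) - (W n + w n • (1 : A)) =
      (3 * (1 / 2 + lam) ^ 2 - 13 / 2 : ℂ) • (1 : A) -
        (oneSymb lam (n + 3))⁻¹ • (K * W (n + 1)) + (oneSymb lam (n + 1))⁻¹ • (W n * K) := by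
    filter_upwards [hd] with n hn
    rw [add_sub_add_comm, hn]
    simp only [hw, centred, oneSymb]
    push_cast
    module
  have h1 : SymK 0 2 (fun n => W n + w n • (1 : A)) := by
    refine SymK.of_difference (R := 1) (SymK.congr ?_ (hd'.mono fun n hn => hn.symm))
    have e1 := (((hy 0).shift 3).smul_const (1 : A)).mul ((SymK.const 0 K).mul ((hW 0).shift 1))
    have e2 := (((hy 0).shift 1).smul_const (1 : A)).mul ((hW 0).mul (SymK.const 0 K))
    refine (((SymK.ofConst zero_le_one 0
      ((3 * (1 / 2 + lam) ^ 2 - 13 / 2 : ℂ) • (1 : A))).sub (e1.mono (by norm_num))).add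
      (e2.mono (by norm_num))).congr (Eventually.of_forall fun n => ?_)
    simp
  refine SymK.of_difference (R := 0) (SymK.congr ?_ (hd'.mono fun n hn => hn.symm))
  have e1 := (((hy 0).shift 3).smul_const (1 : A)).mul ((SymK.const 0 K).mul (h1.shift 1))
  have e2 := (((hy 0).shift 1).smul_const (1 : A)).mul (h1.mul (SymK.const 0 K))
  have e3 : SymK 0 0 (fun n => (oneSymb lam (n + 3))⁻¹ * w (n + 1) - (oneSymb lam (n + 1))⁻¹ * w n) := by
    have f1 := (((hy 1).shift 2).mul (hwS 1)).2
    have f2 := ((hy 1).shift 1).2.mul (hwS 0)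
    refine ((f1.mono (by norm_num)).add (f2.mono (by norm_num))).congr
      (Eventually.of_forall fun n => ?_)
    simp only [show n + 1 + 2 = n + 3 by ring, show n + 1 + 1 = n + 2 by ring]
    ring
  refine ((((SymK.const 0 ((3 * (1 / 2 + lam) ^ 2 - 13 / 2 : ℂ) • (1 : A))).sub
    (e1.mono (by norm_num))).add
    (e2.mono (by norm_num))).add (e3.smul_const K)).congr (Eventually.of_forall fun n => ?_)
  simp only [mul_add, add_mul, smul_mul_assoc, mul_smul_comm, one_mul, mul_one]
  module

/-- If the traces of `L 2 * L (-2)` satisfy the recursion forced by cyclicity of the trace then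
the central charge vanishes. -/
lemma SymbolRel.central_charge (h : SymbolRel lam c X) (tr : A →L[ℂ] ℂ) (f : ℤ → ℂ)
    (hf : ∀ᶠ n in atTop, f n = tr (X 2 (n + 2) * X (-2) n))
    (hd : ∀ᶠ n in atTop, f n - f (n - 2) = tr 1 * (-4 * (lam - n) + c / 2)) : tr 1 * c = 0 := by
  have h1 := h.two_asymp
  have h2 := h.negTwo_asymp
  set W := negTwoSymb lam X with hW
  set w : ℤ → ℂ := fun n => centred lam n ^ 3 + 9 / 2 * centred lam n ^ 2 with hw
  have hy := symK_oneSymb_inv (lam := lam) 0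
  have hs := symK_centred (lam := lam) 0
  have hwS : SymK 0 3 w := by
    refine (((hs.mul hs).mul hs).add (((hs.mul hs).mono (show (1 : ℤ) + 1 ≤ 3 by norm_num)).map
      ((9 / 2 : ℂ) • ContinuousLinearMap.id ℂ ℂ))).congr (Eventually.of_forall fun n => ?_)
    simp only [hw, smul_apply, ContinuousLinearMap.id_apply, smul_eq_mul]
    ring
  set y : ℤ → ℂ := fun n => (oneSymb lam (n + 1))⁻¹ * (oneSymb lam (n + 2))⁻¹ with hyd
  have hyy : SymK 0 (-4) y := (hy.shift 1).mul (hy.shift 2)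
  have hprod : SymK 0 0 (fun n => X 2 (n + 2) * X (-2) n - (y n * w n ^ 2) • (1 : A)) := by
    have f1 := h1.mul h2
    have f2 := (hwS.smul_const (1 : A)).mul h2
    have f3 := h1.mul (hwS.smul_const (1 : A))
    refine ((hyy.smul_const (1 : A)).mul (((f1.mono (show (1 : ℤ) + 1 ≤ 4 by norm_num)).sub f2).sub
      f3)).congr ?_
    filter_upwards [eventually_negTwoSymb lam X] with n hn
    rw [hn, ← hW]
    simp only [mul_add, add_mul, smul_mul_assoc, mul_smul_comm, one_mul, mul_one, hyd, hw]
    module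
  have hq : SymK 0 0 (fun n => y n * w n ^ 2 - (centred lam n ^ 2 + 3 * centred lam n)) := by
    set κ : ℂ := (1 / 2 + lam) ^ 2 with hκ
    have hs2 := hs.mul hs
    have hs3 := hs2.mul hs
    have hc : ∀ a : ℂ, SymK 0 0 (fun _ : ℤ => a) := fun a => SymK.const 0 a
    have hpoly : SymK 0 4 (fun n => w n ^ 2 - (centred lam n ^ 2 + 3 * centred lam n) *
        (oneSymb lam (n + 1) * oneSymb lam (n + 2))) := by
      have g4 := (hc (-27 / 4 - 4 + 2 * κ)).mul (hs3.mul hs)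
      have g3 := (hc (-27 - 24 + 12 * κ)).mul hs3
      have g2 := (hc (-36 - 4 + (5 + 18) * κ - κ ^ 2)).mul hs2
      have g1 := (hc (-12 + 15 * κ - 3 * κ ^ 2)).mul hs
      refine (((g4.add (g3.mono (by norm_num))).add (g2.mono (by norm_num))).add
        (g1.mono (by norm_num))).congr (Eventually.of_forall fun n => ?_)
      simp only [hw, centred, oneSymb, hκ]
      push_cast
      ring
    have h0 := oneSymb_ne_zero lam
    refine (hyy.mul hpoly).congr ?_
    filter_upwards [eventually_add_const h0 1, eventually_add_const h0 2] with n h1 h2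
    simp only [hyd]
    field_simp
  have hH : SymK 0 0 (fun n => f n - tr 1 * (centred lam n ^ 2 + 3 * centred lam n)) := by
    refine ((hprod.map tr).add ((hq.smul_const (1 : A)).map tr)).congr ?_
    filter_upwards [hf] with n hn
    rw [hn, map_sub, map_smul, map_smul]
    simp only [smul_eq_mul]
    ring
  have := eq_zero_of_bounded_of_difference (κ := tr 1 * c / 2) hH (by
    filter_upwards [hd] with n hn
    have e : f n = f (n - 2) + tr 1 * (-4 * (lam - n) + c / 2) := by rw [← hn]; ring
    rw [e]
    simp only [centred]
    push_cast
    ring)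
  simpa using this

end SymbolRelations

section VirasoroTraces

open Filter Asymptotics

variable {M : Type*} [AddCommGroup M] [Module ℂ M] {L : ℤ → End ℂ M} {lam c : ℂ}

/-- The operator given by a word in the Virasoro generators. -/
def word (L : ℤ → End ℂ M) (w : List ℤ) : End ℂ M := (w.map L).prod

@[simp] lemma word_nil : word L [] = 1 := rfl

@[simp] lemma word_cons (i : ℤ) (w : List ℤ) : word L (i :: w) = L i * word L w := by
  simp [word]

lemma word_append (v w : List ℤ) : word L (v ++ w) = word L v * word L w := by
  simp [word]

lemma shifts_one (L0 : End ℂ M) (lam : ℂ) : Shifts L0 lam 0 1 := fun n x hx => by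
  simpa using hx

lemma VirMod.shifts_word (h : VirMod L lam c) (w : List ℤ) :
    Shifts (L 0) lam w.sum (word L w) := by
  induction w with
  | nil => exact shifts_one _ _
  | cons i w ih => simpa using (h.shifts i).mul ih

section

variable {V : Type*} [NormedAddCommGroup V] [NormedSpace ℂ V] [FiniteDimensional ℂ V]
  (Fr : Frame L lam V)

lemma Frame.symbolRel (h : VirMod L lam c) :
    SymbolRel lam c (fun i n => Fr.sym (L i) i n) where
  comm i j := by
    filter_upwards [eventually_ge_atTop Fr.start, eventually_ge_atTop (Fr.start + i),
      eventually_ge_atTop (Fr.start + j)] with n h0 h1 h2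
    exact Fr.sym_comm h rfl h0 (by omega) (by omega)
  zero := by
    filter_upwards [eventually_ge_atTop Fr.start] with n h0
    exact Fr.sym_zero h0
  neg_one := by
    filter_upwards [eventually_ge_atTop Fr.start] with n h0
    exact Fr.sym_neg_one h0

lemma Frame.symb_word (h : VirMod L lam c) (w : List ℤ) :
    Symb (fun n => Fr.sym (word L w) w.sum n) := by
  induction w with
  | nil =>
    refine (Symb.const 1).congr ?_
    filter_upwards [eventually_ge_atTop Fr.start] with n h0
    exact (Fr.sym_one h0).symm
  | cons i w ih =>
    refine (((Fr.symbolRel h).symb i |>.shift (-w.sum)).mul ih).congr ?_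
    filter_upwards [eventually_ge_atTop Fr.start, eventually_ge_atTop (Fr.start + w.sum)]
      with n h0 h1
    rw [word_cons, List.sum_cons, Fr.sym_mul (h.shifts_word w) h0 (by omega), ← sub_eq_add_neg]

/-- The trace as a continuous functional. -/
def traceCLM (V : Type*) [NormedAddCommGroup V] [NormedSpace ℂ V] [FiniteDimensional ℂ V] :
    (V →L[ℂ] V) →L[ℂ] ℂ :=
  LinearMap.toContinuousLinearMap
    (LinearMap.trace ℂ V ∘ₗ ContinuousLinearMap.coeLM ℂ)

lemma traceCLM_apply (A : V →L[ℂ] V) : traceCLM V A = LinearMap.trace ℂ V A := rfl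

lemma traceCLM_one : traceCLM V 1 = finrank ℂ V := by
  rw [traceCLM_apply]
  exact LinearMap.trace_one ℂ V

lemma Frame.symb_wtTrace (Fr : Frame L lam V) (h : VirMod L lam c) {w : List ℤ} (hw : w.sum = 0) :
    Symb (fun n => wtTrace (L 0) lam (-n) (word L w)) := by
  refine ((Fr.symb_word h w).map (traceCLM V)).congr ?_
  filter_upwards [eventually_ge_atTop Fr.start] with n h0
  rw [hw, traceCLM_apply, Fr.wtTrace_eq h _ (hw ▸ h.shifts_word w) h0]

lemma VirMod.wtTrace_commutator (h : VirMod L lam c) (i : ℤ) (n : ℤ) :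
    wtTrace (L 0) lam n (L i * L (-i)) - wtTrace (L 0) lam (n + i) (L i * L (-i)) =
      finrank ℂ (wt (L 0) lam n) * (-2 * i * (lam + n) + ((i : ℂ) ^ 3 - i) / 12 * c) := by
  rw [wtTrace_mul_comm h.top h.fin (h.shifts i) (L (-i)) (n + i), add_sub_cancel_right,
    ← map_sub, h.comm, if_pos (add_neg_cancel i), map_add, map_smul, map_smul,
    wtTrace_one h.top h.fin, add_neg_cancel, show wtTrace (L 0) lam n (L 0) = wtTrace (L 0) lam n (L 0 * 1) by rw [mul_one],
    wtTrace_L0_mul h.top, wtTrace_one h.top h.fin]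
  push_cast
  simp only [smul_eq_mul]
  ring

lemma Frame.central_charge (Fr : Frame L lam V) (h : VirMod L lam c) : (finrank ℂ V : ℂ) * c = 0 := by
  rw [← traceCLM_one]
  refine (Fr.symbolRel h).central_charge (traceCLM V)
    (fun n => wtTrace (L 0) lam (-n) (L 2 * L (-2))) ?_ ?_
  · filter_upwards [eventually_ge_atTop Fr.start] with n h0
    have hs : Shifts (L 0) lam 0 (L 2 * L (-2)) := by simpa using (h.shifts 2).mul (h.shifts (-2))
    rw [traceCLM_apply, Fr.wtTrace_eq h _ hs h0]
    have := Fr.sym_mul (A := L 2) (k := 2) (h.shifts (-2)) h0 (by omega)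
    rw [show (2 + -2 : ℤ) = 0 by norm_num, show n - -2 = n + 2 by ring] at this
    rw [this]
  · filter_upwards [eventually_ge_atTop Fr.start] with n h0
    have h1 := h.wtTrace_commutator 2 (-n)
    have h2 := Fr.wtTrace_eq h 1 (shifts_one _ _) h0
    rw [wtTrace_one h.top h.fin, Fr.sym_one h0, ← traceCLM_apply] at h2
    rw [show -(n - 2) = -n + 2 by ring, h1, h2]
    push_cast
    ring

end

lemma VirMod.symb_wtTrace (h : VirMod L lam c) {N : ℕ} (hN : ∀ n, finrank ℂ (wt (L 0) lam n) ≤ N)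
    {w : List ℤ} (hw : w.sum = 0) : Symb (fun n => wtTrace (L 0) lam (-n) (word L w)) := by
  obtain ⟨d, ⟨Fr⟩⟩ := h.exists_frame hN
  exact Fr.symb_wtTrace h hw

lemma word_flip (L : ℤ → End ℂ M) (w : List ℤ) : word (fun i => - L (-i)) w =
    ((-1 : ℂ) ^ w.length) • word L (w.map (fun i => -i)) := by
  induction w with
  | nil => simp
  | cons i w ih => 
    rw [word_cons, ih, List.map_cons, word_cons, List.length_cons, pow_succ]
    simp

lemma trace_compression_congr {W W' : Submodule ℂ M} (hW : W = W') (p : M →ₗ[ℂ] W)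
    (p' : M →ₗ[ℂ] W') (hp : ∀ x, (p x : M) = p' x) (A : End ℂ M) :
    LinearMap.trace ℂ W (p ∘ₗ A ∘ₗ W.subtype) = LinearMap.trace ℂ W' (p' ∘ₗ A ∘ₗ W'.subtype) := by
  subst hW
  congr 2
  ext x
  exact hp x

lemma iSup_wt_neg {L0 : End ℂ M} {lam : ℂ} (h : ⨆ n, wt L0 lam n = ⊤) :
    ⨆ n, wt (-L0) (-lam) n = ⊤ := by
  rw [← h]
  simp only [wt_neg]
  exact (Equiv.neg ℤ).iSup_comp (g := fun n => wt L0 lam n)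

lemma wtTrace_neg {L0 : End ℂ M} {lam : ℂ} (h : ⨆ n, wt L0 lam n = ⊤) (n : ℤ) (A : End ℂ M) :
    wtTrace (-L0) (-lam) n A = wtTrace L0 lam (-n) A := by
  refine trace_compression_congr (wt_neg L0 lam n) _ _ (fun x => ?_) A
  refine LinearMap.congr_fun (f := (wt (-L0) (-lam) n).subtype ∘ₗ wtProj (-L0) (-lam) n)
    (g := (wt L0 lam (-n)).subtype ∘ₗ wtProj L0 lam (-n)) (ext_wt h fun m x hx => ?_) x
  simp only [LinearMap.comp_apply, Submodule.subtype_apply]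
  rw [wtProj_apply h hx, wtProj_apply (m := -m) (iSup_wt_neg h) (by rwa [wt_neg, neg_neg])]
  by_cases hmn : m = -n
  · rw [if_pos hmn, if_pos (by omega)]
  · rw [if_neg hmn, if_neg (by omega)]

lemma VirMod.symb_wtTrace_top (h : VirMod L lam c) {N : ℕ}
    (hN : ∀ n, finrank ℂ (wt (L 0) lam n) ≤ N)
    {w : List ℤ} (hw : w.sum = 0) : Symb (fun n => wtTrace (L 0) lam n (word L w)) := by
  have hN' : ∀ n, finrank ℂ (wt ((fun i => - L (-i)) 0) (-lam) n) ≤ N := fun n => by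
    beta_reduce
    rw [wt_neg]
    exact hN (-n)
  have hs : ∀ w : List ℤ, (w.map (fun i => -i)).sum = - w.sum := fun w => by
    induction w with
    | nil => simp
    | cons i w ih => simp [ih]; ring
  have h1 := (h.flip.symb_wtTrace hN' (w := w.map (fun i => -i)) (by rw [hs, hw, neg_zero])).smul
    ((-1) ^ w.length)
  refine h1.congr (Eventually.of_forall fun n => ?_)
  simp only [word_flip, List.map_map, List.length_map, neg_zero, map_smul, wtTrace_neg h.top, neg_neg,
    smul_smul, ← mul_pow]
  simp

/-- A bounded weight module whose weights are not bounded below has central charge zero. -/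
lemma VirMod.central_charge (h : VirMod L lam c) {N : ℕ}
    (hN : ∀ n, finrank ℂ (wt (L 0) lam n) ≤ N)
    (hinf : ∀ B : ℤ, ∃ n ≥ B, wt (L 0) lam (-n) ≠ ⊥) : c = 0 := by
  obtain ⟨d, ⟨Fr⟩⟩ := h.exists_frame hN
  obtain hc | hc := mul_eq_zero.mp (Fr.central_charge h)
  · obtain ⟨n, hn, hne⟩ := hinf Fr.start
    refine absurd ?_ hne
    rw [eq_bot_iff]
    intro x hx
    have : Subsingleton (Fin d → ℂ) :=
      (finrank_zero_iff (R := ℂ)).mp (by exact_mod_cast hc)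
    rw [← Fr.right_inv n hn x hx, Subsingleton.elim (Fr.p n x) 0, map_zero]
    exact Submodule.zero_mem _
  · exact hc

end VirasoroTraces

section VirasoroDimensions

open Filter Asymptotics

variable {M : Type*} [AddCommGroup M] [Module ℂ M] {L : ℤ → End ℂ M} {lam c : ℂ}

lemma Frame.finrank_wt {d : ℕ} (Fr : Frame L lam (Fin d → ℂ)) {n : ℤ}
    (hn : Fr.start ≤ n) : finrank ℂ (wt (L 0) lam (-n)) = d := by
  have e : wt (L 0) lam (-n) ≃ₗ[ℂ] (Fin d → ℂ) := LinearEquiv.ofLinearMap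
    (Fr.p n ∘ₗ (wt (L 0) lam (-n)).subtype) ((Fr.e n).codRestrict _ (Fr.mem n hn))
    (LinearMap.ext fun v => Fr.left_inv n hn v) (by ext x; simpa using Fr.right_inv n hn x x.2)
  rw [e.finrank_eq, Module.finrank_fin_fun]

lemma VirMod.eventually_finrank (h : VirMod L lam c) {N : ℕ}
    (hN : ∀ n, finrank ℂ (wt (L 0) lam n) ≤ N) :
    ∃ d : ℕ, ∀ᶠ n in atTop, finrank ℂ (wt (L 0) lam (-n)) = d := by
  obtain ⟨d, ⟨Fr⟩⟩ := h.exists_frame hN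
  exact ⟨d, (eventually_ge_atTop Fr.start).mono fun n hn => Fr.finrank_wt hn⟩

lemma finrank_wt_flip (n : ℤ) : finrank ℂ (wt ((fun i => - L (-i)) 0) (-lam) n) =
    finrank ℂ (wt (L 0) lam (-n)) := by
  beta_reduce
  rw [wt_neg]
  rfl

lemma VirMod.eventually_finrank_top (h : VirMod L lam c) {N : ℕ}
    (hN : ∀ n, finrank ℂ (wt (L 0) lam n) ≤ N) :
    ∃ d : ℕ, ∀ᶠ n in atTop, finrank ℂ (wt (L 0) lam n) = d := by
  obtain ⟨d, hd⟩ := h.flip.eventually_finrank (N := N) fun n => by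
    rw [finrank_wt_flip]; exact hN _
  refine ⟨d, hd.mono fun n hn => ?_⟩
  rwa [finrank_wt_flip, neg_neg] at hn

/-- A function on `ℤ` whose `l`-step difference is eventually that of `P`, and which is a symbol,
agrees with `P` up to a constant. -/
lemma eventually_eq_add_const {F P : ℤ → ℂ} {l : ℕ} (hl : l ≠ 0) (hF : Symb F) (hP : Symb P)
    (hd : ∀ᶠ n in atTop, F (n + l) - F n = P (n + l) - P n) :
    ∃ C, ∀ᶠ n in atTop, F n = P n + C := by
  obtain ⟨C, hC⟩ := (hF.sub hP).eventually_const hl (hd.mono fun n hn => by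
    linear_combination hn)
  exact ⟨C, hC.mono fun n hn => by linear_combination hn⟩

lemma eq_of_step_of_eventually {Q : ℤ → ℂ} {l : ℕ} (hl : 0 < l) {C : ℂ} {r : ℤ}
    (hC : ∀ᶠ n in atTop, Q n = C) (hs : ∀ j : ℕ, Q (r + l * (j + 1)) = Q (r + l * j)) :
    Q r = C := by
  have h1 : ∀ j : ℕ, Q (r + l * j) = Q r := fun j => by
    induction j with
    | zero => simp
    | succ j ih => rw [← ih, ← hs j]; push_cast; rfl
  obtain ⟨B, hB⟩ := eventually_atTop.mp hC
  rw [← h1 (B - r).toNat]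
  refine hB _ ?_
  have : (1 : ℤ) * (B - r).toNat ≤ l * (B - r).toNat :=
    mul_le_mul_of_nonneg_right (by exact_mod_cast hl) (by positivity)
  omega

/-- With central charge zero, the weight multiplicities of a bounded weight module are constant
away from weight zero. -/
lemma VirMod.exists_finrank_eq (h : VirMod L lam 0) {N : ℕ}
    (hN : ∀ n, finrank ℂ (wt (L 0) lam n) ≤ N) :
    ∃ d : ℕ, ∀ n : ℤ, lam + n ≠ 0 → finrank ℂ (wt (L 0) lam n) = d := by
  obtain ⟨dm, hm⟩ := h.eventually_finrank hN
  obtain ⟨dp, hp⟩ := h.eventually_finrank_top hN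
  obtain ⟨R, hR⟩ : ∃ R : ℕ, (∀ n > (R : ℤ), finrank ℂ (wt (L 0) lam n) = dp) ∧
      ∀ n < -(R : ℤ), finrank ℂ (wt (L 0) lam n) = dm := by
    obtain ⟨B, hB⟩ := eventually_atTop.mp (hm.and hp)
    refine ⟨B.toNat, fun n hn => (hB n (by omega)).2, fun n hn => ?_⟩
    have := (hB (-n) (by omega)).1
    rwa [neg_neg] at this
  set l : ℕ := 2 * R + 5 with hl
  set δ : ℤ → ℂ := fun n => finrank ℂ (wt (L 0) lam n) with hδ
  set f : ℤ → ℂ := fun n => wtTrace (L 0) lam n (L l * L (-l)) with hf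
  set P : ℤ → ℂ := fun n => (lam + n) ^ 2 - l * (lam + n) with hP
  have hword : word L [(l : ℤ), -l] = L l * L (-l) := by simp
  have hsum : ([(l : ℤ), -l]).sum = 0 := by simp
  have hfm : Symb (fun n => f (-n)) := by
    simpa only [hword] using h.symb_wtTrace hN hsum
  have hfp : Symb f := by
    simpa only [hword] using h.symb_wtTrace_top hN hsum
  have hPp : Symb P := (Symb.polynomial ((Polynomial.C lam + Polynomial.X) ^ 2 -
    Polynomial.C (l : ℂ) * (Polynomial.C lam + Polynomial.X))).congr
    (Eventually.of_forall fun n => by simp [hP])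
  have hPm : Symb (fun n => P (-n)) := (Symb.polynomial ((Polynomial.C lam - Polynomial.X) ^ 2 -
    Polynomial.C (l : ℂ) * (Polynomial.C lam - Polynomial.X))).congr
    (Eventually.of_forall fun n => by simp [hP, sub_eq_add_neg])
  have hstep : ∀ n, f (n + l) - f n = 2 * l * (lam + n) * δ n := fun n => by
    have := h.wtTrace_commutator l n
    simp only [hf, hδ]
    push_cast at this ⊢
    linear_combination -this
  have hPstep : ∀ n, P (n + l) - P n = 2 * l * (lam + n) := fun n => by
    simp only [hP]; push_cast; ring
  have hl0 : l ≠ 0 := by omega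
  have hδp : ∀ n > (R : ℤ), δ n = dp := fun n hn => by simp only [hδ, hR.1 n hn]
  have hδm : ∀ n < -(R : ℤ), δ n = dm := fun n hn => by simp only [hδ, hR.2 n hn]
  obtain ⟨Cp, hCp⟩ := eventually_eq_add_const hl0 hfp (hPp.smul (dp : ℂ)) (by
    filter_upwards [eventually_gt_atTop (R : ℤ)] with n hn
    rw [hstep, hδp n hn, ← smul_sub, hPstep, smul_eq_mul]; ring)
  obtain ⟨Cm, hCm⟩ := eventually_eq_add_const hl0 hfm (hPm.smul (dm : ℂ)) (by
    filter_upwards [eventually_gt_atTop (R : ℤ)] with n hn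
    have h1 := hstep (-(n + l))
    have h2 := hPstep (-(n + l))
    rw [hδm _ (by omega)] at h1
    rw [show -(n + l) + (l : ℤ) = -n by ring] at h1 h2
    simp only [smul_eq_mul]
    linear_combination -h1 + dm * h2)
  have key : ∀ r : ℤ, -(R : ℤ) ≤ r → r < -(R : ℤ) + l →
      2 * l * (lam + r) * (δ r - dp) + (dm - dp) * P r = Cp - Cm := by
    intro r h1 h2
    have e1 : f (r + l) - dp * P (r + l) = Cp := by
      refine eq_of_step_of_eventually (l := l) (Q := fun n => f n - dp * P n) (by omega)
        (hCp.mono fun n hn => ?_) fun j => ?_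
      · rw [hn, smul_eq_mul]; ring
      · have hj := hstep (r + l + l * j)
        have hj' := hPstep (r + l + l * j)
        have : (0 : ℤ) ≤ l * j := by positivity
        rw [hδp _ (by omega)] at hj
        beta_reduce
        rw [show r + l + (l : ℤ) * (j + 1) = r + l + l * j + l by ring]
        linear_combination hj - dp * hj'
    have e2 : f (- -r) - dm * P (- -r) = Cm := by
      refine eq_of_step_of_eventually (l := l) (r := -r) (Q := fun n => f (-n) - dm * P (-n))
        (by omega) (hCm.mono fun n hn => ?_) fun j => ?_
      · rw [hn, smul_eq_mul]; ring
      · have hj := hstep (r - l * (j + 1))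
        have hj' := hPstep (r - l * (j + 1))
        have : (0 : ℤ) ≤ l * j := by positivity
        rw [hδm _ (by linarith)] at hj
        beta_reduce
        rw [show r - (l : ℤ) * (j + 1) + l = r - l * j by ring] at hj hj'
        rw [show -(-r + (l : ℤ) * (j + 1)) = r - l * (j + 1) by ring,
          show -(-r + (l : ℤ) * j) = r - l * j by ring]
        linear_combination -hj + dm * hj'
    rw [neg_neg] at e2
    have e3 := hPstep r
    linear_combination e1 - e2 - hstep r + dp * e3
  have hd : (dm : ℂ) = dp := by
    have k0 := key (R + 1) (by omega) (by omega)
    have k1 := key (R + 2) (by omega) (by omega)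
    have k2 := key (R + 3) (by omega) (by omega)
    rw [hδp _ (by omega)] at k0 k1 k2
    simp only [hP] at k0 k1 k2
    push_cast at k0 k1 k2
    linear_combination (k0 - 2 * k1 + k2) / 2
  have hC : Cp - Cm = 0 := by
    rw [← key (R + 1) (by omega) (by omega), hδp _ (by omega), hd]
    ring
  refine ⟨dp, fun n hn => ?_⟩
  obtain h1 | h1 | h1 : n < -(R : ℤ) ∨ n > R ∨ (-(R : ℤ) ≤ n ∧ n < -(R : ℤ) + l) := by omega
  · rw [hR.2 n h1]; exact_mod_cast hd
  · exact hR.1 n h1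
  · have h2 := key n h1.1 h1.2
    rw [hC, hd, sub_self, zero_mul, add_zero] at h2
    have h3 : (2 * l * (lam + n) : ℂ) ≠ 0 :=
      mul_ne_zero (mul_ne_zero two_ne_zero (by exact_mod_cast hl0)) hn
    have h4 := (mul_eq_zero.mp h2).resolve_left h3
    simp only [hδ] at h4
    exact_mod_cast sub_eq_zero.mp h4

end VirasoroDimensions

section VirasoroPolynomials

open Polynomial

variable {M : Type*} [AddCommGroup M] [Module ℂ M] {L : ℤ → End ℂ M} {lam : ℂ}

/-- The span of words of given length and weight. -/
def wordSpan (L : ℤ → End ℂ M) (k : ℕ) (s : ℤ) : Submodule ℂ (End ℂ M) :=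
  Submodule.span ℂ {A | ∃ w : List ℤ, w.length = k ∧ w.sum = s ∧ A = word L w}

lemma word_mem_wordSpan (w : List ℤ) : word L w ∈ wordSpan L w.length w.sum :=
  Submodule.subset_span ⟨w, rfl, rfl, rfl⟩

lemma mul_mem_wordSpan {k : ℕ} {s : ℤ} (i : ℤ) {A : End ℂ M} (hA : A ∈ wordSpan L k s) :
    L i * A ∈ wordSpan L (k + 1) (i + s) := by
  refine Submodule.span_induction (p := fun A _ => L i * A ∈ wordSpan L (k + 1) (i + s))
    ?_ (by simp) (fun A B _ _ hA hB => by rw [mul_add]; exact add_mem hA hB)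
    (fun a A _ hA => by rw [mul_smul_comm]; exact Submodule.smul_mem _ _ hA) hA
  rintro _ ⟨w, rfl, rfl, rfl⟩
  simpa using word_mem_wordSpan (L := L) (i :: w)

lemma VirMod.comm_zero (h : VirMod L lam 0) (i j : ℤ) :
    L i * L j - L j * L i = ((j : ℂ) - i) • L (i + j) := by
  simpa using h.comm i j

lemma VirMod.word_commutator (h : VirMod L lam 0) (i : ℤ) (w : List ℤ) :
    word L w * L i - L i * word L w ∈ wordSpan L w.length (i + w.sum) := by
  induction w with
  | nil => simp
  | cons j w ih =>
    have e : word L (j :: w) * L i - L i * word L (j :: w) =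
        L j * (word L w * L i - L i * word L w) + ((i : ℂ) - j) • word L ((j + i) :: w) := by
      rw [word_cons, word_cons, ← smul_mul_assoc, ← h.comm_zero j i]
      noncomm_ring
    rw [e]
    refine add_mem ?_ (Submodule.smul_mem _ _ ?_)
    · have := mul_mem_wordSpan j ih
      rwa [List.length_cons, List.sum_cons, show i + (j + w.sum) = j + (i + w.sum) by ring]
    · have := word_mem_wordSpan (L := L) ((j + i) :: w)
      rwa [List.sum_cons, show j + i + w.sum = i + (j + w.sum) by ring] at this

/-- The traces of `A` on weight spaces are polynomial of degree at most `k`. -/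
def PolyTrace (L0 : End ℂ M) (lam : ℂ) (k : ℕ) (A : End ℂ M) : Prop :=
  ∃ Q : ℂ[X], Q.natDegree ≤ k ∧ ∀ n : ℤ, wtTrace L0 lam n A = Q.eval (n : ℂ)

lemma PolyTrace.of_mem_wordSpan {L0 : End ℂ M} {k : ℕ} {s : ℤ} {A : End ℂ M}
    (hA : A ∈ wordSpan L k s)
    (hw : ∀ w : List ℤ, w.length = k → w.sum = s → PolyTrace L0 lam k (word L w)) :
    PolyTrace L0 lam k A := by
  refine Submodule.span_induction (p := fun A _ => PolyTrace L0 lam k A)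
    ?_ ⟨0, by simp, by simp⟩ ?_ ?_ hA
  · rintro _ ⟨w, h1, h2, rfl⟩
    exact hw w h1 h2
  · rintro A B _ _ ⟨P, hP, hA⟩ ⟨Q, hQ, hB⟩
    exact ⟨P + Q, natDegree_add_le_of_degree_le hP hQ, fun n => by simp [hA, hB]⟩
  · rintro a A _ ⟨P, hP, hA⟩
    exact ⟨C a * P, (natDegree_C_mul_le a P).trans hP, fun n => by simp [hA]⟩

lemma PolyTrace.shift {L0 : End ℂ M} {k : ℕ} {A B : End ℂ M} (hA : PolyTrace L0 lam k A) (s : ℤ)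
    (hB : ∀ n, wtTrace L0 lam n B = wtTrace L0 lam (n - s) A) : PolyTrace L0 lam k B := by
  obtain ⟨Q, hQ, hA⟩ := hA
  refine ⟨Q.comp (X - C (s : ℂ)), ?_, fun n => by rw [hB, hA]; simp⟩
  rw [natDegree_comp, natDegree_X_sub_C, mul_one]
  exact hQ

lemma VirMod.wtTrace_word_replicate (h : VirMod L lam 0) (k : ℕ) (n : ℤ) :
    wtTrace (L 0) lam n (word L (List.replicate k 0)) =
      (lam + n) ^ k * finrank ℂ (wt (L 0) lam n) := by
  induction k with
  | zero => simp [wtTrace_one h.top h.fin]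
  | succ k ih => rw [List.replicate_succ, word_cons, wtTrace_L0_mul h.top, ih]; ring

/-- Traces of nonempty words are polynomial in the weight. -/
lemma VirMod.polyTrace_word (h : VirMod L lam 0) {N : ℕ}
    (hN : ∀ n, finrank ℂ (wt (L 0) lam n) ≤ N) (k : ℕ) : ∀ w : List ℤ, w.length = k + 1 →
    w.sum = 0 → PolyTrace (L 0) lam (k + 1) (word L w) := by
  obtain ⟨d, hd⟩ := h.exists_finrank_eq hN
  have hzero : ∀ k : ℕ, PolyTrace (L 0) lam (k + 1) (word L (List.replicate (k + 1) 0)) := by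
    intro k
    refine ⟨C (d : ℂ) * (C lam + X) ^ (k + 1), ?_, fun n => ?_⟩
    · refine (natDegree_C_mul_le _ _).trans (natDegree_pow_le.trans ?_)
      rw [add_comm (C lam), natDegree_X_add_C, mul_one]
    · rw [h.wtTrace_word_replicate]
      by_cases hn : lam + n = 0
      · simp [hn]
      · rw [hd n hn]; simp [mul_comm]
  induction k with
  | zero =>
    intro w hw hs
    obtain ⟨i, rfl⟩ := List.length_eq_one_iff.mp hw
    simp only [List.sum_singleton] at hs
    exact hs ▸ hzero 0
  | succ k ih =>
    have main : ∀ (i : ℤ) (u : List ℤ), i ≠ 0 → u.length = k + 1 → i + u.sum = 0 →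
        PolyTrace (L 0) lam (k + 2) (word L (i :: u)) := by
      intro i u hi hu hs
      have hcom := h.word_commutator i u
      rw [hu, hs] at hcom
      obtain ⟨Q, hQ, hQn⟩ := PolyTrace.of_mem_wordSpan hcom ih
      have hw0 : (i :: u).sum = 0 := by simpa using hs
      have hdeg : (Q.comp (X - C (i : ℂ))).natDegree ≤ k + 1 := by
        rwa [natDegree_comp, natDegree_X_sub_C, mul_one]
      refine polynomial_of_difference hi hdeg (fun n => ?_) (h.symb_wtTrace hN hw0)
      rw [word_cons, wtTrace_mul_comm h.top h.fin (h.shifts i), ← map_sub, hQn]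
      simp
    intro w hw hs
    by_cases hall : ∀ i ∈ w, i = 0
    · rw [List.eq_replicate_of_mem hall, hw]
      exact hzero _
    · push Not at hall
      obtain ⟨i, hi, hi0⟩ := hall
      obtain ⟨a, b, rfl⟩ := List.append_of_mem hi
      refine (main i (b ++ a) hi0 ?_ ?_).shift a.sum fun n => ?_
      · simp at hw ⊢; omega
      · simp at hs ⊢; omega
      · rw [word_append, wtTrace_mul_comm h.top h.fin (h.shifts_word a), ← word_append,
          List.cons_append]

end VirasoroPolynomials

section FiniteConditions

open Polynomial

lemma exists_finite_conditions {U : Type*} (χ : U → ℤ → ℤ → ℂ) (D : U → ℕ)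
    (hpoly : ∀ u i, ∃ Q : ℂ[X], Q.natDegree ≤ D u ∧ ∀ n : ℤ, χ u n i = Q.eval (n : ℂ)) (K : ℕ)
    (hdet : ∀ (n : ℤ) (us : Fin (K + 1) → U) (is : Fin (K + 1) → ℤ),
      (Matrix.of fun a b => χ (us a) n (is b)).det = 0) :
    ∃ S : Finset (U × ℤ), ∀ c : ℤ →₀ ℂ,
      (∀ p ∈ S, (c.sum fun i x => x * χ p.1 p.2 i) = 0) →
      ∀ u n, (c.sum fun i x => x * χ u n i) = 0 := by
  classical
  set P : ℕ → Prop := fun k => ∃ (n : ℤ) (us : Fin k → U) (is : Fin k → ℤ),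
      (Matrix.of fun a b => χ (us a) n (is b)).det ≠ 0 with hP
  obtain ⟨k, hk, hk1⟩ : ∃ k, P k ∧ ¬ P (k + 1) := by
    by_contra! hcon
    have hall : ∀ k, P k := fun k => by
      induction k with
      | zero => exact ⟨0, Fin.elim0, Fin.elim0, by simp⟩
      | succ k ih => exact hcon k ih
    obtain ⟨n, us, is, hne⟩ := hall (K + 1)
    exact hne (hdet n us is)
  obtain ⟨n₀, us, is, hne⟩ := hk
  choose Q hQd hQ using hpoly
  refine ⟨Finset.univ.biUnion fun a : Fin k =>
    (Finset.range (D (us a) + 1)).image fun m : ℕ => (us a, (m : ℤ)), fun c hc u => ?_⟩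
  set R : U → ℂ[X] := fun u => c.sum fun i x => Polynomial.C x * Q u i with hR
  have hRn : ∀ u (n : ℤ), (c.sum fun i x => x * χ u n i) = (R u).eval (n : ℂ) := fun u n => by
    simp only [hR, Finsupp.sum, eval_finsetSum, eval_mul, eval_C, hQ]
  have hRd : ∀ u, (R u).natDegree ≤ D u := fun u =>
    natDegree_sum_le_of_forall_le _ _ fun i _ => (natDegree_C_mul_le _ _).trans (hQd u i)
  have hrow : ∀ a, R (us a) = 0 := fun a => by
    refine Polynomial.eq_zero_of_natDegree_lt_card_of_eval_eq_zero' _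
      ((Finset.range (D (us a) + 1)).image fun m : ℕ => (m : ℂ)) ?_ ?_
    · intro x hx
      obtain ⟨m, hm, rfl⟩ := Finset.mem_image.mp hx
      have := hc (us a, (m : ℤ)) (Finset.mem_biUnion.mpr
        ⟨a, Finset.mem_univ _, Finset.mem_image.mpr ⟨m, hm, rfl⟩⟩)
      rw [hRn] at this
      simpa using this
    · rw [Finset.card_image_of_injective _ Nat.cast_injective, Finset.card_range]
      exact Nat.lt_succ_of_le (hRd _)
  set Δ : ℂ[X] := (Matrix.of fun a b => Q (us a) (is b)).det with hΔ
  have hΔn : ∀ n : ℤ, Δ.eval (n : ℂ) = (Matrix.of fun a b => χ (us a) n (is b)).det := fun n => by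
    rw [hΔ, ← coe_evalRingHom, RingHom.map_det]
    congr 1
    ext a b
    simp [hQ]
  have hΔ0 : Δ ≠ 0 := fun h0 => hne (by rw [← hΔn, h0, eval_zero])
  have hmain : ∀ n : ℤ, Δ.eval (n : ℂ) * (R u).eval (n : ℂ) = 0 := fun n => by
    have hb : ∀ i : ℤ, (Matrix.of fun a b : Fin (k + 1) =>
        χ (Fin.snoc (α := fun _ => U) us u a) n (Fin.snoc (α := fun _ => ℤ) is i b)).det = 0 := by
      intro i
      by_contra hcon
      exact hk1 ⟨n, _, _, hcon⟩
    have hexp : ∀ i, ∑ a : Fin (k + 1), (-1 : ℂ) ^ (a.val + k) *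
        χ (Fin.snoc (α := fun _ => U) us u a) n i *
        (Matrix.of fun (b : Fin k) (j : Fin k) =>
          χ (Fin.snoc (α := fun _ => U) us u (a.succAbove b)) n (is j)).det = 0 := fun i => by
      rw [← hb i, Matrix.det_succ_column _ (Fin.last k)]
      refine Finset.sum_congr rfl fun a _ => ?_
      simp only [Matrix.of_apply, Fin.snoc_last, Fin.val_last]
      congr 2
      ext b j
      simp [Matrix.submatrix_apply]
    have hsum : ∑ a : Fin (k + 1), (-1 : ℂ) ^ (a.val + k) *
        (c.sum fun i x => x * χ (Fin.snoc (α := fun _ => U) us u a) n i) *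
        (Matrix.of fun (b : Fin k) (j : Fin k) =>
          χ (Fin.snoc (α := fun _ => U) us u (a.succAbove b)) n (is j)).det = 0 := by
      have : c.sum (fun i x => x * ∑ a : Fin (k + 1), (-1 : ℂ) ^ (a.val + k) *
        χ (Fin.snoc (α := fun _ => U) us u a) n i *
        (Matrix.of fun (b : Fin k) (j : Fin k) =>
          χ (Fin.snoc (α := fun _ => U) us u (a.succAbove b)) n (is j)).det) = 0 := by
        simp [hexp]
      rw [← this]
      simp only [Finsupp.sum, Finset.mul_sum, Finset.sum_mul]
      rw [Finset.sum_comm]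
      exact Finset.sum_congr rfl fun a _ => Finset.sum_congr rfl fun i _ => by ring
    rw [Fin.sum_univ_castSucc] at hsum
    simp only [Fin.snoc_castSucc, hRn, hrow, eval_zero, mul_zero, zero_mul,
      Finset.sum_const_zero, zero_add, Fin.snoc_last, Fin.succAbove_last, Fin.val_last] at hsum
    rw [hΔn, mul_comm]
    rw [mul_assoc] at hsum
    exact (mul_eq_zero.mp hsum).resolve_left (by simp)
  have hz : Δ * R u = 0 := by
    refine Polynomial.eq_zero_of_infinite_isRoot _ (Set.Infinite.mono ?_
      (Set.infinite_range_of_injective (f := fun n : ℤ => (n : ℂ)) Int.cast_injective))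
    rintro _ ⟨n, rfl⟩
    simp only [Set.mem_ofPred_eq, IsRoot.def, eval_mul]
    exact hmain n
  intro n
  rw [hRn, (mul_eq_zero.mp hz).resolve_left hΔ0, eval_zero]

end FiniteConditions

section VirasoroRadical

open Polynomial

variable {M : Type*} [AddCommGroup M] [Module ℂ M] {L : ℤ → End ℂ M} {lam : ℂ}

/-- Operators orthogonal to all nonempty words with respect to all traces on weight spaces. -/
def traceRad (L : ℤ → End ℂ M) (lam : ℂ) : Submodule ℂ (End ℂ M) where
  carrier := {A | ∀ u : List ℤ, u ≠ [] → ∀ n, wtTrace (L 0) lam n (word L u * A) = 0}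
  add_mem' ha hb u hu n := by rw [mul_add, map_add, ha u hu n, hb u hu n, add_zero]
  zero_mem' u _ n := by rw [mul_zero, map_zero]
  smul_mem' a A hA u hu n := by rw [mul_smul_comm, map_smul, hA u hu n, smul_zero]

lemma VirMod.det_wtTrace_eq_zero (h : VirMod L lam 0) {N : ℕ}
    (hN : ∀ n, finrank ℂ (wt (L 0) lam n) ≤ N) (l n : ℤ) (us : Fin (N * N + 1) → End ℂ M)
    (is : Fin (N * N + 1) → ℤ) : (Matrix.of fun a b =>
      wtTrace (L 0) lam n (us a * (L (l - is b) * L (is b)))).det = 0 := by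
  have hs : ∀ b, Shifts (L 0) lam l (L (l - is b) * L (is b)) := fun b => by
    simpa using (h.shifts (l - is b)).mul (h.shifts (is b))
  set Y : Fin (N * N + 1) → (wt (L 0) lam n →ₗ[ℂ] wt (L 0) lam (n + l)) := fun b =>
    (L (l - is b) * L (is b)).restrict (hs b n)
  have := h.fin
  have hdep : ¬ LinearIndependent ℂ Y := fun hli => by
    have h1 := hli.fintype_card_le_finrank
    rw [Module.finrank_linearMap, Fintype.card_fin] at h1
    have h2 := Nat.mul_le_mul (hN n) (hN (n + l))
    omega
  obtain ⟨g, hg, i, hi⟩ := Fintype.not_linearIndependent_iff.mp hdep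
  rw [← Matrix.exists_mulVec_eq_zero_iff]
  refine ⟨g, fun h0 => hi (congrFun h0 i), ?_⟩
  ext a
  have hz : (∑ b, g b • (us a * (L (l - is b) * L (is b)))) ∘ₗ (wt (L 0) lam n).subtype = 0 := by
    ext x
    have := congrArg (fun z => us a z) (congrArg Subtype.val (LinearMap.congr_fun hg x))
    simpa [Y, LinearMap.sum_apply, map_sum] using this
  have : wtTrace (L 0) lam n (∑ b, g b • (us a * (L (l - is b) * L (is b)))) = 0 := by
    rw [wtTrace_apply, hz, LinearMap.comp_zero, map_zero]
  rw [map_sum] at this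
  simpa [Matrix.mulVec, dotProduct, mul_comm] using this

/-- Membership in the trace radical amounts to finitely many conditions on quadratic expressions
of fixed weight. -/
lemma VirMod.exists_finset_traceRad (h : VirMod L lam 0) {N : ℕ}
    (hN : ∀ n, finrank ℂ (wt (L 0) lam n) ≤ N) (l : ℤ) :
    ∃ S : Finset (List ℤ × ℤ), ∀ c : ℤ →₀ ℂ,
      (∀ p ∈ S, wtTrace (L 0) lam p.2 (word L p.1 *
        Finsupp.linearCombination ℂ (fun i => L (l - i) * L i) c) = 0) →
      Finsupp.linearCombination ℂ (fun i => L (l - i) * L i) c ∈ traceRad L lam := by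
  classical
  set U := {u : List ℤ // u ≠ [] ∧ u.sum = -l}
  have hlc : ∀ (c : ℤ →₀ ℂ) (A : End ℂ M) (n : ℤ), wtTrace (L 0) lam n (A *
      Finsupp.linearCombination ℂ (fun i => L (l - i) * L i) c) =
      c.sum fun i x => x * wtTrace (L 0) lam n (A * (L (l - i) * L i)) := fun c A n => by
    simp [Finsupp.linearCombination_apply, Finsupp.sum, Finset.mul_sum, map_sum]
  obtain ⟨S, hS⟩ := exists_finite_conditions
    (fun (u : U) n i => wtTrace (L 0) lam n (word L u.1 * (L (l - i) * L i)))
    (fun u => u.1.length + 2) (fun u i => by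
      obtain ⟨Q, hQ, hQn⟩ := h.polyTrace_word hN (u.1.length + 1) (u.1 ++ [l - i, i])
        (by simp) (by simp [u.2.2])
      refine ⟨Q, hQ, fun n => ?_⟩
      rw [← hQn, word_append]
      simp) (N * N)
    (fun n us is => h.det_wtTrace_eq_zero hN l n (fun a => word L (us a).1) is)
  refine ⟨S.image fun p => (p.1.1, p.2), fun c hc u hu n => ?_⟩
  by_cases hul : u.sum = -l
  · rw [hlc]
    refine hS c (fun p hp => ?_) ⟨u, hu, hul⟩ n
    rw [← hlc]
    exact hc (p.1.1, p.2) (Finset.mem_image_of_mem _ hp)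
  · rw [hlc]
    refine Finset.sum_eq_zero fun i _ => ?_
    have := wtTrace_of_shifts h.top (k := u.sum + l) (by omega)
      (A := word L u * (L (l - i) * L i)) (by
        have := (h.shifts_word u).mul ((h.shifts (l - i)).mul (h.shifts i))
        rwa [sub_add_cancel] at this) n
    beta_reduce
    rw [this, mul_zero]

lemma L_mul_mem_traceRad {A : End ℂ M} (hA : A ∈ traceRad L lam) (p : ℤ) :
    L p * A ∈ traceRad L lam := fun u _ n => by
  have := hA (u ++ [p]) (by simp) n
  rwa [word_append, word_cons, word_nil, mul_one, mul_assoc] at this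

lemma VirMod.mul_L_mem_traceRad {c : ℂ} (h : VirMod L lam c) {A : End ℂ M}
    (hA : A ∈ traceRad L lam) (p : ℤ) : A * L p ∈ traceRad L lam := fun u _ n => by
  have := wtTrace_mul_comm h.top h.fin (h.shifts p) (word L u * A) (n + p)
  rw [add_sub_cancel_right] at this
  rw [← mul_assoc, ← this, ← mul_assoc, ← word_cons]
  exact hA _ (by simp) _

lemma VirMod.mul_word_mem_traceRad {c : ℂ} (h : VirMod L lam c) {A : End ℂ M}
    (hA : A ∈ traceRad L lam) (w : List ℤ) : A * word L w ∈ traceRad L lam := by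
  induction w generalizing A with
  | nil => simpa using hA
  | cons i w ih => rw [word_cons, ← mul_assoc]; exact ih (h.mul_L_mem_traceRad hA i)

end VirasoroRadical

/-! ### Generalised Laurent polynomials and Euler derivations -/

section Mono

variable {A : Type*} [AddCommGroup A] {V : Type*} [AddCommGroup V] [Module ℂ V]

/-- The monomial with exponent `a`. -/
def mon (a : A) : AddMonoidAlgebra ℂ A := AddMonoidAlgebra.single a 1

lemma mon_mul_mon (a b : A) : mon a * mon b = mon (a + b) := by
  simp [mon, AddMonoidAlgebra.single_mul_single]

lemma mon_zero : mon (0 : A) = 1 := rfl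

/-- The linear map on Laurent polynomials with prescribed values on monomials. -/
def monoLin (f : A → V) : AddMonoidAlgebra ℂ A →ₗ[ℂ] V :=
  Finsupp.linearCombination ℂ f ∘ₗ
    (AddMonoidAlgebra.coeffLinearEquiv ℂ : AddMonoidAlgebra ℂ A ≃ₗ[ℂ] A →₀ ℂ).toLinearMap

@[simp] lemma monoLin_mon (f : A → V) (a : A) : monoLin f (mon a) = f a := by
  simp [monoLin, mon]

lemma mono_linearMap_ext {f g : AddMonoidAlgebra ℂ A →ₗ[ℂ] V} (h : ∀ a, f (mon a) = g (mon a)) :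
    f = g := by
  refine LinearMap.ext fun x => ?_
  induction x using AddMonoidAlgebra.induction_linear with
  | zero => simp
  | add x y hx hy => simp [hx, hy]
  | single a r =>
    have : AddMonoidAlgebra.single a r = r • mon a := by simp [mon]
    rw [this, map_smul, map_smul, h]

lemma mono_linearMap_congr {f g : AddMonoidAlgebra ℂ A →ₗ[ℂ] V} (h : ∀ a, f (mon a) = g (mon a))
    (x : AddMonoidAlgebra ℂ A) : f x = g x := by rw [mono_linearMap_ext h]

/-- The Euler derivation multiplying the monomial with exponent `a` by `φ a`. -/
def eulerD (φ : A →+ ℂ) :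
    Derivation ℂ (AddMonoidAlgebra ℂ A) (AddMonoidAlgebra ℂ A) :=
  Derivation.mk' (monoLin fun a => φ a • mon a) fun x y => by
    have h : (LinearMap.mul ℂ (AddMonoidAlgebra ℂ A)).compr₂ (monoLin fun a => φ a • mon a) =
        (LinearMap.mul ℂ (AddMonoidAlgebra ℂ A)).compl₂ (monoLin fun a => φ a • mon a) +
        ((LinearMap.mul ℂ (AddMonoidAlgebra ℂ A)) ∘ₗ (monoLin fun a => φ a • mon a)) := by
      refine mono_linearMap_ext fun a => mono_linearMap_ext fun b => ?_
      simp [mon_mul_mon, add_smul, add_comm]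
    have := congrArg (fun f => f x y) h
    simpa [mul_comm] using this

@[simp] lemma eulerD_mon (φ : A →+ ℂ) (a : A) : eulerD φ (mon a) = φ a • mon a := by
  simp [eulerD]

end Mono

/-! ### The Virasoro operators on Laurent polynomials in two variables -/

/-- Laurent polynomials in the variables `z, w`. -/
abbrev Lau2 : Type := AddMonoidAlgebra ℂ (ℤ × ℤ)

/-- The derivation `z ∂_z`. -/
def eulZ : Derivation ℂ Lau2 Lau2 := eulerD ((Int.castAddHom ℂ).comp (AddMonoidHom.fst ℤ ℤ))

/-- The derivation `w ∂_w`. -/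
def eulW : Derivation ℂ Lau2 Lau2 := eulerD ((Int.castAddHom ℂ).comp (AddMonoidHom.snd ℤ ℤ))

@[simp] lemma eulZ_mon (a b : ℤ) : eulZ (mon (a, b)) = (a : ℂ) • mon (a, b) := by simp [eulZ]
@[simp] lemma eulW_mon (a b : ℤ) : eulW (mon (a, b)) = (b : ℂ) • mon (a, b) := by simp [eulW]

lemma mon2_mul (a b c d : ℤ) : (mon (a, b) : Lau2) * mon (c, d) = mon (a + c, b + d) := by
  simp [mon_mul_mon]

/-- The action of `L_p` on quadratic generating functions. -/
def virT (p : ℤ) : Lau2 →ₗ[ℂ] Lau2 :=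
  monoLin fun a => ((a.1 : ℂ) - p) • mon (a.1 + p, a.2) + ((a.2 : ℂ) - p) • mon (a.1, a.2 + p)

lemma virT_mon (p a b : ℤ) : virT p (mon (a, b)) =
    ((a : ℂ) - p) • mon (a + p, b) + ((b : ℂ) - p) • mon (a, b + p) := by
  simp [virT]

lemma virT_eq (p : ℤ) (F : Lau2) : virT p F = mon (p, 0) * (eulZ F - (p : ℂ) • F) +
    mon (0, p) * (eulW F - (p : ℂ) • F) := by
  have := mono_linearMap_congr (f := virT p)
    (g := LinearMap.mulLeft ℂ (mon (p, 0)) ∘ₗ (eulZ.toLinearMap - (p : ℂ) • LinearMap.id) +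
      LinearMap.mulLeft ℂ (mon (0, p)) ∘ₗ (eulW.toLinearMap - (p : ℂ) • LinearMap.id)) (by
      rintro ⟨a, b⟩
      simp [virT_mon, mul_sub, mon2_mul, sub_smul, add_comm]) F
  simpa using this

lemma virT_mul (p : ℤ) (F H : Lau2) : virT p (F * H) = F * virT p H +
    (mon (p, 0) * eulZ F + mon (0, p) * eulW F) * H := by
  simp only [virT_eq, Derivation.leibniz, smul_eq_mul, mul_sub, mul_add, Algebra.smul_def]
  ring

/-- The second order operator `h θ_z θ_w F - (θ_w h) θ_z F - (θ_z h) θ_w F + (θ_z θ_w h) F`. -/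
def virQ (h F : Lau2) : Lau2 :=
  h * eulZ (eulW F) - eulW h * eulZ F - eulZ h * eulW F + eulZ (eulW h) * F

lemma virQ_mon (i j a b : ℤ) : virQ (mon (i, j)) (mon (a, b)) =
    (((a : ℂ) - i) * (b - j)) • mon (a + i, b + j) := by
  simp only [virQ, eulZ_mon, eulW_mon, Derivation.map_smul, smul_mul_assoc, mul_smul_comm, mon2_mul,
    add_comm i a, add_comm j b]
  module

lemma virQ_mul_square (g h F : Lau2) (h1 : eulZ (eulW g) = 0) :
    virQ h (g * g * F) - 2 * virQ (g * h) (g * F) + virQ (g * g * h) F =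
      8 * (eulZ g * eulW g * h * F) := by
  simp only [virQ, Derivation.leibniz, smul_eq_mul, map_add, h1]
  ring

lemma virQ_add_left (h h' F : Lau2) : virQ (h + h') F = virQ h F + virQ h' F := by
  simp only [virQ, map_add]; ring

lemma virQ_smul_left (c : ℂ) (h F : Lau2) : virQ (c • h) F = c • virQ h F := by
  simp only [virQ, Derivation.map_smul, smul_add, smul_sub, smul_mul_assoc]

/-- `virQ` as a linear map in its second argument. -/
def virQl (h : Lau2) : Lau2 →ₗ[ℂ] Lau2 where
  toFun := virQ h
  map_add' F F' := by simp only [virQ, map_add]; ring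
  map_smul' c F := by
    simp only [virQ, Derivation.map_smul, smul_add, smul_sub, mul_smul_comm, RingHom.id_apply]

/-- The antisymmetric polynomial `z^p w^q - z^q w^p`. -/
def altMon (p q : ℤ) : Lau2 := mon (p, q) - mon (q, p)

/-- The variables difference `z - w`. -/
def zmw : Lau2 := mon (1, 0) - mon (0, 1)

lemma cube_altMon (p q : ℤ) : zmw ^ 3 * altMon (p - 3) q =
    mon (p, q) - (3 : ℂ) • mon (p - 1, q + 1) + (3 : ℂ) • mon (p - 2, q + 2) - mon (p - 3, q + 3) +
    (mon (q, p) - (3 : ℂ) • mon (q + 1, p - 1) + (3 : ℂ) • mon (q + 2, p - 2)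
      - mon (q + 3, p - 3)) := by
  have h3 : ∀ x : Lau2, (3 : ℂ) • x = 3 * x := fun x => by rw [Algebra.smul_def, map_ofNat]
  simp only [zmw, altMon, pow_succ, pow_zero, one_mul, mul_sub, sub_mul, mon2_mul, h3]
  ring_nf

lemma virT_third_difference (p q : ℤ) (F : Lau2) :
    virT p (virT q F) - (3 : ℂ) • virT (p - 1) (virT (q + 1) F)
      + (3 : ℂ) • virT (p - 2) (virT (q + 2) F) - virT (p - 3) (virT (q + 3) F) =
    virQ (zmw ^ 3 * altMon (p - 3) q) F := by
  have := mono_linearMap_congr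
    (f := virT p ∘ₗ virT q - (3 : ℂ) • (virT (p - 1) ∘ₗ virT (q + 1))
      + (3 : ℂ) • (virT (p - 2) ∘ₗ virT (q + 2)) - virT (p - 3) ∘ₗ virT (q + 3))
    (g := virQl (zmw ^ 3 * altMon (p - 3) q)) (by
      rintro ⟨a, b⟩
      have e : virQl (zmw ^ 3 * altMon (p - 3) q) (mon (a, b)) =
        virQ (zmw ^ 3 * altMon (p - 3) q) (mon (a, b)) := rfl
      have sub : ∀ h h' : Lau2, virQ (h - h') (mon (a, b)) = virQ h (mon (a, b))
        - virQ h' (mon (a, b)) := fun h h' => by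
          rw [sub_eq_add_neg, virQ_add_left, ← neg_one_smul ℂ h', virQ_smul_left]; module
      rw [e, cube_altMon]
      simp only [virQ_add_left, sub, virQ_smul_left, virQ_mon, LinearMap.add_apply,
        LinearMap.sub_apply, LinearMap.smul_apply, LinearMap.comp_apply, virT_mon, map_add, map_smul]
      simp only [show ∀ x u : ℤ, x + (q + u) + (p - u) = x + q + p from fun x u => by ring]
      push_cast
      module) F
  simpa [virQl] using this

section Ideal

variable {K : Submodule ℂ Lau2}

lemma virQ_mem (hT : ∀ p, ∀ F ∈ K, virT p F ∈ K) {F : Lau2} (hF : F ∈ K) (p q : ℤ) :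
    virQ (zmw ^ 3 * altMon p q) F ∈ K := by
  have := virT_third_difference (p + 3) q F
  rw [add_sub_cancel_right] at this
  rw [← this]
  exact K.sub_mem (K.add_mem (K.sub_mem (hT _ _ (hT _ _ hF)) (K.smul_mem _ (hT _ _ (hT _ _ hF))))
    (K.smul_mem _ (hT _ _ (hT _ _ hF)))) (hT _ _ (hT _ _ hF))

/-- The sum of the variables `z + w`. -/
def zpw : Lau2 := mon (1, 0) + mon (0, 1)

lemma zpw_altMon (p q : ℤ) : zpw * altMon p q = altMon (p + 1) q + altMon p (q + 1) := by
  simp only [zpw, altMon, add_mul, mul_sub, mon2_mul]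
  ring_nf

lemma mon_altMon (p q : ℤ) : mon (1, 1) * altMon p q = altMon (p + 1) (q + 1) := by
  simp only [altMon, mul_sub, mon2_mul]
  ring_nf

lemma altMon_mul_mem (hT : ∀ p, ∀ F ∈ K, virT p F ∈ K) {F : Lau2} (h0 : F ∈ K)
    (h1 : zpw * F ∈ K) (h2 : zpw * zpw * F ∈ K) (p q : ℤ) : zmw ^ 3 * altMon p q * F ∈ K := by
  have key := virQ_mul_square zpw (zmw ^ 3 * altMon (p - 1) (q - 1)) F (by simp [zpw])
  have e1 : ∀ p q, zpw * (zmw ^ 3 * altMon p q) = zmw ^ 3 * altMon (p + 1) q +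
      zmw ^ 3 * altMon p (q + 1) := fun p q => by
    rw [mul_left_comm, zpw_altMon, mul_add]
  have m1 : ∀ F ∈ K, ∀ p q, virQ (zpw * (zmw ^ 3 * altMon p q)) F ∈ K := fun F hF p q => by
    rw [e1, virQ_add_left]
    exact K.add_mem (virQ_mem hT hF _ _) (virQ_mem hT hF _ _)
  have m2 : ∀ F ∈ K, ∀ p q, virQ (zpw * zpw * (zmw ^ 3 * altMon p q)) F ∈ K := fun F hF p q => by
    rw [mul_assoc, e1, mul_add, virQ_add_left]
    exact K.add_mem (m1 F hF _ _) (m1 F hF _ _)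
  have e2 : (8 : ℂ) • (zmw ^ 3 * altMon p q * F) =
      virQ (zmw ^ 3 * altMon (p - 1) (q - 1)) (zpw * zpw * F) -
      (2 : ℂ) • virQ (zpw * (zmw ^ 3 * altMon (p - 1) (q - 1))) (zpw * F) +
      virQ (zpw * zpw * (zmw ^ 3 * altMon (p - 1) (q - 1))) F := by
    have h4 := mon_altMon (p - 1) (q - 1)
    rw [sub_add_cancel, sub_add_cancel] at h4
    have h5 : eulZ zpw * eulW zpw = mon (1, 1) := by simp [zpw, mon2_mul]
    rw [h5] at key
    rw [Algebra.smul_def, Algebra.smul_def, map_ofNat, map_ofNat, key, ← h4]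
    ring
  have : (8 : ℂ) • (zmw ^ 3 * altMon p q * F) ∈ K := by
    rw [e2]
    exact K.add_mem (K.sub_mem (virQ_mem hT h2 _ _) (K.smul_mem _ (m1 _ h1 _ _))) (m2 _ h0 _ _)
  exact (K.smul_mem_iff (by norm_num)).1 this

lemma zmw_pow_four_mul_mem (hT : ∀ p, ∀ F ∈ K, virT p F ∈ K) {F : Lau2} (h0 : F ∈ K)
    (h1 : zpw * F ∈ K) (h2 : zpw * zpw * F ∈ K) (h3 : mon (1, 0) * F ∈ K)
    (h4 : zpw * (mon (1, 0) * F) ∈ K) (h5 : zpw * zpw * (mon (1, 0) * F) ∈ K) (H : Lau2) :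
    H * (zmw ^ 4 * F) ∈ K := by
  have : ∀ a : ℤ × ℤ, mon a * (zmw ^ 4 * F) ∈ K := by
    rintro ⟨i, j⟩
    have e : mon (i, j) * zmw = altMon (j + 1) i + mon (1, 0) * altMon i j := by
      simp only [zmw, altMon, mul_sub, mon2_mul]
      ring_nf
    have e2 : mon (i, j) * (zmw ^ 4 * F) = zmw ^ 3 * altMon (j + 1) i * F +
        zmw ^ 3 * altMon i j * (mon (1, 0) * F) := by
      linear_combination zmw ^ 3 * F * e
    rw [e2]
    exact K.add_mem (altMon_mul_mem hT h0 h1 h2 _ _) (altMon_mul_mem hT h3 h4 h5 _ _)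
  have h := mono_linearMap_congr (f := K.mkQ ∘ₗ LinearMap.mulRight ℂ (zmw ^ 4 * F)) (g := 0)
    (fun a => by simpa [← mul_assoc] using this a) H
  simpa [← mul_assoc] using h

open Polynomial

/-- The substitution of `w / z` into a polynomial. -/
def ratioHom : ℂ[X] →ₐ[ℂ] Lau2 := Polynomial.aeval (mon (-1, 1))

lemma eulZ_ratioHom (c : ℂ[X]) : eulZ (ratioHom c) = - ratioHom (X * derivative c) := by
  rw [ratioHom, Derivation.map_aeval]
  simp [mul_comm]

lemma eulW_ratioHom (c : ℂ[X]) : eulW (ratioHom c) = ratioHom (X * derivative c) := by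
  rw [ratioHom, Derivation.map_aeval]
  simp [mul_comm]

/-- The polynomials in `w / z` generating an ideal contained in `K`. -/
def ratioIdeal (K : Submodule ℂ Lau2) : Ideal ℂ[X] where
  carrier := {c | ∀ H, ratioHom c * H ∈ K}
  add_mem' ha hb H := by
    rw [map_add, add_mul]
    exact K.add_mem (ha H) (hb H)
  zero_mem' H := by simp
  smul_mem' r c hc H := by
    rw [smul_eq_mul, map_mul, mul_right_comm, mul_assoc, mul_comm, mul_assoc]
    have := hc (ratioHom r * H)
    convert this using 1
    ring

lemma mem_ratioIdeal_of_X_mul {c : ℂ[X]} (h : X * c ∈ ratioIdeal K) : c ∈ ratioIdeal K := by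
  intro H
  have := h (mon (1, -1) * H)
  have e : mon (-1, 1) * mon (1, -1) = (1 : Lau2) := by rw [mon2_mul]; rfl
  rw [map_mul, ratioHom, aeval_X] at this
  convert this using 1
  rw [ratioHom]
  linear_combination - (aeval (mon (-1, 1) : Lau2) c * H) * e

lemma derivative_mem_ratioIdeal (hT : ∀ p, ∀ F ∈ K, virT p F ∈ K) {c : ℂ[X]}
    (h : c ∈ ratioIdeal K) : (X - 1) * (X * derivative c) ∈ ratioIdeal K := by
  intro H
  have h1 := hT 1 _ (h (mon (-1, 0) * H))
  rw [virT_mul, eulZ_ratioHom, eulW_ratioHom] at h1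
  have h2 := K.sub_mem h1 (h (virT 1 (mon (-1, 0) * H)))
  have e1 : mon (1, 0) * mon (-1, 0) = (1 : Lau2) := by rw [mon2_mul]; rfl
  have e2 : mon (0, 1) * mon (-1, 0) = (ratioHom X : Lau2) := by
    rw [mon2_mul, ratioHom, aeval_X]; rfl
  convert h2 using 1
  rw [map_mul, map_sub, map_one]
  linear_combination (ratioHom (X * derivative c) * H) * e1 -
    (ratioHom (X * derivative c) * H) * e2

/-- A nonzero ideal of `ℂ[X]` saturated with respect to `X` and stable under `(X - 1) X d/dX`
contains a power of `X - 1`. -/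
lemma exists_X_sub_one_pow_mem_of_stable {I : Ideal ℂ[X]} (hX : ∀ c, X * c ∈ I → c ∈ I)
    (hD : ∀ c ∈ I, (X - 1) * (X * derivative c) ∈ I) {c : ℂ[X]} (hc0 : c ≠ 0)
    (hc : c ∈ I) : ∃ d : ℕ, (X - 1) ^ d ∈ I := by
  obtain ⟨c, ⟨hc, hc0⟩, hmin⟩ : ∃ c : ℂ[X], (c ∈ I ∧ c ≠ 0) ∧
      ∀ b : ℂ[X], b ∈ I → b ≠ 0 → c.natDegree ≤ b.natDegree := by
    have hex : ∃ n : ℕ, ∃ c : ℂ[X], (c ∈ I ∧ c ≠ 0) ∧ c.natDegree = n :=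
      ⟨_, c, ⟨hc, hc0⟩, rfl⟩
    classical
    obtain ⟨c, h1, h2⟩ := Nat.find_spec hex
    exact ⟨c, h1, fun b hb hb0 => by
      rw [h2]; exact Nat.find_min' hex ⟨b, ⟨hb, hb0⟩, rfl⟩⟩
  set d := c.natDegree with hd
  have hlc : c.leadingCoeff ≠ 0 := leadingCoeff_ne_zero.2 hc0
  obtain ⟨κ, hκ⟩ : ∃ κ : ℂ, (X - 1) * (X * derivative c) = (C (d : ℂ) * X + C κ) * c := by
    set κ : ℂ := (((X - 1) * (X * derivative c) - C (d : ℂ) * X * c).coeff d) / c.leadingCoeff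
      with hκ
    refine ⟨κ, ?_⟩
    by_contra hne
    set b := (X - 1) * (X * derivative c) - (C (d : ℂ) * X + C κ) * c with hb
    have hb0 : b ≠ 0 := sub_ne_zero.2 hne
    have hbI : b ∈ I :=
      Ideal.sub_mem _ (hD _ hc) (Ideal.mul_mem_left _ _ hc)
    have hlt : b.degree < d := by
      rw [degree_lt_iff_coeff_zero]
      intro m hm
      have hbig : ∀ n, d < n → c.coeff n = 0 := fun n hn => coeff_eq_zero_of_natDegree_lt hn
      rcases Nat.eq_or_lt_of_le hm with rfl | hm'
      · have : b = ((X - 1) * (X * derivative c) - C (d : ℂ) * X * c) - C κ * c := by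
          rw [hb]; ring
        rw [this, coeff_sub, coeff_C_mul, hκ, hd, coeff_natDegree, div_mul_cancel₀ _ hlc, sub_self]
      · obtain ⟨n, rfl⟩ : ∃ n, m = n + 1 := ⟨m - 1, by omega⟩
        have e : b = X * (X * derivative c) - X * derivative c - C (d : ℂ) * (X * c) - C κ * c := by
          rw [hb]; ring
        rw [e]
        simp only [coeff_sub, coeff_C_mul, coeff_X_mul, coeff_derivative]
        rw [hbig (n + 1) hm']
        rcases n with - | n
        · simp only [Nat.lt_one_iff, zero_add] at hm'
          simp [mul_coeff_zero, hm']
        · rw [coeff_X_mul, coeff_derivative]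
          rcases Nat.eq_or_lt_of_le (Nat.lt_succ_iff.1 hm') with h | h
          · rw [h]; push_cast; ring
          · rw [hbig _ h]; ring
    have h1 := hmin b hbI hb0
    rw [degree_eq_natDegree hb0] at hlt
    have : b.natDegree < d := by exact_mod_cast hlt
    omega
  have hroot : ∀ a ∈ c.roots, a = 1 := by
    intro a ha
    have har : c.IsRoot a := isRoot_of_mem_roots ha
    by_contra ha1
    have ha0 : a ≠ 0 := by
      rintro rfl
      obtain ⟨b, rfl⟩ : X ∣ c := X_dvd_iff.2 (by simpa [coeff_zero_eq_eval_zero] using har)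
      have hb0 : b ≠ 0 := right_ne_zero_of_mul hc0
      have := hmin b (hX _ hc) hb0
      rw [hd, natDegree_X_mul hb0] at this
      omega
    have hdc0 : derivative c ≠ 0 := by
      intro h
      have := derivative_eq_zero.1 h
      rw [eq_C_of_natDegree_eq_zero this] at har hc0
      simp only [IsRoot.def, eval_C] at har
      exact hc0 (by rw [har, C_0])
    have hX1 : (X - 1 : ℂ[X]) ≠ 0 := X_sub_C_ne_zero (1 : ℂ)
    have hL0 : (X - 1) * (X * derivative c) ≠ 0 := mul_ne_zero hX1 (mul_ne_zero X_ne_zero hdc0)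
    have m1 := congrArg (rootMultiplicity a) hκ
    have hR0 : (C (d : ℂ) * X + C κ) * c ≠ 0 := hκ ▸ hL0
    rw [rootMultiplicity_mul hL0, rootMultiplicity_mul (right_ne_zero_of_mul hL0),
      rootMultiplicity_mul hR0, derivative_rootMultiplicity_of_root har] at m1
    have z1 : rootMultiplicity a (X - 1 : ℂ[X]) = 0 := by
      apply rootMultiplicity_eq_zero
      simpa [IsRoot, sub_eq_zero] using ha1
    have z2 : rootMultiplicity a (X : ℂ[X]) = 0 := by
      apply rootMultiplicity_eq_zero
      simpa [IsRoot] using ha0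
    have := (rootMultiplicity_pos hc0).2 har
    omega
  refine ⟨c.roots.card, ?_⟩
  have h1 := (IsAlgClosed.splits c).eq_prod_roots
  rw [Multiset.eq_replicate_card.2 hroot, Multiset.map_replicate, Multiset.prod_replicate,
    C_1] at h1
  have h2 : (X - 1) ^ c.roots.card = C c.leadingCoeff⁻¹ * c := by
    have h2 := congrArg (C c.leadingCoeff⁻¹ * ·) h1
    simp only [← mul_assoc, ← C_mul, inv_mul_cancel₀ (leadingCoeff_ne_zero.2 hc0)] at h2
    rw [h2, C_1, one_mul]
  rw [h2]
  exact Ideal.mul_mem_left _ _ hc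

lemma exists_X_sub_one_pow_mem (hT : ∀ p, ∀ F ∈ K, virT p F ∈ K) {c : ℂ[X]} (hc0 : c ≠ 0)
    (hc : c ∈ ratioIdeal K) : ∃ d : ℕ, (X - 1) ^ d ∈ ratioIdeal K :=
  exists_X_sub_one_pow_mem_of_stable (fun _ => mem_ratioIdeal_of_X_mul)
    (fun _ => derivative_mem_ratioIdeal hT) hc0 hc

theorem exists_zmw_pow_mul_mem (hT : ∀ p, ∀ F ∈ K, virT p F ∈ K)
    (hfin : ∀ l : ℤ, ∃ (n : ℕ) (κ : ℂ[X] →ₗ[ℂ] (Fin n → ℂ)), ∀ c, κ c = 0 →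
      mon (l, 0) * ratioHom c ∈ K) :
    ∃ d : ℕ, ∀ H, zmw ^ d * H ∈ K := by
  choose n κ hκ using hfin
  set f := ((κ 0).prod (κ 1 ∘ₗ LinearMap.mulLeft ℂ (1 + X))).prod
    (((κ 2 ∘ₗ LinearMap.mulLeft ℂ ((1 + X) * (1 + X))).prod (κ 1)).prod
    ((κ 2 ∘ₗ LinearMap.mulLeft ℂ (1 + X)).prod (κ 3 ∘ₗ LinearMap.mulLeft ℂ ((1 + X) * (1 + X)))))
    with hf
  obtain ⟨c, hc, hc0⟩ : ∃ c, f c = 0 ∧ c ≠ 0 := by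
    by_contra! h
    have : Function.Injective f := (injective_iff_map_eq_zero f).2 h
    exact Polynomial.not_finite (Module.Finite.of_injective f this)
  obtain ⟨⟨h0, h1⟩, ⟨h2, h3⟩, h4, h5⟩ :
      (κ 0 c = 0 ∧ κ 1 ((1 + X) * c) = 0) ∧ (κ 2 ((1 + X) * (1 + X) * c) = 0 ∧ κ 1 c = 0) ∧
        κ 2 ((1 + X) * c) = 0 ∧ κ 3 ((1 + X) * (1 + X) * c) = 0 := by
    simp only [Prod.ext_iff] at hc
    exact hc
  have eg : mon (1, 0) * ratioHom (1 + X) = zpw := by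
    rw [ratioHom, map_add, map_one, aeval_X, mul_add, mon2_mul, mul_one]; rfl
  have e1 : mon (0, 0) = (1 : Lau2) := rfl
  have e2 : mon (1, 0) * mon (1, 0) = (mon (2, 0) : Lau2) := by rw [mon2_mul]; rfl
  have e3 : mon (1, 0) * mon (2, 0) = (mon (3, 0) : Lau2) := by rw [mon2_mul]; rfl
  have k0 := hκ _ _ h0
  have k1 := hκ _ _ h1
  have k2 := hκ _ _ h2
  have k3 := hκ _ _ h3
  have k4 := hκ _ _ h4
  have k5 := hκ _ _ h5
  have key := zmw_pow_four_mul_mem (F := ratioHom c) hT (by simpa [e1] using k0)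
    (by convert k1 using 1; rw [map_mul, ← eg]; ring)
    (by convert k2 using 1; rw [map_mul, map_mul, ← eg, ← e2]; ring)
    k3
    (by convert k4 using 1; rw [map_mul, ← eg, ← e2]; ring)
    (by convert k5 using 1; rw [map_mul, map_mul, ← eg, ← e3, ← e2]; ring)
  have ez : zmw = - (mon (1, 0) * ratioHom (X - 1)) := by
    rw [ratioHom, map_sub, map_one, aeval_X, mul_sub, mon2_mul, mul_one, zmw]
    simp
  have hinv : ∀ k : ℕ, ∃ u : Lau2, u * mon (1, 0) ^ k = 1 := fun k => ⟨mon (-1, 0) ^ k, by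
    rw [← mul_pow, mon2_mul]; exact one_pow k⟩
  have hI : (X - 1) ^ 4 * c ∈ ratioIdeal K := by
    intro H
    obtain ⟨u, hu⟩ := hinv 4
    convert key (u * H) using 1
    rw [ez, map_mul, map_pow]
    linear_combination - (ratioHom (X - 1) ^ 4 * ratioHom c * H) * hu
  have hX1 : (X - 1 : ℂ[X]) ≠ 0 := X_sub_C_ne_zero (1 : ℂ)
  obtain ⟨d, hd⟩ := exists_X_sub_one_pow_mem hT (mul_ne_zero (pow_ne_zero 4 hX1) hc0) hI
  refine ⟨d, fun H => ?_⟩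
  convert hd ((- mon (1, 0)) ^ d * H) using 1
  rw [ez, map_pow, ← mul_assoc, ← mul_pow]
  ring

end Ideal

section MonoHom

variable {A B : Type*} [AddCommGroup A] [AddCommGroup B]

/-- The algebra map of Laurent polynomials induced by a map of exponents. -/
def monoHom (f : A →+ B) : AddMonoidAlgebra ℂ A →ₐ[ℂ] AddMonoidAlgebra ℂ B :=
  AddMonoidAlgebra.mapDomainAlgHom ℂ ℂ f

@[simp] lemma monoHom_mon (f : A →+ B) (a : A) : monoHom f (mon a) = mon (f a) := by
  simp [monoHom, mon]

end MonoHom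

section Quad

variable {M : Type*} [AddCommGroup M] [Module ℂ M]

/-- The operator `∑ F_{ab} L_a L_b`. -/
def quadOp (L : ℤ → End ℂ M) : Lau2 →ₗ[ℂ] End ℂ M := monoLin fun a => L a.1 * L a.2

@[simp] lemma quadOp_mon (L : ℤ → End ℂ M) (a b : ℤ) : quadOp L (mon (a, b)) = L a * L b := by
  simp [quadOp]

variable {L : ℤ → End ℂ M} {lam : ℂ}

lemma quadOp_virT (hL : ∀ i j, L i * L j - L j * L i = ((j : ℂ) - i) • L (i + j)) (p : ℤ)
    (F : Lau2) : quadOp L (virT p F) = L p * quadOp L F - quadOp L F * L p := by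
  have := mono_linearMap_congr (f := quadOp L ∘ₗ virT p)
    (g := LinearMap.mulLeft ℂ (L p) ∘ₗ quadOp L - LinearMap.mulRight ℂ (L p) ∘ₗ quadOp L) (by
      rintro ⟨a, b⟩
      simp only [LinearMap.comp_apply, virT_mon, map_add, map_smul, quadOp_mon,
        LinearMap.sub_apply, LinearMap.mulLeft_apply, LinearMap.mulRight_apply]
      rw [add_comm a p, add_comm b p, ← smul_mul_assoc, ← mul_smul_comm, ← hL, ← hL]
      noncomm_ring) F
  simpa using this

lemma VirMod.exists_quadOp_mem_traceRad (h : VirMod L lam 0) {N : ℕ}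
    (hN : ∀ n, finrank ℂ (wt (L 0) lam n) ≤ N) :
    ∃ m : ℕ, ∀ H, quadOp L (zmw ^ m * H) ∈ traceRad L lam := by
  refine exists_zmw_pow_mul_mem (K := (traceRad L lam).comap (quadOp L)) (fun p F hF => ?_)
    fun l => ?_
  · rw [Submodule.mem_comap] at hF ⊢
    rw [quadOp_virT h.comm_zero]
    exact Submodule.sub_mem _ (L_mul_mem_traceRad hF p) (h.mul_L_mem_traceRad hF p)
  · obtain ⟨S, hS⟩ := h.exists_finset_traceRad hN l
    let f : Polynomial ℂ →ₗ[ℂ] ℤ →₀ ℂ :=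
      Finsupp.lmapDomain ℂ ℂ (fun n : ℕ => (n : ℤ)) ∘ₗ (Polynomial.basisMonomials ℂ).repr.toLinearMap
    have hf : Finsupp.linearCombination ℂ (fun i => L (l - i) * L i) ∘ₗ f =
        quadOp L ∘ₗ LinearMap.mulLeft ℂ (mon (l, 0)) ∘ₗ ratioHom.toLinearMap := by
      refine (Polynomial.basisMonomials ℂ).ext fun n => ?_
      have e : (mon (-1, 1) : Lau2) ^ n = mon (-(n : ℤ), (n : ℤ)) := by
        induction n with
        | zero => rfl
        | succ n ih => rw [pow_succ, ih, mon2_mul]; congr 2; push_cast; ring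
      have e2 : mon (l, 0) * (mon (-1, 1) : Lau2) ^ n = mon (l - n, (n : ℤ)) := by
        rw [e, mon2_mul, zero_add, sub_eq_add_neg]
      have e3 : (Polynomial.basisMonomials ℂ).repr (Polynomial.monomial n 1) =
          Finsupp.single n 1 := by
        have := (Polynomial.basisMonomials ℂ).repr_self n
        rwa [Polynomial.coe_basisMonomials] at this
      have e4 : ratioHom (Polynomial.monomial n 1) = (mon (-1, 1) : Lau2) ^ n := by
        rw [ratioHom, Polynomial.aeval_monomial, map_one, one_mul]
      simp [f, e2, e3, e4]
    refine ⟨S.card, LinearMap.pi fun i => wtTrace (L 0) lam (S.equivFin.symm i).1.2 ∘ₗ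
      LinearMap.mulLeft ℂ (word L (S.equivFin.symm i).1.1) ∘ₗ
      Finsupp.linearCombination ℂ (fun i => L (l - i) * L i) ∘ₗ f, fun c hc => ?_⟩
    rw [Submodule.mem_comap]
    have e : quadOp L (mon (l, 0) * ratioHom c) =
        Finsupp.linearCombination ℂ (fun i => L (l - i) * L i) (f c) :=
      (LinearMap.congr_fun hf c).symm
    rw [e]
    refine hS _ fun p hp => ?_
    have := congrFun hc (S.equivFin ⟨p, hp⟩)
    simpa using this

end Quad

section Comm

/-- Laurent polynomials in three variables. -/
abbrev Lau3 : Type := AddMonoidAlgebra ℂ (ℤ × ℤ × ℤ)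

/-- Laurent polynomials in four variables. -/
abbrev Lau4 : Type := AddMonoidAlgebra ℂ (ℤ × ℤ × ℤ × ℤ)

variable {M : Type*} [AddCommGroup M] [Module ℂ M]

/-- The operator `∑ F_{abc} L_a L_b L_c`. -/
def cubOp (L : ℤ → End ℂ M) : Lau3 →ₗ[ℂ] End ℂ M := monoLin fun a => L a.1 * L a.2.1 * L a.2.2

/-- The operator `∑ F_{abcd} L_a L_b L_c L_d`. -/
def quartOp (L : ℤ → End ℂ M) : Lau4 →ₗ[ℂ] End ℂ M :=
  monoLin fun a => L a.1 * L a.2.1 * (L a.2.2.1 * L a.2.2.2)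

/-- The operators attached to the multiples of `(z - w)^m`. -/
def diffOps (L : ℤ → End ℂ M) (m : ℕ) : Submodule ℂ (End ℂ M) :=
  LinearMap.range (quadOp L ∘ₗ LinearMap.mulLeft ℂ (zmw ^ m))

lemma quadOp_mem_diffOps (L : ℤ → End ℂ M) (m : ℕ) (H : Lau2) :
    quadOp L (zmw ^ m * H) ∈ diffOps L m := ⟨H, rfl⟩

/-- The difference of the variables with indices `i` and `j`, given by their exponents. -/
def varDiff {A : Type*} [AddCommGroup A] (a b : A) : AddMonoidAlgebra ℂ A := mon a - mon b

/-- Inclusion of the first two variables. -/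
def inl4 : Lau2 →ₐ[ℂ] Lau4 := monoHom (AddMonoidHom.mk' (fun a => (a.1, a.2, 0, 0)) (by simp))

/-- Inclusion of the last two variables. -/
def inr4 : Lau2 →ₐ[ℂ] Lau4 := monoHom (AddMonoidHom.mk' (fun a => (0, 0, a.1, a.2)) (by simp))

/-- Exchange of the two inner variables. -/
def swap4 : Lau4 →ₐ[ℂ] Lau4 :=
  monoHom (AddMonoidHom.mk' (fun a => (a.1, a.2.2.1, a.2.1, a.2.2.2)) (by simp))

/-- Identification of the two inner variables. -/
def merge4 : Lau4 →ₐ[ℂ] Lau3 :=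
  monoHom (AddMonoidHom.mk' (fun a => (a.1, a.2.1 + a.2.2.1, a.2.2.2))
    (by intro a b; simp only [Prod.fst_add, Prod.snd_add, Prod.mk_add_mk]; congr 2; ring))

/-- The derivation `θ₃ - θ₂` in four variables. -/
def inner4 : Derivation ℂ Lau4 Lau4 :=
  eulerD (AddMonoidHom.mk' (fun a => (a.2.2.1 : ℂ) - a.2.1) (by
    intro a b; simp only [Prod.fst_add, Prod.snd_add, Int.cast_add]; ring))

variable {L : ℤ → End ℂ M}

lemma quartOp_mul (F F' : Lau2) : quartOp L (inl4 F * inr4 F') = quadOp L F * quadOp L F' := by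
  have h : ((LinearMap.mul ℂ Lau4).compl₁₂ inl4.toLinearMap inr4.toLinearMap).compr₂ (quartOp L) =
      (LinearMap.mul ℂ (End ℂ M)).compl₁₂ (quadOp L) (quadOp L) := by
    refine mono_linearMap_ext fun a => mono_linearMap_ext fun b => ?_
    simp [inl4, inr4, quartOp, quadOp, mon_mul_mon]
  simpa using congrArg (fun f => f F F') h

lemma quartOp_mem (m : ℕ) (R : Lau4) :
    quartOp L (inl4 zmw ^ m * inr4 zmw ^ m * R) ∈ diffOps L m * diffOps L m := by
  have := mono_linearMap_congr (f := (diffOps L m * diffOps L m).mkQ ∘ₗ quartOp L ∘ₗ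
    LinearMap.mulLeft ℂ (inl4 zmw ^ m * inr4 zmw ^ m)) (g := 0) (by
      rintro ⟨a, b, c, d⟩
      have e : (mon (a, b, c, d) : Lau4) = inl4 (mon (a, b)) * inr4 (mon (c, d)) := by
        simp [inl4, inr4, mon_mul_mon]
      have e2 : inl4 zmw ^ m * inr4 zmw ^ m * (mon (a, b, c, d) : Lau4) =
          inl4 (zmw ^ m * mon (a, b)) * inr4 (zmw ^ m * mon (c, d)) := by
        rw [e, map_mul, map_mul, map_pow, map_pow]; ring
      simp only [LinearMap.comp_apply, LinearMap.mulLeft_apply, e2, quartOp_mul,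
        LinearMap.zero_apply, Submodule.mkQ_apply, Submodule.Quotient.mk_eq_zero]
      exact Submodule.mul_mem_mul (quadOp_mem_diffOps _ _ _) (quadOp_mem_diffOps _ _ _)) R
  simpa [← mul_assoc] using this

lemma quartOp_sub_swap (hL : ∀ i j, L i * L j - L j * L i = ((j : ℂ) - i) • L (i + j)) (T : Lau4) :
    quartOp L T - quartOp L (swap4 T) = cubOp L (merge4 (inner4 T)) := by
  have := mono_linearMap_congr (f := quartOp L - quartOp L ∘ₗ swap4.toLinearMap)
    (g := cubOp L ∘ₗ merge4.toLinearMap ∘ₗ inner4.toLinearMap) (by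
      rintro ⟨a, b, c, d⟩
      have := congrArg (fun X => L a * X * L d) (hL b c)
      simp only [mul_smul_comm, smul_mul_assoc, mul_sub, sub_mul, mul_assoc] at this
      simp [quartOp, cubOp, swap4, merge4, inner4, ← this, mul_assoc]) T
  simpa using this

lemma cubOp_mem (hL : ∀ i j, L i * L j - L j * L i = ((j : ℂ) - i) • L (i + j)) (m : ℕ) (R : Lau3) :
    cubOp L (varDiff (1, 0, 0) (0, 1, 0) ^ (2 * m) * varDiff (0, 1, 0) (0, 0, 1) ^ (2 * m) * R) ∈
      diffOps L m * diffOps L m := by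
  let lift : Lau3 →ₐ[ℂ] Lau4 :=
    monoHom (AddMonoidHom.mk' (fun a => (a.1, a.2.1, 0, a.2.2)) (by simp))
  have hlift : ∀ R, merge4 (lift R) = R := fun R => by
    have := mono_linearMap_congr (f := merge4.toLinearMap ∘ₗ lift.toLinearMap)
      (g := LinearMap.id) (by rintro ⟨a, b, c⟩; simp [lift, merge4]) R
    simpa using this
  set R' : Lau4 := lift (mon (0, -1, 0) * R) with hR'
  set z13 : Lau4 := varDiff (1, 0, 0, 0) (0, 0, 1, 0)
  set z24 : Lau4 := varDiff (0, 1, 0, 0) (0, 0, 0, 1)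
  set z23 : Lau4 := varDiff (0, 1, 0, 0) (0, 0, 1, 0)
  have s12 : swap4 (inl4 zmw) = z13 := by simp [swap4, inl4, zmw, z13, varDiff]
  have s34 : swap4 (inr4 zmw) = z24 := by simp [swap4, inr4, zmw, z24, varDiff]
  have s13 : swap4 z13 = inl4 zmw := by simp [swap4, inl4, zmw, z13, varDiff]
  have s24 : swap4 z24 = inr4 zmw := by simp [swap4, inr4, zmw, z24, varDiff]
  set U : Lau4 := inl4 zmw ^ m * inr4 zmw ^ m * (z13 ^ m * z24 ^ m * R') with hU
  have h1 : quartOp L (z23 * U) ∈ diffOps L m * diffOps L m := by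
    rw [hU, mul_left_comm]; exact quartOp_mem _ _
  have h2 : quartOp L (swap4 (z23 * U)) ∈ diffOps L m * diffOps L m := by
    have : swap4 (z23 * U) = inl4 zmw ^ m * inr4 zmw ^ m *
        (swap4 z23 * (z13 ^ m * z24 ^ m * swap4 R')) := by
      simp only [hU, map_mul, map_pow, s12, s34, s13, s24]; ring
    rw [this]; exact quartOp_mem _ _
  have h3 := Submodule.sub_mem _ h1 h2
  rw [quartOp_sub_swap hL] at h3
  have p23 : merge4 z23 = 0 := by simp [merge4, z23, varDiff]
  have d23 : merge4 (inner4 z23) = (-2 : ℂ) • mon (0, 1, 0) := by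
    simp [merge4, inner4, z23, varDiff]; module
  have e : merge4 (inner4 (z23 * U)) = (-2 : ℂ) •
      (varDiff (1, 0, 0) (0, 1, 0) ^ (2 * m) * varDiff (0, 1, 0) (0, 0, 1) ^ (2 * m) * R) := by
    have e0 : (mon (0, 1, 0) : Lau3) * mon (0, -1, 0) = 1 := by rw [mon_mul_mon]; rfl
    rw [Derivation.leibniz, map_add, smul_eq_mul, smul_eq_mul, map_mul merge4, map_mul merge4, p23, d23, zero_mul,
      zero_add, hU, hR']
    simp only [map_mul, map_pow, hlift, mul_smul_comm]
    have q12 : merge4 (inl4 zmw) = varDiff (1, 0, 0) (0, 1, 0) := by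
      simp [merge4, inl4, zmw, varDiff]
    have q34 : merge4 (inr4 zmw) = varDiff (0, 1, 0) (0, 0, 1) := by
      simp [merge4, inr4, zmw, varDiff]
    have q13 : merge4 z13 = varDiff (1, 0, 0) (0, 1, 0) := by simp [merge4, z13, varDiff]
    have q24 : merge4 z24 = varDiff (0, 1, 0) (0, 0, 1) := by simp [merge4, z24, varDiff]
    rw [q12, q34, q13, q24]
    congr 1
    linear_combination (varDiff (1, 0, 0) (0, 1, 0) ^ (2 * m) *
      varDiff (0, 1, 0) (0, 0, 1) ^ (2 * m) * R) * e0
  rw [e, map_smul] at h3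
  exact (Submodule.smul_mem_iff _ (by norm_num)).1 h3

/-- The homomorphism of exponents given by an additive map on triples. -/
def outer3 : Lau3 →ₐ[ℂ] Lau3 :=
  monoHom (AddMonoidHom.mk' (fun a => (a.2.2, a.2.1, a.1)) (by simp))

/-- Identification of the first two variables. -/
def mergeL : Lau3 →ₐ[ℂ] Lau2 :=
  monoHom (AddMonoidHom.mk' (fun a => (a.1 + a.2.1, a.2.2)) (by
    intro a b; simp only [Prod.fst_add, Prod.snd_add, Prod.mk_add_mk]; congr 1; ring))

/-- Identification of the outer variables, put last. -/
def mergeM : Lau3 →ₐ[ℂ] Lau2 :=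
  monoHom (AddMonoidHom.mk' (fun a => (a.2.1, a.1 + a.2.2)) (by
    intro a b; simp only [Prod.fst_add, Prod.snd_add, Prod.mk_add_mk]; congr 1; ring))

/-- Identification of the last two variables, put first. -/
def mergeR : Lau3 →ₐ[ℂ] Lau2 :=
  monoHom (AddMonoidHom.mk' (fun a => (a.2.1 + a.2.2, a.1)) (by
    intro a b; simp only [Prod.fst_add, Prod.snd_add, Prod.mk_add_mk]; congr 1; ring))

/-- The derivation `θ₂ - θ₁` in three variables. -/
def derL : Derivation ℂ Lau3 Lau3 :=
  eulerD (AddMonoidHom.mk' (fun a => (a.2.1 : ℂ) - a.1) (by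
    intro a b; simp only [Prod.fst_add, Prod.snd_add, Int.cast_add]; ring))

/-- The derivation `θ₃ - θ₁` in three variables. -/
def derM : Derivation ℂ Lau3 Lau3 :=
  eulerD (AddMonoidHom.mk' (fun a => (a.2.2 : ℂ) - a.1) (by
    intro a b; simp only [Prod.fst_add, Prod.snd_add, Int.cast_add]; ring))

/-- The derivation `θ₃ - θ₂` in three variables. -/
def derR : Derivation ℂ Lau3 Lau3 :=
  eulerD (AddMonoidHom.mk' (fun a => (a.2.2 : ℂ) - a.2.1) (by
    intro a b; simp only [Prod.fst_add, Prod.snd_add, Int.cast_add]; ring))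

lemma cubOp_sub_outer (hL : ∀ i j, L i * L j - L j * L i = ((j : ℂ) - i) • L (i + j)) (T : Lau3) :
    cubOp L T - cubOp L (outer3 T) = quadOp L (mergeL (derL T)) + quadOp L (mergeM (derM T)) +
      quadOp L (mergeR (derR T)) := by
  have := mono_linearMap_congr (f := cubOp L - cubOp L ∘ₗ outer3.toLinearMap)
    (g := quadOp L ∘ₗ mergeL.toLinearMap ∘ₗ derL.toLinearMap +
      quadOp L ∘ₗ mergeM.toLinearMap ∘ₗ derM.toLinearMap +
      quadOp L ∘ₗ mergeR.toLinearMap ∘ₗ derR.toLinearMap) (by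
      rintro ⟨a, b, c⟩
      simp only [cubOp, outer3, mergeL, derL, mergeM, derM, mergeR, derR, LinearMap.sub_apply,
        LinearMap.add_apply, LinearMap.comp_apply, AlgHom.toLinearMap_apply, monoLin_mon,
        monoHom_mon, eulerD_mon, map_smul, quadOp_mon, AddMonoidHom.mk'_apply,
        Derivation.coeFn_coe]
      rw [← smul_mul_assoc, ← mul_smul_comm, ← smul_mul_assoc, ← hL, ← hL, ← hL]
      noncomm_ring) T
  simpa using this

lemma AlgHom.map_derivation_sq_mul {R S : Type*} [CommRing R] [CommRing S] [Algebra ℂ R]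
    [Algebra ℂ S] (f : R →ₐ[ℂ] S) (D : Derivation ℂ R R) {v : R} (hv : f v = 0) (s : R) :
    f (D (v ^ 2 * s)) = 0 := by
  simp [Derivation.leibniz, pow_two, hv]

theorem diffOps_le_mul (hL : ∀ i j, L i * L j - L j * L i = ((j : ℂ) - i) • L (i + j)) {m : ℕ}
    (hm : 1 ≤ m) : diffOps L (4 * m) ≤ diffOps L m * diffOps L m := by
  rintro _ ⟨H, rfl⟩
  let lift : Lau2 →ₐ[ℂ] Lau3 := monoHom (AddMonoidHom.mk' (fun a => (0, a.1, a.2)) (by simp))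
  have hlift : ∀ R, mergeM (lift R) = R := fun R => by
    have := mono_linearMap_congr (f := mergeM.toLinearMap ∘ₗ lift.toLinearMap)
      (g := LinearMap.id) (by rintro ⟨a, b⟩; simp [lift, mergeM]) R
    simpa using this
  set R' : Lau3 := lift (mon (0, -1) * H) with hR'
  set xy : Lau3 := varDiff (1, 0, 0) (0, 1, 0) with hxy
  set yz : Lau3 := varDiff (0, 1, 0) (0, 0, 1) with hyz
  set xz : Lau3 := varDiff (1, 0, 0) (0, 0, 1) with hxz
  have sxy : outer3 xy = - yz := by simp [outer3, xy, yz, varDiff]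
  have syz : outer3 yz = - xy := by simp [outer3, xy, yz, varDiff]
  set U : Lau3 := xy ^ (2 * m) * yz ^ (2 * m) * R' with hU
  have h1 : cubOp L (xz * U) ∈ diffOps L m * diffOps L m := by
    rw [hU, mul_left_comm]; exact cubOp_mem hL _ _
  have h2 : cubOp L (outer3 (xz * U)) ∈ diffOps L m * diffOps L m := by
    have : outer3 (xz * U) = xy ^ (2 * m) * yz ^ (2 * m) * (outer3 xz * outer3 R') := by
      simp only [hU, map_mul, map_pow, sxy, syz, (even_two_mul m).neg_pow]; ring
    rw [this]; exact cubOp_mem hL _ _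
  have h3 := Submodule.sub_mem _ h1 h2
  rw [cubOp_sub_outer hL] at h3
  obtain ⟨n, rfl⟩ : ∃ n, m = n + 1 := ⟨m - 1, by omega⟩
  have k1 : mergeL (derL (xz * U)) = 0 := by
    have : xz * U = xy ^ 2 * (xy ^ (2 * n) * yz ^ (2 * (n + 1)) * R' * xz) := by rw [hU]; ring
    rw [this]
    exact AlgHom.map_derivation_sq_mul _ _ (by simp [mergeL, xy, varDiff]) _
  have k2 : mergeR (derR (xz * U)) = 0 := by
    have : xz * U = yz ^ 2 * (xy ^ (2 * (n + 1)) * yz ^ (2 * n) * R' * xz) := by rw [hU]; ring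
    rw [this]
    exact AlgHom.map_derivation_sq_mul _ _ (by simp [mergeR, yz, varDiff]) _
  have k3 : mergeM (derM (xz * U)) = (-2 : ℂ) • (zmw ^ (4 * (n + 1)) * H) := by
    have p : mergeM xz = 0 := by simp [mergeM, xz, varDiff]
    have d : mergeM (derM xz) = (-2 : ℂ) • mon (0, 1) := by
      simp [mergeM, derM, xz, varDiff]; module
    have e0 : (mon (0, 1) : Lau2) * mon (0, -1) = 1 := by rw [mon_mul_mon]; rfl
    have q1 : mergeM xy = - zmw := by simp [mergeM, xy, varDiff, zmw]
    have q2 : mergeM yz = zmw := by simp [mergeM, yz, varDiff, zmw]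
    rw [Derivation.leibniz, map_add, smul_eq_mul, smul_eq_mul, map_mul mergeM, map_mul mergeM, p, d, zero_mul,
      zero_add, hU, hR']
    simp only [map_mul, map_pow, hlift, mul_smul_comm, q1, q2, (even_two_mul _).neg_pow]
    have aux : ∀ z u v : Lau2, v * u = 1 → z ^ (2 * (n + 1)) * z ^ (2 * (n + 1)) * (u * H) * v =
        z ^ (4 * (n + 1)) * H := fun z u v h => by
      linear_combination (z ^ (4 * (n + 1)) * H) * h
    rw [aux _ _ _ e0]
  rw [k1, k2, k3, map_zero, zero_add, add_zero, map_smul] at h3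
  exact (Submodule.smul_mem_iff _ (by norm_num)).1 h3

lemma diffOps_le_pow (hL : ∀ i j, L i * L j - L j * L i = ((j : ℂ) - i) • L (i + j)) {m : ℕ}
    (hm : 1 ≤ m) (k : ℕ) : diffOps L (4 ^ k * m) ≤ diffOps L m ^ (2 ^ k) := by
  induction k with
  | zero => simp
  | succ k ih =>
    have h1 : 1 ≤ 4 ^ k * m := Nat.mul_pos (by positivity) hm
    calc diffOps L (4 ^ (k + 1) * m) = diffOps L (4 * (4 ^ k * m)) := by congr 1; ring
      _ ≤ diffOps L (4 ^ k * m) * diffOps L (4 ^ k * m) := diffOps_le_mul hL h1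
      _ ≤ diffOps L m ^ (2 ^ k) * diffOps L m ^ (2 ^ k) := mul_le_mul' ih ih
      _ = diffOps L m ^ (2 ^ (k + 1)) := by rw [← pow_add]; congr 1; ring

end Comm

section TraceNil

open Polynomial

variable {W : Type*} [AddCommGroup W] [Module ℂ W]

lemma isNilpotent_of_trace_pow [FiniteDimensional ℂ W] {r : End ℂ W}
    (h : ∀ k, 2 ≤ k → LinearMap.trace ℂ W (r ^ k) = 0) : IsNilpotent r := by
  obtain ⟨g, hg, hX⟩ := exists_eq_pow_rootMultiplicity_mul_and_not_dvd (minpoly ℂ r)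
    (minpoly.ne_zero (Algebra.IsIntegral.isIntegral r)) 0
  rw [C_0, sub_zero] at hg hX
  set a := rootMultiplicity 0 (minpoly ℂ r)
  have hm : aeval r (X ^ a * g) = 0 := by rw [← hg, minpoly.aeval]
  obtain ⟨u, v, huv⟩ : IsCoprime (X ^ (a + 2)) g :=
    (((irreducible_X (R := ℂ)).coprime_iff_not_dvd).mpr hX).pow_left
  have huv' : aeval r (u * X ^ (a + 2)) + aeval r (v * g) = 1 := by
    rw [← map_add, huv, map_one]
  have he : aeval r (u * X ^ (a + 2)) * aeval r (v * g) = 0 := by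
    rw [← map_mul, show u * X ^ (a + 2) * (v * g) = u * v * X ^ 2 * (X ^ a * g) by ring, map_mul,
      hm, mul_zero]
  have hidem : IsIdempotentElem (aeval r (u * X ^ (a + 2))) := by
    have e := congrArg (fun y => aeval r (u * X ^ (a + 2)) * y) huv'
    simp only [mul_add, he, add_zero, mul_one] at e
    exact e
  have htr : LinearMap.trace ℂ W (aeval r (u * X ^ (a + 2))) = 0 := by
    rw [map_mul, map_pow, aeval_X, aeval_eq_sum_range, Finset.sum_mul, map_sum]
    refine Finset.sum_eq_zero fun i _ => ?_
    rw [smul_mul_assoc, map_smul, ← pow_add, h _ (by omega), smul_zero]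
  have h0 := LinearMap.IsIdempotentElem.eq_zero_of_trace_eq_zero hidem htr
  rw [h0, zero_add] at huv'
  refine ⟨a, ?_⟩
  calc r ^ a = r ^ a * aeval r (v * g) := by rw [huv', mul_one]
    _ = aeval r (X ^ a * g) * aeval r v := by
      rw [← map_mul, show X ^ a * g * v = X ^ a * (v * g) by ring, map_mul (aeval r) (X ^ a),
        map_pow, aeval_X]
    _ = 0 := by rw [hm, zero_mul]

lemma eq_bot_of_le_span_of_trace [FiniteDimensional ℂ W] (R : Submodule ℂ (End ℂ W))
    (hmul : ∀ r ∈ R, ∀ s ∈ R, r * s ∈ R) (htr : ∀ r ∈ R, ∀ s ∈ R, LinearMap.trace ℂ W (r * s) = 0)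
    (X : Submodule ℂ W) (hX : X ≤ Submodule.span ℂ {y | ∃ r ∈ R, ∃ x ∈ X, y = r x}) : X = ⊥ := by
  let _ : LieRing (End ℂ W) := LieRing.ofAssociativeRing
  have hlie : ∀ {r s : End ℂ W}, r ∈ R → s ∈ R → ⁅r, s⁆ ∈ R := fun {r s} hr hs => by
    rw [Ring.lie_def]
    exact R.sub_mem (hmul r hr s hs) (hmul s hs r hr)
  let R' : LieSubalgebra ℂ (End ℂ W) := { R with lie_mem' := hlie }
  have hnil : LieModule.IsNilpotent R' W := by
    rw [LieModule.isNilpotent_iff_forall (R := ℂ)]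
    rintro ⟨r, hr⟩
    have e : LieModule.toEnd ℂ R' W ⟨r, hr⟩ = r := by ext x; rfl
    rw [e]
    refine isNilpotent_of_trace_pow fun k hk => ?_
    obtain ⟨k, rfl⟩ := Nat.exists_eq_add_of_le hk
    have hp : ∀ k, r ^ (k + 1) ∈ R := fun k => by
      induction k with
      | zero => rw [zero_add, pow_one]; exact hr
      | succ k ih => rw [pow_succ]; exact hmul _ ih _ hr
    rw [show 2 + k = (k + 1) + 1 by omega, pow_succ]
    exact htr _ (hp k) _ hr
  obtain ⟨k, hk⟩ := (LieModule.isNilpotent_iff ℂ R' W).mp hnil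
  have hle : ∀ k, X ≤ (LieModule.lowerCentralSeries ℂ R' W k).toSubmodule := by
    intro k
    induction k with
    | zero => simp
    | succ k ih =>
      refine hX.trans (Submodule.span_le.mpr ?_)
      rintro _ ⟨r, hr, x, hx, rfl⟩
      rw [LieModule.lowerCentralSeries_succ]
      exact LieSubmodule.lie_mem_lie (x := (⟨r, hr⟩ : R')) (LieSubmodule.mem_top _) (ih hx)
  have := hle k
  rw [hk] at this
  simpa using this

end TraceNil

section StableSubmodules

variable {M : Type*} [AddCommGroup M] [Module ℂ M]

lemma mem_of_sum_mem {T : End ℂ M} {X : Submodule ℂ M} (hX : ∀ x ∈ X, T x ∈ X) {lam : ℂ}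
    (s : Finset ℤ) (x : ℤ → M) (hx : ∀ n ∈ s, x n ∈ wt T lam n) (hs : ∑ n ∈ s, x n ∈ X) :
    ∀ n ∈ s, x n ∈ X := by
  classical
  induction s using Finset.induction_on generalizing x with
  | empty => simp
  | insert a s ha ih =>
    have key : ∀ n ∈ s, x n ∈ X := by
      have h1 : ∑ n ∈ s, ((n : ℂ) - a) • x n ∈ X := by
        have e : ∑ n ∈ s, ((n : ℂ) - a) • x n =
            T (∑ n ∈ insert a s, x n) - (lam + a) • ∑ n ∈ insert a s, x n := by
          rw [map_sum, Finset.smul_sum, ← Finset.sum_sub_distrib, Finset.sum_insert ha,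
            mem_wt.mp (hx a (Finset.mem_insert_self a s)), sub_self, zero_add]
          refine Finset.sum_congr rfl fun n hn => ?_
          rw [mem_wt.mp (hx n (Finset.mem_insert_of_mem hn)), ← sub_smul]
          congr 1; ring
        rw [e]
        exact X.sub_mem (hX _ hs) (X.smul_mem _ hs)
      intro n hn
      have h2 := ih (fun n => ((n : ℂ) - a) • x n)
        (fun n hn => Submodule.smul_mem _ _ (hx n (Finset.mem_insert_of_mem hn))) h1 n hn
      have hne : (n : ℂ) - a ≠ 0 := by
        rw [sub_ne_zero]
        exact_mod_cast fun h : n = a => ha (h ▸ hn)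
      exact (X.smul_mem_iff hne).mp h2
    intro n hn
    rcases Finset.mem_insert.mp hn with rfl | hn
    · rw [Finset.sum_insert ha] at hs
      exact (X.add_mem_iff_left (X.sum_mem key)).mp hs
    · exact key n hn

/-- A stable submodule is the sum of its weight spaces. -/
lemma le_iSup_inf_wt {T : End ℂ M} {lam : ℂ} (h : ⨆ n, wt T lam n = ⊤) {X : Submodule ℂ M}
    (hX : ∀ x ∈ X, T x ∈ X) : X ≤ ⨆ n, X ⊓ wt T lam n := by
  classical
  intro x hx
  obtain ⟨f, hf⟩ := (Submodule.mem_iSup_iff_exists_dfinsupp' _ x).mp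
    (h ▸ Submodule.mem_top : x ∈ ⨆ n, wt T lam n)
  have hsum : ∑ n ∈ f.support, (f n : M) = x := hf
  have hm := mem_of_sum_mem hX f.support (fun n => (f n : M)) (fun n _ => (f n).2)
    (by rw [hsum]; exact hx)
  rw [← hsum]
  exact Submodule.sum_mem _ fun n hn =>
    Submodule.mem_iSup_of_mem n ⟨hm n hn, (f n).2⟩

lemma iSup_wt_restrict {T : End ℂ M} {lam : ℂ} (h : ⨆ n, wt T lam n = ⊤) {X : Submodule ℂ M}
    (hX : ∀ x ∈ X, T x ∈ X) : ⨆ n, wt (T.restrict hX) lam n = ⊤ := by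
  have hmap : ∀ n, (wt (T.restrict hX) lam n).map X.subtype = X ⊓ wt T lam n := fun n => by
    have : wt (T.restrict hX) lam n = (wt T lam n).comap X.subtype := by
      ext x
      rw [Submodule.mem_comap, mem_wt, mem_wt, ← Subtype.coe_inj]
      rfl
    rw [this, Submodule.map_comap_subtype]
  refine Submodule.map_injective_of_injective X.injective_subtype ?_
  rw [Submodule.map_iSup, Submodule.map_subtype_top]
  simp_rw [hmap]
  exact le_antisymm (iSup_le fun n => inf_le_left) (le_iSup_inf_wt h hX)

lemma finrank_wt_restrict {T : End ℂ M} {lam : ℂ} {X : Submodule ℂ M}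
    (hX : ∀ x ∈ X, T x ∈ X) (n : ℤ) :
    finrank ℂ (wt (T.restrict hX) lam n) = finrank ℂ ↥(X ⊓ wt T lam n) := by
  have : wt (T.restrict hX) lam n = (wt T lam n).comap X.subtype := by
    ext x
    rw [Submodule.mem_comap, mem_wt, mem_wt, ← Subtype.coe_inj]
    rfl
  rw [← Submodule.map_comap_subtype, ← this]
  exact (Submodule.equivMapOfInjective _ X.injective_subtype _).finrank_eq

variable {L : ℤ → End ℂ M} {lam c : ℂ}

lemma VirMod.restrict (h : VirMod L lam c) {X : Submodule ℂ M} (hX : ∀ i, ∀ x ∈ X, L i x ∈ X) :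
    VirMod (fun i => (L i).restrict (hX i)) lam c where
  comm i j := by
    ext x
    have := LinearMap.congr_fun (h.comm i j) x
    split_ifs at this ⊢ <;> simpa using this
  top := iSup_wt_restrict h.top (hX 0)
  fin n := by
    have := h.fin n
    have : wt ((L 0).restrict (hX 0)) lam n = (wt (L 0) lam n).comap X.subtype := by
      ext x
      rw [Submodule.mem_comap, mem_wt, mem_wt, ← Subtype.coe_inj]
      rfl
    rw [this]
    exact Module.Finite.of_injective (X.subtype.restrict (p := (wt (L 0) lam n).comap X.subtype)
      (q := wt (L 0) lam n) fun x hx => hx) fun x y hxy =>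
        Subtype.ext (Subtype.ext (congrArg (fun z : wt (L 0) lam n => (z : M)) hxy))

lemma VirMod.exists_finrank_inf_eq (h : VirMod L lam 0) {N : ℕ}
    (hN : ∀ n, finrank ℂ (wt (L 0) lam n) ≤ N) {X : Submodule ℂ M}
    (hX : ∀ i, ∀ x ∈ X, L i x ∈ X) :
    ∃ d : ℕ, ∀ n : ℤ, lam + n ≠ 0 → finrank ℂ ↥(X ⊓ wt (L 0) lam n) = d := by
  obtain ⟨d, hd⟩ := (h.restrict hX).exists_finrank_eq (N := N) fun n => by
    have := h.fin n
    rw [finrank_wt_restrict]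
    exact (Submodule.finrank_mono inf_le_right).trans (hN n)
  exact ⟨d, fun n hn => by rw [← finrank_wt_restrict (hX 0), hd n hn]⟩

/-- The elements of weight `k` of the trace radical that come from the augmentation ideal. -/
def radOps (L : ℤ → End ℂ M) (lam : ℂ) (k : ℤ) : Submodule ℂ (End ℂ M) :=
  traceRad L lam ⊓ Submodule.span ℂ {A | ∃ w : List ℤ, w ≠ [] ∧ w.sum = k ∧ A = word L w}

lemma L_mul_mem_radOps {k : ℤ} {A : End ℂ M} (hA : A ∈ radOps L lam k) (p : ℤ) :
    L p * A ∈ radOps L lam (p + k) := by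
  refine ⟨L_mul_mem_traceRad hA.1 p, ?_⟩
  refine Submodule.span_induction (p := fun A _ => L p * A ∈ Submodule.span ℂ
    {A | ∃ w : List ℤ, w ≠ [] ∧ w.sum = p + k ∧ A = word L w}) ?_ (by simp)
    (fun A B _ _ hA hB => by rw [mul_add]; exact add_mem hA hB)
    (fun a A _ hA => by rw [mul_smul_comm]; exact Submodule.smul_mem _ _ hA) hA.2
  rintro _ ⟨w, hw, rfl, rfl⟩
  exact Submodule.subset_span ⟨p :: w, by simp, by simp, by simp⟩

lemma VirMod.mul_word_mem_radOps (h : VirMod L lam c) {k : ℤ} {A : End ℂ M}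
    (hA : A ∈ radOps L lam k) (u : List ℤ) : A * word L u ∈ radOps L lam (k + u.sum) := by
  refine ⟨h.mul_word_mem_traceRad hA.1 u, ?_⟩
  refine Submodule.span_induction (p := fun A _ => A * word L u ∈ Submodule.span ℂ
    {A | ∃ w : List ℤ, w ≠ [] ∧ w.sum = k + u.sum ∧ A = word L w}) ?_ (by simp)
    (fun A B _ _ hA hB => by rw [add_mul]; exact add_mem hA hB)
    (fun a A _ hA => by rw [smul_mul_assoc]; exact Submodule.smul_mem _ _ hA) hA.2
  rintro _ ⟨w, hw, rfl, rfl⟩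
  exact Submodule.subset_span ⟨w ++ u, by simp [hw], by simp, by rw [word_append]⟩

lemma VirMod.mul_mem_radOps (h : VirMod L lam c) {k l : ℤ} {A B : End ℂ M}
    (hA : A ∈ radOps L lam k) (hB : B ∈ radOps L lam l) : A * B ∈ radOps L lam (k + l) := by
  refine Submodule.span_induction (p := fun B _ => A * B ∈ radOps L lam (k + l)) ?_ (by simp)
    (fun A B _ _ hA hB => by rw [mul_add]; exact add_mem hA hB)
    (fun a A _ hA => by rw [mul_smul_comm]; exact Submodule.smul_mem _ _ hA) hB.2
  rintro _ ⟨w, hw, rfl, rfl⟩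
  exact h.mul_word_mem_radOps hA w

lemma VirMod.shifts_radOps (h : VirMod L lam c) {k : ℤ} {A : End ℂ M}
    (hA : A ∈ radOps L lam k) : Shifts (L 0) lam k A := by
  refine Submodule.span_induction (p := fun A _ => Shifts (L 0) lam k A) ?_ ?_ ?_ ?_ hA.2
  · rintro _ ⟨w, hw, rfl, rfl⟩
    exact h.shifts_word w
  · exact fun n x _ => Submodule.zero_mem _
  · exact fun A B _ _ hA hB n x hx => Submodule.add_mem _ (hA n x hx) (hB n x hx)
  · exact fun a A _ hA n x hx => Submodule.smul_mem _ _ (hA n x hx)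

lemma wtTrace_mul_radOps {k l : ℤ} {A B : End ℂ M}
    (hA : A ∈ radOps L lam k) (hB : B ∈ radOps L lam l) (n : ℤ) :
    wtTrace (L 0) lam n (A * B) = 0 := by
  refine Submodule.span_induction (p := fun A _ => wtTrace (L 0) lam n (A * B) = 0) ?_ (by simp)
    (fun A C _ _ hA hC => by rw [add_mul, map_add, hA, hC, add_zero])
    (fun a A _ hA => by rw [smul_mul_assoc, map_smul, hA, smul_zero]) hA.2
  rintro _ ⟨w, hw, rfl, rfl⟩
  exact hB.1 w hw n

lemma VirMod.eq_bot_of_le_span_radOps (h : VirMod L lam c) (n : ℤ) {X : Submodule ℂ M}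
    (hXn : X ≤ wt (L 0) lam n)
    (hX : X ≤ Submodule.span ℂ {y | ∃ k, ∃ A ∈ radOps L lam k, ∃ x ∈ X, y = A x}) : X = ⊥ := by
  have := h.fin n
  let f : End ℂ M →ₗ[ℂ] End ℂ (wt (L 0) lam n) :=
    { toFun := fun A => wtProj (L 0) lam n ∘ₗ A ∘ₗ (wt (L 0) lam n).subtype
      map_add' := fun A B => by rw [LinearMap.add_comp, LinearMap.comp_add]
      map_smul' := fun a A => by rw [LinearMap.smul_comp, LinearMap.comp_smul]; rfl }
  have hf : ∀ A ∈ radOps L lam 0, ∀ x : wt (L 0) lam n, ((f A x : wt (L 0) lam n) : M) = A x := by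
    intro A hA x
    have := h.shifts_radOps hA n x x.2
    rw [add_zero] at this
    exact (wtProj_apply h.top this).trans (if_pos rfl)
  have hmul : ∀ A ∈ radOps L lam 0, ∀ B ∈ radOps L lam 0, f A * f B = f (A * B) := by
    intro A hA B hB
    ext x
    have hAB := h.mul_mem_radOps hA hB
    rw [Module.End.mul_apply, hf A hA, hf B hB, hf _ (by simpa using hAB), Module.End.mul_apply]
  have key := eq_bot_of_le_span_of_trace ((radOps L lam 0).map f) (by
      rintro _ ⟨A, hA, rfl⟩ _ ⟨B, hB, rfl⟩
      rw [hmul A hA B hB]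
      exact ⟨A * B, by simpa using h.mul_mem_radOps hA hB, rfl⟩)
    (by
      rintro _ ⟨A, hA, rfl⟩ _ ⟨B, hB, rfl⟩
      rw [hmul A hA B hB]
      exact wtTrace_mul_radOps hA hB n)
    (X.comap (wt (L 0) lam n).subtype) (by
      intro x hx
      have h1 : wtProj (L 0) lam n (x : M) ∈ Submodule.span ℂ {y | ∃ r ∈ (radOps L lam 0).map f,
          ∃ x ∈ X.comap (wt (L 0) lam n).subtype, y = r x} := by
        refine Submodule.span_induction (p := fun y _ => wtProj (L 0) lam n y ∈ Submodule.span ℂ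
          {y | ∃ r ∈ (radOps L lam 0).map f, ∃ x ∈ X.comap (wt (L 0) lam n).subtype, y = r x})
          ?_ (by simp) (fun a b _ _ ha hb => by rw [map_add]; exact add_mem ha hb)
          (fun a b _ hb => by rw [map_smul]; exact Submodule.smul_mem _ _ hb) (hX hx)
        rintro _ ⟨k, A, hA, y, hy, rfl⟩
        by_cases hk : k = 0
        · subst hk
          exact Submodule.subset_span ⟨f A, ⟨A, hA, rfl⟩, ⟨y, hXn hy⟩, hy, rfl⟩
        · have : wtProj (L 0) lam n (A y) = 0 := by
            ext
            rw [wtProj_apply h.top (h.shifts_radOps hA n y (hXn hy)), if_neg (by omega)]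
            rfl
          rw [this]
          exact Submodule.zero_mem _
      rwa [wtProj_self h.top] at h1)
  rw [eq_bot_iff]
  intro x hx
  have : (⟨x, hXn hx⟩ : wt (L 0) lam n) ∈ X.comap (wt (L 0) lam n).subtype := hx
  rw [key, Submodule.mem_bot] at this
  exact congrArg Subtype.val this

/-- The image of `X` under the homogeneous radical operators. -/
def radAct (L : ℤ → End ℂ M) (lam : ℂ) (X : Submodule ℂ M) : Submodule ℂ M :=
  Submodule.span ℂ {y | ∃ k, ∃ A ∈ radOps L lam k, ∃ x ∈ X, y = A x}

lemma apply_mem_radAct {k : ℤ} {A : End ℂ M} (hA : A ∈ radOps L lam k) {X : Submodule ℂ M} {x : M}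
    (hx : x ∈ X) : A x ∈ radAct L lam X := Submodule.subset_span ⟨k, A, hA, x, hx, rfl⟩

lemma word_apply_mem {X : Submodule ℂ M} (hX : ∀ i, ∀ x ∈ X, L i x ∈ X) (w : List ℤ) {x : M}
    (hx : x ∈ X) : word L w x ∈ X := by
  induction w with
  | nil => simpa using hx
  | cons i w ih => rw [word_cons]; exact hX i _ ih

lemma radOps_apply_mem {X Y : Submodule ℂ M} (hY : ∀ i, ∀ x ∈ Y, L i x ∈ Y)
    (hXY : ∀ i, ∀ x ∈ X, L i x ∈ Y) {k : ℤ} {A : End ℂ M} (hA : A ∈ radOps L lam k) {x : M}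
    (hx : x ∈ X) : A x ∈ Y := by
  have hYX : ∀ w : List ℤ, w ≠ [] → word L w x ∈ Y := by
    intro w hw
    induction w using List.reverseRecOn with
    | nil => exact absurd rfl hw
    | append_singleton w i _ =>
      rw [word_append, word_cons, word_nil, mul_one]
      exact word_apply_mem hY w (hXY i x hx)
  refine Submodule.span_induction (p := fun A _ => A x ∈ Y) ?_ Y.zero_mem
    (fun A B _ _ hA hB => Y.add_mem hA hB) (fun a A _ hA => Y.smul_mem a hA) hA.2
  rintro _ ⟨w, hw, -, rfl⟩
  exact hYX w hw

lemma radAct_le {X : Submodule ℂ M} (hX : ∀ i, ∀ x ∈ X, L i x ∈ X) : radAct L lam X ≤ X := by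
  refine Submodule.span_le.mpr ?_
  rintro _ ⟨k, A, hA, x, hx, rfl⟩
  exact radOps_apply_mem hX hX hA hx

lemma L_mem_radAct (X : Submodule ℂ M) (i : ℤ) : ∀ x ∈ radAct L lam X, L i x ∈ radAct L lam X := by
  intro x hx
  refine Submodule.span_induction (p := fun x _ => L i x ∈ radAct L lam X) ?_
    (by simp) (fun a b _ _ ha hb => by rw [map_add]; exact add_mem ha hb)
    (fun a b _ hb => by rw [map_smul]; exact Submodule.smul_mem _ _ hb) hx
  rintro _ ⟨k, A, hA, x, hx, rfl⟩
  exact apply_mem_radAct (L_mul_mem_radOps hA i) hx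

lemma VirMod.inf_wt_le (h : VirMod L lam 0) {N : ℕ} (hN : ∀ n, finrank ℂ (wt (L 0) lam n) ≤ N)
    {X Y : Submodule ℂ M} (hX : ∀ i, ∀ x ∈ X, L i x ∈ X) (hY : ∀ i, ∀ x ∈ Y, L i x ∈ Y)
    (hYX : Y ≤ X) {m : ℤ} (hm : lam + m ≠ 0) (hle : X ⊓ wt (L 0) lam m ≤ Y) {n : ℤ}
    (hn : lam + n ≠ 0) : X ⊓ wt (L 0) lam n ≤ Y := by
  obtain ⟨d, hd⟩ := h.exists_finrank_inf_eq hN hX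
  obtain ⟨d', hd'⟩ := h.exists_finrank_inf_eq hN hY
  have hdd : d = d' := by
    have e : X ⊓ wt (L 0) lam m = Y ⊓ wt (L 0) lam m :=
      le_antisymm (le_inf hle inf_le_right) (inf_le_inf_right _ hYX)
    rw [← hd m hm, ← hd' m hm, e]
  have := h.fin n
  have : FiniteDimensional ℂ ↥(X ⊓ wt (L 0) lam n) := Submodule.finiteDimensional_inf_right _ _
  have e := Submodule.eq_of_le_of_finrank_eq (inf_le_inf_right (wt (L 0) lam n) hYX)
    (by rw [hd n hn, hd' n hn, hdd])
  rw [← e]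
  exact inf_le_left

lemma VirMod.eq_bot_of_radAct (h : VirMod L lam 0) {N : ℕ}
    (hN : ∀ n, finrank ℂ (wt (L 0) lam n) ≤ N) {X : Submodule ℂ M}
    (hX : ∀ i, ∀ x ∈ X, L i x ∈ X) {m m' : ℤ} (hm : lam + m ≠ 0)
    (hm' : ∀ n : ℤ, lam + n = 0 → n = m') (h1 : X ⊓ wt (L 0) lam m ≤ radAct L lam X)
    (h2 : X ⊓ wt (L 0) lam m' ≤ radAct L lam X) : X = ⊥ := by
  have hXR : X ≤ radAct L lam X := by
    refine (le_iSup_inf_wt h.top (hX 0)).trans (iSup_le fun n => ?_)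
    by_cases hn : lam + n = 0
    · rw [hm' n hn]; exact h2
    · exact h.inf_wt_le hN hX (L_mem_radAct X) (radAct_le hX) hm h1 hn
  set Z := X ⊓ wt (L 0) lam m
  set Y : Submodule ℂ M := Submodule.span ℂ {y | ∃ u : List ℤ, ∃ z ∈ Z, y = word L u z} with hYdef
  have hY : ∀ i, ∀ x ∈ Y, L i x ∈ Y := by
    intro i x hx
    refine Submodule.span_induction (p := fun x _ => L i x ∈ Y) ?_
      (by simp) (fun a b _ _ ha hb => by rw [map_add]; exact add_mem ha hb)
      (fun a b _ hb => by rw [map_smul]; exact Submodule.smul_mem _ _ hb) hx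
    rintro _ ⟨u, z, hz, rfl⟩
    exact Submodule.subset_span ⟨i :: u, z, hz, by simp⟩
  have hYX : Y ≤ X := by
    refine Submodule.span_le.mpr ?_
    rintro _ ⟨u, z, hz, rfl⟩
    exact word_apply_mem hX u hz.1
  have hZY : Z ≤ Y := fun z hz => Submodule.subset_span ⟨[], z, hz, by simp⟩
  have hLX : ∀ i, ∀ x ∈ X, L i x ∈ Y := by
    intro i
    suffices X ≤ Y.comap (L i) from this
    refine (le_iSup_inf_wt h.top (hX 0)).trans (iSup_le fun n x hx => ?_)
    rw [Submodule.mem_comap]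
    by_cases hn : lam + n = 0
    · by_cases hi : i = 0
      · rw [hi, mem_wt.mp hx.2, hn, zero_smul]
        exact Y.zero_mem
      · refine h.inf_wt_le hN hX hY hYX hm hZY (n := n + i) ?_ ⟨hX i x hx.1, h.shifts i n x hx.2⟩
        push_cast
        rw [← add_assoc, hn, zero_add]
        exact_mod_cast hi
    · exact hY i x (h.inf_wt_le hN hX hY hYX hm hZY hn hx)
  have hXY : X ≤ Y := hXR.trans (Submodule.span_le.mpr (by
    rintro _ ⟨k, A, hA, x, hx, rfl⟩
    exact radOps_apply_mem hY hLX hA hx))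
  have hZ : Z = ⊥ := by
    refine h.eq_bot_of_le_span_radOps m inf_le_right ((inf_le_left.trans hXR).trans
      (Submodule.span_le.mpr ?_))
    rintro _ ⟨k, A, hA, x, hx, rfl⟩
    refine Submodule.span_induction (p := fun x _ => A x ∈ Submodule.span ℂ
      {y | ∃ k, ∃ A ∈ radOps L lam k, ∃ x ∈ Z, y = A x}) ?_
      (by simp) (fun a b _ _ ha hb => by rw [map_add]; exact add_mem ha hb)
      (fun a b _ hb => by rw [map_smul]; exact Submodule.smul_mem _ _ hb) (hXY hx)
    rintro _ ⟨u, z, hz, rfl⟩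
    exact Submodule.subset_span ⟨_, _, h.mul_word_mem_radOps hA u, z, hz, rfl⟩
  rw [eq_bot_iff]
  refine hXY.trans (Submodule.span_le.mpr ?_)
  rintro _ ⟨u, z, hz, rfl⟩
  rw [hZ, Submodule.mem_bot] at hz
  simp [hz]

lemma VirMod.exists_iterate_radAct_eq_bot (h : VirMod L lam 0) {N : ℕ}
    (hN : ∀ n, finrank ℂ (wt (L 0) lam n) ≤ N) : ∃ q, (radAct L lam)^[q] ⊤ = ⊥ := by
  obtain ⟨m, hm⟩ : ∃ m : ℤ, lam + m ≠ 0 := by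
    by_contra! hcon
    have h0 := hcon 0
    have h1 := hcon 1
    rw [Int.cast_zero, add_zero] at h0
    simp [h0] at h1
  obtain ⟨m', hm'⟩ : ∃ m' : ℤ, ∀ n : ℤ, lam + n = 0 → n = m' := by
    by_cases hex : ∃ m' : ℤ, lam + m' = 0
    · obtain ⟨m', hm'⟩ := hex
      refine ⟨m', fun n hn => ?_⟩
      have : (n : ℂ) = m' := by linear_combination hn - hm'
      exact_mod_cast this
    · exact ⟨0, fun n hn => absurd ⟨n, hn⟩ hex⟩
  set X : ℕ → Submodule ℂ M := fun q => (radAct L lam)^[q] ⊤ with hXdef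
  have hsucc : ∀ q, X (q + 1) = radAct L lam (X q) := fun q => Function.iterate_succ_apply' _ _ _
  have hst : ∀ q, ∀ i, ∀ x ∈ X q, L i x ∈ X q := by
    intro q
    cases q with
    | zero => exact fun i x _ => Submodule.mem_top
    | succ q => rw [hsucc]; exact L_mem_radAct _
  have := h.fin m
  have := h.fin m'
  set f : ℕ → ℕ := fun q => finrank ℂ ↥(X q ⊓ wt (L 0) lam m) +
    finrank ℂ ↥(X q ⊓ wt (L 0) lam m') with hf
  have hmono : ∀ q n, X (q + 1) ⊓ wt (L 0) lam n ≤ X q ⊓ wt (L 0) lam n := fun q n => by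
    rw [hsucc]
    exact inf_le_inf_right _ (radAct_le (hst q))
  by_contra! hne
  have hlt : ∀ q, f (q + 1) < f q := by
    intro q
    have : FiniteDimensional ℂ ↥(X q ⊓ wt (L 0) lam m) := Submodule.finiteDimensional_inf_right _ _
    have : FiniteDimensional ℂ ↥(X q ⊓ wt (L 0) lam m') := Submodule.finiteDimensional_inf_right _ _
    have i1 := Submodule.finrank_mono (hmono q m)
    have i2 := Submodule.finrank_mono (hmono q m')
    by_contra hge
    have hge' : f q ≤ f (q + 1) := not_lt.mp hge
    simp only [hf] at hge'
    have e1 := Submodule.eq_of_le_of_finrank_eq (hmono q m) (by omega)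
    have e2 := Submodule.eq_of_le_of_finrank_eq (hmono q m') (by omega)
    refine hne q (h.eq_bot_of_radAct hN (hst q) hm hm' ?_ ?_)
    · rw [← hsucc]; exact e1 ▸ inf_le_left
    · rw [← hsucc]; exact e2 ▸ inf_le_left
  have hbound : ∀ q, f q + q ≤ f 0 := by
    intro q
    induction q with
    | zero => simp
    | succ q ih => have := hlt q; omega
  have := hbound (f 0 + 1)
  omega

lemma quadOp_zmw_pow_mem_span (m : ℕ) (a b : ℤ) : quadOp L (zmw ^ m * mon (a, b)) ∈
    Submodule.span ℂ {A | ∃ w : List ℤ, w ≠ [] ∧ w.sum = m + a + b ∧ A = word L w} := by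
  induction m generalizing a b with
  | zero =>
    rw [pow_zero, one_mul, quadOp_mon]
    exact Submodule.subset_span ⟨[a, b], by simp, by simp, by simp⟩
  | succ m ih =>
    have e : (zmw ^ (m + 1) * mon (a, b) : Lau2) =
        zmw ^ m * mon (a + 1, b) - zmw ^ m * mon (a, b + 1) := by
      rw [pow_succ, mul_assoc, ← mul_sub]
      congr 1
      rw [zmw, sub_mul, mon2_mul, mon2_mul]
      simp only [zero_add, add_comm (1 : ℤ)]
    rw [e, map_sub]
    have h1 := ih (a + 1) b
    have h2 := ih a (b + 1)
    rw [show (m : ℤ) + (a + 1) + b = (m + 1 : ℕ) + a + b by push_cast; ring] at h1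
    rw [show (m : ℤ) + a + (b + 1) = (m + 1 : ℕ) + a + b by push_cast; ring] at h2
    exact sub_mem h1 h2

theorem VirMod.exists_quadOp_eq_zero (h : VirMod L lam 0) {N : ℕ}
    (hN : ∀ n, finrank ℂ (wt (L 0) lam n) ≤ N) : ∃ m : ℕ, ∀ H, quadOp L (zmw ^ m * H) = 0 := by
  obtain ⟨m, hm⟩ := h.exists_quadOp_mem_traceRad hN
  obtain ⟨q, hq⟩ := h.exists_iterate_radAct_eq_bot hN
  have hdiff : ∀ A ∈ diffOps L (m + 1), ∀ X : Submodule ℂ M, ∀ x ∈ X, A x ∈ radAct L lam X := by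
    rintro _ ⟨H, rfl⟩ X x hx
    have hmem : ∀ a b, quadOp L (zmw ^ (m + 1) * mon (a, b)) ∈
        radOps L lam ((m + 1 : ℕ) + a + b) := fun a b =>
      ⟨by rw [pow_succ, mul_assoc]; exact hm _, quadOp_zmw_pow_mem_span _ _ _⟩
    change quadOp L (zmw ^ (m + 1) * H) x ∈ _
    induction H using AddMonoidAlgebra.induction_linear with
    | zero => simp
    | add f g hf hg => rw [mul_add, map_add]; exact add_mem hf hg
    | single a r =>
      have : (AddMonoidAlgebra.single a r : Lau2) = r • mon a := by simp [mon]
      rw [this, mul_smul_comm, map_smul]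
      exact Submodule.smul_mem _ _ (apply_mem_radAct (hmem a.1 a.2) hx)
  have hpow : ∀ k : ℕ, ∀ A ∈ diffOps L (m + 1) ^ k, ∀ x, A x ∈ (radAct L lam)^[k] ⊤ := by
    intro k
    induction k with
    | zero => exact fun A _ x => Submodule.mem_top
    | succ k ih =>
      intro A hA x
      have hA' : A ∈ diffOps L (m + 1) * diffOps L (m + 1) ^ k :=
        (pow_succ' (diffOps L (m + 1)) k).le hA
      rw [Function.iterate_succ_apply']
      refine Submodule.mul_induction_on hA' (fun B hB C hC => ?_) fun B C hB hC => ?_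
      · exact hdiff B hB _ _ (ih C hC x)
      · exact add_mem hB hC
  refine ⟨4 ^ q * (m + 1), fun H => ?_⟩
  have h1 := diffOps_le_pow h.comm_zero (Nat.le_add_left 1 m) q (quadOp_mem_diffOps L _ H)
  have hle : q ≤ 2 ^ q := Nat.lt_two_pow_self.le
  obtain ⟨r, hr⟩ := Nat.exists_eq_add_of_le hle
  ext x
  have h2 := hpow _ _ h1 x
  have hbot : (radAct L lam)^[2 ^ q] ⊤ = ⊥ := by
    rw [hr, add_comm, Function.iterate_add_apply, hq]
    clear hr
    induction r with
    | zero => rfl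
    | succ r ih =>
      rw [Function.iterate_succ_apply', ih]
      exact le_bot_iff.mp (radAct_le fun i x hx => by simp_all)
  rw [hbot, Submodule.mem_bot] at h2
  simpa using h2

end StableSubmodules

section Mix

variable {M : Type*} [AddCommGroup M] [Module ℂ M]

/-- The operator `∑ F_{ab} x_a y_b`. -/
def mixOp (x y : ℤ → End ℂ M) : Lau2 →ₗ[ℂ] End ℂ M := monoLin fun a => x a.1 * y a.2

@[simp] lemma mixOp_mon (x y : ℤ → End ℂ M) (a b : ℤ) : mixOp x y (mon (a, b)) = x a * y b := by
  simp [mixOp]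

variable {L x : ℤ → End ℂ M} {α : ℂ}

lemma mixOp_commutator (hx : ∀ i j : ℤ, L i * x j - x j * L i = ((j : ℂ) - α * i) • x (i + j))
    (p : ℤ) (H : Lau2) :
    mixOp x L (mon (p, -p) * ((p : ℂ) • H - α • eulZ H)) + ((1 + α) * p) • mixOp L x H
      - α • mixOp L x (eulW H) =
    quadOp L (mon (0, -p) * H) * x p - x p * quadOp L (mon (0, -p) * H) := by
  have := mono_linearMap_congr
    (f := mixOp x L ∘ₗ LinearMap.mulLeft ℂ (mon (p, -p)) ∘ₗ
      ((p : ℂ) • LinearMap.id - α • eulZ.toLinearMap) + ((1 + α) * p) • mixOp L x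
      - α • (mixOp L x ∘ₗ eulW.toLinearMap))
    (g := (LinearMap.mulRight ℂ (x p) - LinearMap.mulLeft ℂ (x p)) ∘ₗ quadOp L ∘ₗ
      LinearMap.mulLeft ℂ (mon (0, -p))) (by
      rintro ⟨a, b⟩
      have e1 : L a * L (b - p) * x p - x p * (L a * L (b - p)) =
          L a * (L (b - p) * x p - x p * L (b - p)) + (L a * x p - x p * L a) * L (b - p) := by
        noncomm_ring
      simp only [LinearMap.add_apply, LinearMap.sub_apply, LinearMap.smul_apply,
        LinearMap.comp_apply, LinearMap.mulLeft_apply, LinearMap.mulRight_apply,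
        LinearMap.id_apply, Derivation.coeFn_coe, eulZ_mon, eulW_mon, mixOp_mon, quadOp_mon,
        mon2_mul, map_sub, map_smul, zero_add, add_comm p a,
        neg_add_eq_sub]
      rw [e1, hx, hx, sub_add_cancel, mul_smul_comm, smul_mul_assoc]
      push_cast
      module) H
  simpa only [LinearMap.add_apply, LinearMap.sub_apply, LinearMap.smul_apply,
        LinearMap.comp_apply, LinearMap.mulLeft_apply, LinearMap.mulRight_apply,
        LinearMap.id_apply, Derivation.coeFn_coe] using this

/-- The relations among quadratic expressions in `L` propagate to any intertwining family. -/
theorem mixOp_eq_zero (hx : ∀ i j : ℤ, L i * x j - x j * L i = ((j : ℂ) - α * i) • x (i + j))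
    (hα : 1 + α ≠ 0) {m : ℕ} (hm : ∀ H, quadOp L (zmw ^ m * H) = 0) (H : Lau2) :
    mixOp x L (zmw ^ (m + 2) * H) = 0 := by
  have h1 : ∀ (p : ℤ) (F : Lau2), mixOp x L (mon (p, -p) *
      ((p : ℂ) • (zmw ^ m * F) - α • eulZ (zmw ^ m * F))) +
      ((1 + α) * p) • mixOp L x (zmw ^ m * F) - α • mixOp L x (eulW (zmw ^ m * F)) = 0 := by
    intro p F
    rw [mixOp_commutator hx, mul_left_comm, hm, zero_mul, mul_zero, sub_zero]
  have h2 : ∀ (p : ℤ) (F : Lau2), mixOp x L (mon (p, -p) *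
      ((p : ℂ) • (zmw ^ m * F) - α • eulZ (zmw ^ m * F))) -
      (2 : ℂ) • mixOp x L (mon (p - 1, -(p - 1)) *
      (((p : ℂ) - 1) • (zmw ^ m * F) - α • eulZ (zmw ^ m * F))) +
      mixOp x L (mon (p - 2, -(p - 2)) *
      (((p : ℂ) - 2) • (zmw ^ m * F) - α • eulZ (zmw ^ m * F))) = 0 := by
    intro p F
    have a := h1 p F
    have b := h1 (p - 1) F
    have c := h1 (p - 2) F
    push_cast at a b c
    linear_combination (norm := module) a - (2 : ℂ) • b + c
  have h4 := h2 0 (mon (2, 0) * H)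
  have h5 := h2 1 (mon (-1, 1) * (mon (2, 0) * H))
  have e1 : eulZ (zmw ^ m * (mon (-1, 1) * (mon (2, 0) * H))) =
      mon (-1, 1) * (eulZ (zmw ^ m * (mon (2, 0) * H)) - zmw ^ m * (mon (2, 0) * H)) := by
    rw [mul_left_comm, Derivation.leibniz, eulZ_mon]
    simp only [smul_eq_mul, Int.cast_neg, Int.cast_one, neg_smul, one_smul]
    ring
  have e2 : zmw ^ (m + 2) * H = zmw ^ m * (mon (2, 0) * H) -
      (2 : ℂ) • (mon (-1, 1) * (zmw ^ m * (mon (2, 0) * H))) +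
      mon (-2, 2) * (zmw ^ m * (mon (2, 0) * H)) := by
    have e3 : zmw ^ 2 = mon (2, 0) - (2 : ℂ) • (mon (-1, 1) * mon (2, 0)) +
        mon (-2, 2) * mon (2, 0) := by
      simp only [zmw, sq, mul_sub, sub_mul, mon2_mul]
      norm_num
      module
    rw [pow_add, e3, Algebra.smul_def, Algebra.smul_def]
    ring
  have e4 : ∀ p q : ℤ, ∀ F : Lau2, mon (p, -p) * (mon (-q, q) * F) = mon (p - q, -(p - q)) * F := by
    intro p q F
    rw [← mul_assoc, mon2_mul]
    ring_nf
  have e5 : mon (0, -0) * (zmw ^ m * (mon (2, 0) * H)) = zmw ^ m * (mon (2, 0) * H) := by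
    rw [neg_zero, show ((0 : ℤ), (0 : ℤ)) = 0 from rfl, mon_zero, one_mul]
  rw [e1] at h5
  generalize hA : zmw ^ m * (mon (2, 0) * H) = A at *
  have e6 : zmw ^ m * (mon (-1, 1) * (mon (2, 0) * H)) = mon (-1, 1) * A := by
    rw [← hA]; ring
  rw [e6] at h5
  have hN : mixOp x L (zmw ^ (m + 2) * H) = mixOp x L (mon (0, -0) * A) -
      (2 : ℂ) • mixOp x L (mon (-1, - -1) * A) + mixOp x L (mon (-2, - -2) * A) := by
    rw [e2, e5, map_add, map_sub, map_smul, neg_neg, neg_neg]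
  have e7 : ∀ p : ℤ, ∀ F : Lau2, mon (p, -p) * (mon (-1, 1) * F) = mon (p - 1, -(p - 1)) * F :=
    fun p F => e4 p 1 F
  simp only [mul_sub, mul_smul_comm, map_sub, map_smul, e7] at h4 h5
  norm_num at h4 h5
  norm_num at hN
  refine (smul_eq_zero.mp (?_ : (1 + α) • mixOp x L (zmw ^ (m + 2) * H) = 0)).resolve_left hα
  rw [hN]
  linear_combination (norm := module) h5 - h4

lemma mixOp_zmw_pow (x y : ℤ → End ℂ M) (m : ℕ) (k s : ℤ) :
    mixOp x y (zmw ^ m * mon (k - m, s)) =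
      ∑ j ∈ Finset.range (m + 1), ((-1 : ℂ) ^ j * (m.choose j : ℂ)) • (x (k - j) * y (s + j)) := by
  have hpow : ∀ (a b : ℤ) (n : ℕ), (mon (a, b) : Lau2) ^ n = mon (n * a, n * b) := by
    intro a b n
    induction n with
    | zero => simp only [pow_zero, Nat.cast_zero, zero_mul]; rfl
    | succ n ih => rw [pow_succ, ih, mon2_mul]; congr 2 <;> push_cast <;> ring
  have hz : zmw = (-1 : ℂ) • mon (0, 1) + mon (1, 0) := by rw [zmw]; module
  rw [hz, add_pow, Finset.sum_mul, map_sum]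
  refine Finset.sum_congr rfl fun j hj => ?_
  have hj' : j ≤ m := Nat.lt_succ_iff.mp (Finset.mem_range.mp hj)
  have e : (((-1 : ℂ) • mon (0, 1)) ^ j * mon (1, 0) ^ (m - j) * (m.choose j : Lau2) *
      mon (k - m, s) : Lau2) = ((-1 : ℂ) ^ j * (m.choose j : ℂ)) • mon (k - j, s + j) := by
    have e1 : (mon (k - j, s + j) : Lau2) =
        mon (0, (j : ℤ)) * (mon (((m - j : ℕ) : ℤ), 0) * mon (k - m, s)) := by
      rw [mon2_mul, mon2_mul]
      push_cast [hj']
      congr 2 <;> ring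
    rw [smul_pow, hpow, hpow, e1, mul_smul, mul_zero, mul_one, mul_one, mul_zero,
      show ((m.choose j : ℂ)) • (mon (0, (j : ℤ)) * (mon (((m - j : ℕ) : ℤ), 0) *
        mon (k - m, s)) : Lau2) = (m.choose j : Lau2) * (mon (0, (j : ℤ)) *
        (mon (((m - j : ℕ) : ℤ), 0) * mon (k - m, s))) by
        rw [Algebra.smul_def, map_natCast]]
    simp only [smul_mul_assoc]
    congr 1
    ring
  rw [e, map_smul, mixOp_mon]

end Mix

section Parity

variable {M : Type} [AddCommGroup M] [Module ℂ M]

/-- The parity involution of a super vector space. -/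
def parityOp (gr : Fin 2 → Submodule ℂ M) (h : IsCompl (gr 0) (gr 1)) : End ℂ M :=
  (2 : ℂ) • (gr 0).projection (gr 1) h - 1

variable {gr : Fin 2 → Submodule ℂ M}

lemma mem_gr_zero (h : IsCompl (gr 0) (gr 1)) {x : M} : x ∈ gr 0 ↔ parityOp gr h x = x := by
  rw [← Submodule.projection_eq_self_iff h, parityOp, LinearMap.sub_apply,
    LinearMap.smul_apply, End.one_apply, sub_eq_iff_eq_add, ← two_smul ℂ x]
  exact (smul_right_injective M (two_ne_zero (α := ℂ))).eq_iff.symm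

lemma mem_gr_one (h : IsCompl (gr 0) (gr 1)) {x : M} : x ∈ gr 1 ↔ parityOp gr h x = -x := by
  rw [← Submodule.projection_apply_eq_zero_iff h, parityOp, LinearMap.sub_apply,
    LinearMap.smul_apply, End.one_apply, sub_eq_iff_eq_add, neg_add_cancel, smul_eq_zero]
  simp

lemma exists_add_of_isCompl (h : IsCompl (gr 0) (gr 1)) (x : M) :
    ∃ a ∈ gr 0, ∃ b ∈ gr 1, x = a + b := by
  obtain ⟨a, ha, b, hb, hab⟩ := Submodule.mem_sup.mp
    (h.sup_eq_top ▸ Submodule.mem_top : x ∈ gr 0 ⊔ gr 1)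
  exact ⟨a, ha, b, hb, hab.symm⟩

lemma parityOp_sq (h : IsCompl (gr 0) (gr 1)) : parityOp gr h * parityOp gr h = 1 := by
  ext x
  obtain ⟨a, ha, b, hb, rfl⟩ := exists_add_of_isCompl h x
  rw [mem_gr_zero h] at ha
  rw [mem_gr_one h] at hb
  simp [ha, hb]

lemma MapsGr.commute_parityOp (h : IsCompl (gr 0) (gr 1)) {A : End ℂ M} (hA : MapsGr gr 0 A) :
    A * parityOp gr h = parityOp gr h * A := by
  ext x
  obtain ⟨a, ha, b, hb, rfl⟩ := exists_add_of_isCompl h x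
  have h0 := (mem_gr_zero h).mp (hA 0 (Submodule.mem_map_of_mem ha))
  have h1 := (mem_gr_one h).mp (hA 1 (Submodule.mem_map_of_mem hb))
  rw [mem_gr_zero h] at ha
  rw [mem_gr_one h] at hb
  simp [ha, hb, h0, h1]

lemma MapsGr.anticommute_parityOp (h : IsCompl (gr 0) (gr 1)) {A : End ℂ M} (hA : MapsGr gr 1 A) :
    A * parityOp gr h = -(parityOp gr h * A) := by
  ext x
  obtain ⟨a, ha, b, hb, rfl⟩ := exists_add_of_isCompl h x
  have h0 := (mem_gr_one h).mp (hA 0 (Submodule.mem_map_of_mem ha))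
  have h1 := (mem_gr_zero h).mp (hA 1 (Submodule.mem_map_of_mem hb))
  rw [mem_gr_zero h] at ha
  rw [mem_gr_one h] at hb
  simp [ha, hb, h0, h1, add_comm]

lemma gradedSub_of_parityOp (h : IsCompl (gr 0) (gr 1)) {N : Submodule ℂ M}
    (hN : ∀ v ∈ N, parityOp gr h v ∈ N) : GradedSub gr N := by
  intro x hx
  obtain ⟨a, ha, b, hb, rfl⟩ := exists_add_of_isCompl h x
  have h1 := hN _ hx
  rw [map_add, (mem_gr_zero h).mp ha, (mem_gr_one h).mp hb] at h1
  refine Submodule.add_mem_sup ⟨?_, ha⟩ ⟨?_, hb⟩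
  · have := N.smul_mem (2⁻¹ : ℂ) (N.add_mem hx h1)
    rwa [show (2⁻¹ : ℂ) • (a + b + (a + -b)) = a by module] at this
  · have := N.smul_mem (2⁻¹ : ℂ) (N.sub_mem hx h1)
    rwa [show (2⁻¹ : ℂ) • (a + b - (a + -b)) = b by module] at this

end Parity

section SccMod

variable {𝕘 : Type} [LieRing 𝕘] [LieAlgebra ℂ 𝕘] {M : Type} [AddCommGroup M] [Module ℂ M]

/-- A subspace stable under the operators `L, G, E, F` and the parity involution. -/
structure SccStable (L G : ℤ → End ℂ M) (E F : ℤ → 𝕘 →ₗ[ℂ] End ℂ M) (σ : End ℂ M)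
    (N : Submodule ℂ M) : Prop where
  hL : ∀ i, ∀ v ∈ N, L i v ∈ N
  hG : ∀ i, ∀ v ∈ N, G i v ∈ N
  hE : ∀ i x, ∀ v ∈ N, E i x v ∈ N
  hF : ∀ i x, ∀ v ∈ N, F i x v ∈ N
  hσ : ∀ v ∈ N, σ v ∈ N

/-- A simple Harish-Chandra module, with grading encoded by the parity involution `σ`, weights in
`lam + ℤ` and central charges `c, c1`. -/
structure SccMod (Φ : 𝕘 →ₗ[ℂ] 𝕘 →ₗ[ℂ] ℂ) (L G : ℤ → End ℂ M) (E F : ℤ → 𝕘 →ₗ[ℂ] End ℂ M)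
    (σ : End ℂ M) (lam c c1 : ℂ) : Prop where
  rep : IsSCCRep 𝕘 Φ L G (c • 1) (c1 • 1) E F
  sq : σ * σ = 1
  hL : ∀ i, L i * σ = σ * L i
  hG : ∀ i, G i * σ = -(σ * G i)
  hE : ∀ i x, E i x * σ = σ * E i x
  hF : ∀ i x, F i x * σ = -(σ * F i x)
  nontriv : ∃ v : M, v ≠ 0
  top : ⨆ n, wt (L 0) lam n = ⊤
  fin : ∀ n, FiniteDimensional ℂ (wt (L 0) lam n)
  simple : ∀ N, SccStable L G E F σ N → N = ⊥ ∨ N = ⊤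

variable {Φ : 𝕘 →ₗ[ℂ] 𝕘 →ₗ[ℂ] ℂ} {L G : ℤ → End ℂ M} {C C1 : End ℂ M}
  {E F : ℤ → 𝕘 →ₗ[ℂ] End ℂ M}

namespace IsSCCRep

lemma shifts_L (h : IsSCCRep 𝕘 Φ L G C C1 E F) (lam : ℂ) (i : ℤ) : Shifts (L 0) lam i (L i) :=
  Shifts.of_comm (by
    have := h.comm_LL 0 i
    simpa using this)

lemma shifts_G (h : IsSCCRep 𝕘 Φ L G C C1 E F) (lam : ℂ) (i : ℤ) : Shifts (L 0) lam i (G i) :=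
  Shifts.of_comm (by
    have := h.comm_LG 0 i
    simpa using this)

lemma shifts_E (h : IsSCCRep 𝕘 Φ L G C C1 E F) (lam : ℂ) (i : ℤ) (x : 𝕘) :
    Shifts (L 0) lam i (E i x) :=
  Shifts.of_comm (by
    have := h.comm_LE 0 i x
    simpa using this)

lemma shifts_F (h : IsSCCRep 𝕘 Φ L G C C1 E F) (lam : ℂ) (i : ℤ) (x : 𝕘) :
    Shifts (L 0) lam i (F i x) :=
  Shifts.of_comm (by
    have := h.comm_LF 0 i x
    simpa using this)

end IsSCCRep

lemma Shifts.of_commute {L0 σ : End ℂ M} {lam : ℂ} (h : L0 * σ = σ * L0) : Shifts L0 lam 0 σ :=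
  Shifts.of_comm (by simp [h])

lemma Shifts.iSup_stable {L0 A : End ℂ M} {lam : ℂ} {k : ℤ} (h : Shifts L0 lam k A) :
    ∀ v ∈ ⨆ n, wt L0 lam n, A v ∈ ⨆ n, wt L0 lam n := by
  intro v hv
  refine Submodule.iSup_induction (wt L0 lam) (motive := fun v => A v ∈ ⨆ n, wt L0 lam n) hv
    (fun n x hx => Submodule.mem_iSup_of_mem (n + k) (h n x hx)) (by simp) fun x y hx hy => ?_
  rw [map_add]
  exact add_mem hx hy

lemma ker_stable_of_commute {A T : End ℂ M} {c : ℂ} (h : A * T = T * A) :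
    ∀ v ∈ A.eigenspace c, T v ∈ A.eigenspace c := by
  intro v hv
  rw [End.mem_eigenspace_iff] at hv ⊢
  rw [← End.mul_apply, h, End.mul_apply, hv, map_smul]

lemma exists_eigenvector_of_commute {A L0 : End ℂ M} {μ : ℂ} (hc : A * L0 = L0 * A)
    [FiniteDimensional ℂ (L0.eigenspace μ)] (hμ : L0.eigenspace μ ≠ ⊥) :
    ∃ c, A.eigenspace c ≠ ⊥ := by
  have hn : Nontrivial (L0.eigenspace μ) := Submodule.nontrivial_iff_ne_bot.mpr hμ
  obtain ⟨c, hc'⟩ := End.exists_eigenvalue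
    (A.restrict (ker_stable_of_commute (c := μ) hc.symm) : End ℂ (L0.eigenspace μ))
  obtain ⟨v, hv⟩ := hc'.exists_hasEigenvector
  refine ⟨c, fun h => hv.2 (Subtype.ext ?_)⟩
  have : (v : M) ∈ A.eigenspace c := by
    rw [End.mem_eigenspace_iff]
    exact congrArg Subtype.val hv.apply_eq_smul
  rw [h] at this
  simpa using this

/-- A simple Harish-Chandra module satisfies `SccMod`. -/
theorem exists_sccMod {gr : Fin 2 → Submodule ℂ M} (hrep : IsSCCRep 𝕘 Φ L G C C1 E F)
    (hsuper : IsSCCSuper 𝕘 gr L G C C1 E F) (hsimple : IsSimpleRep (sccOps 𝕘 L G C C1 E F) gr)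
    (hHC : IsHarishChandra (L 0)) :
    ∃ (σ : End ℂ M) (lam c c1 : ℂ), SccMod Φ L G E F σ lam c c1 ∧ C = c • 1 ∧ C1 = c1 • 1 ∧
      (∀ x, x ∈ gr 0 ↔ σ x = x) ∧ ∀ x, x ∈ gr 1 ↔ σ x = -x := by
  have hcompl : IsCompl (gr 0) (gr 1) :=
    (DirectSum.isInternal_submodule_iff_isCompl gr (by decide) (by
      ext i; fin_cases i <;> simp)).mp hsuper.internal
  set σ := parityOp gr hcompl with hσ
  have hL := fun i => (hsuper.hL i).commute_parityOp hcompl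
  have hG := fun i => (hsuper.hG i).anticommute_parityOp hcompl
  have hE := fun i x => (hsuper.hE i x).commute_parityOp hcompl
  have hF := fun i x => (hsuper.hF i x).anticommute_parityOp hcompl
  have hC := hsuper.hC.commute_parityOp hcompl
  have hC1 := hsuper.hC1.commute_parityOp hcompl
  have hsim : ∀ N, SccStable L G E F σ N → (∀ v ∈ N, C v ∈ N) → (∀ v ∈ N, C1 v ∈ N) →
      N = ⊥ ∨ N = ⊤ := by
    intro N h h1 h2
    refine hsimple.2 N ?_ (gradedSub_of_parityOp hcompl h.hσ)
    rintro f ((((⟨i, rfl⟩ | ⟨i, rfl⟩) | rfl | rfl) | ⟨i, x, rfl⟩) | ⟨i, x, rfl⟩) <;>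
      rw [Submodule.map_le_iff_le_comap] <;> intro v hv
    exacts [h.hL _ _ hv, h.hG _ _ hv, h1 _ hv, h2 _ hv, h.hE _ _ _ hv, h.hF _ _ _ hv]
  have hbot : (⊤ : Submodule ℂ M) ≠ ⊥ := by
    obtain ⟨v, hv⟩ := hsimple.1
    exact fun h => hv ((Submodule.mem_bot ℂ).mp (h ▸ Submodule.mem_top))
  obtain ⟨lam, hlam⟩ : ∃ μ, (L 0).eigenspace μ ≠ ⊥ := by
    by_contra! h
    exact hbot (by rw [← hHC.1]; simp [h])
  have hfd := hHC.2
  have scal : ∀ A : End ℂ M, (∀ i, A * L i = L i * A) → (∀ i, A * G i = G i * A) →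
      (∀ i x, A * E i x = E i x * A) → (∀ i x, A * F i x = F i x * A) → A * σ = σ * A →
      A * C = C * A → A * C1 = C1 * A → ∃ a : ℂ, A = a • 1 := by
    intro A h1 h2 h3 h4 h5 h6 h7
    have := hfd lam
    obtain ⟨a, ha⟩ := exists_eigenvector_of_commute (h1 0) hlam
    have := (hsim (A.eigenspace a) ⟨fun i => ker_stable_of_commute (h1 i),
      fun i => ker_stable_of_commute (h2 i), fun i x => ker_stable_of_commute (h3 i x),
      fun i x => ker_stable_of_commute (h4 i x), ker_stable_of_commute h5⟩
      (ker_stable_of_commute h6) (ker_stable_of_commute h7)).resolve_left ha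
    refine ⟨a, LinearMap.ext fun v => ?_⟩
    have hv : v ∈ A.eigenspace a := this ▸ Submodule.mem_top
    simpa using End.mem_eigenspace_iff.mp hv
  obtain ⟨c, rfl⟩ := scal C hrep.central_C_L hrep.central_C_G hrep.central_C_E hrep.central_C_F
    hC rfl hrep.central_C_C1
  obtain ⟨c1, rfl⟩ := scal C1 hrep.central_C1_L hrep.central_C1_G hrep.central_C1_E
    hrep.central_C1_F hC1 hrep.central_C_C1.symm rfl
  have hsim' : ∀ N, SccStable L G E F σ N → N = ⊥ ∨ N = ⊤ := fun N h =>
    hsim N h (fun v hv => N.smul_mem _ hv) (fun v hv => N.smul_mem _ hv)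
  refine ⟨σ, lam, c, c1, ⟨hrep, parityOp_sq hcompl, hL, hG, hE, hF, hsimple.1, ?_,
    fun n => hfd _, hsim'⟩, rfl, rfl, fun x => mem_gr_zero hcompl, fun x => mem_gr_one hcompl⟩
  refine (hsim' _ ⟨fun i => (hrep.shifts_L lam i).iSup_stable,
    fun i => (hrep.shifts_G lam i).iSup_stable, fun i x => (hrep.shifts_E lam i x).iSup_stable,
    fun i x => (hrep.shifts_F lam i x).iSup_stable,
    (Shifts.of_commute (hL 0)).iSup_stable⟩).resolve_left fun h => hlam ?_
  have := le_iSup (wt (L 0) lam) 0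
  rw [h, le_bot_iff] at this
  simpa [wt] using this

end SccMod

section Dichotomy

variable {𝕘 : Type} [LieRing 𝕘] [LieAlgebra ℂ 𝕘] {M : Type} [AddCommGroup M] [Module ℂ M]
  {Φ : 𝕘 →ₗ[ℂ] 𝕘 →ₗ[ℂ] ℂ} {L G : ℤ → End ℂ M} {C C1 : End ℂ M} {E F : ℤ → 𝕘 →ₗ[ℂ] End ℂ M}
  {σ : End ℂ M} {lam c c1 : ℂ}

lemma apply_of_comm {A B X : End ℂ M} (h : A * B - B * A = X) (v : M) :
    A (B v) = B (A v) + X v := by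
  rw [← h]; simp

lemma apply_of_anticomm {A B X : End ℂ M} (h : A * B + B * A = X) (v : M) :
    A (B v) = -B (A v) + X v := by
  rw [← h]; simp

/-- The vectors killed by all operators of degree at least `K`. -/
def annih (L G : ℤ → End ℂ M) (E F : ℤ → 𝕘 →ₗ[ℂ] End ℂ M) (K : ℤ) : Submodule ℂ M where
  carrier := {v | ∀ i, K ≤ i → L i v = 0 ∧ G i v = 0 ∧ ∀ x, E i x v = 0 ∧ F i x v = 0}
  add_mem' ha hb i hi := by
    obtain ⟨a1, a2, a3⟩ := ha i hi
    obtain ⟨b1, b2, b3⟩ := hb i hi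
    simp only [map_add, a1, a2, b1, b2, add_zero, true_and]
    exact fun x => by simp [a3 x, b3 x]
  zero_mem' i hi := by simp
  smul_mem' r v hv i hi := by
    obtain ⟨a1, a2, a3⟩ := hv i hi
    simp only [map_smul, a1, a2, smul_zero, true_and]
    exact fun x => by simp [a3 x]

namespace IsSCCRep

lemma L_mem_annih {K : ℤ} (hK : 0 < K) (h : IsSCCRep 𝕘 Φ L G C C1 E F) {i : ℤ} (hi : 0 ≤ i) {v : M}
    (hv : v ∈ annih L G E F K) : L i v ∈ annih L G E F K := by
  intro j hj
  obtain ⟨h1, h2, h3⟩ := hv j hj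
  obtain ⟨k1, k2, k3⟩ := hv (i + j) (by lia)
  have h0 : ¬ j + i = 0 := by lia
  refine ⟨?_, ?_, fun x => ⟨?_, ?_⟩⟩
  · rw [apply_of_comm (h.comm_LL j i), h1, if_neg h0, add_comm j i]
    simp [k1]
  · have := apply_of_comm (h.comm_LG i j) v
    simpa [h2, k2] using this.symm
  · have := apply_of_comm (h.comm_LE i j x) v
    simpa [h3 x, k3 x] using this.symm
  · have := apply_of_comm (h.comm_LF i j x) v
    simpa [h3 x, k3 x] using this.symm

lemma G_mem_annih {K : ℤ} (hK : 0 < K) (h : IsSCCRep 𝕘 Φ L G C C1 E F) {i : ℤ} (hi : 0 ≤ i) {v : M}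
    (hv : v ∈ annih L G E F K) : G i v ∈ annih L G E F K := by
  intro j hj
  obtain ⟨h1, h2, h3⟩ := hv j hj
  obtain ⟨k1, k2, k3⟩ := hv (j + i) (by lia)
  have h0 : ¬ j + i = 0 := by lia
  refine ⟨?_, ?_, fun x => ⟨?_, ?_⟩⟩
  · rw [apply_of_comm (h.comm_LG j i), h1]
    simp [k2]
  · rw [apply_of_anticomm (h.comm_GG j i), h2, if_neg h0]
    simp [k1]
  · have := apply_of_comm (h.comm_GE i j x) v
    rw [add_comm i j] at this
    simpa [h3 x, k3 x] using this.symm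
  · have := apply_of_anticomm (h.comm_GF i j x) v
    rw [add_comm i j] at this
    simpa [h3 x, k3 x] using this.symm

lemma E_mem_annih {K : ℤ} (hK : 0 < K) (h : IsSCCRep 𝕘 Φ L G C C1 E F) {i : ℤ} (hi : 0 ≤ i)
    (y : 𝕘) {v : M} (hv : v ∈ annih L G E F K) : E i y v ∈ annih L G E F K := by
  intro j hj
  obtain ⟨h1, h2, h3⟩ := hv j hj
  obtain ⟨k1, k2, k3⟩ := hv (j + i) (by lia)
  have h0 : ¬ j + i = 0 := by lia
  refine ⟨?_, ?_, fun x => ⟨?_, ?_⟩⟩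
  · rw [apply_of_comm (h.comm_LE j i y), h1]
    simp [k3 y]
  · rw [apply_of_comm (h.comm_GE j i y), h2]
    simp [k3 y]
  · rw [apply_of_comm (h.comm_EE j i x y), (h3 x).1, if_neg h0]
    simp [k3 _]
  · rw [apply_of_comm (h.comm_FE j i x y), (h3 x).2]
    simp [k3 _]

lemma F_mem_annih {K : ℤ} (hK : 0 < K) (h : IsSCCRep 𝕘 Φ L G C C1 E F) {i : ℤ} (hi : 0 ≤ i)
    (y : 𝕘) {v : M} (hv : v ∈ annih L G E F K) : F i y v ∈ annih L G E F K := by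
  intro j hj
  obtain ⟨h1, h2, h3⟩ := hv j hj
  obtain ⟨k1, k2, k3⟩ := hv (j + i) (by lia)
  have h0 : ¬ j + i = 0 := by lia
  refine ⟨?_, ?_, fun x => ⟨?_, ?_⟩⟩
  · rw [apply_of_comm (h.comm_LF j i y), h1]
    simp [k3 y]
  · rw [apply_of_anticomm (h.comm_GF j i y), h2]
    simp [k3 y]
  · have := apply_of_comm (h.comm_FE i j y x) v
    rw [add_comm i j] at this
    simpa [h3 x, k3 _] using this.symm
  · rw [apply_of_anticomm (h.comm_FF j i x y), (h3 x).2, if_neg h0]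
    simp

lemma L_eq_zero_of_two (h : IsSCCRep 𝕘 Φ L G C C1 E F) {k : ℤ} (hk : 0 < k) {v : M}
    (h1 : L k v = 0) (h2 : L (k + 1) v = 0) : ∀ i, k * (2 * k + 1) ≤ i → L i v = 0 := by
  have step : ∀ i j, 0 < i → i < j → L i v = 0 → L j v = 0 → L (i + j) v = 0 := by
    intro i j hi hij hLi hLj
    have := apply_of_comm (h.comm_LL i j) v
    rw [hLi, hLj, if_neg (by lia)] at this
    have hne : (j : ℂ) - i ≠ 0 := sub_ne_zero.mpr (by exact_mod_cast hij.ne')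
    simpa [hne] using this.symm
  have gen : ∀ a b : ℕ, L (((a : ℤ) + 1) * k + ((b : ℤ) + 1) * (k + 1)) v = 0 := by
    have pos : ∀ a b : ℕ, k + 1 < ((a : ℤ) + 1) * k + ((b : ℤ) + 1) * (k + 1) := by
      intro a b
      have : 0 ≤ (a : ℤ) * k := by positivity
      have : 0 ≤ (b : ℤ) * (k + 1) := by positivity
      linarith
    intro a b
    induction a with
    | zero =>
      induction b with
      | zero =>
        have := step k (k + 1) hk (by lia) h1 h2
        simpa using this
      | succ b ih =>
        have := step (k + 1) _ (by lia) (pos 0 b) h2 ih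
        convert this using 2
        push_cast; ring_nf
    | succ a ih =>
      have := step k _ hk (by have := pos a b; lia) h1 ih
      convert this using 2
      push_cast; ring_nf
  intro i hi
  obtain ⟨b, hb⟩ := Int.eq_ofNat_of_zero_le (Int.emod_nonneg i hk.ne')
  have hlt := Int.emod_lt_of_pos i hk
  have hdiv := Int.mul_ediv_add_emod i k
  have hq : 2 * k + 1 ≤ i / k := (Int.le_ediv_iff_mul_le hk).mpr (by linarith)
  obtain ⟨a, ha⟩ := Int.eq_ofNat_of_zero_le (show 0 ≤ i / k - 2 - (b + k) by lia)
  obtain ⟨k', rfl⟩ := Int.eq_ofNat_of_zero_le hk.le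
  have := gen a (b + k' - 1)
  have e : ((a : ℤ) + 1) * k' + (((b + k' - 1 : ℕ) : ℤ) + 1) * (k' + 1) = i := by
    rw [Nat.cast_sub (by lia)]
    push_cast
    linear_combination hdiv - hb - (k' : ℤ) * ha
  rwa [e] at this

lemma mem_annih_of_killed (h : IsSCCRep 𝕘 Φ L G C C1 E F) {k : ℤ} (hk : 0 < k) {v : M}
    (h1 : L k v = 0) (h2 : L (k + 1) v = 0) (h3 : G k v = 0) (h4 : ∀ x, E k x v = 0)
    (h5 : ∀ x, F k x v = 0) : v ∈ annih L G E F (k * (2 * k + 1) + k) := by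
  have hL := h.L_eq_zero_of_two hk h1 h2
  intro j hj
  obtain ⟨i, rfl⟩ : ∃ i, j = i + k := ⟨j - k, by ring⟩
  have hi : k * (2 * k + 1) ≤ i := by linarith
  have hi2 : 2 * k < i := by nlinarith
  have hk0 : (k : ℂ) ≠ 0 := by exact_mod_cast hk.ne'
  refine ⟨hL _ (by linarith), ?_, fun x => ⟨?_, ?_⟩⟩
  · have := apply_of_comm (h.comm_LG i k) v
    have hne : (k : ℂ) - i / 2 ≠ 0 := by
      rw [sub_ne_zero, ne_eq, eq_div_iff two_ne_zero]
      exact_mod_cast (by linarith : k * 2 < i).ne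
    rw [h3, hL i hi] at this
    simpa [hne] using this.symm
  · have := apply_of_comm (h.comm_LE i k x) v
    rw [h4, hL i hi] at this
    simpa [hk0] using this.symm
  · have := apply_of_comm (h.comm_LF i k x) v
    have hne : (k : ℂ) + i / 2 ≠ 0 := by
      rw [ne_eq, add_div_eq_mul_add_div _ _ two_ne_zero, div_eq_zero_iff]
      push Not
      exact ⟨by exact_mod_cast (by linarith : 0 < k * 2 + i).ne', two_ne_zero⟩
    rw [h5, hL i hi] at this
    simpa [hne] using this.symm

end IsSCCRep

namespace SccMod

lemma virMod (h : SccMod Φ L G E F σ lam c c1) : VirMod L lam c where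
  comm i j := by
    rw [h.rep.comm_LL, smul_smul]
    congr 2
    split_ifs <;> ring
  top := h.top
  fin := h.fin

/-- The module twisted by the automorphism reversing degrees. -/
lemma flip (h : SccMod Φ L G E F σ lam c c1) :
    SccMod Φ (fun i => -L (-i)) (fun i => Complex.I • G (-i)) (fun i => E (-i))
      (fun i => -Complex.I • F (-i)) σ (-lam) (-c) (-c1) where
  rep :=
    { comm_LL := fun i j => by
        have := h.rep.comm_LL (-i) (-j)
        rw [neg_mul_neg, neg_mul_neg, this, show -i + -j = -(i + j) by ring]
        simp only [neg_eq_zero]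
        split_ifs
        · push_cast
          module
        · push_cast
          module
      comm_LG := fun i j => by
        have := h.rep.comm_LG (-i) (-j)
        rw [show -i + -j = -(i + j) by ring] at this
        rw [neg_mul, mul_neg, mul_smul_comm, smul_mul_assoc, ← neg_add', ← sub_eq_add_neg,
          ← smul_sub, this]
        push_cast
        module
      comm_GG := fun i j => by
        have := h.rep.comm_GG (-i) (-j)
        rw [show -i + -j = -(i + j) by ring] at this
        simp only [neg_eq_zero] at this
        rw [smul_mul_smul_comm, smul_mul_smul_comm, ← smul_add, Complex.I_mul_I, this]
        split_ifs
        · push_cast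
          module
        · module
      comm_LE := fun i j x => by
        have := h.rep.comm_LE (-i) (-j) x
        rw [show -i + -j = -(i + j) by ring] at this
        rw [neg_mul, mul_neg, ← neg_add', ← sub_eq_add_neg, this]
        push_cast
        module
      comm_LF := fun i j x => by
        have := h.rep.comm_LF (-i) (-j) x
        rw [show -i + -j = -(i + j) by ring] at this
        simp only [LinearMap.smul_apply]
        rw [neg_mul, mul_neg, mul_smul_comm, smul_mul_assoc, ← neg_add', ← sub_eq_add_neg,
          ← smul_sub, this]
        push_cast
        module
      comm_GE := fun i j x => by
        have := h.rep.comm_GE (-i) (-j) x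
        rw [show -i + -j = -(i + j) by ring] at this
        simp only [LinearMap.smul_apply]
        rw [mul_smul_comm, smul_mul_assoc, ← smul_sub, this]
        push_cast
        module
      comm_GF := fun i j x => by
        have := h.rep.comm_GF (-i) (-j) x
        rw [show -i + -j = -(i + j) by ring] at this
        simp only [LinearMap.smul_apply]
        rw [smul_mul_smul_comm, smul_mul_smul_comm, mul_comm (-Complex.I), ← smul_add, this,
          mul_neg, Complex.I_mul_I, neg_neg, one_smul]
      comm_EE := fun i j x y => by
        have := h.rep.comm_EE (-i) (-j) x y
        rw [show -i + -j = -(i + j) by ring] at this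
        simp only [neg_eq_zero] at this
        rw [this]
        split_ifs
        · push_cast
          module
        · module
      comm_FE := fun i j x y => by
        have := h.rep.comm_FE (-i) (-j) x y
        rw [show -i + -j = -(i + j) by ring] at this
        simp only [LinearMap.smul_apply]
        rw [mul_smul_comm, smul_mul_assoc, ← smul_sub, this]
      comm_FF := fun i j x y => by
        have := h.rep.comm_FF (-i) (-j) x y
        rw [show -i + -j = -(i + j) by ring] at this
        simp only [neg_eq_zero] at this
        simp only [LinearMap.smul_apply]
        rw [smul_mul_smul_comm, smul_mul_smul_comm, ← smul_add, neg_mul_neg, Complex.I_mul_I, this]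
        split_ifs <;> module
      central_C_L := by simp
      central_C_G := by simp [smul_smul, mul_comm]
      central_C_E := by simp
      central_C_F := by simp [smul_smul, mul_comm]
      central_C_C1 := by simp [smul_smul, mul_comm]
      central_C1_L := by simp
      central_C1_G := by simp [smul_smul, mul_comm]
      central_C1_E := by simp
      central_C1_F := by simp [smul_smul, mul_comm] }
  sq := h.sq
  hL i := by rw [neg_mul, mul_neg, h.hL]
  hG i := by rw [smul_mul_assoc, mul_smul_comm, h.hG, smul_neg]
  hE i x := h.hE _ x
  hF i x := by rw [LinearMap.smul_apply, smul_mul_assoc, mul_smul_comm, h.hF, smul_neg]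
  nontriv := h.nontriv
  top := h.virMod.flip.top
  fin := h.virMod.flip.fin
  simple N hN := by
    refine h.simple N ⟨fun i v hv => ?_, fun i v hv => ?_, fun i x v hv => ?_, fun i x v hv => ?_,
      hN.hσ⟩
    · have := hN.hL (-i) v hv
      simpa using this
    · have := N.smul_mem (-Complex.I) (hN.hG (-i) v hv)
      simpa [smul_smul] using this
    · have := hN.hE (-i) x v hv
      simpa using this
    · have := N.smul_mem Complex.I (hN.hF (-i) x v hv)
      simpa [smul_smul] using this

lemma exists_singular (h : SccMod Φ L G E F σ lam c c1) {K : ℤ} (hK : 0 < K) {n : ℤ}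
    (hn : wt (L 0) lam n ⊓ annih L G E F K ≠ ⊥) : ∃ m, wt (L 0) lam m ⊓ annih L G E F 1 ≠ ⊥ := by
  obtain ⟨K, rfl⟩ := Int.eq_ofNat_of_zero_le hK.le
  obtain ⟨B, hB⟩ := h.virMod.bounded_of_annihilated (k := K) (by exact_mod_cast hK)
  have hne : ∀ n : ℤ, wt (L 0) lam n ⊓ annih L G E F K ≠ ⊥ → n ≤ B := by
    intro n hn
    by_contra! hlt
    refine hn ((Submodule.eq_bot_iff _).mpr fun v hv => hB n hlt.le v hv.1 (hv.2 K le_rfl).1)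
  obtain ⟨m, hm, hmax⟩ := Int.exists_greatest_of_bdd ⟨B, hne⟩ ⟨n, hn⟩
  refine ⟨m, fun hbot => hm ((Submodule.eq_bot_iff _).mpr fun v hv => ?_)⟩
  have hzero : ∀ i : ℤ, 1 ≤ i → ∀ w ∈ wt (L 0) lam (m + i) ⊓ annih L G E F K, w = 0 := by
    intro i hi w hw
    by_contra hw0
    have := hmax (m + i) fun hb => hw0 (by rw [hb] at hw; simpa using hw)
    lia
  refine (Submodule.eq_bot_iff _).mp hbot v ⟨hv.1, fun i hi => ⟨?_, ?_, fun x => ⟨?_, ?_⟩⟩⟩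
  · exact hzero i hi _ ⟨h.rep.shifts_L lam i _ _ hv.1, h.rep.L_mem_annih hK (by lia) hv.2⟩
  · exact hzero i hi _ ⟨h.rep.shifts_G lam i _ _ hv.1, h.rep.G_mem_annih hK (by lia) hv.2⟩
  · exact hzero i hi _ ⟨h.rep.shifts_E lam i x _ _ hv.1, h.rep.E_mem_annih hK (by lia) x hv.2⟩
  · exact hzero i hi _ ⟨h.rep.shifts_F lam i x _ _ hv.1, h.rep.F_mem_annih hK (by lia) x hv.2⟩

lemma bounded_below [FiniteDimensional ℂ 𝕘] (h : SccMod Φ L G E F σ lam c c1)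
    (hs : ∀ m, wt (L 0) lam m ⊓ annih L G E F 1 = ⊥) :
    ∃ N, ∀ n : ℤ, n ≤ 0 → finrank ℂ (wt (L 0) lam n) ≤ N := by
  have hfin := h.fin
  let b := Module.finBasis ℂ 𝕘
  let T := wt (L 0) lam 0 × wt (L 0) lam 1 × wt (L 0) lam 0 ×
    (Fin (finrank ℂ 𝕘) → wt (L 0) lam 0) × (Fin (finrank ℂ 𝕘) → wt (L 0) lam 0)
  refine ⟨finrank ℂ T + finrank ℂ (wt (L 0) lam 0), fun n hn => ?_⟩
  obtain rfl | hn := hn.eq_or_lt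
  · exact Nat.le_add_left _ _
  have key : ∀ A : End ℂ M, ∀ k l : ℤ, n + k = l → Shifts (L 0) lam k A →
      ∀ v ∈ wt (L 0) lam n, A v ∈ wt (L 0) lam l := by
    rintro A k l rfl hA v hv
    exact hA n v hv
  let f : wt (L 0) lam n →ₗ[ℂ] T :=
    ((L (-n)).restrict (key _ _ 0 (by ring) (h.rep.shifts_L lam _))).prod
    (((L (-n + 1)).restrict (key _ _ 1 (by ring) (h.rep.shifts_L lam _))).prod
    (((G (-n)).restrict (key _ _ 0 (by ring) (h.rep.shifts_G lam _))).prod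
    ((LinearMap.pi fun j => (E (-n) (b j)).restrict
      (key _ _ 0 (by ring) (h.rep.shifts_E lam _ _))).prod
    (LinearMap.pi fun j => (F (-n) (b j)).restrict
      (key _ _ 0 (by ring) (h.rep.shifts_F lam _ _))))))
  have hf : Function.Injective f := by
    rw [← LinearMap.ker_eq_bot, LinearMap.ker_eq_bot']
    intro v hv
    have h1 := congrArg (fun t : T => (t.1 : M)) hv
    have h2 := congrArg (fun t : T => (t.2.1 : M)) hv
    have h3 := congrArg (fun t : T => (t.2.2.1 : M)) hv
    have h4 := fun j => congrArg (fun t : T => (t.2.2.2.1 j : M)) hv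
    have h5 := fun j => congrArg (fun t : T => (t.2.2.2.2 j : M)) hv
    have lift : ∀ A : 𝕘 →ₗ[ℂ] End ℂ M, (∀ j, A (b j) v = 0) → ∀ x, A x v = 0 := by
      intro A hA x
      have : A.flip (v : M) = 0 := b.ext fun j => by simpa using hA j
      exact LinearMap.congr_fun this x
    have hmem := h.rep.mem_annih_of_killed (k := -n) (by lia) h1 h2 h3 (lift _ h4) (lift _ h5)
    by_contra hv0
    obtain ⟨m, hm⟩ := h.exists_singular (by nlinarith) (n := n) fun hb => hv0
      (Subtype.ext ((Submodule.eq_bot_iff _).mp hb v ⟨v.2, hmem⟩))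
    exact hm (hs m)
  exact (LinearMap.finrank_le_finrank_of_injective hf).trans (Nat.le_add_right _ _)

/-- Without highest and lowest weight vectors the weight multiplicities are bounded. -/
lemma bounded [FiniteDimensional ℂ 𝕘] (h : SccMod Φ L G E F σ lam c c1)
    (hs : ∀ m, wt (L 0) lam m ⊓ annih L G E F 1 = ⊥)
    (hs' : ∀ m, wt (-L 0) (-lam) m ⊓ annih (fun i => -L (-i)) (fun i => Complex.I • G (-i))
      (fun i => E (-i)) (fun i => -Complex.I • F (-i)) 1 = ⊥) :
    ∃ N, ∀ n : ℤ, finrank ℂ (wt (L 0) lam n) ≤ N := by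
  obtain ⟨N, hN⟩ := h.bounded_below hs
  obtain ⟨N', hN'⟩ := h.flip.bounded_below hs'
  refine ⟨max N N', fun n => ?_⟩
  rcases le_total n 0 with hn | hn
  · exact (hN n hn).trans (le_max_left _ _)
  · have : finrank ℂ (wt (-L 0) (-lam) (-n)) ≤ N' := hN' (-n) (by lia)
    rw [wt_neg, neg_neg] at this
    exact this.trans (le_max_right _ _)

end SccMod

end Dichotomy

section CommonEigenvector

variable {V : Type} [AddCommGroup V] [Module ℂ V]

lemma exists_eigenvector_mem {U : Submodule ℂ V} [FiniteDimensional ℂ U] (hU : U ≠ ⊥)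
    {T : End ℂ V} (hT : ∀ v ∈ U, T v ∈ U) : ∃ c, U ⊓ T.eigenspace c ≠ ⊥ := by
  have hn : Nontrivial U := Submodule.nontrivial_iff_ne_bot.mpr hU
  obtain ⟨c, hc⟩ := End.exists_eigenvalue (T.restrict hT : End ℂ U)
  obtain ⟨v, hv⟩ := hc.exists_hasEigenvector
  refine ⟨c, fun h => hv.2 (Subtype.ext ?_)⟩
  have : (v : V) ∈ U ⊓ T.eigenspace c :=
    ⟨v.2, End.mem_eigenspace_iff.mpr (congrArg Subtype.val hv.apply_eq_smul)⟩
  rw [h] at this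
  simpa using this

lemma exists_common_eigenvector {ι : Type} {T : ι → End ℂ V}
    (hcomm : ∀ i j, T i * T j = T j * T i) (U : Submodule ℂ V) [FiniteDimensional ℂ U]
    (hU : U ≠ ⊥) (hT : ∀ i, ∀ v ∈ U, T i v ∈ U) :
    ∃ v ∈ U, v ≠ 0 ∧ ∀ i, ∃ c : ℂ, T i v = c • v := by
  induction h : finrank ℂ U using Nat.strong_induction_on generalizing U with
  | _ n ih =>
    by_cases hs : ∀ i, ∃ c : ℂ, ∀ v ∈ U, T i v = c • v
    · obtain ⟨v, hv, hv0⟩ := U.exists_mem_ne_zero_of_ne_bot hU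
      exact ⟨v, hv, hv0, fun i => (hs i).imp fun c hc => hc v hv⟩
    · push Not at hs
      obtain ⟨i, hi⟩ := hs
      obtain ⟨c, hc⟩ := exists_eigenvector_mem hU (hT i)
      have hlt : U ⊓ (T i).eigenspace c < U := by
        refine inf_lt_left.mpr fun hle => ?_
        obtain ⟨v, hv, hne⟩ := hi c
        exact hne (End.mem_eigenspace_iff.mp (hle hv))
      have hfin : FiniteDimensional ℂ ↥(U ⊓ (T i).eigenspace c) :=
        Submodule.finiteDimensional_of_le inf_le_left
      obtain ⟨v, hv, h2⟩ := ih _ (h ▸ Submodule.finrank_lt_finrank_of_lt hlt) _ hc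
        (fun j v hv => ⟨hT j v hv.1, ker_stable_of_commute (hcomm i j) v hv.2⟩) rfl
      exact ⟨v, hv.1, h2⟩

end CommonEigenvector

/-- Positivity for the lexicographic order on `ℂ = ℝ²`. -/
def LexPos (z : ℂ) : Prop := 0 < z.re ∨ z.re = 0 ∧ 0 < z.im

lemma LexPos.add {z w : ℂ} (hz : LexPos z) (hw : LexPos w) : LexPos (z + w) := by
  unfold LexPos at *
  rw [Complex.add_re, Complex.add_im]
  rcases hz with hz | ⟨hz, hz'⟩ <;> rcases hw with hw | ⟨hw, hw'⟩
  · left; linarith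
  · left; linarith
  · left; linarith
  · right; constructor <;> linarith

lemma lexPos_or_neg {z : ℂ} (hz : z ≠ 0) : LexPos z ∨ LexPos (-z) := by
  unfold LexPos
  rw [Complex.neg_re, Complex.neg_im]
  rcases lt_trichotomy z.re 0 with h | h | h
  · right; left; linarith
  · rcases lt_trichotomy z.im 0 with h' | h' | h'
    · right; right; constructor <;> linarith
    · exact absurd (Complex.ext h h') hz
    · left; right; exact ⟨h, h'⟩
  · left; left; exact h

lemma LexPos.not_neg {z : ℂ} (hz : LexPos z) : ¬ LexPos (-z) := by
  intro h
  have := hz.add h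
  simp [LexPos] at this

lemma exists_lex_max {S : Set ℂ} (hS : S.Finite) (hne : S.Nonempty) :
    ∃ θ ∈ S, ∀ z, LexPos z → θ + z ∉ S := by
  obtain ⟨θ, hθ, hmax⟩ := Set.exists_max_image S (fun z => toLex (z.re, z.im)) hS hne
  refine ⟨θ, hθ, fun z hz hmem => ?_⟩
  have := hmax _ hmem
  rw [← not_lt] at this
  refine this ?_
  rw [Prod.Lex.toLex_lt_toLex]
  rcases hz with hz | ⟨hz, hz'⟩
  · left; simpa using hz
  · right; simpa [hz] using hz'

section Roots

variable {𝕘 : Type} [LieRing 𝕘] [LieAlgebra ℂ 𝕘]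

lemma exists_cartan_regular [FiniteDimensional ℂ 𝕘] [LieAlgebra.IsKilling ℂ 𝕘] :
    ∃ H : LieSubalgebra ℂ 𝕘, H.IsCartanSubalgebra ∧ (∀ h k : H, ⁅(h : 𝕘), (k : 𝕘)⁆ = 0) ∧
      (∀ χ : H → ℂ, rootSp H χ ≠ ⊥ → rootSp H (-χ) ≠ ⊥) ∧
      ∃ h₀ : H, ∀ χ : H → ℂ, χ ≠ 0 → rootSp H χ ≠ ⊥ → χ h₀ ≠ 0 := by
  obtain ⟨x, hx⟩ := LieAlgebra.exists_isCartanSubalgebra_engel ℂ 𝕘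
  generalize LieSubalgebra.engel ℂ x = H at hx
  have heq : ∀ χ : H → ℂ, rootSp H χ = (LieAlgebra.rootSpace H χ).toSubmodule := by
    intro χ
    refine le_antisymm (fun x hx => ?_) fun x hx h =>
      LieAlgebra.IsKilling.lie_eq_smul_of_mem_rootSpace hx h
    refine (LieModule.mem_genWeightSpace 𝕘 χ x).mpr fun h => ⟨1, ?_⟩
    have := hx h
    simp [LieSubalgebra.coe_bracket_of_module, this]
  have hbot : ∀ χ : H → ℂ, rootSp H χ ≠ ⊥ → LieAlgebra.rootSpace H χ ≠ ⊥ := by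
    intro χ hχ h
    rw [heq, h] at hχ
    exact hχ rfl
  refine ⟨H, hx, fun h k => ?_, fun χ hχ => ?_, ?_⟩
  · have : ⁅h, k⁆ = 0 := trivial_lie_zero H H h k
    exact congrArg Subtype.val this
  · let α : LieModule.Weight ℂ H 𝕘 := ⟨χ, hbot χ hχ⟩
    have := (-α).genWeightSpace_ne_bot
    rw [heq]
    simpa [α] using this
  · obtain ⟨h₀, -, hh⟩ := Module.Dual.exists_forall_mem_ne_zero_of_forall_exists
      (⊤ : Submodule ℂ H)
      (fun α : {α : LieModule.Weight ℂ H 𝕘 // α.IsNonZero} => LieModule.Weight.toLinear ℂ H 𝕘 α.1)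
      (fun α => by
        by_contra! hc
        exact α.2 (funext fun h => hc h trivial))
    refine ⟨h₀, fun χ hχ hr => ?_⟩
    exact hh ⟨⟨χ, hbot χ hr⟩, hχ⟩

lemma isPositiveSystem_of_sign {H : LieSubalgebra ℂ 𝕘} {h₀ : H}
    (hneg : ∀ χ : H → ℂ, rootSp H χ ≠ ⊥ → rootSp H (-χ) ≠ ⊥)
    (hreg : ∀ χ : H → ℂ, χ ≠ 0 → rootSp H χ ≠ ⊥ → χ h₀ ≠ 0) (p : ℂ → Prop)
    (hadd : ∀ z w, p z → p w → p (z + w)) (htri : ∀ z, z ≠ 0 → (p z ∨ p (-z)))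
    (hanti : ∀ z, p z → ¬ p (-z)) :
    IsPositiveSystem H {χ | χ ≠ 0 ∧ rootSp H χ ≠ ⊥ ∧ p (χ h₀)} := by
  refine ⟨fun χ hχ => ⟨hχ.1, hχ.2.1⟩, fun χ h0 hχ => ⟨?_, ?_⟩, fun χ ψ hχ hψ hr => ⟨?_, hr, ?_⟩⟩
  · rcases htri _ (hreg χ h0 hχ) with h | h
    · exact .inl ⟨h0, hχ, h⟩
    · exact .inr ⟨neg_ne_zero.mpr h0, hneg χ hχ, h⟩
  · rintro ⟨h1, h2⟩
    exact hanti _ h1.2.2 h2.2.2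
  · intro h
    have := hadd _ _ hχ.2.2 hψ.2.2
    rw [← Pi.add_apply, h] at this
    exact hanti _ this (by simpa using this)
  · exact hadd _ _ hχ.2.2 hψ.2.2

lemma exists_highest_vector {M : Type} [AddCommGroup M] [Module ℂ M] {H : LieSubalgebra ℂ 𝕘}
    (hH : ∀ h k : H, ⁅(h : 𝕘), (k : 𝕘)⁆ = 0) (h₀ : H) (ρ : 𝕘 → End ℂ M) (hρ0 : ρ 0 = 0)
    (hρs : ∀ (a : ℂ) x, ρ (a • x) = a • ρ x)
    (hρ : ∀ x y, ρ x * ρ y - ρ y * ρ x = ρ ⁅x, y⁆) (W : Submodule ℂ M) [FiniteDimensional ℂ W]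
    (hW : W ≠ ⊥) (hWρ : ∀ x, ∀ v ∈ W, ρ x v ∈ W) :
    ∃ v ∈ W, v ≠ 0 ∧ (∀ h : H, ∃ a : ℂ, ρ h v = a • v) ∧
      ∀ χ : H → ℂ, LexPos (χ h₀) → ∀ x ∈ rootSp H χ, ρ x v = 0 := by
  have hfinite : {a : ℂ | W ⊓ (ρ h₀).eigenspace a ≠ ⊥}.Finite := by
    refine ((End.finite_hasEigenvalue ((ρ h₀).restrict (hWρ h₀) : End ℂ W))).subset ?_
    intro a ha
    obtain ⟨v, hv, hv0⟩ := Submodule.exists_mem_ne_zero_of_ne_bot ha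
    refine End.hasEigenvalue_of_hasEigenvector (x := ⟨v, hv.1⟩)
      ⟨End.mem_eigenspace_iff.mpr (Subtype.ext ?_), fun h => hv0 (congrArg Subtype.val h)⟩
    exact End.mem_eigenspace_iff.mp hv.2
  obtain ⟨θ, hθ, hmax⟩ := exists_lex_max hfinite (exists_eigenvector_mem hW (hWρ h₀))
  have hcomm : ∀ h k : H, ρ h * ρ k = ρ k * ρ h := fun h k => by
    rw [← sub_eq_zero, hρ, hH, hρ0]
  have hfin : FiniteDimensional ℂ ↥(W ⊓ (ρ h₀).eigenspace θ) :=
    Submodule.finiteDimensional_of_le inf_le_left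
  obtain ⟨v, hv, hv0, hev⟩ := exists_common_eigenvector hcomm _ hθ
    fun h v hv => ⟨hWρ h v hv.1, ker_stable_of_commute (hcomm h₀ h) v hv.2⟩
  refine ⟨v, hv.1, hv0, hev, fun χ hχ x hx => ?_⟩
  by_contra hne
  refine hmax _ hχ fun hbot => hne ?_
  have hmem : ρ x v ∈ W ⊓ (ρ h₀).eigenspace (θ + χ h₀) := by
    refine ⟨hWρ x v hv.1, End.mem_eigenspace_iff.mpr ?_⟩
    rw [apply_of_comm (hρ h₀ x), End.mem_eigenspace_iff.mp hv.2, hx h₀, hρs]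
    simp [add_smul]
  rw [hbot] at hmem
  simpa using hmem

end Roots

section HighestWeight

variable {𝕘 : Type} [LieRing 𝕘] [LieAlgebra ℂ 𝕘] {M : Type} [AddCommGroup M] [Module ℂ M]
  {Φ : 𝕘 →ₗ[ℂ] 𝕘 →ₗ[ℂ] ℂ} {L G : ℤ → End ℂ M} {C C1 : End ℂ M} {E F : ℤ → 𝕘 →ₗ[ℂ] End ℂ M}
  {σ : End ℂ M} {lam c c1 : ℂ}

namespace SccMod

/-- A homogeneous nonzero vector generates the module. -/
lemma generates (h : SccMod Φ L G E F σ lam c c1) {v : M} (hv : v ≠ 0) {ε : ℂ}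
    (hσ : σ v = ε • v) {N : Submodule ℂ M} (hN : InvariantUnder (sccOps 𝕘 L G C C1 E F) N)
    (hvN : v ∈ N) : N = ⊤ := by
  have sL : ∀ i, ∀ w ∈ N, L i w ∈ N := fun i w hw =>
    hN (L i) (by simp [sccOps]) ⟨w, hw, rfl⟩
  have sG : ∀ i, ∀ w ∈ N, G i w ∈ N := fun i w hw =>
    hN (G i) (by simp [sccOps]) ⟨w, hw, rfl⟩
  have sE : ∀ i x, ∀ w ∈ N, E i x w ∈ N := fun i x w hw =>
    hN (E i x) (.inl (.inr ⟨i, x, rfl⟩)) ⟨w, hw, rfl⟩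
  have sF : ∀ i x, ∀ w ∈ N, F i x w ∈ N := fun i x w hw =>
    hN (F i x) (.inr ⟨i, x, rfl⟩) ⟨w, hw, rfl⟩
  have even : ∀ A : End ℂ M, A * σ = σ * A → ∀ w, σ (A w) = A (σ w) := fun A hA w =>
    (LinearMap.congr_fun hA w).symm
  have odd : ∀ A : End ℂ M, A * σ = -(σ * A) → ∀ w, σ (A w) = -A (σ w) := fun A hA w => by
    have := LinearMap.congr_fun hA w
    simp only [End.mul_apply, LinearMap.neg_apply] at this
    rw [this, neg_neg]
  have hst : SccStable L G E F σ (N ⊓ N.comap σ) := by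
    refine ⟨fun i w hw => ⟨sL i w hw.1, ?_⟩, fun i w hw => ⟨sG i w hw.1, ?_⟩,
      fun i x w hw => ⟨sE i x w hw.1, ?_⟩, fun i x w hw => ⟨sF i x w hw.1, ?_⟩,
      fun w hw => ⟨hw.2, ?_⟩⟩
    · change σ (L i w) ∈ N
      rw [even _ (h.hL i)]
      exact sL i _ hw.2
    · change σ (G i w) ∈ N
      rw [odd _ (h.hG i)]
      exact neg_mem (sG i _ hw.2)
    · change σ (E i x w) ∈ N
      rw [even _ (h.hE i x)]
      exact sE i x _ hw.2
    · change σ (F i x w) ∈ N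
      rw [odd _ (h.hF i x)]
      exact neg_mem (sF i x _ hw.2)
    · change σ (σ w) ∈ N
      rw [← End.mul_apply, h.sq]
      exact hw.1
  have hmem : v ∈ N ⊓ N.comap σ := ⟨hvN, by
    change σ v ∈ N
    rw [hσ]
    exact N.smul_mem _ hvN⟩
  rcases h.simple _ hst with hb | ht
  · rw [hb] at hmem
    exact absurd (by simpa using hmem) hv
  · exact eq_top_iff.mpr (ht ▸ inf_le_left)

lemma exists_highest [FiniteDimensional ℂ 𝕘] (h : SccMod Φ L G E F σ lam c c1)
    {H : LieSubalgebra ℂ 𝕘} (hH : ∀ h k : H, ⁅(h : 𝕘), (k : 𝕘)⁆ = 0) (h₀ : H) {m : ℤ}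
    (hm : wt (L 0) lam m ⊓ annih L G E F 1 ≠ ⊥) :
    ∃ v, v ≠ 0 ∧ (∃ ε : ℂ, σ v = ε • v) ∧ L 0 v = (lam + m) • v ∧ v ∈ annih L G E F 1 ∧
      (∀ h : H, ∃ a : ℂ, E 0 (h : 𝕘) v = a • v) ∧
      ∀ χ : H → ℂ, LexPos (χ h₀) → ∀ x ∈ rootSp H χ, E 0 x v = 0 := by
  have hfin := h.fin m
  have hfin' : FiniteDimensional ℂ ↥(wt (L 0) lam m ⊓ annih L G E F 1) :=
    Submodule.finiteDimensional_of_le inf_le_left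
  have even : ∀ A : End ℂ M, A * σ = σ * A → ∀ w, A (σ w) = σ (A w) := fun A hA w =>
    LinearMap.congr_fun hA w
  have odd : ∀ A : End ℂ M, A * σ = -(σ * A) → ∀ w, A (σ w) = -σ (A w) := fun A hA w =>
    LinearMap.congr_fun hA w
  obtain ⟨ε, hε⟩ := exists_eigenvector_mem hm (T := σ) fun v hv => by
    refine ⟨?_, fun i hi => ?_⟩
    · have := (Shifts.of_commute (lam := lam) (h.hL 0)) m v hv.1
      simpa using this
    · obtain ⟨h1, h2, h3⟩ := hv.2 i hi
      refine ⟨by rw [even _ (h.hL i), h1, map_zero], by rw [odd _ (h.hG i), h2, map_zero, neg_zero],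
        fun x => ⟨by rw [even _ (h.hE i x), (h3 x).1, map_zero],
          by rw [odd _ (h.hF i x), (h3 x).2, map_zero, neg_zero]⟩⟩
  have hfin'' : FiniteDimensional ℂ
      ↥(wt (L 0) lam m ⊓ annih L G E F 1 ⊓ σ.eigenspace ε) :=
    Submodule.finiteDimensional_of_le inf_le_left
  obtain ⟨v, hv, hv0, h1, h2⟩ := exists_highest_vector hH h₀ (fun x => E 0 x) (map_zero _)
    (fun a x => map_smul _ a x) (fun x y => by simpa using h.rep.comm_EE 0 0 x y) _ hε
    (fun x v hv => ⟨⟨by simpa using h.rep.shifts_E lam 0 x m v hv.1.1,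
      h.rep.E_mem_annih one_pos le_rfl x hv.1.2⟩, ker_stable_of_commute (h.hE 0 x).symm v hv.2⟩)
  exact ⟨v, hv0, ⟨ε, End.mem_eigenspace_iff.mp hv.2⟩, mem_wt.mp hv.1.1, hv.1.2, h1, h2⟩

lemma isHighestWeight [FiniteDimensional ℂ 𝕘] [LieAlgebra.IsKilling ℂ 𝕘]
    (h : SccMod Φ L G E F σ lam c c1) {m : ℤ}
    (hm : wt (L 0) lam m ⊓ annih L G E F 1 ≠ ⊥) :
    IsHighestWeight 𝕘 L G (c • 1) (c1 • 1) E F := by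
  obtain ⟨H, hC, hH, hneg, h₀, hreg⟩ := exists_cartan_regular (𝕘 := 𝕘)
  obtain ⟨v, hv0, ⟨ε, hε⟩, hw, hann, hE, hχ⟩ := h.exists_highest hH h₀ hm
  refine ⟨H, hC, _, isPositiveSystem_of_sign hneg hreg LexPos (fun _ _ => LexPos.add)
    (fun _ => lexPos_or_neg) (fun _ => LexPos.not_neg), v, hv0, fun i hi => hann i hi,
    fun χ hP => hχ χ hP.2.2, hE, ⟨_, hw⟩, ⟨c, by simp⟩, ⟨c1, by simp⟩,
    fun N hN hvN => h.generates hv0 hε hN hvN⟩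

lemma isLowestWeight [FiniteDimensional ℂ 𝕘] [LieAlgebra.IsKilling ℂ 𝕘]
    (h : SccMod Φ L G E F σ lam c c1) {m : ℤ}
    (hm : wt (-L 0) (-lam) m ⊓ annih (fun i => -L (-i)) (fun i => Complex.I • G (-i))
      (fun i => E (-i)) (fun i => -Complex.I • F (-i)) 1 ≠ ⊥) :
    IsLowestWeight 𝕘 L G (c • 1) (c1 • 1) E F := by
  obtain ⟨H, hC, hH, hneg, h₀, hreg⟩ := exists_cartan_regular (𝕘 := 𝕘)
  obtain ⟨v, hv0, ⟨ε, hε⟩, hw, hann, hE, hχ⟩ := h.flip.exists_highest hH h₀ hm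
  refine ⟨H, hC, _, isPositiveSystem_of_sign hneg hreg (fun z => LexPos (-z))
    (fun z w hz hw => by rw [neg_add]; exact hz.add hw)
    (fun z hz => by rw [neg_neg]; exact (lexPos_or_neg hz).symm) (fun z => LexPos.not_neg),
    v, hv0, fun i hi => ?_, fun χ hP => hχ _ hP.2.2, hE, ⟨-(-lam + m), ?_⟩, ⟨c, by simp⟩,
    ⟨c1, by simp⟩, fun N hN hvN => h.generates hv0 hε hN hvN⟩
  · obtain ⟨h1, h2, h3⟩ := hann (-i) (by lia)
    refine ⟨by simpa using h1, by simpa using h2, fun x => ⟨by simpa using (h3 x).1,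
      by simpa using (h3 x).2⟩⟩
  · have : -L 0 v = (-lam + m) • v := hw
    rw [neg_smul, ← this, neg_neg]

end SccMod

end HighestWeight

section Fermions

variable {M : Type} [AddCommGroup M] [Module ℂ M]

lemma linearIndependent_of_dual_ops {ι : Type} [Fintype ι] [DecidableEq ι] {v : M} (hv : v ≠ 0)
    (u : ι → M) (T : ι → End ℂ M) (h : ∀ k i, T k (u i) = if i = k then v else 0) :
    LinearIndependent ℂ u := by
  rw [Fintype.linearIndependent_iff]
  intro g hg k
  have := congrArg (T k) hg
  simpa [map_sum, h, hv] using this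

/-- Creation and annihilation operators force unbounded multiplicities. -/
lemma card_le_of_fermions {a b : ℤ → End ℂ M} {R : ℕ}
    (hab : ∀ i j, 0 < i → 0 < j → a i * b j + b j * a i = if i = j then 1 else 0)
    {v : M} (hv : v ≠ 0) (hvac : ∀ i : ℤ, 0 < i → i ≤ 2 * R + 1 → a i v = 0) :
    LinearIndependent ℂ fun k : Fin R => b (k + 1) (b (2 * R - k) v) := by
  refine linearIndependent_of_dual_ops hv _ (fun k => a (2 * R - k) * a (k + 1)) fun k i => ?_
  have hk := k.2
  have hi := i.2
  have step : ∀ p q : ℤ, 0 < p → 0 < q → ∀ w, a p (b q w) = -b q (a p w) + if p = q then w else 0 := by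
    intro p q hp hq w
    rw [apply_of_anticomm (hab p q hp hq)]
    split_ifs <;> simp
  rw [End.mul_apply]
  have hz : a (k + 1) v = 0 := hvac _ (by lia) (by lia)
  rw [step _ _ (by lia) (by lia), step _ _ (by lia) (by lia), hz, map_zero, neg_zero, zero_add,
    if_neg (by lia : ¬ ((k : ℤ) + 1 = 2 * R - i)), map_zero, neg_zero, zero_add]
  by_cases hik : i = k
  · subst hik
    rw [if_pos rfl, if_pos rfl, step _ _ (by lia) (by lia), if_pos rfl,
      hvac _ (by lia) (by lia), map_zero, neg_zero, zero_add]
  · rw [if_neg hik, if_neg, map_zero]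
    intro h
    exact hik (Fin.ext (by lia))

lemma exists_vacuum {a : ℤ → End ℂ M} {L0 : End ℂ M} {lam : ℂ}
    (haa : ∀ i j, 0 < i → 0 < j → a i * a j + a j * a i = 0)
    (hsh : ∀ i, Shifts L0 lam i (a i)) {n : ℤ} {v : M} (hv : v ≠ 0) (hn : v ∈ wt L0 lam n) (R : ℕ) :
    ∃ w ≠ 0, ∃ m, w ∈ wt L0 lam m ∧ ∀ i : ℤ, 0 < i → i ≤ R → a i w = 0 := by
  induction R with
  | zero => exact ⟨v, hv, n, hn, fun i h h' => by lia⟩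
  | succ R ih =>
    obtain ⟨w, hw, m, hm, hann⟩ := ih
    by_cases h0 : a (R + 1) w = 0
    · refine ⟨w, hw, m, hm, fun i hi hi' => ?_⟩
      obtain rfl | h : i = R + 1 ∨ i ≤ R := by push_cast at hi'; lia
      exacts [h0, hann i hi h]
    · refine ⟨_, h0, _, hsh _ _ _ hm, fun i hi hi' => ?_⟩
      obtain rfl | h : i = R + 1 ∨ i ≤ R := by push_cast at hi'; lia
      · have := apply_of_anticomm (haa (R + 1) (R + 1) hi hi) w
        rw [LinearMap.zero_apply, add_zero, eq_neg_iff_add_eq_zero, ← two_smul ℂ, smul_eq_zero] at this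
        exact this.resolve_left two_ne_zero
      · rw [apply_of_anticomm (haa i (R + 1) hi (by lia)), hann i hi h]
        simp

variable {𝕘 : Type} [LieRing 𝕘] [LieAlgebra ℂ 𝕘]
  {Φ : 𝕘 →ₗ[ℂ] 𝕘 →ₗ[ℂ] ℂ} {L G : ℤ → End ℂ M} {C C1 : End ℂ M} {E F : ℤ → 𝕘 →ₗ[ℂ] End ℂ M}
  {σ : End ℂ M} {lam c c1 : ℂ}

lemma SccMod.exists_weight_vector (h : SccMod Φ L G E F σ lam c c1) :
    ∃ n, wt (L 0) lam n ≠ ⊥ := by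
  by_contra! hb
  obtain ⟨v, hv⟩ := h.nontriv
  have := h.top
  simp only [hb, iSup_bot] at this
  exact hv ((Submodule.mem_bot ℂ).mp (this ▸ Submodule.mem_top))

lemma SccMod.current_charge (h : SccMod Φ L G E F σ lam c c1) {N : ℕ}
    (hN : ∀ n : ℤ, finrank ℂ (wt (L 0) lam n) ≤ N) {x y : 𝕘} (hxy : Φ x y ≠ 0) : c1 = 0 := by
  by_contra hc
  let a : ℤ → End ℂ M := fun i => F i x
  let b : ℤ → End ℂ M := fun i => (Φ x y * c1)⁻¹ • F (-i) y
  have haa : ∀ i j, 0 < i → 0 < j → a i * a j + a j * a i = 0 := fun i j hi hj => by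
    have := h.rep.comm_FF i j x x
    rwa [if_neg (by lia : ¬ i + j = 0), zero_smul] at this
  have hab : ∀ i j, 0 < i → 0 < j → a i * b j + b j * a i = if i = j then 1 else 0 := by
    intro i j _ _
    have := h.rep.comm_FF i (-j) x y
    simp only [a, b]
    rw [mul_smul_comm, smul_mul_assoc, ← smul_add, this, smul_smul, smul_smul]
    by_cases hij : i = j
    · rw [if_pos (by lia), if_pos hij, mul_assoc, inv_mul_cancel₀ (mul_ne_zero hxy hc), one_smul]
    · rw [if_neg (by lia), if_neg hij]
      simp
  obtain ⟨n, hn⟩ := h.exists_weight_vector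
  obtain ⟨v, hv, hv0⟩ := Submodule.exists_mem_ne_zero_of_ne_bot hn
  obtain ⟨w, hw, m, hm, hvac⟩ := exists_vacuum haa (h.rep.shifts_F lam · x) hv0 hv
    (2 * (N + 1) + 1)
  have hli := card_le_of_fermions (R := N + 1) hab hw (by exact_mod_cast hvac)
  have hmem : ∀ k : Fin (N + 1), b (k + 1) (b (2 * (N + 1 : ℕ) - k) w) ∈
      wt (L 0) lam (m - (2 * (N + 1) + 1)) := by
    intro k
    have hb : ∀ i l u, u ∈ wt (L 0) lam l → b i u ∈ wt (L 0) lam (l + -i) := fun i l u hu =>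
      Submodule.smul_mem _ _ (h.rep.shifts_F lam (-i) y l u hu)
    have := hb (k + 1) _ _ (hb (2 * (N + 1 : ℕ) - k) _ _ hm)
    rwa [show m + -(2 * ((N + 1 : ℕ) : ℤ) - k) + -((k : ℤ) + 1) = m - (2 * (N + 1) + 1) by
      push_cast; ring] at this
  have hfin := h.fin (m - (2 * (N + 1) + 1))
  have hli' : LinearIndependent ℂ fun k : Fin (N + 1) =>
      (⟨_, hmem k⟩ : wt (L 0) lam (m - (2 * (N + 1) + 1))) :=
    LinearIndependent.of_comp (Submodule.subtype _) hli
  have := hli'.fintype_card_le_finrank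
  have := hN (m - (2 * (N + 1) + 1))
  simp only [Fintype.card_fin] at *
  lia

lemma SccMod.weights_unbounded_below (h : SccMod Φ L G E F σ lam c c1)
    (hs : ∀ m, wt (-L 0) (-lam) m ⊓ annih (fun i => -L (-i)) (fun i => Complex.I • G (-i))
      (fun i => E (-i)) (fun i => -Complex.I • F (-i)) 1 = ⊥) (B : ℤ) :
    ∃ n ≥ B, wt (L 0) lam (-n) ≠ ⊥ := by
  by_contra! hB
  obtain ⟨n₀, hn₀⟩ := h.exists_weight_vector
  obtain ⟨n, hn, hmin⟩ := Int.exists_least_of_bdd (P := fun n => wt (L 0) lam n ≠ ⊥)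
    ⟨-B, fun n hn => by
      by_contra! hlt
      exact hn (by simpa using hB (-n) (by lia))⟩ ⟨n₀, hn₀⟩
  have hzero : ∀ (i : ℤ) (A : End ℂ M), 1 ≤ i → Shifts (L 0) lam (-i) A →
      ∀ v ∈ wt (L 0) lam n, A v = 0 := by
    intro i A hi hA v hv
    by_contra hne
    have := hmin (n + -i) fun hb => hne (by simpa [hb] using hA n v hv)
    lia
  refine hn ((Submodule.eq_bot_iff _).mpr fun v hv => ?_)
  refine (Submodule.eq_bot_iff _).mp (hs (-n)) v ⟨?_, fun i hi => ?_⟩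
  · rwa [SetLike.mem_coe, wt_neg, neg_neg]
  · refine ⟨?_, ?_, fun x => ⟨?_, ?_⟩⟩
    · simpa using hzero i _ hi (h.rep.shifts_L lam _) v hv
    · simpa using hzero i _ hi (h.rep.shifts_G lam _) v hv
    · simpa using hzero i _ hi (h.rep.shifts_E lam _ x) v hv
    · simpa using hzero i _ hi (h.rep.shifts_F lam _ x) v hv

/-- The difference relation `∑ (-1)ʲ (m choose j) x_{k-j} y_{s+j} = 0`. -/
def DiffRel (m : ℕ) (x y : ℤ → End ℂ M) : Prop :=
  ∀ k s : ℤ, ∑ j ∈ Finset.range (m + 1),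
    ((-1 : ℂ) ^ j * (m.choose j : ℂ)) • (x (k - j) * y (s + j)) = 0

lemma SccMod.exists_diffRel (h : SccMod Φ L G E F σ lam 0 c1) {N : ℕ}
    (hN : ∀ n : ℤ, finrank ℂ (wt (L 0) lam n) ≤ N) :
    ∃ m : ℕ, DiffRel m G L ∧ (∀ a, DiffRel m (E · a) L) ∧ ∀ a, DiffRel m (F · a) L := by
  obtain ⟨m, hm⟩ := h.virMod.exists_quadOp_eq_zero hN
  refine ⟨m + 2, fun k s => ?_, fun a k s => ?_, fun a k s => ?_⟩
  · rw [← mixOp_zmw_pow]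
    refine mixOp_eq_zero (α := 1 / 2) (fun i j => ?_) (by norm_num) hm _
    rw [h.rep.comm_LG]
    ring_nf
  · have := mixOp_zmw_pow (E · a) L (m + 2) k s
    rw [← this]
    refine mixOp_eq_zero (α := 0) (fun i j => ?_) (by norm_num) hm _
    rw [h.rep.comm_LE]
    ring_nf
  · have := mixOp_zmw_pow (F · a) L (m + 2) k s
    rw [← this]
    refine mixOp_eq_zero (α := -1 / 2) (fun i j => ?_) (by norm_num) hm _
    rw [h.rep.comm_LF]
    ring_nf

end Fermions

section Translates

open Polynomial

variable {V : Type*} [AddCommGroup V] [Module ℂ V]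

/-- The combination `∑ aₙ x_{k+n}` of the translates of a family `x` attached to the polynomial
`∑ aₙ Xⁿ`. -/
def transl (x : ℤ → V) (k : ℤ) : ℂ[X] →ₗ[ℂ] V :=
  Polynomial.lsum fun n => LinearMap.toSpanSingleton ℂ V (x (k + n))

@[simp] lemma transl_monomial (x : ℤ → V) (k : ℤ) (n : ℕ) (a : ℂ) :
    transl x k (monomial n a) = a • x (k + n) := by
  simp [transl, Polynomial.sum_monomial_index]

lemma transl_one (x : ℤ → V) (k : ℤ) : transl x k 1 = x k := by
  rw [← Polynomial.monomial_zero_one, transl_monomial]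
  simp

lemma transl_X_mul (x : ℤ → V) (k : ℤ) (p : ℂ[X]) : transl x k (X * p) = transl x (k + 1) p := by
  induction p using Polynomial.induction_on' with
  | add p q hp hq => rw [mul_add, map_add, map_add, hp, hq]
  | monomial n a =>
    rw [X_mul_monomial, transl_monomial, transl_monomial]
    congr 2
    push_cast
    ring

lemma transl_X_sub_one_mul (x : ℤ → V) (k : ℤ) (p : ℂ[X]) :
    transl x k ((X - 1) * p) = transl x (k + 1) p - transl x k p := by
  rw [sub_mul, one_mul, map_sub, transl_X_mul]

lemma transl_C_mul (x : ℤ → V) (k : ℤ) (a : ℂ) (p : ℂ[X]) :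
    transl x k (C a * p) = a • transl x k p := by
  rw [← Polynomial.smul_eq_C_mul, map_smul]

variable {ℓ x y : ℤ → End ℂ V} {α : ℂ}

lemma commutator_transl
    (h : ∀ i j : ℤ, ℓ i * x j - x j * ℓ i =
      ((j : ℂ) - α * i) • x (i + j) - (j : ℂ) • x j + (i : ℂ) • y i) (i k : ℤ) (p : ℂ[X]) :
    ℓ i * transl x k p - transl x k p * ℓ i =
      transl x (k + i) (X * derivative p) + ((k : ℂ) - α * i) • transl x (k + i) p -
        transl x k (X * derivative p) - (k : ℂ) • transl x k p + ((i : ℂ) * p.eval 1) • y i := by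
  induction p using Polynomial.induction_on' with
  | add p q hp hq =>
    simp only [map_add, mul_add, add_mul, eval_add, smul_add]
    linear_combination (norm := module) hp + hq
  | monomial n a =>
    have hd : X * derivative (monomial n a) = monomial n (a * n) := by
      rcases n with - | n
      · simp
      · rw [derivative_monomial, X_mul_monomial]
        simp
    rw [hd]
    simp only [transl_monomial, mul_smul_comm, smul_mul_assoc, ← smul_sub, h, eval_monomial,
      one_pow, mul_one]
    rw [show i + (k + n) = k + i + n by ring]
    push_cast
    module

/-- A family `x` of endomorphisms of a finite-dimensional space satisfying the commutation
relations of a Virasoro primary field is a quasi-polynomial with the only frequency `1`. -/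
theorem exists_transl_X_sub_one_pow_eq_zero [FiniteDimensional ℂ V]
    (h : ∀ i j : ℤ, ℓ i * x j - x j * ℓ i =
      ((j : ℂ) - α * i) • x (i + j) - (j : ℂ) • x j + (i : ℂ) • y i) (hα : 1 + α ≠ 0) :
    ∃ d : ℕ, ∀ (n : ℕ) (k : ℤ), d ≤ n → transl x k ((X - 1) ^ n) = 0 := by
  obtain ⟨p, hp0, hp⟩ : ∃ p : ℂ[X], p ≠ 0 ∧
      (transl x 0 p = 0 ∧ transl x 1 p = 0 ∧ p.eval 1 = 0) := by
    set f : ℂ[X] →ₗ[ℂ] End ℂ V × End ℂ V × ℂ :=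
      (transl x 0).prod ((transl x 1).prod (Polynomial.leval 1)) with hf
    by_contra! hne
    have : Function.Injective f := (injective_iff_map_eq_zero f).2 fun p hp => by
      by_contra hp0
      simp only [hf, LinearMap.prod_apply, Function.prod_apply, Prod.mk_eq_zero,
        Polynomial.leval_apply] at hp
      exact hne p hp0 hp.1 hp.2.1 hp.2.2
    have hfin := Module.Finite.of_injective f this
    exact Polynomial.not_finite hfin
  let I : Ideal ℂ[X] :=
    { carrier := {p | p.eval 1 = 0 ∧ ∀ k, transl x k p = 0}
      add_mem' := fun {a b} ha hb => ⟨by rw [eval_add, ha.1, hb.1, add_zero],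
        fun k => by rw [map_add, ha.2, hb.2, add_zero]⟩
      zero_mem' := ⟨eval_zero, fun k => map_zero _⟩
      smul_mem' := fun q a ha => by
        refine ⟨by rw [smul_eq_mul, eval_mul, ha.1, mul_zero], ?_⟩
        induction q using Polynomial.induction_on with
        | C c => intro k; rw [smul_eq_mul, transl_C_mul, ha.2, smul_zero]
        | add p q hp hq => intro k; rw [add_smul, map_add, hp, hq, add_zero]
        | monomial n c ih =>
          intro k
          rw [show (C c * X ^ (n + 1)) • a = X * ((C c * X ^ n) • a) by
            simp only [smul_eq_mul]; ring, transl_X_mul, ih] }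
  have hpI : p ∈ I := by
    refine ⟨hp.2.2, fun k => ?_⟩
    obtain ⟨h0, h1, he⟩ := hp
    obtain ⟨i, rfl⟩ : ∃ i, k = 1 + i := ⟨k - 1, by ring⟩
    have r1 := commutator_transl h i 1 p
    have r2 := commutator_transl h (i + 1) 0 p
    have r3 := commutator_transl h 1 0 p
    rw [zero_add, add_comm i 1] at r2
    rw [zero_add] at r3
    simp only [h0, h1, he, mul_zero, zero_mul, sub_zero, zero_smul, add_zero, smul_zero] at r1 r2 r3
    have : (1 + α) • transl x (1 + i) p = 0 := by
      push_cast at r1 r2 r3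
      linear_combination (norm := module) r2 - r1 - r3
    exact (smul_eq_zero.mp this).resolve_left hα
  obtain ⟨d, hd⟩ := exists_X_sub_one_pow_mem_of_stable (I := I)
    (fun c hc => ⟨by simpa using hc.1, fun k => by
      have := hc.2 (k - 1)
      rwa [transl_X_mul, sub_add_cancel] at this⟩)
    (fun c hc => ⟨by simp, fun k => by
      have := commutator_transl h 1 k c
      rw [transl_X_sub_one_mul]
      simp only [hc.1, hc.2, mul_zero, zero_mul, sub_zero, zero_smul, add_zero, smul_zero] at this
      exact this.symm⟩) hp0 hpI
  refine ⟨d, fun n k hn => ?_⟩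
  obtain ⟨m, rfl⟩ := Nat.exists_eq_add_of_le' hn
  rw [pow_add]
  exact (I.mul_mem_left _ hd).2 k

theorem transl_apply_eq_zero [FiniteDimensional ℂ V]
    (h : ∀ i j : ℤ, ℓ i * x j - x j * ℓ i =
      ((j : ℂ) - α * i) • x (i + j) - (j : ℂ) • x j + (i : ℂ) • y i) (hα : 1 + α ≠ 0)
    {n₀ : ℕ} (hy : y 1 = 0 ∨ n₀ ≠ 0) {κ : ℂ} {u : V} (hu : ℓ 1 u = κ • u)
    (hκ : ∀ n : ℕ, n₀ ≤ n → (ℓ 1).eigenspace (κ + (n - α)) = ⊥) :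
    ∀ (n : ℕ) (k : ℤ), n₀ ≤ n → transl x k ((X - 1) ^ n) u = 0 := by
  obtain ⟨d, hd⟩ := exists_transl_X_sub_one_pow_eq_zero h hα
  suffices ∀ m n : ℕ, d ≤ n + m → ∀ k, n₀ ≤ n → transl x k ((X - 1) ^ n) u = 0 from
    fun n k => this d n (Nat.le_add_left d n) k
  intro m
  induction m with
  | zero => intro n hn k _; rw [hd n k hn, LinearMap.zero_apply]
  | succ m ih =>
    intro n hn k hn₀
    have h1 := ih (n + 1) (by omega) k (by omega)
    have hc := commutator_transl h 1 k ((X - 1) ^ n)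
    have hy' : ((1 : ℤ) : ℂ) * ((X - 1 : ℂ[X]) ^ n).eval 1 = 0 ∨ y 1 = 0 := by
      rcases hy with hy | hy
      · exact .inr hy
      · have : n ≠ 0 := by omega
        simp [this]
    rw [smul_eq_zero.mpr hy', add_zero] at hc
    have e1 : (X - 1 : ℂ[X]) * (X * derivative ((X - 1) ^ n)) =
        C (n : ℂ) * ((X - 1) * (X - 1) ^ n + (X - 1) ^ n) := by
      rcases n with - | n
      · simp
      · rw [derivative_pow]
        simp
        ring
    have e2 := congrArg (transl x k) e1
    rw [transl_X_sub_one_mul, transl_C_mul, map_add] at e2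
    rw [pow_succ', transl_X_sub_one_mul] at h1
    rw [transl_X_sub_one_mul] at e2
    have hc' := LinearMap.congr_fun (hc.trans (by
      linear_combination (norm := module) e2 :
      _ = (n : ℂ) • transl x (k + 1) ((X - 1) ^ n) + ((k : ℂ) - α) • transl x (k + 1) ((X - 1) ^ n)
        - (k : ℂ) • transl x k ((X - 1) ^ n))) u
    simp only [LinearMap.sub_apply, End.mul_apply, LinearMap.add_apply, LinearMap.smul_apply, hu,
      map_smul] at hc'
    have : transl x k ((X - 1) ^ n) u ∈ (ℓ 1).eigenspace (κ + (n - α)) := by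
      rw [End.mem_eigenspace_iff]
      rw [LinearMap.sub_apply] at h1
      linear_combination (norm := module) hc' + ((n : ℂ) + k - α) • h1
    rwa [hκ n hn₀, Submodule.mem_bot] at this

end Translates

lemma int_linear {V : Type*} [AddCommGroup V] [Module ℂ V] {f : ℤ → V} (h : ∀ k, f (k + 1) - f k = f 1) (i : ℤ) : f i = (i : ℂ) • f 1 := by
  induction i using Int.induction_on with
  | zero =>
    have := h 0
    rw [zero_add] at this
    rw [Int.cast_zero, zero_smul]
    exact (sub_eq_self.mp this)
  | succ n ih =>
    have := h n
    push_cast at ih ⊢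
    linear_combination (norm := module) this + ih
  | pred n ih =>
    have := h (-n - 1)
    rw [sub_add_cancel] at this
    push_cast at ih ⊢
    linear_combination (norm := module) ih - this

lemma int_const {α : Type*} {f : ℤ → α} (h : ∀ k, f (k + 1) = f k) (i : ℤ) : f i = f 0 := by
  induction i using Int.induction_on with
  | zero => rfl
  | succ n ih => rw [h, ih]
  | pred n ih =>
    have := h (-n - 1)
    rw [sub_add_cancel] at this
    rw [← this, ih]

section CurrentLimit

open Polynomial

variable {𝕘 : Type} [LieRing 𝕘] {V : Type} [AddCommGroup V] [Module ℂ V]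

/-- The commutation relations satisfied by the operators `tⁱ ∘ a - a₀`, for `a` in the
superconformal current algebra, on curves in a Harish-Chandra module. -/
structure CurveRel (ℓ γ : ℤ → End ℂ V) (e φ : ℤ → 𝕘 → End ℂ V) (σ : End ℂ V) : Prop where
  ll : ∀ i j : ℤ, ℓ i * ℓ j - ℓ j * ℓ i =
    ((j : ℂ) - i) • ℓ (i + j) + (i : ℂ) • ℓ i - (j : ℂ) • ℓ j
  lg : ∀ i j : ℤ, ℓ i * γ j - γ j * ℓ i =
    ((j : ℂ) - i / 2) • γ (i + j) - (j : ℂ) • γ j + ((i : ℂ) / 2) • γ i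
  le : ∀ (i j : ℤ) a, ℓ i * e j a - e j a * ℓ i = (j : ℂ) • e (i + j) a - (j : ℂ) • e j a
  lf : ∀ (i j : ℤ) a, ℓ i * φ j a - φ j a * ℓ i =
    ((j : ℂ) + i / 2) • φ (i + j) a - (j : ℂ) • φ j a
  ge : ∀ (i : ℤ) a, γ i * e 0 a = e 0 a * γ i
  ee : ∀ (i : ℤ) a b, e i a * e 0 b - e 0 b * e i a = e i ⁅a, b⁆
  fe : ∀ (i : ℤ) a b, φ i a * e 0 b - e 0 b * φ i a = φ i ⁅a, b⁆
  l0 : ℓ 0 = 0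
  g0 : γ 0 = 0
  sl : ∀ i, σ * ℓ i = ℓ i * σ
  sg : ∀ i, σ * γ i = -(γ i * σ)
  se : ∀ i a, σ * e i a = e i a * σ
  sf : ∀ i a, σ * φ i a = -(φ i a * σ)
  sq : σ * σ = 1

namespace CurveRel

variable {ℓ γ : ℤ → End ℂ V} {e φ : ℤ → 𝕘 → End ℂ V} {σ : End ℂ V}

/-- The vectors on which the operators `ℓ i` are linear in `i`, the `γ i` and `φ i a` vanish and the
`e i a` are constant in `i`. -/
def tame (ℓ γ : ℤ → End ℂ V) (e φ : ℤ → 𝕘 → End ℂ V) : Submodule ℂ V where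
  carrier := {v | (∀ i, ℓ i v = (i : ℂ) • ℓ 1 v) ∧ (∀ i, γ i v = 0) ∧
    (∀ i a, e i a v = e 0 a v) ∧ ∀ i a, φ i a v = 0}
  add_mem' := by
    rintro v w ⟨h1, h2, h3, h4⟩ ⟨k1, k2, k3, k4⟩
    exact ⟨fun i => by rw [map_add, map_add, h1, k1, smul_add],
      fun i => by rw [map_add, h2, k2, add_zero],
      fun i a => by rw [map_add, map_add, h3, k3], fun i a => by rw [map_add, h4, k4, add_zero]⟩
  zero_mem' := by simp
  smul_mem' := by
    rintro c v ⟨h1, h2, h3, h4⟩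
    exact ⟨fun i => by rw [map_smul, map_smul, h1, smul_comm],
      fun i => by rw [map_smul, h2, smul_zero],
      fun i a => by rw [map_smul, map_smul, h3], fun i a => by rw [map_smul, h4, smul_zero]⟩

theorem tame_ne_bot [FiniteDimensional ℂ V] [Nontrivial V] (h : CurveRel ℓ γ e φ σ) :
    tame ℓ γ e φ ≠ ⊥ := by
  have hfin : {z : ℂ | (ℓ 1).eigenspace z ≠ ⊥}.Finite := End.finite_hasEigenvalue (ℓ 1)
  obtain ⟨κ₀, hκ₀⟩ := End.exists_eigenvalue (ℓ 1)
  obtain ⟨κ, hκ, hmax⟩ := exists_lex_max hfin ⟨κ₀, hκ₀⟩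
  obtain ⟨u, hu, hu0⟩ := Submodule.exists_mem_ne_zero_of_ne_bot hκ
  rw [End.mem_eigenspace_iff] at hu
  have big : ∀ (α : ℝ) (n₀ : ℕ), α < n₀ → ∀ n : ℕ, n₀ ≤ n →
      (ℓ 1).eigenspace (κ + (n - (α : ℂ))) = ⊥ := by
    intro α n₀ hα n hn
    by_contra hne
    refine hmax _ (Or.inl ?_) hne
    have : (n₀ : ℝ) ≤ n := Nat.cast_le.mpr hn
    simp only [Complex.sub_re, Complex.natCast_re, Complex.ofReal_re]
    linarith
  refine (Submodule.ne_bot_iff _).mpr ⟨u, ⟨?_, ?_, ?_, ?_⟩, hu0⟩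
  · have key := transl_apply_eq_zero (x := ℓ) (y := ℓ) (α := (1 : ℝ)) (n₀ := 2)
      (fun i j => by rw [h.ll]; push_cast; module) (by norm_num) (.inr two_ne_zero) hu
      (big 1 2 (by norm_num))
    have hd : ∀ k, ℓ (k + 1) u - ℓ k u = ℓ 1 u := by
      intro k
      rw [int_const (f := fun k => ℓ (k + 1) u - ℓ k u) (fun k => ?_) k]
      · simp [h.l0]
      · have := key 2 k le_rfl
        rw [pow_two, transl_X_sub_one_mul, ← mul_one (X - 1), transl_X_sub_one_mul,
          transl_X_sub_one_mul, transl_one, transl_one, transl_one] at this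
        rw [← sub_eq_zero]
        simpa using this
    exact int_linear hd
  · have key := transl_apply_eq_zero (x := γ) (y := fun i => (1 / 2 : ℂ) • γ i)
      (α := ((1 / 2 : ℝ) : ℂ)) (n₀ := 1)
      (fun i j => by rw [h.lg]; push_cast; module) (by norm_num) (.inr one_ne_zero) hu
      (big (1 / 2) 1 (by norm_num))
    intro i
    rw [int_const (f := fun k => γ k u) (fun k => ?_) i, h.g0, LinearMap.zero_apply]
    have := key 1 k le_rfl
    rwa [pow_one, ← mul_one (X - 1), transl_X_sub_one_mul, transl_one, transl_one,
      LinearMap.sub_apply, sub_eq_zero] at this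
  · intro i a
    have key := transl_apply_eq_zero (x := fun i => e i a) (y := 0)
      (α := ((0 : ℝ) : ℂ)) (n₀ := 1)
      (fun i j => by rw [h.le]; simp) (by norm_num) (.inr one_ne_zero) hu
      (big 0 1 (by norm_num))
    refine int_const (f := fun k => e k a u) (fun k => ?_) i
    have := key 1 k le_rfl
    rwa [pow_one, ← mul_one (X - 1), transl_X_sub_one_mul, transl_one, transl_one,
      LinearMap.sub_apply, sub_eq_zero] at this
  · intro i a
    have key := transl_apply_eq_zero (x := fun i => φ i a) (y := 0)
      (α := ((-1 / 2 : ℝ) : ℂ)) (n₀ := 0)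
      (fun i j => by
        rw [h.lf, Pi.zero_apply]
        push_cast
        module) (by norm_num) (.inl rfl) hu
      (big (-1 / 2) 0 (by norm_num))
    have := key 0 i le_rfl
    rwa [pow_zero, transl_one] at this

lemma ell_mem_tame (h : CurveRel ℓ γ e φ σ) : ∀ v ∈ tame ℓ γ e φ, ℓ 1 v ∈ tame ℓ γ e φ := by
  rintro v ⟨h1, h2, h3, h4⟩
  refine ⟨fun i => ?_, fun i => ?_, fun i a => ?_, fun i a => ?_⟩
  · rw [apply_of_comm (h.ll i 1), h1 i, map_smul]
    simp only [LinearMap.add_apply, LinearMap.sub_apply, LinearMap.smul_apply]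
    rw [h1 (i + 1), h1 i]
    push_cast
    module
  · have := apply_of_comm (h.lg 1 i) v
    simp only [LinearMap.add_apply, LinearMap.sub_apply, LinearMap.smul_apply, h2, smul_zero,
      map_zero, add_zero, sub_zero] at this
    exact this.symm
  · have := apply_of_comm (h.le 1 i a) v
    have h0 := apply_of_comm (h.le 1 0 a) v
    simp only [LinearMap.sub_apply, LinearMap.smul_apply, h3, Int.cast_zero, zero_smul, sub_self,
      add_zero, LinearMap.zero_apply] at this h0
    rw [← h0, this]
  · have := apply_of_comm (h.lf 1 i a) v
    simp only [LinearMap.sub_apply, LinearMap.smul_apply, h4, smul_zero,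
      map_zero, add_zero, sub_zero] at this
    exact this.symm

lemma comm_ell_e (h : CurveRel ℓ γ e φ σ) (i : ℤ) (a : 𝕘) : ℓ i * e 0 a = e 0 a * ℓ i := by
  have := h.le i 0 a
  simpa [sub_eq_zero] using this

lemma e_mem_tame (h : CurveRel ℓ γ e φ σ) (b : 𝕘) :
    ∀ v ∈ tame ℓ γ e φ, e 0 b v ∈ tame ℓ γ e φ := by
  rintro v ⟨h1, h2, h3, h4⟩
  refine ⟨fun i => ?_, fun i => ?_, fun i a => ?_, fun i a => ?_⟩
  · rw [← End.mul_apply, h.comm_ell_e, End.mul_apply, h1, map_smul, ← End.mul_apply,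
      ← h.comm_ell_e, End.mul_apply]
  · rw [← End.mul_apply, h.ge, End.mul_apply, h2, map_zero]
  · rw [apply_of_comm (h.ee i a b), h3, h3, apply_of_comm (h.ee 0 a b), h3 i]
  · rw [apply_of_comm (h.fe i a b), h4, h4, map_zero, add_zero]

lemma sigma_mem_tame (h : CurveRel ℓ γ e φ σ) :
    ∀ v ∈ tame ℓ γ e φ, σ v ∈ tame ℓ γ e φ := by
  have even : ∀ {A : End ℂ V}, σ * A = A * σ → ∀ v, A (σ v) = σ (A v) := fun hA v => by
    rw [← End.mul_apply, ← hA, End.mul_apply]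
  have odd : ∀ {A : End ℂ V}, σ * A = -(A * σ) → ∀ v, A v = 0 → A (σ v) = 0 := fun hA v hv => by
    rw [← End.mul_apply, ← neg_neg (_ * σ), ← hA, LinearMap.neg_apply, End.mul_apply, hv, map_zero,
      neg_zero]
  rintro v ⟨h1, h2, h3, h4⟩
  exact ⟨fun i => by rw [even (h.sl i), even (h.sl 1), h1, map_smul],
    fun i => odd (h.sg i) v (h2 i),
    fun i a => by rw [even (h.se i a), even (h.se 0 a), h3], fun i a => odd (h.sf i a) v (h4 i a)⟩

/-- There is a minimal nonzero `e 0`-stable subspace consisting of tame common eigenvectors of `ℓ 1`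
and `σ`. -/
theorem exists_simple [FiniteDimensional ℂ V] [Nontrivial V] (h : CurveRel ℓ γ e φ σ) :
    ∃ (β ε : ℂ) (K : Submodule ℂ V), K ≠ ⊥ ∧ (∀ a, ∀ v ∈ K, e 0 a v ∈ K) ∧
      (∀ N ≤ K, (∀ a, ∀ v ∈ N, e 0 a v ∈ N) → N = ⊥ ∨ N = K) ∧
      (ε = 1 ∨ ε = -1) ∧
      ∀ v ∈ K, (∀ i, ℓ i v = ((i : ℂ) * β) • v) ∧ (∀ i, γ i v = 0) ∧
        (∀ i a, e i a v = e 0 a v) ∧ (∀ i a, φ i a v = 0) ∧ σ v = ε • v := by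
  obtain ⟨β, hβ⟩ := exists_eigenvector_mem h.tame_ne_bot h.ell_mem_tame
  obtain ⟨ε, hε⟩ := exists_eigenvector_mem hβ (T := σ) fun v hv =>
    ⟨h.sigma_mem_tame v hv.1, ker_stable_of_commute (h.sl 1).symm v hv.2⟩
  set U := tame ℓ γ e φ ⊓ (ℓ 1).eigenspace β ⊓ σ.eigenspace ε with hU
  have hUe : ∀ a, ∀ v ∈ U, e 0 a v ∈ U := fun a v hv =>
    ⟨⟨h.e_mem_tame a v hv.1.1, ker_stable_of_commute (h.comm_ell_e 1 a) v hv.1.2⟩,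
      ker_stable_of_commute (h.se 0 a) v hv.2⟩
  have hε1 : ε = 1 ∨ ε = -1 := by
    obtain ⟨u, hu, hu0⟩ := Submodule.exists_mem_ne_zero_of_ne_bot hε
    have hu' := End.mem_eigenspace_iff.mp hu.2
    have := LinearMap.congr_fun h.sq u
    rw [End.mul_apply, hu', map_smul, hu', smul_smul, End.one_apply] at this
    refine mul_self_eq_one_iff.mp (sub_eq_zero.mp ((smul_eq_zero.mp ?_).resolve_right hu0))
    rw [sub_smul, this, one_smul, sub_self]
  obtain ⟨K, ⟨hKU, hK0, hKe⟩, hmin⟩ := wellFounded_lt.has_min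
    {K : Submodule ℂ V | K ≤ U ∧ K ≠ ⊥ ∧ ∀ a, ∀ v ∈ K, e 0 a v ∈ K} ⟨U, le_rfl, hε, hUe⟩
  refine ⟨β, ε, K, hK0, hKe, fun N hN hNe => ?_, hε1, fun v hv => ?_⟩
  · by_contra! hne
    exact hmin N ⟨hN.trans hKU, hne.1, hNe⟩ (lt_of_le_of_ne hN hne.2)
  · obtain ⟨⟨⟨h1, h2, h3, h4⟩, h5⟩, h6⟩ := hKU hv
    rw [SetLike.mem_coe, End.mem_eigenspace_iff] at h5 h6
    exact ⟨fun i => by rw [h1, h5, smul_smul], h2, h3, h4, h6⟩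

end CurveRel

end CurrentLimit

section CurveSpace

variable {M : Type} [AddCommGroup M] [Module ℂ M] {W : Type} [AddCommGroup W] [Module ℂ W]

/-- The curve `s ↦ x_{k+s} v`. -/
def curve (x : ℤ → End ℂ M) (k : ℤ) (v : M) : ℤ → M := fun s => x (k + s) v

/-- The curves `s ↦ X_{k+s} w v`, bilinearly in `w` and `v`. -/
def curveLin (X : ℤ → W →ₗ[ℂ] End ℂ M) (k : ℤ) : W →ₗ[ℂ] M →ₗ[ℂ] (ℤ → M) :=
  LinearMap.mk₂ ℂ (fun w v => curve (X · w) k v)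
    (fun w w' v => by ext; simp [curve]) (fun c w v => by ext; simp [curve])
    (fun w v v' => by ext; simp [curve]) (fun c w v => by ext; simp [curve])

/-- The space spanned by the curves `s ↦ X_{k+s} w v` with `v` of weight `-k`. -/
def curveSp (X : ℤ → W →ₗ[ℂ] End ℂ M) (L0 : End ℂ M) (μ : ℂ) : Submodule ℂ (ℤ → M) :=
  ⨆ k : ℤ, Submodule.map₂ (curveLin X k) ⊤ (wt L0 μ (-k))

variable {X : ℤ → W →ₗ[ℂ] End ℂ M} {L0 : End ℂ M} {μ : ℂ}

lemma curve_mem_curveSp {k : ℤ} (w : W) {v : M} (hv : v ∈ wt L0 μ (-k)) :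
    curve (X · w) k v ∈ curveSp X L0 μ :=
  Submodule.mem_iSup_of_mem k (Submodule.apply_mem_map₂ (curveLin X k) Submodule.mem_top hv)

lemma curveSp_le {N : Submodule ℂ (ℤ → M)}
    (h : ∀ k w, ∀ v ∈ wt L0 μ (-k), curve (X · w) k v ∈ N) : curveSp X L0 μ ≤ N :=
  iSup_le fun k => Submodule.map₂_le.mpr fun w _ v hv => h k w v hv

variable {L : ℤ → End ℂ M}

lemma smul_curve_eq_sum {m : ℕ} {x : ℤ → End ℂ M} (hx : DiffRel m x L) {k : ℤ} {v : M}
    (hv : v ∈ wt (L 0) μ (-k)) {j₀ : ℕ} (hj₀ : j₀ ≤ m) :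
    ((-1) ^ j₀ * (m.choose j₀ : ℂ) * (μ - k)) • curve x k v =
      -∑ j ∈ (Finset.range (m + 1)).erase j₀, ((-1 : ℂ) ^ j * (m.choose j : ℂ)) •
        curve x (k + j₀ - j) (L (j - j₀) v) := by
  ext s
  have h := LinearMap.congr_fun (hx (k + j₀ + s) (-j₀)) v
  rw [← Finset.add_sum_erase _ _ (Finset.mem_range.mpr (Nat.lt_succ_of_le hj₀))] at h
  rw [LinearMap.add_apply, LinearMap.smul_apply, End.mul_apply, neg_add_cancel, mem_wt.mp hv,
    LinearMap.zero_apply, map_smul, smul_smul] at h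
  have e : (∑ j ∈ (Finset.range (m + 1)).erase j₀, ((-1 : ℂ) ^ j * (m.choose j : ℂ)) •
        curve x (k + j₀ - j) (L (j - j₀) v)) s =
      (∑ j ∈ (Finset.range (m + 1)).erase j₀, ((-1 : ℂ) ^ j * (m.choose j : ℂ)) •
        (x (k + j₀ + s - j) * L (-j₀ + j))) v := by
    rw [Finset.sum_apply, LinearMap.sum_apply]
    refine Finset.sum_congr rfl fun j _ => ?_
    rw [Pi.smul_apply, LinearMap.smul_apply, End.mul_apply, curve,
      show k + j₀ - j + s = k + j₀ + s - (j : ℤ) by ring,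
      show (j : ℤ) - j₀ = -j₀ + j by ring]
  rw [Pi.neg_apply, e, Pi.smul_apply, curve]
  rw [show k + j₀ + s - (j₀ : ℤ) = k + s by ring] at h
  rw [Int.cast_neg, ← sub_eq_add_neg] at h
  exact eq_neg_of_add_eq_zero_left h

/-- The space of curves is finite-dimensional as soon as difference relations hold. -/
theorem curveSp_finiteDimensional [FiniteDimensional ℂ W] {m : ℕ} (hL : ∀ i, Shifts (L 0) μ i (L i))
    (hfin : ∀ n, FiniteDimensional ℂ (wt (L 0) μ n)) (hX : ∀ w, DiffRel m (X · w) L)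
    (hμ : ∀ k : ℤ, k ≠ 0 → μ ≠ k) : FiniteDimensional ℂ (curveSp X (L 0) μ) := by
  set B : Submodule ℂ (ℤ → M) :=
    ⨆ k : Set.Icc (-(m : ℤ)) m, Submodule.map₂ (curveLin X k) ⊤ (wt (L 0) μ (-k)) with hB
  have hBfin : FiniteDimensional ℂ B := by
    have : ∀ k : Set.Icc (-(m : ℤ)) m, FiniteDimensional ℂ
        (Submodule.map₂ (curveLin X k) ⊤ (wt (L 0) μ (-k))) := fun k =>
      Module.Finite.iff_fg.mpr (Submodule.FG.map₂ _ Module.Finite.fg_top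
        (Module.Finite.iff_fg.mp (hfin _)))
    exact Submodule.finiteDimensional_iSup _
  refine Submodule.finiteDimensional_of_le (S₂ := B) (curveSp_le ?_)
  suffices ∀ n : ℕ, ∀ k : ℤ, k.natAbs ≤ n → ∀ w, ∀ v ∈ wt (L 0) μ (-k), curve (X · w) k v ∈ B from
    fun k => this _ k le_rfl
  intro n
  induction n using Nat.strong_induction_on with
  | _ n ih =>
    intro k hk w v hv
    by_cases hkm : k.natAbs ≤ m
    · exact Submodule.mem_iSup_of_mem (⟨k, by lia, by lia⟩ : Set.Icc (-(m : ℤ)) m)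
        (Submodule.apply_mem_map₂ (curveLin X k) Submodule.mem_top hv)
    have hstep : ∀ j₀ : ℕ, j₀ ≤ m → (∀ j : ℕ, j ≤ m → j ≠ j₀ → (k + j₀ - j).natAbs < k.natAbs) →
        curve (X · w) k v ∈ B := by
      intro j₀ hj₀ hlt
      have hne : (-1) ^ j₀ * (m.choose j₀ : ℂ) * (μ - k) ≠ 0 :=
        mul_ne_zero (mul_ne_zero (pow_ne_zero _ (by norm_num))
          (Nat.cast_ne_zero.mpr (Nat.choose_pos hj₀).ne'))
          (sub_ne_zero.mpr (hμ k (by lia)))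
      rw [← Submodule.smul_mem_iff B hne, smul_curve_eq_sum (hX w) hv hj₀]
      refine B.neg_mem (B.sum_mem fun j hj => B.smul_mem _ ?_)
      rw [Finset.mem_erase, Finset.mem_range] at hj
      have := hlt j (by lia) hj.1
      refine ih _ (by lia) _ le_rfl w _ ?_
      have := hL (j - j₀) _ v hv
      rwa [show -k + ((j : ℤ) - j₀) = -(k + j₀ - j) by ring] at this
    rcases le_or_gt 0 k with hk0 | hk0
    · exact hstep 0 (by lia) fun j hj hj0 => by lia
    · exact hstep m le_rfl fun j hj hj0 => by lia

end CurveSpace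

section CurveOperators

variable {M : Type} [AddCommGroup M] [Module ℂ M]

/-- The operator `f ↦ (s ↦ A f(s - i))` on curves. -/
def crvA (A : End ℂ M) (i : ℤ) : End ℂ (ℤ → M) := LinearMap.pi fun s => A ∘ₗ LinearMap.proj (s - i)

@[simp] lemma crvA_apply (A : End ℂ M) (i : ℤ) (f : ℤ → M) (s : ℤ) :
    crvA A i f s = A (f (s - i)) := rfl

/-- The operator `f ↦ (s ↦ Lᵢ f(s - i) - (μ + s - i) f(s))` on curves. -/
def crvL (L : ℤ → End ℂ M) (μ : ℂ) (i : ℤ) : End ℂ (ℤ → M) :=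
  LinearMap.pi fun s => L i ∘ₗ LinearMap.proj (s - i) - (μ + s - i) • LinearMap.proj s

@[simp] lemma crvL_apply (L : ℤ → End ℂ M) (μ : ℂ) (i : ℤ) (f : ℤ → M) (s : ℤ) :
    crvL L μ i f s = L i (f (s - i)) - (μ + s - i) • f s := rfl

/-- The operator `f ↦ (s ↦ Gᵢ f(s - i) - G₀ f(s))` on curves. -/
def crvG (G : ℤ → End ℂ M) (i : ℤ) : End ℂ (ℤ → M) := crvA (G i) i - crvA (G 0) 0

@[simp] lemma crvG_apply (G : ℤ → End ℂ M) (i : ℤ) (f : ℤ → M) (s : ℤ) :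
    crvG G i f s = G i (f (s - i)) - G 0 (f s) := by
  simp [crvG]

variable {𝕘 : Type} [LieRing 𝕘] [LieAlgebra ℂ 𝕘]

/-- The space of curves attached to a Harish-Chandra module. -/
def sccCurves (L G : ℤ → End ℂ M) (E F : ℤ → 𝕘 →ₗ[ℂ] End ℂ M) (μ : ℂ) : Submodule ℂ (ℤ → M) :=
  curveSp (fun k => LinearMap.toSpanSingleton ℂ (End ℂ M) (G k)) (L 0) μ ⊔
    (curveSp E (L 0) μ ⊔ curveSp F (L 0) μ)

variable {Φ : 𝕘 →ₗ[ℂ] 𝕘 →ₗ[ℂ] ℂ} {L G : ℤ → End ℂ M} {E F : ℤ → 𝕘 →ₗ[ℂ] End ℂ M}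
  {σ : End ℂ M} {μ : ℂ} {k : ℤ} {v : M}

lemma curve_G_mem (hv : v ∈ wt (L 0) μ (-k)) : curve G k v ∈ sccCurves L G E F μ := by
  have := curve_mem_curveSp (X := fun k => LinearMap.toSpanSingleton ℂ (End ℂ M) (G k)) (1 : ℂ) hv
  simp only [LinearMap.toSpanSingleton_apply, one_smul] at this
  exact Submodule.mem_sup_left this

lemma curve_E_mem (a : 𝕘) (hv : v ∈ wt (L 0) μ (-k)) : curve (E · a) k v ∈ sccCurves L G E F μ :=
  Submodule.mem_sup_right (Submodule.mem_sup_left (curve_mem_curveSp a hv))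

lemma curve_F_mem (a : 𝕘) (hv : v ∈ wt (L 0) μ (-k)) : curve (F · a) k v ∈ sccCurves L G E F μ :=
  Submodule.mem_sup_right (Submodule.mem_sup_right (curve_mem_curveSp a hv))

lemma sccCurves_le {N : Submodule ℂ (ℤ → M)}
    (hG : ∀ k, ∀ v ∈ wt (L 0) μ (-k), curve G k v ∈ N)
    (hE : ∀ a k, ∀ v ∈ wt (L 0) μ (-k), curve (E · a) k v ∈ N)
    (hF : ∀ a k, ∀ v ∈ wt (L 0) μ (-k), curve (F · a) k v ∈ N) : sccCurves L G E F μ ≤ N := by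
  refine sup_le (curveSp_le fun k w v hv => ?_)
    (sup_le (curveSp_le fun k a v hv => hE a k v hv) (curveSp_le fun k a v hv => hF a k v hv))
  have := N.smul_mem w (hG k v hv)
  convert this using 1
  ext s
  simp [curve]

namespace SccMod

lemma relLL (h : SccMod Φ L G E F σ μ 0 0) (i j : ℤ) :
    L i * L j - L j * L i = ((j : ℂ) - i) • L (i + j) := by simpa using h.rep.comm_LL i j

lemma relGG (h : SccMod Φ L G E F σ μ 0 0) (i j : ℤ) :
    G i * G j + G j * G i = (-2 : ℂ) • L (i + j) := by simpa using h.rep.comm_GG i j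

lemma relEE (h : SccMod Φ L G E F σ μ 0 0) (i j : ℤ) (a b : 𝕘) :
    E i a * E j b - E j b * E i a = E (i + j) ⁅a, b⁆ := by simpa using h.rep.comm_EE i j a b

lemma relFF (h : SccMod Φ L G E F σ μ 0 0) (i j : ℤ) (a b : 𝕘) :
    F i a * F j b + F j b * F i a = 0 := by simpa using h.rep.comm_FF i j a b

lemma shift_neg {A : End ℂ M} {i : ℤ} (hA : Shifts (L 0) μ i A) (hv : v ∈ wt (L 0) μ (-k)) :
    A v ∈ wt (L 0) μ (-(k - i)) := by
  have := hA _ v hv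
  rwa [show -k + i = -(k - i) by ring] at this

lemma mem_wt_of_mem_sccCurves (h : SccMod Φ L G E F σ μ 0 0) {f : ℤ → M}
    (hf : f ∈ sccCurves L G E F μ) (s : ℤ) : f s ∈ wt (L 0) μ s := by
  have key : ∀ {x : ℤ → End ℂ M}, (∀ i, Shifts (L 0) μ i (x i)) → ∀ k,
      ∀ v ∈ wt (L 0) μ (-k), curve x k v ∈ (wt (L 0) μ s).comap (LinearMap.proj s) := by
    intro x hx k v hv
    have := hx (k + s) _ v hv
    rwa [show -k + (k + s) = s by ring] at this
  exact sccCurves_le (N := (wt (L 0) μ s).comap (LinearMap.proj s))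
    (key (h.rep.shifts_G μ)) (fun a => key (h.rep.shifts_E μ · a))
    (fun a => key (h.rep.shifts_F μ · a)) hf

lemma crvL_mem (h : SccMod Φ L G E F σ μ 0 0) (i : ℤ) :
    ∀ f ∈ sccCurves L G E F μ, crvL L μ i f ∈ sccCurves L G E F μ := by
  have key : ∀ {x : ℤ → End ℂ M} {β : ℂ}, (∀ i j : ℤ, L i * x j - x j * L i =
      ((j : ℂ) + β * i) • x (i + j)) → ∀ k v, crvL L μ i (curve x k v) =
      curve x (k - i) (L i v) + (k - μ + β * i) • curve x k v := by
    intro x β hx k v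
    ext s
    have := apply_of_comm (hx i (k + s - i)) v
    simp only [crvL_apply, curve, Pi.add_apply, Pi.smul_apply]
    rw [LinearMap.smul_apply, show i + (k + s - i) = k + s by ring] at this
    rw [show k + (s - i) = k + s - i by ring, show k - i + s = k + s - i by ring, this]
    push_cast
    module
  have fin : ∀ {x : ℤ → End ℂ M} {β : ℂ}, (∀ i j : ℤ, L i * x j - x j * L i =
      ((j : ℂ) + β * i) • x (i + j)) →
      (∀ k, ∀ v ∈ wt (L 0) μ (-k), curve x k v ∈ sccCurves L G E F μ) →
      ∀ k, ∀ v ∈ wt (L 0) μ (-k), crvL L μ i (curve x k v) ∈ sccCurves L G E F μ := by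
    intro x β hx hm k v hv
    rw [key hx]
    exact add_mem (hm _ _ (shift_neg (h.rep.shifts_L μ i) hv)) (Submodule.smul_mem _ _ (hm _ _ hv))
  refine sccCurves_le (N := (sccCurves L G E F μ).comap (crvL L μ i))
    (fin (β := -1 / 2) (fun i j => by rw [h.rep.comm_LG]; ring_nf) fun k v hv => curve_G_mem hv)
    (fun a => fin (β := 0) (fun i j => by rw [h.rep.comm_LE]; ring_nf)
      fun k v hv => curve_E_mem a hv)
    (fun a => fin (β := 1 / 2) (fun i j => by rw [h.rep.comm_LF]; ring_nf)
      fun k v hv => curve_F_mem a hv)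

lemma crvG_mem (h : SccMod Φ L G E F σ μ 0 0) (i : ℤ) :
    ∀ f ∈ sccCurves L G E F μ, crvG G i f ∈ sccCurves L G E F μ := by
  have h0 : ∀ {k} {v}, v ∈ wt (L 0) μ (-k) → G 0 v ∈ wt (L 0) μ (-k) := fun hv => by
    simpa using shift_neg (h.rep.shifts_G μ 0) hv
  refine sccCurves_le (N := (sccCurves L G E F μ).comap (crvG G i)) (fun k v hv => ?_)
    (fun a k v hv => ?_) (fun a k v hv => ?_)
  · have e : crvG G i (curve G k v) = -curve G (k - i) (G i v) + curve G k (G 0 v) := by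
      ext s
      have h1 := apply_of_anticomm (h.relGG i (k + s - i)) v
      have h2 := apply_of_anticomm (h.relGG 0 (k + s)) v
      rw [show i + (k + s - i) = k + s by ring] at h1
      rw [zero_add] at h2
      simp only [crvG_apply, curve, Pi.add_apply, Pi.neg_apply]
      rw [show k + (s - i) = k + s - i by ring, show k - i + s = k + s - i by ring, h1, h2]
      module
    rw [Submodule.mem_comap, e]
    exact add_mem (neg_mem (curve_G_mem (shift_neg (h.rep.shifts_G μ i) hv))) (curve_G_mem (h0 hv))
  · have e : crvG G i (curve (E · a) k v) = curve (E · a) (k - i) (G i v) -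
        curve (E · a) k (G 0 v) - (i : ℂ) • curve (F · a) k v := by
      ext s
      have h1 := apply_of_comm (h.rep.comm_GE i (k + s - i) a) v
      have h2 := apply_of_comm (h.rep.comm_GE 0 (k + s) a) v
      rw [LinearMap.smul_apply, show i + (k + s - i) = k + s by ring] at h1
      rw [LinearMap.smul_apply, zero_add] at h2
      simp only [crvG_apply, curve, Pi.sub_apply, Pi.smul_apply]
      rw [show k + (s - i) = k + s - i by ring, show k - i + s = k + s - i by ring, h1, h2]
      push_cast
      module
    rw [Submodule.mem_comap, e]
    exact sub_mem (sub_mem (curve_E_mem a (shift_neg (h.rep.shifts_G μ i) hv))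
      (curve_E_mem a (h0 hv))) (Submodule.smul_mem _ _ (curve_F_mem a hv))
  · have e : crvG G i (curve (F · a) k v) = -curve (F · a) (k - i) (G i v) +
        curve (F · a) k (G 0 v) := by
      ext s
      have h1 := apply_of_anticomm (h.rep.comm_GF i (k + s - i) a) v
      have h2 := apply_of_anticomm (h.rep.comm_GF 0 (k + s) a) v
      rw [show i + (k + s - i) = k + s by ring] at h1
      rw [zero_add] at h2
      simp only [crvG_apply, curve, Pi.add_apply, Pi.neg_apply]
      rw [show k + (s - i) = k + s - i by ring, show k - i + s = k + s - i by ring, h1, h2]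
      module
    rw [Submodule.mem_comap, e]
    exact add_mem (neg_mem (curve_F_mem a (shift_neg (h.rep.shifts_G μ i) hv)))
      (curve_F_mem a (h0 hv))

lemma crvE_mem (h : SccMod Φ L G E F σ μ 0 0) (i : ℤ) (b : 𝕘) :
    ∀ f ∈ sccCurves L G E F μ, crvA (E i b) i f ∈ sccCurves L G E F μ := by
  refine sccCurves_le (N := (sccCurves L G E F μ).comap (crvA (E i b) i)) (fun k v hv => ?_)
    (fun a k v hv => ?_) (fun a k v hv => ?_)
  · have e : crvA (E i b) i (curve G k v) =
        curve G (k - i) (E i b v) - (i : ℂ) • curve (F · b) k v := by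
      ext s
      have h1 := apply_of_comm (h.rep.comm_GE (k + s - i) i b) v
      rw [LinearMap.smul_apply, sub_add_cancel] at h1
      simp only [crvA_apply, curve, Pi.sub_apply, Pi.smul_apply]
      rw [show k + (s - i) = k + s - i by ring, show k - i + s = k + s - i by ring, h1]
      module
    rw [Submodule.mem_comap, e]
    exact sub_mem (curve_G_mem (shift_neg (h.rep.shifts_E μ i b) hv))
      (Submodule.smul_mem _ _ (curve_F_mem b hv))
  · have e : crvA (E i b) i (curve (E · a) k v) =
        curve (E · a) (k - i) (E i b v) + curve (E · ⁅b, a⁆) k v := by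
      ext s
      have h1 := apply_of_comm (h.relEE i (k + s - i) b a) v
      rw [show i + (k + s - i) = k + s by ring] at h1
      simp only [crvA_apply, curve, Pi.add_apply]
      rw [show k + (s - i) = k + s - i by ring, show k - i + s = k + s - i by ring, h1]
    rw [Submodule.mem_comap, e]
    exact add_mem (curve_E_mem a (shift_neg (h.rep.shifts_E μ i b) hv)) (curve_E_mem _ hv)
  · have e : crvA (E i b) i (curve (F · a) k v) =
        curve (F · a) (k - i) (E i b v) - curve (F · ⁅a, b⁆) k v := by
      ext s
      have h1 := apply_of_comm (h.rep.comm_FE (k + s - i) i a b) v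
      rw [sub_add_cancel] at h1
      simp only [crvA_apply, curve, Pi.sub_apply]
      rw [show k + (s - i) = k + s - i by ring, show k - i + s = k + s - i by ring, h1]
      module
    rw [Submodule.mem_comap, e]
    exact sub_mem (curve_F_mem a (shift_neg (h.rep.shifts_E μ i b) hv)) (curve_F_mem _ hv)

lemma crvF_mem (h : SccMod Φ L G E F σ μ 0 0) (i : ℤ) (b : 𝕘) :
    ∀ f ∈ sccCurves L G E F μ, crvA (F i b) i f ∈ sccCurves L G E F μ := by
  refine sccCurves_le (N := (sccCurves L G E F μ).comap (crvA (F i b) i)) (fun k v hv => ?_)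
    (fun a k v hv => ?_) (fun a k v hv => ?_)
  · have e : crvA (F i b) i (curve G k v) =
        -curve G (k - i) (F i b v) - curve (E · b) k v := by
      ext s
      have h1 := apply_of_anticomm (h.rep.comm_GF (k + s - i) i b) v
      rw [LinearMap.neg_apply, sub_add_cancel] at h1
      simp only [crvA_apply, curve, Pi.sub_apply, Pi.neg_apply]
      rw [show k + (s - i) = k + s - i by ring, show k - i + s = k + s - i by ring, h1]
      module
    rw [Submodule.mem_comap, e]
    exact sub_mem (neg_mem (curve_G_mem (shift_neg (h.rep.shifts_F μ i b) hv)))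
      (curve_E_mem b hv)
  · have e : crvA (F i b) i (curve (E · a) k v) =
        curve (E · a) (k - i) (F i b v) + curve (F · ⁅b, a⁆) k v := by
      ext s
      have h1 := apply_of_comm (h.rep.comm_FE i (k + s - i) b a) v
      rw [show i + (k + s - i) = k + s by ring] at h1
      simp only [crvA_apply, curve, Pi.add_apply]
      rw [show k + (s - i) = k + s - i by ring, show k - i + s = k + s - i by ring, h1]
    rw [Submodule.mem_comap, e]
    exact add_mem (curve_E_mem a (shift_neg (h.rep.shifts_F μ i b) hv)) (curve_F_mem _ hv)
  · have e : crvA (F i b) i (curve (F · a) k v) = -curve (F · a) (k - i) (F i b v) := by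
      ext s
      have h1 := apply_of_anticomm (h.relFF i (k + s - i) b a) v
      simp only [crvA_apply, curve, Pi.neg_apply]
      rw [show k + (s - i) = k + s - i by ring, show k - i + s = k + s - i by ring, h1,
        LinearMap.zero_apply, add_zero]
    rw [Submodule.mem_comap, e]
    exact neg_mem (curve_F_mem a (shift_neg (h.rep.shifts_F μ i b) hv))

lemma crvσ_mem (h : SccMod Φ L G E F σ μ 0 0) :
    ∀ f ∈ sccCurves L G E F μ, crvA σ 0 f ∈ sccCurves L G E F μ := by
  have hσ : ∀ {k} {v}, v ∈ wt (L 0) μ (-k) → σ v ∈ wt (L 0) μ (-k) := fun hv => by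
    simpa using shift_neg (Shifts.of_commute (lam := μ) (h.hL 0)) hv
  have odd : ∀ {x : ℤ → End ℂ M}, (∀ i, x i * σ = -(σ * x i)) → ∀ k v,
      crvA σ 0 (curve x k v) = -curve x k (σ v) := by
    intro x hx k v
    ext s
    have := LinearMap.congr_fun (hx (k + s)) v
    rw [LinearMap.neg_apply, End.mul_apply, End.mul_apply] at this
    simp [curve, this]
  refine sccCurves_le (N := (sccCurves L G E F μ).comap (crvA σ 0)) (fun k v hv => ?_)
    (fun a k v hv => ?_) (fun a k v hv => ?_)
  · rw [Submodule.mem_comap, odd h.hG]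
    exact neg_mem (curve_G_mem (hσ hv))
  · have e : crvA σ 0 (curve (E · a) k v) = curve (E · a) k (σ v) := by
      ext s
      have := LinearMap.congr_fun (h.hE (k + s) a) v
      rw [End.mul_apply, End.mul_apply] at this
      simp [curve, this]
    rw [Submodule.mem_comap, e]
    exact curve_E_mem a (hσ hv)
  · rw [Submodule.mem_comap, odd (h.hF · a)]
    exact neg_mem (curve_F_mem a (hσ hv))

end SccMod

end CurveOperators

section SccLimit

variable {M : Type} [AddCommGroup M] [Module ℂ M] {𝕘 : Type} [LieRing 𝕘] [LieAlgebra ℂ 𝕘]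
  {Φ : 𝕘 →ₗ[ℂ] 𝕘 →ₗ[ℂ] ℂ} {L G : ℤ → End ℂ M} {E F : ℤ → 𝕘 →ₗ[ℂ] End ℂ M}
  {σ : End ℂ M} {μ : ℂ}

namespace SccMod

lemma curveRel (h : SccMod Φ L G E F σ μ 0 0) :
    CurveRel (fun i => (crvL L μ i).restrict (h.crvL_mem i))
      (fun i => (crvG G i).restrict (h.crvG_mem i))
      (fun i a => (crvA (E i a) i).restrict (h.crvE_mem i a))
      (fun i a => (crvA (F i a) i).restrict (h.crvF_mem i a))
      ((crvA σ 0).restrict h.crvσ_mem) where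
  ll i j := by
    ext f s
    have h1 := apply_of_comm (h.relLL i j) (f.1 (s - (i + j)))
    simp only [LinearMap.sub_apply, LinearMap.add_apply, LinearMap.smul_apply, End.mul_apply,
      LinearMap.coe_restrict_apply, Submodule.coe_sub, Submodule.coe_add, Submodule.coe_smul,
      Pi.sub_apply, Pi.add_apply, Pi.smul_apply, crvL_apply, map_sub, map_smul] at h1 ⊢
    rw [show s - i - j = s - (i + j) by ring, show s - j - i = s - (i + j) by ring, h1]
    push_cast
    module
  lg i j := by
    ext f s
    have h1 := apply_of_comm (h.rep.comm_LG i j) (f.1 (s - (i + j)))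
    have h2 := apply_of_comm (h.rep.comm_LG i 0) (f.1 (s - i))
    simp only [LinearMap.sub_apply, LinearMap.add_apply, LinearMap.smul_apply, End.mul_apply,
      LinearMap.coe_restrict_apply, Submodule.coe_sub, Submodule.coe_add, Submodule.coe_smul,
      Pi.sub_apply, Pi.add_apply, Pi.smul_apply, crvL_apply, crvG_apply, map_sub, map_smul,
      add_zero] at h1 h2 ⊢
    rw [show s - i - j = s - (i + j) by ring, show s - j - i = s - (i + j) by ring, h1, h2]
    push_cast
    module
  le i j a := by
    ext f s
    have h1 := apply_of_comm (h.rep.comm_LE i j a) (f.1 (s - (i + j)))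
    simp only [LinearMap.sub_apply, LinearMap.smul_apply, End.mul_apply,
      LinearMap.coe_restrict_apply, Submodule.coe_sub, Submodule.coe_smul,
      Pi.sub_apply, Pi.smul_apply, crvL_apply, crvA_apply, map_sub, map_smul] at h1 ⊢
    rw [show s - i - j = s - (i + j) by ring, show s - j - i = s - (i + j) by ring, h1]
    push_cast
    module
  lf i j a := by
    ext f s
    have h1 := apply_of_comm (h.rep.comm_LF i j a) (f.1 (s - (i + j)))
    simp only [LinearMap.sub_apply, LinearMap.smul_apply, End.mul_apply,
      LinearMap.coe_restrict_apply, Submodule.coe_sub, Submodule.coe_smul,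
      Pi.sub_apply, Pi.smul_apply, crvL_apply, crvA_apply, map_sub, map_smul] at h1 ⊢
    rw [show s - i - j = s - (i + j) by ring, show s - j - i = s - (i + j) by ring, h1]
    push_cast
    module
  ge i a := by
    ext f s
    have h1 := apply_of_comm (h.rep.comm_GE i 0 a) (f.1 (s - i))
    have h2 := apply_of_comm (h.rep.comm_GE 0 0 a) (f.1 s)
    simp only [Int.cast_zero, zero_smul, add_zero] at h1 h2
    simp only [End.mul_apply, LinearMap.coe_restrict_apply, crvG_apply, crvA_apply, map_sub,
      sub_zero, h1, h2, LinearMap.zero_apply, add_zero]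
  ee i a b := by
    ext f s
    have h1 := apply_of_comm (h.relEE i 0 a b) (f.1 (s - i))
    simp only [LinearMap.sub_apply, End.mul_apply, LinearMap.coe_restrict_apply, crvA_apply,
      Submodule.coe_sub, Pi.sub_apply, sub_zero, h1, add_zero, add_sub_cancel_left]
  fe i a b := by
    ext f s
    have h1 := apply_of_comm (h.rep.comm_FE i 0 a b) (f.1 (s - i))
    simp only [LinearMap.sub_apply, End.mul_apply, LinearMap.coe_restrict_apply, crvA_apply,
      Submodule.coe_sub, Pi.sub_apply, sub_zero, h1, add_zero, add_sub_cancel_left]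
  l0 := by
    ext f s
    have := mem_wt.mp (h.mem_wt_of_mem_sccCurves f.2 s)
    simp [this]
  g0 := by
    ext f s
    simp
  sl i := by
    ext f s
    have h1 := LinearMap.congr_fun (h.hL i) (f.1 (s - i))
    simp only [End.mul_apply] at h1
    simp [h1]
  sg i := by
    ext f s
    have h1 := LinearMap.congr_fun (h.hG i) (f.1 (s - i))
    have h2 := LinearMap.congr_fun (h.hG 0) (f.1 s)
    simp only [End.mul_apply, LinearMap.neg_apply] at h1 h2
    simp [h1, h2]
    abel
  se i a := by
    ext f s
    have h1 := LinearMap.congr_fun (h.hE i a) (f.1 (s - i))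
    simp only [End.mul_apply] at h1
    simp [h1]
  sf i a := by
    ext f s
    have h1 := LinearMap.congr_fun (h.hF i a) (f.1 (s - i))
    simp only [End.mul_apply, LinearMap.neg_apply] at h1
    simp [h1]
  sq := by
    ext f s
    have h1 := LinearMap.congr_fun h.sq (f.1 s)
    simpa using h1

lemma sccCurves_ne_bot (h : SccMod Φ L G E F σ μ 0 0)
    (hs : ∀ m, wt (L 0) μ m ⊓ annih L G E F 1 = ⊥) : sccCurves L G E F μ ≠ ⊥ := by
  intro hb
  have zero : ∀ {x : ℤ → End ℂ M},
      (∀ k, ∀ v ∈ wt (L 0) μ (-k), curve x k v ∈ sccCurves L G E F μ) → ∀ i, x i = 0 := by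
    intro x hx i
    refine ext_wt h.top fun n v hv => ?_
    have := hx (-n) v (by rwa [neg_neg])
    rw [hb, Submodule.mem_bot] at this
    have := congrFun this (n + i)
    simpa [curve] using this
  have hG := zero fun k v hv => curve_G_mem (G := G) (E := E) (F := F) (μ := μ) hv
  have hE := fun a => zero fun k v hv => curve_E_mem (G := G) (E := E) (F := F) (μ := μ) a hv
  have hF := fun a => zero fun k v hv => curve_F_mem (G := G) (E := E) (F := F) (μ := μ) a hv
  have hL : ∀ i, L i = 0 := fun i => by
    have := h.relGG i 0
    simp only [hG, zero_mul, add_zero] at this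
    exact (smul_eq_zero.mp this.symm).resolve_left (by norm_num)
  obtain ⟨n, hn⟩ := h.exists_weight_vector
  refine hn ?_
  rw [eq_bot_iff, ← hs n]
  intro v hv
  refine ⟨hv, fun i _ => ?_⟩
  simp [hL, hG, hE, hF]

/-- A bounded simple module without highest weight vectors contains a finite-dimensional space of
curves on which the superconformal current algebra acts as on a tensor module. -/
theorem exists_simple_curves [FiniteDimensional ℂ 𝕘] (h : SccMod Φ L G E F σ μ 0 0)
    (hs : ∀ m, wt (L 0) μ m ⊓ annih L G E F 1 = ⊥) (hμ : ∀ k : ℤ, k ≠ 0 → μ ≠ k) {N : ℕ}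
    (hN : ∀ n : ℤ, finrank ℂ (wt (L 0) μ n) ≤ N) :
    ∃ (β ε : ℂ) (K : Submodule ℂ (ℤ → M)), K ≠ ⊥ ∧ FiniteDimensional ℂ K ∧
      (∀ a, ∀ f ∈ K, crvA (E 0 a) 0 f ∈ K) ∧
      (∀ N ≤ K, (∀ a, ∀ f ∈ N, crvA (E 0 a) 0 f ∈ N) → N = ⊥ ∨ N = K) ∧
      (ε = 1 ∨ ε = -1) ∧
      ∀ f ∈ K, ∀ s, (∀ i, L i (f s) = (μ + s + i * β) • f (s + i)) ∧
        (∀ i, G i (f s) = G 0 (f (s + i))) ∧ (∀ i a, E i a (f s) = E 0 a (f (s + i))) ∧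
        (∀ i a, F i a (f s) = 0) ∧ σ (f s) = ε • f s := by
  obtain ⟨m, hG, hE, hF⟩ := h.exists_diffRel hN
  set B := sccCurves L G E F μ with hB
  have hfin : FiniteDimensional ℂ B := by
    have f1 := curveSp_finiteDimensional (X := E) (h.rep.shifts_L μ) h.fin hE hμ
    have f2 := curveSp_finiteDimensional (X := F) (h.rep.shifts_L μ) h.fin hF hμ
    have f3 := curveSp_finiteDimensional
      (X := fun k => LinearMap.toSpanSingleton ℂ (End ℂ M) (G k)) (h.rep.shifts_L μ) h.fin
      (fun w k s => by
        have := congrArg (w • ·) (hG k s)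
        simpa [Finset.smul_sum, smul_comm w] using this) hμ
    rw [hB, sccCurves]
    infer_instance
  have hnt : Nontrivial B := Submodule.nontrivial_iff_ne_bot.mpr (h.sccCurves_ne_bot hs)
  obtain ⟨β, ε, K, hK0, hKe, hKmin, hε, hK⟩ := h.curveRel.exists_simple
  refine ⟨β, ε, K.map B.subtype, ?_, inferInstance, ?_, ?_, hε, ?_⟩
  · rw [← Submodule.map_bot B.subtype]
    exact fun hb => hK0 (Submodule.map_injective_of_injective B.injective_subtype hb)
  · rintro a _ ⟨f, hf, rfl⟩
    exact ⟨_, hKe a f hf, rfl⟩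
  · intro N hN hNe
    have hNB : (N.comap B.subtype).map B.subtype = N :=
      Submodule.map_comap_eq_self (hN.trans LinearMap.map_le_range)
    have := hKmin (N.comap B.subtype) (fun f hf => by
      obtain ⟨g, hg, hgf⟩ := hN hf
      rwa [← B.injective_subtype hgf]) (fun a f hf => hNe a _ hf)
    refine this.imp (fun h0 => ?_) fun h0 => ?_
    · rw [← hNB, h0, Submodule.map_bot]
    · rw [← hNB, h0]
  · rintro _ ⟨f, hf, rfl⟩ s
    obtain ⟨h1, h2, h3, h4, h5⟩ := hK f hf
    refine ⟨fun i => ?_, fun i => ?_, fun i a => ?_, fun i a => ?_, ?_⟩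
    · have := congrFun (congrArg Subtype.val (h1 i)) (s + i)
      simp only [LinearMap.coe_restrict_apply, crvL_apply, add_sub_cancel_right,
        Submodule.coe_smul, Pi.smul_apply] at this
      rw [Submodule.subtype_apply, sub_eq_iff_eq_add.mp this]
      push_cast
      module
    · have := congrFun (congrArg Subtype.val (h2 i)) (s + i)
      simp only [LinearMap.coe_restrict_apply, crvG_apply, add_sub_cancel_right,
        Submodule.coe_zero, Pi.zero_apply] at this
      exact sub_eq_zero.mp this
    · have := congrFun (congrArg Subtype.val (h3 i a)) (s + i)
      simpa using this
    · have := congrFun (congrArg Subtype.val (h4 i a)) (s + i)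
      simpa using this
    · have := congrFun (congrArg Subtype.val h5) s
      simpa using this

end SccMod

end SccLimit

section TensorMap

section Action

variable {V : Type} [AddCommGroup V] [Module ℂ V] {𝕘 : Type} [LieRing 𝕘] [LieAlgebra ℂ 𝕘]
  [LieRingModule 𝕘 V] [LieModule ℂ 𝕘 V] (lam b : ℂ) (i m : ℤ) (x : 𝕘) (v : V)

lemma tmL_single_zero : tmL V lam b i (Finsupp.single (m, 0) v) =
    (lam + m + i * b) • Finsupp.single (m + i, 0) v := by
  simp [tmL]

lemma tmL_single_one : tmL V lam b i (Finsupp.single (m, 1) v) =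
    (lam + m + i * b + i / 2) • Finsupp.single (m + i, 1) v := by
  simp [tmL]

lemma tmG_single_zero : tmG V lam b i (Finsupp.single (m, 0) v) =
    (lam + m + 2 * i * b) • Finsupp.single (m + i, 1) v := by
  simp [tmG]

lemma tmG_single_one : tmG V lam b i (Finsupp.single (m, 1) v) =
    -Finsupp.single (m + i, 0) v := by
  simp [tmG]

lemma tmE_single (r : Fin 2) : tmE V i x (Finsupp.single (m, r) v) =
    Finsupp.single (m + i, r) ⁅x, v⁆ := by
  simp [tmE]

lemma tmF_single_zero : tmF V i x (Finsupp.single (m, 0) v) =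
    Finsupp.single (m + i, 1) ⁅x, v⁆ := by
  simp [tmF]

lemma tmF_single_one : tmF V i x (Finsupp.single (m, 1) v) = 0 := by
  simp [tmF]

lemma tmod_hom_ext {W : Type} [AddCommGroup W] [Module ℂ W] {f g : TMod V →ₗ[ℂ] W}
    (h0 : ∀ m v, f (Finsupp.single (m, 0) v) = g (Finsupp.single (m, 0) v))
    (h1 : ∀ m v, f (Finsupp.single (m, 1) v) = g (Finsupp.single (m, 1) v)) : f = g := by
  refine Finsupp.lhom_ext ?_
  rintro ⟨m, r⟩ v
  fin_cases r
  exacts [h0 m v, h1 m v]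

end Action

variable {M : Type} [AddCommGroup M] [Module ℂ M] {𝕘 : Type} [LieRing 𝕘] [LieAlgebra ℂ 𝕘]
  {Φ : 𝕘 →ₗ[ℂ] 𝕘 →ₗ[ℂ] ℂ} {L G : ℤ → End ℂ M} {E F : ℤ → 𝕘 →ₗ[ℂ] End ℂ M}
  {σ : End ℂ M} {μ β ε : ℂ} {V : Type} [AddCommGroup V] [Module ℂ V] {ι : V →ₗ[ℂ] ℤ → M}

/-- The map `Γ(μ, V, b) → M` which sends `tᵐξ ⊗ v` to `ι v m` and `tᵐ ⊗ v` to `-G₀ (ι v m)`. -/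
def tensorMap (G : ℤ → End ℂ M) (ι : V →ₗ[ℂ] ℤ → M) : TMod V →ₗ[ℂ] M :=
  Finsupp.lsum ℂ fun p =>
    if p.2 = 0 then -(G 0 ∘ₗ LinearMap.proj p.1 ∘ₗ ι) else LinearMap.proj p.1 ∘ₗ ι

lemma tensorMap_zero (m : ℤ) (v : V) :
    tensorMap G ι (Finsupp.single (m, 0) v) = -G 0 (ι v m) := by
  simp [tensorMap]

lemma tensorMap_one (m : ℤ) (v : V) :
    tensorMap G ι (Finsupp.single (m, 1) v) = ι v m := by
  simp [tensorMap]

/-- The curve `f` transforms like the vectors `tˢξ ⊗ v` of a tensor module. -/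
def IsTensorLike (L G : ℤ → End ℂ M) (E F : ℤ → 𝕘 →ₗ[ℂ] End ℂ M) (σ : End ℂ M) (μ β ε : ℂ)
    (f : ℤ → M) : Prop :=
  ∀ s, (∀ i, L i (f s) = (μ + s + i * β) • f (s + i)) ∧
    (∀ i, G i (f s) = G 0 (f (s + i))) ∧ (∀ i a, E i a (f s) = E 0 a (f (s + i))) ∧
    (∀ i a, F i a (f s) = 0) ∧ σ (f s) = ε • f s

namespace SccMod

lemma tensorMap_L (h : SccMod Φ L G E F σ μ 0 0) (hT : ∀ v, IsTensorLike L G E F σ μ β ε (ι v))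
    (i : ℤ) : tensorMap G ι ∘ₗ tmL V μ (β - 1 / 2) i = (L i : M →ₗ[ℂ] M) ∘ₗ tensorMap G ι := by
  refine tmod_hom_ext (fun m v => ?_) fun m v => ?_
  · obtain ⟨h1, h2, -⟩ := hT v m
    have h3 := apply_of_comm (h.rep.comm_LG i 0) (ι v m)
    rw [h1, add_zero, LinearMap.smul_apply, h2 i, map_smul] at h3
    rw [LinearMap.comp_apply, LinearMap.comp_apply, tmL_single_zero, tensorMap_zero, map_smul,
      tensorMap_zero, map_neg, h3]
    push_cast
    module
  · obtain ⟨h1, -⟩ := hT v m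
    rw [LinearMap.comp_apply, LinearMap.comp_apply, tmL_single_one, tensorMap_one, map_smul,
      tensorMap_one, h1]
    module

lemma tensorMap_G (h : SccMod Φ L G E F σ μ 0 0) (hT : ∀ v, IsTensorLike L G E F σ μ β ε (ι v))
    (i : ℤ) : tensorMap G ι ∘ₗ tmG V μ (β - 1 / 2) i = (G i : M →ₗ[ℂ] M) ∘ₗ tensorMap G ι := by
  refine tmod_hom_ext (fun m v => ?_) fun m v => ?_
  · obtain ⟨h1, h2, -⟩ := hT v m
    have h0 := (hT v (m + i)).1 0
    have h3 := apply_of_anticomm (h.relGG i 0) (ι v m)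
    have h4 := LinearMap.congr_fun (h.relGG 0 0) (ι v (m + i))
    simp only [LinearMap.smul_apply, LinearMap.add_apply, End.mul_apply, add_zero, h0] at h4
    rw [LinearMap.smul_apply, add_zero, h1, h2 i] at h3
    rw [LinearMap.comp_apply, LinearMap.comp_apply, tmG_single_zero, tensorMap_zero, map_smul,
      tensorMap_one, map_neg, h3]
    push_cast at h4
    linear_combination (norm := module) (-1 / 2 : ℂ) • h4
  · obtain ⟨-, h2, -⟩ := hT v m
    rw [LinearMap.comp_apply, LinearMap.comp_apply, tmG_single_one, tensorMap_one, map_neg,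
      tensorMap_zero, h2, neg_neg]

lemma sigma_tensorMap (h : SccMod Φ L G E F σ μ 0 0)
    (hT : ∀ v, IsTensorLike L G E F σ μ β ε (ι v)) (m : ℤ) (v : V) :
    σ (tensorMap G ι (Finsupp.single (m, 0) v)) =
        -ε • tensorMap G ι (Finsupp.single (m, 0) v) ∧
      σ (tensorMap G ι (Finsupp.single (m, 1) v)) =
        ε • tensorMap G ι (Finsupp.single (m, 1) v) := by
  obtain ⟨-, -, -, -, h1⟩ := hT v m
  have h2 := LinearMap.congr_fun (h.hG 0) (ι v m)
  rw [LinearMap.neg_apply, End.mul_apply, End.mul_apply, h1, map_smul] at h2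
  rw [tensorMap_zero, tensorMap_one, map_neg, ← h2, h1]
  exact ⟨by module, rfl⟩

variable [LieRingModule 𝕘 V] [LieModule ℂ 𝕘 V]

lemma tensorMap_E (h : SccMod Φ L G E F σ μ 0 0) (hT : ∀ v, IsTensorLike L G E F σ μ β ε (ι v))
    (hι : ∀ (x : 𝕘) v s, ι ⁅x, v⁆ s = E 0 x (ι v s)) (i : ℤ) (x : 𝕘) :
    tensorMap G ι ∘ₗ tmE V i x = (E i x : M →ₗ[ℂ] M) ∘ₗ tensorMap G ι := by
  refine tmod_hom_ext (fun m v => ?_) fun m v => ?_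
  · obtain ⟨-, -, h1, h2, -⟩ := hT v m
    have h3 := apply_of_comm (h.rep.comm_GE 0 i x) (ι v m)
    simp only [LinearMap.smul_apply, zero_add, h1, h2, smul_zero, add_zero] at h3
    rw [LinearMap.comp_apply, LinearMap.comp_apply, tmE_single, tensorMap_zero, tensorMap_zero,
      map_neg, hι, h3]
  · obtain ⟨-, -, h1, -⟩ := hT v m
    rw [LinearMap.comp_apply, LinearMap.comp_apply, tmE_single, tensorMap_one, tensorMap_one, hι,
      h1]

lemma tensorMap_F (h : SccMod Φ L G E F σ μ 0 0) (hT : ∀ v, IsTensorLike L G E F σ μ β ε (ι v))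
    (hι : ∀ (x : 𝕘) v s, ι ⁅x, v⁆ s = E 0 x (ι v s)) (i : ℤ) (x : 𝕘) :
    tensorMap G ι ∘ₗ tmF V i x = (F i x : M →ₗ[ℂ] M) ∘ₗ tensorMap G ι := by
  refine tmod_hom_ext (fun m v => ?_) fun m v => ?_
  · obtain ⟨-, -, h1, h2, -⟩ := hT v m
    have h3 := apply_of_anticomm (h.rep.comm_GF 0 i x) (ι v m)
    simp only [LinearMap.neg_apply, zero_add, h1, h2, map_zero] at h3
    rw [LinearMap.comp_apply, LinearMap.comp_apply, tmF_single_zero, tensorMap_one,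
      tensorMap_zero, map_neg, hι]
    linear_combination (norm := module) h3
  · obtain ⟨-, -, -, h2, -⟩ := hT v m
    rw [LinearMap.comp_apply, LinearMap.comp_apply, tmF_single_one, tensorMap_one, h2, map_zero]

lemma tensorMap_surjective (h : SccMod Φ L G E F σ μ 0 0)
    (hT : ∀ v, IsTensorLike L G E F σ μ β ε (ι v))
    (hι : ∀ (x : 𝕘) v s, ι ⁅x, v⁆ s = E 0 x (ι v s)) (hι0 : ι ≠ 0) :
    Function.Surjective (tensorMap G ι) := by
  rw [← LinearMap.range_eq_top]
  refine (h.simple _ ⟨?_, ?_, ?_, ?_, ?_⟩).resolve_left fun hb => hι0 ?_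
  · rintro i _ ⟨w, rfl⟩
    exact ⟨_, LinearMap.congr_fun (h.tensorMap_L hT i) w⟩
  · rintro i _ ⟨w, rfl⟩
    exact ⟨_, LinearMap.congr_fun (h.tensorMap_G hT i) w⟩
  · rintro i x _ ⟨w, rfl⟩
    exact ⟨_, LinearMap.congr_fun (h.tensorMap_E hT hι i x) w⟩
  · rintro i x _ ⟨w, rfl⟩
    exact ⟨_, LinearMap.congr_fun (h.tensorMap_F hT hι i x) w⟩
  · rintro _ ⟨w, rfl⟩
    induction w using Finsupp.induction_linear with
    | zero => simp
    | add w z hw hz =>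
      rw [map_add, map_add]
      exact add_mem hw hz
    | single p v =>
      obtain ⟨m, r⟩ := p
      obtain ⟨h0, h1⟩ := h.sigma_tensorMap hT m v
      fin_cases r
      · exact h0 ▸ Submodule.smul_mem _ _ ⟨_, rfl⟩
      · exact h1 ▸ Submodule.smul_mem _ _ ⟨_, rfl⟩
  · ext v s
    have : tensorMap G ι (Finsupp.single (s, 1) v) = 0 := by
      rw [← Submodule.mem_bot ℂ, ← hb]
      exact ⟨_, rfl⟩
    rwa [tensorMap_one] at this

end SccMod

lemma tmGr_map_le {W : Type} [AddCommGroup W] [Module ℂ W] {π : TMod V →ₗ[ℂ] W} {q : Fin 2}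
    {N : Submodule ℂ W} (hN : ∀ m v, π (Finsupp.single (m, q) v) ∈ N) :
    (tmGr V q).map π ≤ N := by
  rintro _ ⟨w, hw, rfl⟩
  rw [← Finsupp.sum_single w, Finsupp.sum, map_sum]
  refine sum_mem fun p hp => ?_
  have : p.2 = q := (Finsupp.mem_supported ℂ w).mp hw hp
  obtain ⟨m, r⟩ := p
  subst this
  exact hN m _

section CurveModule

variable {K : Submodule ℂ (ℤ → M)}

/-- The action of the simple Lie algebra on a stable space of curves. -/
abbrev SccMod.curveLieRingModule (h : SccMod Φ L G E F σ μ 0 0)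
    (hK : ∀ a, ∀ f ∈ K, crvA (E 0 a) 0 f ∈ K) : LieRingModule 𝕘 K where
  bracket x f := ⟨crvA (E 0 x) 0 f, hK x f f.2⟩
  add_lie x y f := by
    ext s
    simp
  lie_add x f g := by
    ext s
    simp
  leibniz_lie x y f := by
    ext s
    have := apply_of_comm (h.relEE 0 0 x y) (f.1 s)
    simp only [add_zero] at this
    simp [this, add_comm]

/-- A simple space of curves is a simple module over the simple Lie algebra. -/
theorem SccMod.exists_curveModule (h : SccMod Φ L G E F σ μ 0 0)
    (hK : ∀ a, ∀ f ∈ K, crvA (E 0 a) 0 f ∈ K) (hfin : FiniteDimensional ℂ K) (hK0 : K ≠ ⊥)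
    (hmin : ∀ N ≤ K, (∀ a, ∀ f ∈ N, crvA (E 0 a) 0 f ∈ N) → N = ⊥ ∨ N = K) :
    ∃ (D : SimpleFDModuleData 𝕘) (ι : D.V →ₗ[ℂ] ℤ → M), ι ≠ 0 ∧ (∀ v, ι v ∈ K) ∧
      ∀ (x : 𝕘) v s, ι ⁅x, v⁆ s = E 0 x (ι v s) := by
  let _ := h.curveLieRingModule hK
  have hlie : ∀ (x : 𝕘) (f : K) s, (⁅x, f⁆ : K).1 s = E 0 x (f.1 s) := fun x f s => by
    change E 0 x (f.1 (s - 0)) = _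
    rw [sub_zero]
  obtain ⟨f, hf, hf0⟩ := Submodule.exists_mem_ne_zero_of_ne_bot hK0
  have hinj := Submodule.map_injective_of_injective K.injective_subtype
  let D : SimpleFDModuleData 𝕘 :=
    { V := K
      lm :=
        { smul_lie := fun t x f => by
            ext s
            simp [hlie]
          lie_smul := fun t x f => by
            ext s
            simp [hlie] }
      findim := hfin
      simple := by
        refine ⟨⟨⟨f, hf⟩, fun h0 => hf0 (congrArg Subtype.val h0)⟩, fun N hN => ?_⟩
        refine (hmin (N.map K.subtype) ?_ ?_).imp (fun h0 => hinj ?_) fun h0 => hinj ?_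
        · rintro _ ⟨g, -, rfl⟩
          exact g.2
        · rintro a _ ⟨g, hg, rfl⟩
          exact ⟨_, hN a g hg, rfl⟩
        · rw [h0, Submodule.map_bot]
        · rw [h0, Submodule.map_top, Submodule.range_subtype] }
  refine ⟨D, K.subtype, fun h0 => hf0 ?_, fun v => v.2, hlie⟩
  exact LinearMap.congr_fun h0 (⟨f, hf⟩ : K)

end CurveModule

end TensorMap

section Classification

variable {M : Type} [AddCommGroup M] [Module ℂ M] {𝕘 : Type} [LieRing 𝕘] [LieAlgebra ℂ 𝕘]
  {Φ : 𝕘 →ₗ[ℂ] 𝕘 →ₗ[ℂ] ℂ} {L G : ℤ → End ℂ M} {E F : ℤ → 𝕘 →ₗ[ℂ] End ℂ M}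
  {σ : End ℂ M} {lam μ c c1 : ℂ}

lemma wt_sub_intCast (L0 : End ℂ M) (lam : ℂ) (p n : ℤ) :
    wt L0 (lam - p) n = wt L0 lam (n - p) := by
  rw [wt, wt]
  congr 1
  push_cast
  ring

namespace SccMod

lemma sub_intCast (h : SccMod Φ L G E F σ lam c c1) (p : ℤ) :
    SccMod Φ L G E F σ (lam - p) c c1 where
  __ := h
  top := by
    simp only [wt_sub_intCast]
    rw [← h.top]
    exact (Equiv.subRight p).iSup_comp (g := wt (L 0) lam)
  fin n := by
    rw [wt_sub_intCast]
    exact h.fin _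

/-- The weights of a simple Harish-Chandra module can be normalised so that the base weight is
not a nonzero integer. -/
lemma exists_base_weight (h : SccMod Φ L G E F σ lam c c1) :
    ∃ μ, SccMod Φ L G E F σ μ c c1 ∧ ∀ k : ℤ, k ≠ 0 → μ ≠ k := by
  by_cases hl : ∃ p : ℤ, lam = p
  · obtain ⟨p, rfl⟩ := hl
    refine ⟨_, h.sub_intCast p, fun k hk hk' => hk ?_⟩
    rw [sub_self] at hk'
    exact_mod_cast hk'.symm
  · push Not at hl
    exact ⟨lam, h, fun k _ => hl k⟩

/-- A space of curves of tensor type exhibits the module as a quotient of a tensor module. -/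
theorem exists_tensor_quotient [FiniteDimensional ℂ 𝕘] (h : SccMod Φ L G E F σ μ 0 0)
    (hs : ∀ m, wt (L 0) μ m ⊓ annih L G E F 1 = ⊥) (hμ : ∀ k : ℤ, k ≠ 0 → μ ≠ k) {N : ℕ}
    (hN : ∀ n : ℤ, finrank ℂ (wt (L 0) μ n) ≤ N) {gr : Fin 2 → Submodule ℂ M}
    (hgr0 : ∀ x, x ∈ gr 0 ↔ σ x = x) (hgr1 : ∀ x, x ∈ gr 1 ↔ σ x = -x) :
    ∃ (D : SimpleFDModuleData 𝕘) (lam b : ℂ) (π : TMod D.V →ₗ[ℂ] M),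
      Function.Surjective π ∧
      (∀ i : ℤ, π ∘ₗ tmL D.V lam b i = (L i : M →ₗ[ℂ] M) ∘ₗ π) ∧
      (∀ i : ℤ, π ∘ₗ tmG D.V lam b i = (G i : M →ₗ[ℂ] M) ∘ₗ π) ∧
      (∀ (i : ℤ) (x : 𝕘), π ∘ₗ tmE D.V i x = (E i x : M →ₗ[ℂ] M) ∘ₗ π) ∧
      (∀ (i : ℤ) (x : 𝕘), π ∘ₗ tmF D.V i x = (F i x : M →ₗ[ℂ] M) ∘ₗ π) ∧
      ((∀ q, (tmGr D.V q).map π ≤ gr q) ∨ (∀ q, (tmGr D.V q).map π ≤ gr (q + 1))) := by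
  obtain ⟨β, ε, K, hK0, hfin, hK, hmin, hε, hT⟩ := h.exists_simple_curves hs hμ hN
  obtain ⟨D, ι, hι0, hιK, hι⟩ := h.exists_curveModule hK hfin hK0 hmin
  have hT' : ∀ v, IsTensorLike L G E F σ μ β ε (ι v) := fun v => hT _ (hιK v)
  refine ⟨D, μ, β - 1 / 2, tensorMap G ι, h.tensorMap_surjective hT' hι hι0, h.tensorMap_L hT',
    h.tensorMap_G hT', h.tensorMap_E hT' hι, h.tensorMap_F hT' hι, ?_⟩
  have hσ := h.sigma_tensorMap hT'
  obtain rfl | rfl := hε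
  · refine Or.inr fun q => tmGr_map_le fun m v => ?_
    fin_cases q
    · exact (hgr1 _).mpr ((hσ m v).1.trans (neg_one_smul ℂ _))
    · exact (hgr0 _).mpr ((hσ m v).2.trans (one_smul _ _))
  · refine Or.inl fun q => tmGr_map_le fun m v => ?_
    fin_cases q
    · exact (hgr0 _).mpr ((hσ m v).1.trans (by simp))
    · exact (hgr1 _).mpr ((hσ m v).2.trans (neg_one_smul ℂ _))

end SccMod

end Classification

/-- **Main theorem.** Let `M` be a simple Harish-Chandra module over
the superconformal current algebra `ĝ`.  Then `M` is a highest weight module, a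
lowest weight module, or a simple quotient of a tensor module `Γ(λ, V, b)` or of
its parity change `Π(Γ(λ, V, b))` for some finite-dimensional simple `ġ`-module
`V` and some `λ, b ∈ ℂ`.  (Being a simple quotient is expressed by a surjective
equivariant linear map `π` from `Γ(λ, V, b)`, which preserves parity for
`Γ(λ, V, b)` and reverses it for `Π(Γ(λ, V, b))`; the central elements act by
zero on `Γ(λ, V, b)`.) -/
theorem simple_HC_module_classification
    (𝕘 : Type) [LieRing 𝕘] [LieAlgebra ℂ 𝕘] [FiniteDimensional ℂ 𝕘]
    [LieAlgebra.IsSimple ℂ 𝕘]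
    (Φ : 𝕘 →ₗ[ℂ] 𝕘 →ₗ[ℂ] ℂ)
    (hΦsymm : ∀ x y : 𝕘, Φ x y = Φ y x)
    (hΦinv : ∀ x y z : 𝕘, Φ ⁅x, y⁆ z = Φ x ⁅y, z⁆)
    (hΦnd : ∀ x : 𝕘, (∀ y : 𝕘, Φ x y = 0) → x = 0)
    (M : Type) [AddCommGroup M] [Module ℂ M]
    (L G : ℤ → End ℂ M) (C C1 : End ℂ M)
    (E F : ℤ → 𝕘 →ₗ[ℂ] End ℂ M)
    (gr : Fin 2 → Submodule ℂ M)
    (hrep : IsSCCRep 𝕘 Φ L G C C1 E F)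
    (hsuper : IsSCCSuper 𝕘 gr L G C C1 E F)
    (hsimple : IsSimpleRep (sccOps 𝕘 L G C C1 E F) gr)
    (hHC : IsHarishChandra (L 0)) :
    IsHighestWeight 𝕘 L G C C1 E F ∨ IsLowestWeight 𝕘 L G C C1 E F ∨
    ∃ (D : SimpleFDModuleData 𝕘) (lam b : ℂ) (π : TMod D.V →ₗ[ℂ] M),
      Function.Surjective π ∧
      (∀ i : ℤ, π ∘ₗ tmL D.V lam b i = (L i : M →ₗ[ℂ] M) ∘ₗ π) ∧
      (∀ i : ℤ, π ∘ₗ tmG D.V lam b i = (G i : M →ₗ[ℂ] M) ∘ₗ π) ∧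
      (∀ (i : ℤ) (x : 𝕘), π ∘ₗ tmE D.V i x = (E i x : M →ₗ[ℂ] M) ∘ₗ π) ∧
      (∀ (i : ℤ) (x : 𝕘), π ∘ₗ tmF D.V i x = (F i x : M →ₗ[ℂ] M) ∘ₗ π) ∧
      (C : M →ₗ[ℂ] M) ∘ₗ π = 0 ∧ (C1 : M →ₗ[ℂ] M) ∘ₗ π = 0 ∧
      ((∀ q, (tmGr D.V q).map π ≤ gr q) ∨ (∀ q, (tmGr D.V q).map π ≤ gr (q + 1))) := by
  obtain ⟨σ, lam, c, c1, h', rfl, rfl, hgr0, hgr1⟩ := exists_sccMod hrep hsuper hsimple hHC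
  obtain ⟨μ, h, hμ⟩ := h'.exists_base_weight
  by_cases hs : ∀ m, wt (L 0) μ m ⊓ annih L G E F 1 = ⊥
  swap
  · push Not at hs
    obtain ⟨m, hm⟩ := hs
    exact Or.inl (h.isHighestWeight hm)
  by_cases hs' : ∀ m, wt (-L 0) (-μ) m ⊓ annih (fun i => -L (-i)) (fun i => Complex.I • G (-i))
      (fun i => E (-i)) (fun i => -Complex.I • F (-i)) 1 = ⊥
  swap
  · push Not at hs'
    obtain ⟨m, hm⟩ := hs'
    exact Or.inr (Or.inl (h.isLowestWeight hm))
  obtain ⟨N, hN⟩ := h.bounded hs hs'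
  obtain rfl : c = 0 := h.virMod.central_charge hN (h.weights_unbounded_below hs')
  obtain rfl : c1 = 0 := by
    by_contra hc1
    refine LieAlgebra.IsSimple.non_abelian ℂ (L := 𝕘) ⟨fun x y => hΦnd _ fun z => ?_⟩
    by_contra hz
    exact hc1 (h.current_charge hN hz)
  obtain ⟨D, lam, b, π, hπ, h1, h2, h3, h4, h5⟩ := h.exists_tensor_quotient hs hμ hN hgr0 hgr1
  exact Or.inr (Or.inr ⟨D, lam, b, π, hπ, h1, h2, h3, h4, by ext; simp, by ext; simp, h5⟩)
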